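/- Let f(Z), g(Z) ∈ ℤ[Z] satisfy the nondegeneracy condition and let K be an imaginary quadratic field. Then there is a constant C (depending only on f, g, K) such that for every positive integer T and every real x ≥ 2, one has Σ_{t ∈ I(T), Δ(t) ≠ 0} π_{E(t)}(K; x) ≤ C (T^{1/2} x^{4/3} + T x^{5/6}). -/

import Mathlib

open Polynomial Finset

attribute [local instance 10] Classical.propDecidable

noncomputable section

/-- The discriminant polynomial `Δ = -16(4f³+27g²)`. -/
def Dpoly (f g : Polynomial ℤ) : Polynomial ℤ := -16 * (4 * f ^ 3 + 27 * g ^ 2)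

/-- Nondegeneracy: `Δ ≠ 0` as a polynomial and the `j`-invariant
`j = -1728(4f)³/Δ` is not a constant rational function, i.e. `-1728(4f)³`
is not a rational multiple of `Δ`. -/
def Nondeg (f g : Polynomial ℤ) : Prop :=
  Dpoly f g ≠ 0 ∧
    ¬∃ c : ℚ, (-1728 : Polynomial ℚ) * (4 * f.map (Int.castRingHom ℚ)) ^ 3 =
      Polynomial.C c * (Dpoly f g).map (Int.castRingHom ℚ)

/-- The set `F(T) = {u/v ∈ ℚ : gcd(u,v) = 1, 1 ≤ u, v ≤ T}`. -/
def FT (T : ℝ) : Finset ℚ :=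
  ((Finset.Icc (1 : ℤ) ⌊T⌋ ×ˢ Finset.Icc (1 : ℤ) ⌊T⌋).filter
      fun w => Int.gcd w.1 w.2 = 1).image fun w => (w.1 : ℚ) / (w.2 : ℚ)

/-- Reduction of a rational number `t` modulo `p`, as `num·den⁻¹` in `ZMod p`. -/
def redQ (p : ℕ) (t : ℚ) : ZMod p := (t.num : ZMod p) * (t.den : ZMod p)⁻¹

/-- The number of `𝔽_p`-points of the curve `Y² = X³ + AX + B`
(affine points together with the point at infinity). -/
def numPoints (p : ℕ) (A B : ZMod p) : ℕ :=
  1 + Nat.card {P : ZMod p × ZMod p // P.2 ^ 2 = P.1 ^ 3 + A * P.1 + B}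

/-- The Frobenius trace `p + 1 - #E(𝔽_p)` of `Y² = X³ + AX + B` over `𝔽_p`. -/
def frobTrace (p : ℕ) (A B : ZMod p) : ℤ := (p : ℤ) + 1 - numPoints p A B

/-- `a_p(E(t))`: the Frobenius trace of the reduction modulo `p` of the curve
`E(t) : Y² = X³ + f(t)X + g(t)`. -/
def apE (f g : Polynomial ℤ) (p : ℕ) (t : ℚ) : ℤ :=
  frobTrace p ((f.map (Int.castRingHom (ZMod p))).eval (redQ p t))
    ((g.map (Int.castRingHom (ZMod p))).eval (redQ p t))

/-- Good reduction of `E(t)` at `p`: the denominator of `t` is coprime to `p`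
and `Δ(t) ≢ 0 (mod p)`. -/
def goodRed (f g : Polynomial ℤ) (p : ℕ) (t : ℚ) : Prop :=
  ¬(p ∣ t.den) ∧ ((Dpoly f g).map (Int.castRingHom (ZMod p))).eval (redQ p t) ≠ 0

/-- `π_{E(t)}(𝔄; x)`: the number of primes `p ≤ x` of good reduction for `E(t)`
with `a_p(E(t)) = a_p`. -/
def piSeq (f g : Polynomial ℤ) (a : ℕ → ℤ) (t : ℚ) (x : ℝ) : ℕ :=
  ((Finset.Icc 1 ⌊x⌋₊).filter fun p =>
      p.Prime ∧ goodRed f g p t ∧ apE f g p t = a p).card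

/-- `π_{E(t)}(K; x)` for `K = ℚ(√d)`: the number of primes `p ≤ x` of good
reduction for `E(t)` with `a_p(E(t)) ≠ 0` and `a_p(E(t))² - 4p = d·m²`. -/
def piK (f g : Polynomial ℤ) (d : ℤ) (t : ℚ) (x : ℝ) : ℕ :=
  ((Finset.Icc 1 ⌊x⌋₊).filter fun p =>
      p.Prime ∧ goodRed f g p t ∧ apE f g p t ≠ 0 ∧
        ∃ m : ℤ, 0 < m ∧ (apE f g p t) ^ 2 - 4 * (p : ℤ) = d * m ^ 2).card

/-- The Frobenius angle `ψ_p(E(t)) ∈ [0, π]`, with `cos ψ_p = a_p/(2√p)`. -/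
def psiE (f g : Polynomial ℤ) (p : ℕ) (t : ℚ) : ℝ :=
  Real.arccos ((apE f g p t : ℝ) / (2 * Real.sqrt p))

/-- `π_{E(t)}(α, β; x)`: the number of primes `p ≤ x` of good reduction for
`E(t)` with `ψ_p(E(t)) ∈ [α, β]`. -/
def piAngle (f g : Polynomial ℤ) (α β : ℝ) (t : ℚ) (x : ℝ) : ℕ :=
  ((Finset.Icc 1 ⌊x⌋₊).filter fun p =>
      p.Prime ∧ goodRed f g p t ∧ psiE f g p t ∈ Set.Icc α β).card

/-- The Sato–Tate density `μ_ST(α, β) = (2/π) ∫_α^β sin²θ dθ`. -/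
def muST (α β : ℝ) : ℝ := (2 / Real.pi) * ∫ θ in α..β, Real.sin θ ^ 2

/-- `π(x)`: the number of primes `p ≤ x`. -/
def primePi (x : ℝ) : ℕ := ((Finset.Icc 1 ⌊x⌋₊).filter Nat.Prime).card

/-- `e_p(w) = exp(2πi w/p)`. -/
def ep (p : ℕ) (w : ZMod p) : ℂ :=
  Complex.exp (2 * (Real.pi : ℂ) * Complex.I * (w.val : ℂ) / (p : ℂ))

namespace LT

section FunctionField

variable {k : Type} [Field k] (A B : k)

/-- The cubic `x³ + Ax + B`. -/
def cubic : k[X] := X ^ 3 + C A * X + C B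

lemma cubic_monic : (cubic A B).Monic := by
  unfold cubic; monicity!

lemma natDegree_cubic : (cubic A B).natDegree = 3 := by
  unfold cubic; compute_degree!

lemma cubic_ne_zero : cubic A B ≠ 0 := (cubic_monic A B).ne_zero

/-- The cubic `x³ + Ax + B` as a rational function. -/
def cubicR : RatFunc k := algebraMap k[X] (RatFunc k) (cubic A B)

lemma cubicR_eq : cubicR A B =
    RatFunc.X ^ 3 + algebraMap k (RatFunc k) A * RatFunc.X + algebraMap k (RatFunc k) B := by
  simp [cubicR, cubic]

lemma cubicR_ne_zero : cubicR A B ≠ 0 := by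
  simpa [cubicR] using cubic_ne_zero A B

lemma intDegree_cubicR : (cubicR A B).intDegree = 3 := by
  rw [cubicR, RatFunc.intDegree_polynomial, natDegree_cubic]; rfl

lemma sq_ne_cubicR (r : RatFunc k) : r ^ 2 ≠ cubicR A B := by
  intro h
  have h0 : r ≠ 0 := by
    rintro rfl
    exact cubicR_ne_zero A B (by rw [← h]; simp)
  have := congrArg RatFunc.intDegree h
  rw [sq, RatFunc.intDegree_mul h0 h0, intDegree_cubicR] at this
  omega

lemma irreducible_quad : Irreducible (X ^ 2 - C (cubicR A B) : (RatFunc k)[X]) := by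
  rw [X_pow_sub_C_irreducible_iff_of_prime Nat.prime_two]
  exact fun r => sq_ne_cubicR A B r

instance factIrred : Fact (Irreducible (X ^ 2 - C (cubicR A B) : (RatFunc k)[X])) :=
  ⟨irreducible_quad A B⟩

/-- The function field of `y² = x³ + Ax + B` over `k`. -/
def FF := AdjoinRoot (X ^ 2 - C (cubicR A B) : (RatFunc k)[X])

instance : Field (FF A B) :=
  inferInstanceAs (Field (AdjoinRoot (X ^ 2 - C (cubicR A B) : (RatFunc k)[X])))

instance : Algebra (RatFunc k) (FF A B) :=
  inferInstanceAs (Algebra (RatFunc k) (AdjoinRoot (X ^ 2 - C (cubicR A B) : (RatFunc k)[X])))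

instance : Algebra k (FF A B) :=
  inferInstanceAs (Algebra k (AdjoinRoot (X ^ 2 - C (cubicR A B) : (RatFunc k)[X])))

instance : IsScalarTower k (RatFunc k) (FF A B) :=
  inferInstanceAs (IsScalarTower k (RatFunc k)
    (AdjoinRoot (X ^ 2 - C (cubicR A B) : (RatFunc k)[X])))

/-- The coordinate function `y`. -/
def yF : FF A B := AdjoinRoot.root (X ^ 2 - C (cubicR A B) : (RatFunc k)[X])

/-- The coordinate function `x`. -/
def xF : FF A B := algebraMap (RatFunc k) _ RatFunc.X

lemma yF_sq' : (yF A B) ^ 2 = algebraMap (RatFunc k) (FF A B) (cubicR A B) := by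
  have h := AdjoinRoot.eval₂_root (X ^ 2 - C (cubicR A B) : (RatFunc k)[X])
  rw [eval₂_sub, eval₂_pow, eval₂_X, eval₂_C, sub_eq_zero] at h
  exact h

lemma yF_sq : (yF A B) ^ 2 = xF A B ^ 3 + algebraMap k _ A * xF A B + algebraMap k _ B := by
  rw [yF_sq', congrArg (algebraMap (RatFunc k) (FF A B)) (cubicR_eq A B), map_add, map_add, map_mul,
    map_pow, ← IsScalarTower.algebraMap_apply, ← IsScalarTower.algebraMap_apply]
  rfl

lemma yF_ne_zero : yF A B ≠ 0 := by
  intro h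
  have := yF_sq' A B
  rw [h, zero_pow two_ne_zero] at this
  exact cubicR_ne_zero A B ((map_eq_zero _).mp this.symm)

lemma exists_repr (r : FF A B) : ∃ a b : RatFunc k,
    r = algebraMap (RatFunc k) _ a + algebraMap (RatFunc k) _ b * yF A B := by
  obtain ⟨P, rfl⟩ : ∃ P, AdjoinRoot.mk (X ^ 2 - C (cubicR A B) : (RatFunc k)[X]) P = r :=
    AdjoinRoot.mk_surjective r
  have hm : (X ^ 2 - C (cubicR A B) : (RatFunc k)[X]).Monic := by monicity!
  rw [← Polynomial.modByMonic_add_div P (X ^ 2 - C (cubicR A B) : (RatFunc k)[X])]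
  have hd : (P %ₘ (X ^ 2 - C (cubicR A B) : (RatFunc k)[X])).natDegree < 2 := by
    have := Polynomial.natDegree_modByMonic_lt P hm (by
      intro h
      have := congrArg natDegree h
      rw [natDegree_X_pow_sub_C] at this
      simp at this)
    rwa [natDegree_X_pow_sub_C] at this
  set Q := P %ₘ (X ^ 2 - C (cubicR A B) : (RatFunc k)[X])
  refine ⟨Q.coeff 0, Q.coeff 1, ?_⟩
  rw [map_add, map_mul, AdjoinRoot.mk_self, zero_mul, add_zero]
  conv_lhs => rw [Q.as_sum_range' 2 hd]
  rw [Finset.sum_range_succ, Finset.sum_range_one, ← C_mul_X_pow_eq_monomial,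
    ← C_mul_X_pow_eq_monomial, pow_zero, mul_one, pow_one, map_add, map_mul, AdjoinRoot.mk_X,
    AdjoinRoot.mk_C, AdjoinRoot.mk_C]
  rfl

variable {L : Type} [Field L] [Algebra k L]

/-- The `k`-embedding of `k(x)` sending `x` to a transcendental element `u`. -/
def subsR (u : L) (hu : Transcendental k u) : RatFunc k →ₐ[k] L :=
  RatFunc.liftAlgHom (Polynomial.aeval u)
    (nonZeroDivisors_le_comap_nonZeroDivisors_of_injective _
      (transcendental_iff_injective.mp hu))

lemma subsR_poly (u : L) (hu : Transcendental k u) (P : k[X]) :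
    subsR u hu (algebraMap k[X] (RatFunc k) P) = aeval u P :=
  RatFunc.liftRingHom_algebraMap _ _ P

@[simp] lemma subsR_X (u : L) (hu : Transcendental k u) : subsR u hu RatFunc.X = u := by
  rw [← RatFunc.algebraMap_X, subsR_poly, aeval_X]

lemma algHom_ratFunc_ext {φ ψ : RatFunc k →ₐ[k] L} (h : φ RatFunc.X = ψ RatFunc.X) : φ = ψ := by
  have hp : ∀ P : k[X], φ (algebraMap k[X] (RatFunc k) P) = ψ (algebraMap k[X] (RatFunc k) P) := by
    intro P
    induction P using Polynomial.induction_on' with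
    | add p q hp hq => simp [hp, hq]
    | monomial n a =>
      rw [← C_mul_X_pow_eq_monomial]
      have e : algebraMap k[X] (RatFunc k) (C a) = algebraMap k (RatFunc k) a := by simp
      rw [map_mul, map_pow, RatFunc.algebraMap_X, e]
      simp only [map_mul, map_pow, AlgHom.commutes, h]
  refine AlgHom.ext fun r => ?_
  rw [← RatFunc.num_div_denom r, map_div₀, map_div₀, hp, hp]

lemma subsR_cubic (u : L) (hu : Transcendental k u) :
    subsR u hu (cubicR A B) = u ^ 3 + algebraMap k L A * u + algebraMap k L B := by
  rw [cubicR_eq, map_add, map_add, map_mul, map_pow, AlgHom.commutes, AlgHom.commutes, subsR_X]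

variable {A B}

lemma eval₂_quad (u v : L) (hu : Transcendental k u)
    (h : v ^ 2 = u ^ 3 + algebraMap k L A * u + algebraMap k L B) :
    eval₂ (subsR u hu : RatFunc k →+* L) v (X ^ 2 - C (cubicR A B)) = 0 := by
  rw [eval₂_sub, eval₂_pow, eval₂_X, eval₂_C, h]
  exact sub_eq_zero.mpr (subsR_cubic A B u hu).symm

/-- The `k`-embedding of the function field determined by a point with transcendental abscissa. -/
def subs (u v : L) (hu : Transcendental k u)
    (h : v ^ 2 = u ^ 3 + algebraMap k L A * u + algebraMap k L B) : FF A B →ₐ[k] L :=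
  AdjoinRoot.liftAlgHom (X ^ 2 - C (cubicR A B) : (RatFunc k)[X]) (subsR u hu) v
    (eval₂_quad u v hu h)

lemma subs_ratFunc (u v : L) (hu : Transcendental k u)
    (h : v ^ 2 = u ^ 3 + algebraMap k L A * u + algebraMap k L B) (r : RatFunc k) :
    subs u v hu h (algebraMap (RatFunc k) (FF A B) r) = subsR u hu r :=
  AdjoinRoot.lift_of (eval₂_quad u v hu h)

@[simp] lemma subs_x (u v : L) (hu : Transcendental k u)
    (h : v ^ 2 = u ^ 3 + algebraMap k L A * u + algebraMap k L B) :
    subs u v hu h (xF A B) = u := by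
  rw [xF, subs_ratFunc, subsR_X]

@[simp] lemma subs_y (u v : L) (hu : Transcendental k u)
    (h : v ^ 2 = u ^ 3 + algebraMap k L A * u + algebraMap k L B) :
    subs u v hu h (yF A B) = v :=
  AdjoinRoot.lift_root (eval₂_quad u v hu h)

lemma algHom_FF_ext {φ ψ : FF A B →ₐ[k] L} (hx : φ (xF A B) = ψ (xF A B))
    (hy : φ (yF A B) = ψ (yF A B)) : φ = ψ := by
  have h1 : φ.comp (IsScalarTower.toAlgHom k (RatFunc k) (FF A B)) =
      ψ.comp (IsScalarTower.toAlgHom k (RatFunc k) (FF A B)) := algHom_ratFunc_ext hx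
  refine AlgHom.ext fun r => ?_
  obtain ⟨a, b, rfl⟩ := exists_repr A B r
  have h2 : ∀ a, φ (algebraMap (RatFunc k) (FF A B) a) = ψ (algebraMap (RatFunc k) (FF A B) a) :=
    fun a => DFunLike.congr_fun h1 a
  simp [h2, hy]

variable (A B)

lemma transcendental_X : Transcendental k (RatFunc.X : RatFunc k) :=
  RatFunc.transcendental_of_ne_C _ (by
    rintro ⟨c, hc⟩
    have := congrArg RatFunc.intDegree hc
    simp at this)

lemma transcendental_xF : Transcendental k (xF A B) :=
  (transcendental_algebraMap_iff (algebraMap (RatFunc k) (FF A B)).injective).mpr (transcendental_X)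

/-- The involution `(x, y) ↦ (x, -y)`. -/
def iota : FF A B →ₐ[k] FF A B :=
  subs (xF A B) (-yF A B) (transcendental_xF A B) (by rw [neg_sq, yF_sq])

@[simp] lemma iota_x : iota A B (xF A B) = xF A B := subs_x ..
@[simp] lemma iota_y : iota A B (yF A B) = -yF A B := subs_y ..

lemma iota_ratFunc (r : RatFunc k) :
    iota A B (algebraMap (RatFunc k) (FF A B) r) = algebraMap (RatFunc k) (FF A B) r := by
  have : (iota A B).comp (IsScalarTower.toAlgHom k (RatFunc k) (FF A B)) =
      IsScalarTower.toAlgHom k (RatFunc k) (FF A B) := algHom_ratFunc_ext (iota_x A B)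
  exact DFunLike.congr_fun this r

variable {A B}

lemma two_ne_zero_of_algebra (k : Type) {L : Type} [Field k] [Field L] [Algebra k L]
    [NeZero (2 : k)] : (2 : L) ≠ 0 := by
  rw [← map_ofNat (algebraMap k L) 2]
  exact (map_ne_zero (algebraMap k L)).mpr (NeZero.ne (2 : k))

lemma ratFunc_of_iota_eq [NeZero (2 : k)] {r : FF A B} (h : iota A B r = r) :
    ∃ a : RatFunc k, r = algebraMap (RatFunc k) _ a := by
  obtain ⟨a, b, rfl⟩ := exists_repr A B r
  refine ⟨a, ?_⟩
  simp only [map_add, map_mul, iota_ratFunc, iota_y] at h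
  have h2 : (2 : FF A B) ≠ 0 := two_ne_zero_of_algebra k
  have : 2 * (algebraMap (RatFunc k) (FF A B) b * yF A B) = 0 := by linear_combination -h
  simp [h2] at this
  rcases this with h | h
  · simp [h]
  · simp [h]

lemma ratFunc_mul_y_of_iota_eq [NeZero (2 : k)] {r : FF A B} (h : iota A B r = -r) :
    ∃ b : RatFunc k, r = algebraMap (RatFunc k) _ b * yF A B := by
  obtain ⟨a, b, rfl⟩ := exists_repr A B r
  refine ⟨b, ?_⟩
  simp only [map_add, map_mul, iota_ratFunc, iota_y] at h
  have h2 : (2 : FF A B) ≠ 0 := two_ne_zero_of_algebra k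
  have : 2 * (algebraMap (RatFunc k) (FF A B) a) = 0 := by linear_combination h
  simp [h2] at this
  simp [this]

end FunctionField

section Points

open WeierstrassCurve WeierstrassCurve.Affine

/-- The curve `y² = x³ + Ax + B` is an elliptic curve in characteristic different from `2, 3`. -/
class EC {k : Type} [Field k] (A B : k) : Prop where
  two : (2 : k) ≠ 0
  three : (3 : k) ≠ 0
  disc : 4 * A ^ 3 + 27 * B ^ 2 ≠ 0

variable {k : Type} [Field k] (A B : k)

/-- The short Weierstrass curve `y² = x³ + Ax + B`. -/
def wc : WeierstrassCurve.Affine k := ⟨0, 0, 0, A, B⟩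

lemma wc_delta : (wc A B).Δ = -16 * (4 * A ^ 3 + 27 * B ^ 2) := by
  simp only [wc, WeierstrassCurve.Δ, WeierstrassCurve.b₂, WeierstrassCurve.b₄,
    WeierstrassCurve.b₆, WeierstrassCurve.b₈]; ring

instance [h : EC A B] : (wc A B).IsElliptic := by
  refine ⟨?_⟩
  rw [wc_delta, isUnit_iff_ne_zero]
  refine mul_ne_zero ?_ h.disc
  have : (-16 : k) = -(2 ^ 4) := by norm_num
  rw [this]
  exact neg_ne_zero.2 (pow_ne_zero _ h.two)

variable (L : Type) [Field L] [Algebra k L]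

/-- The group of `L`-points of `y² = x³ + Ax + B`. -/
def Pt := ((wc A B)⁄L).Point

instance : AddCommGroup (Pt A B L) :=
  inferInstanceAs (AddCommGroup ((wc A B)⁄L).Point)

variable {A B L}

lemma wc_a₁ : ((wc A B)⁄L).a₁ = 0 := map_zero _
lemma wc_a₂ : ((wc A B)⁄L).a₂ = 0 := map_zero _
lemma wc_a₃ : ((wc A B)⁄L).a₃ = 0 := map_zero _
lemma wc_a₄ : ((wc A B)⁄L).a₄ = algebraMap k L A := rfl
lemma wc_a₆ : ((wc A B)⁄L).a₆ = algebraMap k L B := rfl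

lemma wc_negY (u v : L) : ((wc A B)⁄L).negY u v = -v := by
  rw [WeierstrassCurve.Affine.negY, wc_a₁, wc_a₃]; ring

lemma wc_addX (u v l : L) : ((wc A B)⁄L).addX u v l = l ^ 2 - u - v := by
  rw [WeierstrassCurve.Affine.addX, wc_a₁, wc_a₂]; ring

lemma wc_addY (u u' v l : L) : ((wc A B)⁄L).addY u u' v l =
    l * (u - (l ^ 2 - u - u')) - v := by
  rw [WeierstrassCurve.Affine.addY, WeierstrassCurve.Affine.negAddY, wc_addX, wc_negY]; ring

instance [h : EC A B] : WeierstrassCurve.IsElliptic ((wc A B)⁄L) :=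
  inferInstanceAs (((wc A B).map (algebraMap k L)).IsElliptic)

lemma wc_equation {u v : L} :
    ((wc A B)⁄L).Equation u v ↔ v ^ 2 = u ^ 3 + algebraMap k L A * u + algebraMap k L B := by
  rw [WeierstrassCurve.Affine.equation_iff]
  rw [wc_a₁, wc_a₂, wc_a₃, wc_a₄, wc_a₆]; simp

variable [EC A B]

lemma wc_nonsingular {u v : L} (h : v ^ 2 = u ^ 3 + algebraMap k L A * u + algebraMap k L B) :
    ((wc A B)⁄L).Nonsingular u v :=
  (WeierstrassCurve.Affine.equation_iff_nonsingular (W := (wc A B)⁄L)).1 (wc_equation.2 h)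

/-- The point `(u, v)`. -/
def Pt.mk (u v : L) (h : v ^ 2 = u ^ 3 + algebraMap k L A * u + algebraMap k L B) : Pt A B L :=
  WeierstrassCurve.Affine.Point.some u v (wc_nonsingular h)

lemma Pt.cases (P : Pt A B L) : P = 0 ∨ ∃ u v h, P = Pt.mk u v h := by
  rcases P with _ | ⟨u, v, h⟩
  · exact Or.inl rfl
  · exact Or.inr ⟨u, v, wc_equation.1 h.1, rfl⟩

lemma Pt.mk_ne_zero (u v : L) (h) : (Pt.mk u v h : Pt A B L) ≠ 0 := by
  exact WeierstrassCurve.Affine.Point.some_ne_zero (W' := (wc A B)⁄L) _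

lemma Pt.mk_inj {u v u' v' : L} {h h'} :
    (Pt.mk u v h : Pt A B L) = Pt.mk u' v' h' ↔ u = u' ∧ v = v' := by
  exact iff_of_eq (WeierstrassCurve.Affine.Point.some.injEq (W' := (wc A B)⁄L) ..)

lemma Pt.mk_congr {u v u' v' : L} {h} (hu : u = u') (hv : v = v') :
    (Pt.mk u v h : Pt A B L) = Pt.mk u' v' (hu ▸ hv ▸ h) := by
  subst hu hv; rfl

lemma Pt.neg_mk (u v : L) (h) :
    -(Pt.mk u v h : Pt A B L) = Pt.mk u (-v) (by rw [neg_sq, h]) := by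
  unfold Pt.mk
  refine (WeierstrassCurve.Affine.Point.neg_some _).trans ?_
  congr 1
  exact wc_negY u v

lemma Pt.add_curve_eq {u₁ v₁ u₂ v₂ l : L}
    (h₁ : v₁ ^ 2 = u₁ ^ 3 + algebraMap k L A * u₁ + algebraMap k L B)
    (h₂ : v₂ ^ 2 = u₂ ^ 3 + algebraMap k L A * u₂ + algebraMap k L B)
    (hne : u₁ ≠ u₂) (hl : l = (v₁ - v₂) / (u₁ - u₂)) :
    (l * (u₁ - (l ^ 2 - u₁ - u₂)) - v₁) ^ 2 = (l ^ 2 - u₁ - u₂) ^ 3 +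
      algebraMap k L A * (l ^ 2 - u₁ - u₂) + algebraMap k L B := by
  have hs : u₁ - u₂ ≠ 0 := sub_ne_zero.2 hne
  have e1 : l * (u₁ - u₂) = v₁ - v₂ := by rw [hl, div_mul_cancel₀ _ hs]
  have e2 : l * (v₁ + v₂) = u₁ ^ 2 + u₁ * u₂ + u₂ ^ 2 + algebraMap k L A := by
    apply mul_left_cancel₀ hs
    linear_combination (v₁ + v₂) * e1 + h₁ - h₂
  have e3 : 2 * l * v₁ = u₁ ^ 2 + u₁ * u₂ + u₂ ^ 2 + algebraMap k L A + l ^ 2 * (u₁ - u₂) := by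
    linear_combination e2 - l * e1
  linear_combination h₁ - (u₁ - (l ^ 2 - u₁ - u₂)) * e3

lemma Pt.add_mk {u₁ v₁ u₂ v₂ : L} {h₁ h₂} (l : L) (hne : u₁ ≠ u₂)
    (hl : l = (v₁ - v₂) / (u₁ - u₂)) :
    (Pt.mk u₁ v₁ h₁ : Pt A B L) + Pt.mk u₂ v₂ h₂ =
      Pt.mk (l ^ 2 - u₁ - u₂) (l * (u₁ - (l ^ 2 - u₁ - u₂)) - v₁)
        (add_curve_eq h₁ h₂ hne hl) := by
  unfold Pt.mk
  refine (WeierstrassCurve.Affine.Point.add_of_X_ne hne).trans ?_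
  have hsl : ((wc A B)⁄L).slope u₁ u₂ v₁ v₂ = l := by
    rw [WeierstrassCurve.Affine.slope_of_X_ne hne, hl]
  rw [WeierstrassCurve.Affine.Point.some.injEq]
  rw [hsl]
  exact ⟨wc_addX .., wc_addY ..⟩

lemma Pt.double_curve_eq (h2 : (2 : L) ≠ 0) {u v l : L}
    (h : v ^ 2 = u ^ 3 + algebraMap k L A * u + algebraMap k L B)
    (hv : v ≠ 0) (hl : l = (3 * u ^ 2 + algebraMap k L A) / (2 * v)) :
    (l * (u - (l ^ 2 - u - u)) - v) ^ 2 = (l ^ 2 - u - u) ^ 3 +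
      algebraMap k L A * (l ^ 2 - u - u) + algebraMap k L B := by
  have e : 2 * l * v = 3 * u ^ 2 + algebraMap k L A := by
    rw [hl]; field_simp
  linear_combination h - (u - (l ^ 2 - u - u)) * e

lemma EC.two' (A B : k) (L : Type) [Field L] [Algebra k L] [h : EC A B] : (2 : L) ≠ 0 := by
  rw [← map_ofNat (algebraMap k L) 2]
  exact (map_ne_zero (algebraMap k L)).2 h.two

lemma EC.disc' (A B : k) (L : Type) [Field L] [Algebra k L] [h : EC A B] :
    4 * algebraMap k L A ^ 3 + 27 * algebraMap k L B ^ 2 ≠ 0 := by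
  have := (map_ne_zero (algebraMap k L)).2 h.disc
  rwa [map_add, map_mul, map_mul, map_ofNat, map_ofNat, map_pow, map_pow] at this

lemma Pt.double_mk {u v : L} {h} (l : L) (hv : v ≠ 0)
    (hl : l = (3 * u ^ 2 + algebraMap k L A) / (2 * v)) :
    (Pt.mk u v h : Pt A B L) + Pt.mk u v h =
      Pt.mk (l ^ 2 - u - u) (l * (u - (l ^ 2 - u - u)) - v)
        (double_curve_eq (EC.two' A B L) h hv hl) := by
  have hy : v ≠ ((wc A B)⁄L).negY u v := by
    rw [wc_negY]
    intro h'
    have : 2 * v = 0 := by linear_combination h'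
    exact (mul_ne_zero (EC.two' A B L) hv) this
  unfold Pt.mk
  refine (WeierstrassCurve.Affine.Point.add_self_of_Y_ne hy).trans ?_
  have hsl : ((wc A B)⁄L).slope u u v v = l := by
    rw [WeierstrassCurve.Affine.slope_of_Y_ne rfl hy, hl]
    rw [wc_negY, wc_a₁, wc_a₂, wc_a₄]
    congr 1 <;> ring
  rw [WeierstrassCurve.Affine.Point.some.injEq]
  rw [hsl]
  exact ⟨wc_addX .., wc_addY ..⟩

lemma Pt.mk_add_mk_neg {u v : L} {h h'} : (Pt.mk u v h : Pt A B L) + Pt.mk u (-v) h' = 0 := by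
  rw [← Pt.neg_mk u v h, add_neg_cancel]

variable {K : Type} [Field K] [Algebra k K] {M : Type} [Field M] [Algebra k M]

/-- Functoriality of points. -/
def pmap (φ : L →ₐ[k] K) : Pt A B L →+ Pt A B K :=
  WeierstrassCurve.Affine.Point.map (W' := wc A B) φ

lemma map_curve (φ : L →ₐ[k] K) {u v : L}
    (h : v ^ 2 = u ^ 3 + algebraMap k L A * u + algebraMap k L B) :
    (φ v) ^ 2 = (φ u) ^ 3 + algebraMap k K A * φ u + algebraMap k K B := by
  rw [← map_pow, h]; simp

lemma pmap_mk (φ : L →ₐ[k] K) (u v : L) (h) :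
    pmap φ (Pt.mk u v h : Pt A B L) = Pt.mk (φ u) (φ v) (map_curve φ h) := rfl

lemma pmap_pmap (φ : L →ₐ[k] K) (ψ : K →ₐ[k] M) (P : Pt A B L) :
    pmap ψ (pmap φ P) = pmap (ψ.comp φ) P :=
  WeierstrassCurve.Affine.Point.map_map (W' := wc A B) φ ψ P

lemma pmap_injective (φ : L →ₐ[k] K) : Function.Injective (pmap φ : Pt A B L → Pt A B K) :=
  WeierstrassCurve.Affine.Point.map_injective (W' := wc A B) φ

/-- The `x`-coordinate in homogeneous form: `O ↦ [1 : 0]`, `(u, v) ↦ [u : 1]`. -/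
lemma Pt.eq_or_neg {u v v' : L} {h h'} :
    (Pt.mk u v h : Pt A B L) = Pt.mk u v' h' ∨ (Pt.mk u v h : Pt A B L) = -Pt.mk u v' h' := by
  rw [Pt.neg_mk]
  rcases sq_eq_sq_iff_eq_or_eq_neg.1 (h.trans h'.symm) with e | e
  · left; exact Pt.mk_congr rfl e
  · right; exact Pt.mk_congr rfl e

end Points

section SumDiff

open WeierstrassCurve WeierstrassCurve.Affine

variable {k : Type} [Field k] {A B : k} {L : Type} [Field L] [Algebra k L]

/-- The `x`-coordinate in homogeneous form: `O ↦ [1 : 0]`, `(u, v) ↦ [u : 1]`. -/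
def Pt.xr (P : Pt A B L) : L × L :=
  (WeierstrassCurve.Affine.Point.xRep (W' := (wc A B)⁄L) P 0,
    WeierstrassCurve.Affine.Point.xRep (W' := (wc A B)⁄L) P 1)

lemma Pt.xr_zero : (0 : Pt A B L).xr = (1, 0) := by
  have : (WeierstrassCurve.Affine.Point.xRep (W' := (wc A B)⁄L) 0) = ![1, 0] :=
    WeierstrassCurve.Affine.Point.xRep_zero
  exact Prod.ext (congrFun this 0) (congrFun this 1)

lemma Pt.xr_mk [EC A B] (u v : L) (h) : (Pt.mk u v h : Pt A B L).xr = (u, 1) := rfl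

/-- The symmetric square of a pair of homogeneous coordinates. -/
def sy {R : Type} [CommRing R] (a b : R × R) : R × R × R :=
  (a.1 * b.1, a.1 * b.2 + b.1 * a.2, a.2 * b.2)

/-- The map `s(P, Q) ↦ s(P + Q, P - Q)` on symmetric squares of `x`-coordinates. -/
def ph {R : Type} [CommRing R] (A B : R) (s : R × R × R) : R × R × R :=
  (s.1 ^ 2 - 2 * A * s.1 * s.2.2 - 4 * B * s.2.1 * s.2.2 + A ^ 2 * s.2.2 ^ 2,
    2 * s.2.1 * s.1 + 2 * A * s.2.1 * s.2.2 + 4 * B * s.2.2 ^ 2,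
    s.2.1 ^ 2 - 4 * s.1 * s.2.2)

lemma ph_ne_zero [EC A B] {s : L × L × L} (hs : s ≠ 0) :
    ph (algebraMap k L A) (algebraMap k L B) s ≠ 0 := by
  have key := WeierstrassCurve.addSubMap_ne_zero ((wc A B)⁄L) (x := ![s.1, s.2.1, s.2.2]) (by
    intro h
    apply hs
    have h0 := congrFun h 0
    have h1 := congrFun h 1
    have h2 := congrFun h 2
    simp only [Matrix.cons_val_zero, Matrix.cons_val_one, Matrix.cons_val, Pi.zero_apply] at h0 h1 h2
    exact Prod.ext h0 (Prod.ext h1 h2))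
  intro h
  apply key
  have h0 := congrArg Prod.fst h
  have h1 := congrArg (fun z => z.2.1) h
  have h2 := congrArg (fun z => z.2.2) h
  simp only [ph, Prod.fst_zero, Prod.snd_zero] at h0 h1 h2
  have e2 : ((wc A B)⁄L).b₂ = 0 := by rw [WeierstrassCurve.b₂, wc_a₁, wc_a₂]; ring
  have e4 : ((wc A B)⁄L).b₄ = 2 * algebraMap k L A := by
    rw [WeierstrassCurve.b₄, wc_a₁, wc_a₃, wc_a₄]; ring
  have e6 : ((wc A B)⁄L).b₆ = 4 * algebraMap k L B := by
    rw [WeierstrassCurve.b₆, wc_a₃, wc_a₆]; ring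
  have e8 : ((wc A B)⁄L).b₈ = -(algebraMap k L A) ^ 2 := by
    rw [WeierstrassCurve.b₈, wc_a₁, wc_a₂, wc_a₃, wc_a₄, wc_a₆]; ring
  funext i
  fin_cases i
  · simp [WeierstrassCurve.addSubMap, e4, e6, e8]
    linear_combination h0
  · simp [WeierstrassCurve.addSubMap, e2, e4, e6]
    linear_combination h1
  · simp [WeierstrassCurve.addSubMap]
    linear_combination h2

/-- Proportionality of triples. -/
def Prp (s t : L × L × L) : Prop := ∃ c : L, c ≠ 0 ∧ s = c • t

variable [EC A B]

lemma prp_ph_xr (P Q : Pt A B L) :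
    Prp (ph (algebraMap k L A) (algebraMap k L B) (sy P.xr Q.xr)) (sy (P + Q).xr (P - Q).xr) := by
  rcases P.cases with rfl | ⟨u₁, v₁, h₁, rfl⟩
  · rcases Q.cases with rfl | ⟨u, v, h, rfl⟩
    · refine ⟨1, one_ne_zero, ?_⟩
      simp [Pt.xr_zero, sy, ph]
    · refine ⟨1, one_ne_zero, ?_⟩
      rw [zero_add, zero_sub, Pt.neg_mk]
      simp [Pt.xr_zero, Pt.xr_mk, sy, ph]
      constructor <;> ring
  · rcases Q.cases with rfl | ⟨u₂, v₂, h₂, rfl⟩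
    · refine ⟨1, one_ne_zero, ?_⟩
      rw [add_zero, sub_zero]
      simp [Pt.xr_zero, Pt.xr_mk, sy, ph]
      constructor <;> ring
    · by_cases hne : u₁ = u₂
      · subst hne
        have h2 : (2 : L) ≠ 0 := EC.two' A B L
        by_cases hv : v₁ = 0
        · subst hv
          have : v₂ = 0 := by
            have : v₂ ^ 2 = 0 := by rw [h₂, ← h₁]; ring
            exact pow_eq_zero_iff (two_ne_zero) |>.1 this
          subst this
          have e1 : (Pt.mk u₁ 0 h₁ : Pt A B L) + Pt.mk u₁ 0 h₂ = 0 := by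
            have aux : ∀ w : L, w = -0 → ∀ h', (Pt.mk u₁ 0 h₁ : Pt A B L) + Pt.mk u₁ w h' = 0 := by
              rintro w rfl h'
              exact Pt.mk_add_mk_neg
            exact aux 0 neg_zero.symm h₂
          rw [e1, sub_self, Pt.xr_zero, Pt.xr_mk]
          have hn := ph_ne_zero (A := A) (B := B) (s := sy (u₁, 1) (u₁, (1 : L)))
            (by intro h; have := congrArg (fun z => z.2.2) h; simp [sy] at this)
          refine ⟨(ph (algebraMap k L A) (algebraMap k L B) (sy (u₁, 1) (u₁, (1 : L)))).1, ?_, ?_⟩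
          · intro h0
            apply hn
            refine Prod.ext h0 (Prod.ext ?_ ?_)
            · simp [ph, sy]; linear_combination (-4) * h₁
            · simp [ph, sy]; ring
          · refine Prod.ext ?_ (Prod.ext ?_ ?_)
            · simp [sy]
            · simp [ph, sy]; linear_combination (-4) * h₁
            · simp [ph, sy]; ring
        · set l := (3 * u₁ ^ 2 + algebraMap k L A) / (2 * v₁) with hl
          have el : 2 * l * v₁ = 3 * u₁ ^ 2 + algebraMap k L A := by
            rw [hl]; field_simp
          have hd := Pt.double_mk (A := A) (B := B) (h := h₁) l hv hl
          have hx : Prp (ph (algebraMap k L A) (algebraMap k L B) (sy (u₁, 1) (u₁, (1 : L))))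
              (sy (l ^ 2 - u₁ - u₁, 1) (1, 0)) := by
            refine ⟨4 * v₁ ^ 2, mul_ne_zero ?_ (pow_ne_zero _ hv), ?_⟩
            · have : (4 : L) = 2 * 2 := by norm_num
              rw [this]; exact mul_ne_zero h2 h2
            · refine Prod.ext ?_ (Prod.ext ?_ ?_)
              · simp [ph, sy]
                linear_combination (-(2 * l * v₁) - 3 * u₁ ^ 2 - algebraMap k L A) * el
                  + 8 * u₁ * h₁
              · simp [ph, sy]; linear_combination (-4) * h₁
              · simp [ph, sy]; ring
          rcases Pt.eq_or_neg (A := A) (B := B) (h := h₂) (h' := h₁) with e | e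
          · rw [e, hd, sub_self]
            simpa only [Pt.xr_mk, Pt.xr_zero] using hx
          · rw [e, add_neg_cancel, sub_neg_eq_add, hd, Pt.neg_mk, Pt.xr_mk, Pt.xr_mk, Pt.xr_mk,
              Pt.xr_zero]
            convert hx using 1
            simp [sy]
      · have hs : u₁ - u₂ ≠ 0 := sub_ne_zero.2 hne
        rw [sub_eq_add_neg, Pt.neg_mk, Pt.add_mk _ hne rfl, Pt.add_mk _ hne rfl]
        simp only [Pt.xr_mk]
        refine ⟨(u₁ - u₂) ^ 2, pow_ne_zero _ hs, ?_⟩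
        have e1 : (v₁ - v₂) ^ 2 / (u₁ - u₂) ^ 2 = ((v₁ - v₂) / (u₁ - u₂)) ^ 2 := by rw [div_pow]
        have e2 : (v₁ - -v₂) ^ 2 / (u₁ - u₂) ^ 2 = ((v₁ - -v₂) / (u₁ - u₂)) ^ 2 := by rw [div_pow]
        set l := (v₁ - v₂) / (u₁ - u₂) with hl
        set n := (v₁ - -v₂) / (u₁ - u₂) with hn
        have el : l * (u₁ - u₂) = v₁ - v₂ := by rw [hl, div_mul_cancel₀ _ hs]
        have en : n * (u₁ - u₂) = v₁ + v₂ := by rw [hn, div_mul_cancel₀ _ hs]; ring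
        have el2 : l ^ 2 * (u₁ - u₂) ^ 2 = (v₁ - v₂) ^ 2 := by rw [← el]; ring
        have en2 : n ^ 2 * (u₁ - u₂) ^ 2 = (v₁ + v₂) ^ 2 := by rw [← en]; ring
        have eln : l * n * (u₁ - u₂) = u₁ ^ 2 + u₁ * u₂ + u₂ ^ 2 + algebraMap k L A := by
          apply mul_left_cancel₀ hs
          linear_combination (n * (u₁ - u₂)) * el + (v₁ - v₂) * en + h₁ - h₂
        refine Prod.ext ?_ (Prod.ext ?_ ?_)
        · simp [ph, sy]
          linear_combination (-(l * n * (u₁ - u₂)) - (u₁ ^ 2 + u₁ * u₂ + u₂ ^ 2 + algebraMap k L A))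
            * eln + (u₁ + u₂) * (el2 + en2 + 2 * h₁ + 2 * h₂)
        · simp [ph, sy]
          linear_combination -el2 - en2 - 2 * h₁ - 2 * h₂
        · simp [ph, sy]; ring

end SumDiff

section Triples

/-- The largest degree of the entries of a triple of polynomials. -/
def md {k : Type} [Field k] (t : k[X] × k[X] × k[X]) : ℕ :=
  max t.1.natDegree (max t.2.1.natDegree t.2.2.natDegree)

/-- The largest degree of the entries of a pair of polynomials. -/
def md2 {k : Type} [Field k] (t : k[X] × k[X]) : ℕ := max t.1.natDegree t.2.natDegree

variable {k : Type} [Field k]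

lemma sy_ne_zero {a b : k × k} (ha : a ≠ 0) (hb : b ≠ 0) : sy a b ≠ 0 := by
  intro h
  have h0 : a.1 * b.1 = 0 := congrArg Prod.fst h
  have h1 : a.1 * b.2 + b.1 * a.2 = 0 := congrArg (fun z => z.2.1) h
  have h2 : a.2 * b.2 = 0 := congrArg (fun z => z.2.2) h
  by_cases ha1 : a.1 = 0
  · have ha2 : a.2 ≠ 0 := fun h' => ha (Prod.ext ha1 h')
    have hb2 : b.2 = 0 := (mul_eq_zero.1 h2).resolve_left ha2
    rw [ha1, zero_mul, zero_add] at h1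
    exact hb (Prod.ext ((mul_eq_zero.1 h1).resolve_right ha2) hb2)
  · have hb1 : b.1 = 0 := (mul_eq_zero.1 h0).resolve_left ha1
    rw [hb1, zero_mul, add_zero] at h1
    exact hb (Prod.ext hb1 ((mul_eq_zero.1 h1).resolve_left ha1))

lemma md2_coeff {t : k[X] × k[X]} (ht : t ≠ 0) :
    ((t.1.coeff (md2 t), t.2.coeff (md2 t)) : k × k) ≠ 0 := by
  intro h
  have h1 : t.1.coeff (md2 t) = 0 := congrArg Prod.fst h
  have h2 : t.2.coeff (md2 t) = 0 := congrArg Prod.snd h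
  unfold md2 at h1 h2
  rcases le_total t.1.natDegree t.2.natDegree with hle | hle
  · rw [max_eq_right hle] at h1 h2
    have h2' := leadingCoeff_eq_zero.1 h2
    rw [h2', natDegree_zero, Nat.le_zero] at hle
    rw [h2', natDegree_zero, ← hle] at h1
    exact ht (Prod.ext (leadingCoeff_eq_zero.1 h1) h2')
  · rw [max_eq_left hle] at h1 h2
    have h1' := leadingCoeff_eq_zero.1 h1
    rw [h1', natDegree_zero, Nat.le_zero] at hle
    rw [h1', natDegree_zero, ← hle] at h2
    exact ht (Prod.ext h1' (leadingCoeff_eq_zero.1 h2))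

lemma md_eq_of_coeff {t : k[X] × k[X] × k[X]} {D : ℕ} (h0 : t.1.natDegree ≤ D)
    (h1 : t.2.1.natDegree ≤ D) (h2 : t.2.2.natDegree ≤ D)
    (h : ((t.1.coeff D, t.2.1.coeff D, t.2.2.coeff D) : k × k × k) ≠ 0) : md t = D := by
  unfold md
  refine le_antisymm (max_le h0 (max_le h1 h2)) ?_
  by_contra hlt
  rw [not_le, max_lt_iff, max_lt_iff] at hlt
  apply h
  rw [coeff_eq_zero_of_natDegree_lt hlt.1, coeff_eq_zero_of_natDegree_lt hlt.2.1,
    coeff_eq_zero_of_natDegree_lt hlt.2.2]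
  rfl

lemma sy_natDegree {a b : k[X] × k[X]} {m n : ℕ} (ha1 : a.1.natDegree ≤ m) (ha2 : a.2.natDegree ≤ m)
    (hb1 : b.1.natDegree ≤ n) (hb2 : b.2.natDegree ≤ n) :
    (sy a b).1.natDegree ≤ m + n ∧ (sy a b).2.1.natDegree ≤ m + n ∧
      (sy a b).2.2.natDegree ≤ m + n ∧
    (((sy a b).1.coeff (m + n), (sy a b).2.1.coeff (m + n), (sy a b).2.2.coeff (m + n)) :
      k × k × k) = sy (a.1.coeff m, a.2.coeff m) (b.1.coeff n, b.2.coeff n) := by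
  refine ⟨natDegree_mul_le_of_le ha1 hb1, natDegree_add_le_of_degree_le
    (natDegree_mul_le_of_le ha1 hb2) ?_, natDegree_mul_le_of_le ha2 hb2, ?_⟩
  · rw [add_comm]; exact natDegree_mul_le_of_le hb1 ha2
  · simp only [sy, coeff_add]
    rw [coeff_mul_add_eq_of_natDegree_le ha1 hb1, coeff_mul_add_eq_of_natDegree_le ha1 hb2,
      coeff_mul_add_eq_of_natDegree_le ha2 hb2]
    rw [mul_comm b.1 a.2, coeff_mul_add_eq_of_natDegree_le ha2 hb1]
    simp [mul_comm]

lemma ph_natDegree (A B : k) {s : k[X] × k[X] × k[X]} {m : ℕ} (h0 : s.1.natDegree ≤ m)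
    (h1 : s.2.1.natDegree ≤ m) (h2 : s.2.2.natDegree ≤ m) :
    (ph (C A) (C B) s).1.natDegree ≤ m + m ∧ (ph (C A) (C B) s).2.1.natDegree ≤ m + m ∧
      (ph (C A) (C B) s).2.2.natDegree ≤ m + m ∧
    (((ph (C A) (C B) s).1.coeff (m + m), (ph (C A) (C B) s).2.1.coeff (m + m),
      (ph (C A) (C B) s).2.2.coeff (m + m)) : k × k × k) =
      ph A B (s.1.coeff m, s.2.1.coeff m, s.2.2.coeff m) := by
  have e : ph (C A) (C B) s = (s.1 * s.1 - C (2 * A) * (s.1 * s.2.2) - C (4 * B) * (s.2.1 * s.2.2)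
      + C (A ^ 2) * (s.2.2 * s.2.2),
    C 2 * (s.2.1 * s.1) + C (2 * A) * (s.2.1 * s.2.2) + C (4 * B) * (s.2.2 * s.2.2),
    s.2.1 * s.2.1 - C 4 * (s.1 * s.2.2)) := by
    have h2 : (C (2 : k) : k[X]) = 2 := rfl
    have h4 : (C (4 : k) : k[X]) = 4 := rfl
    refine Prod.ext ?_ (Prod.ext ?_ ?_) <;> simp only [ph, C_mul, C_pow, h2, h4] <;> ring
  rw [e]
  have d : ∀ {p q : k[X]}, p.natDegree ≤ m → q.natDegree ≤ m → (p * q).natDegree ≤ m + m :=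
    fun hp hq => natDegree_mul_le_of_le hp hq
  have dc : ∀ {c : k} {p : k[X]}, p.natDegree ≤ m + m → (C c * p).natDegree ≤ m + m :=
    fun hp => (natDegree_C_mul_le _ _).trans hp
  have ds : ∀ {p q : k[X]}, p.natDegree ≤ m + m → q.natDegree ≤ m + m →
      (p - q).natDegree ≤ m + m :=
    fun hp hq => (natDegree_sub_le _ _).trans (max_le hp hq)
  refine ⟨?_, ?_, ?_, ?_⟩
  · exact natDegree_add_le_of_degree_le (ds (ds (d h0 h0) (dc (d h0 h2))) (dc (d h1 h2)))
      (dc (d h2 h2))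
  · exact natDegree_add_le_of_degree_le (natDegree_add_le_of_degree_le (dc (d h1 h0))
      (dc (d h1 h2))) (dc (d h2 h2))
  · exact ds (d h1 h1) (dc (d h0 h2))
  · simp only [coeff_add, coeff_sub, coeff_C_mul, coeff_mul_add_eq_of_natDegree_le h0 h0,
      coeff_mul_add_eq_of_natDegree_le h0 h2, coeff_mul_add_eq_of_natDegree_le h1 h2,
      coeff_mul_add_eq_of_natDegree_le h2 h2, coeff_mul_add_eq_of_natDegree_le h1 h0,
      coeff_mul_add_eq_of_natDegree_le h1 h1]
    refine Prod.ext ?_ (Prod.ext ?_ ?_) <;> simp only [ph] <;> ring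

lemma md_sy {a b : k[X] × k[X]} (ha : a ≠ 0) (hb : b ≠ 0) : md (sy a b) = md2 a + md2 b := by
  have := sy_natDegree (a := a) (b := b) (m := md2 a) (n := md2 b) (le_max_left _ _ : _ ≤ md2 a) (le_max_right _ _)
    (le_max_left _ _ : _ ≤ md2 b) (le_max_right _ _)
  refine md_eq_of_coeff this.1 this.2.1 this.2.2.1 ?_
  rw [this.2.2.2]
  exact sy_ne_zero (md2_coeff ha) (md2_coeff hb)

lemma md_ph_sy (A B : k) [EC A B] {a b : k[X] × k[X]} (ha : a ≠ 0) (hb : b ≠ 0) :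
    md (ph (C A) (C B) (sy a b)) = 2 * (md2 a + md2 b) := by
  have h := sy_natDegree (a := a) (b := b) (m := md2 a) (n := md2 b) (le_max_left _ _ : _ ≤ md2 a) (le_max_right _ _)
    (le_max_left _ _ : _ ≤ md2 b) (le_max_right _ _)
  have := ph_natDegree A B h.1 h.2.1 h.2.2.1
  rw [two_mul]
  refine md_eq_of_coeff this.1 this.2.1 this.2.2.1 ?_
  rw [this.2.2.2, h.2.2.2]
  exact ph_ne_zero (A := A) (B := B) (L := k) (sy_ne_zero (md2_coeff ha) (md2_coeff hb))

/-- A triple of polynomials without common zeros. -/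
def Prim (t : k[X] × k[X] × k[X]) : Prop :=
  ∀ x : k, ¬(t.1.eval x = 0 ∧ t.2.1.eval x = 0 ∧ t.2.2.eval x = 0)

lemma Prim.bezout [IsAlgClosed k] {t : k[X] × k[X] × k[X]} (h : Prim t) :
    ∃ r₀ r₁ r₂ : k[X], r₀ * t.1 + r₁ * t.2.1 + r₂ * t.2.2 = 1 := by
  set g := gcd t.1 (gcd t.2.1 t.2.2) with hg
  have hdeg : g.degree = 0 := by
    by_contra hne
    obtain ⟨x, hx⟩ := IsAlgClosed.exists_root g hne
    have hd : ∀ p, g ∣ p → p.eval x = 0 := fun p hp => by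
      obtain ⟨q, rfl⟩ := hp
      rw [eval_mul, hx.eq_zero, zero_mul]
    exact h x ⟨hd _ (gcd_dvd_left _ _), hd _ ((gcd_dvd_right _ _).trans (gcd_dvd_left _ _)),
      hd _ ((gcd_dvd_right _ _).trans (gcd_dvd_right _ _))⟩
  have hu : IsUnit g := isUnit_iff_degree_eq_zero.2 hdeg
  obtain ⟨x, y, hxy⟩ := exists_gcd_eq_mul_add_mul t.1 (gcd t.2.1 t.2.2)
  obtain ⟨z, w, hzw⟩ := exists_gcd_eq_mul_add_mul t.2.1 t.2.2
  obtain ⟨v, hv⟩ := hu.exists_left_inv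
  refine ⟨v * x, v * y * z, v * y * w, ?_⟩
  rw [← hv, hg, hxy, hzw]; ring

lemma md_eq_of_prp [IsAlgClosed k] {s t : k[X] × k[X] × k[X]} (hs : Prim s) (ht : Prim t)
    (h01 : s.1 * t.2.1 = s.2.1 * t.1) (h02 : s.1 * t.2.2 = s.2.2 * t.1)
    (h12 : s.2.1 * t.2.2 = s.2.2 * t.2.1) : md s = md t := by
  obtain ⟨r₀, r₁, r₂, hr⟩ := ht.bezout
  obtain ⟨q₀, q₁, q₂, hq⟩ := hs.bezout
  set g := r₀ * s.1 + r₁ * s.2.1 + r₂ * s.2.2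
  set g' := q₀ * t.1 + q₁ * t.2.1 + q₂ * t.2.2
  have a0 : s.1 = g * t.1 := by linear_combination (-s.1) * hr + r₁ * h01 + r₂ * h02
  have a1 : s.2.1 = g * t.2.1 := by linear_combination (-s.2.1) * hr - r₀ * h01 + r₂ * h12
  have a2 : s.2.2 = g * t.2.2 := by linear_combination (-s.2.2) * hr - r₀ * h02 - r₁ * h12
  have b0 : t.1 = g' * s.1 := by linear_combination (-t.1) * hq - q₁ * h01 - q₂ * h02
  have b1 : t.2.1 = g' * s.2.1 := by linear_combination (-t.2.1) * hq + q₀ * h01 - q₂ * h12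
  have b2 : t.2.2 = g' * s.2.2 := by linear_combination (-t.2.2) * hq + q₀ * h02 + q₁ * h12
  have hgg : g * g' = 1 := by
    linear_combination hq - q₀ * a0 - q₁ * a1 - q₂ * a2
  have hu : IsUnit g := IsUnit.of_mul_eq_one _ hgg
  have hd : ∀ p : k[X], (g * p).natDegree = p.natDegree := by
    obtain ⟨c, hc, hcg⟩ := Polynomial.isUnit_iff.1 hu
    intro p
    rw [← hcg, natDegree_C_mul hc.ne_zero]
  unfold md
  rw [a0, a1, a2, hd, hd, hd]

end Triples

section OddPoints

variable {k : Type} [Field k] {A B : k} [EC A B]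

lemma EC.neZero_two (A B : k) [h : EC A B] : NeZero (2 : k) := ⟨h.two⟩

variable (A B) in
/-- The generic point `(x, y)`. -/
def gen : Pt A B (FF A B) := Pt.mk (xF A B) (yF A B) (yF_sq A B)

variable (A B) in
/-- Points of the quadratic twist by `x³ + Ax + B` over `k(x)`. -/
def Tw (u s : RatFunc k) : Prop :=
  s ^ 2 * cubicR A B = u ^ 3 + algebraMap k (RatFunc k) A * u + algebraMap k (RatFunc k) B

lemma Tw.curve {u s : RatFunc k} (h : Tw A B u s) :
    (algebraMap (RatFunc k) (FF A B) s * yF A B) ^ 2 = (algebraMap (RatFunc k) (FF A B) u) ^ 3 +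
      algebraMap k (FF A B) A * algebraMap (RatFunc k) (FF A B) u + algebraMap k (FF A B) B := by
  rw [mul_pow, yF_sq', ← map_pow, ← map_mul, h, map_add, map_add, map_mul, map_pow,
    IsScalarTower.algebraMap_apply k (RatFunc k) (FF A B),
    IsScalarTower.algebraMap_apply k (RatFunc k) (FF A B)]

/-- The point `(u, sy)` on the function field. -/
def opt (u s : RatFunc k) (h : Tw A B u s) : Pt A B (FF A B) :=
  Pt.mk (algebraMap (RatFunc k) (FF A B) u) (algebraMap (RatFunc k) (FF A B) s * yF A B) h.curve

lemma Tw.X : Tw A B RatFunc.X 1 := by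
  unfold Tw; rw [cubicR_eq]; ring

lemma gen_eq : gen A B = opt RatFunc.X 1 Tw.X :=
  Pt.mk_congr rfl (by rw [map_one, one_mul])

lemma opt_inj {u s u' s' : RatFunc k} {h : Tw A B u s} {h' : Tw A B u' s'} :
    opt u s h = opt u' s' h' ↔ u = u' ∧ s = s' := by
  unfold opt
  rw [Pt.mk_inj]
  constructor
  · rintro ⟨h1, h2⟩
    exact ⟨(algebraMap (RatFunc k) (FF A B)).injective h1,
      (algebraMap (RatFunc k) (FF A B)).injective (mul_right_cancel₀ (yF_ne_zero A B) h2)⟩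
  · rintro ⟨rfl, rfl⟩; exact ⟨rfl, rfl⟩

lemma opt_congr {u s u' s' : RatFunc k} {h : Tw A B u s} (hu : u = u') (hs : s = s') :
    opt u s h = opt u' s' (hu ▸ hs ▸ h) := by subst hu hs; rfl

lemma opt_ne_zero {u s : RatFunc k} {h : Tw A B u s} : opt u s h ≠ 0 := Pt.mk_ne_zero _ _ _

lemma Tw.neg {u s : RatFunc k} (h : Tw A B u s) : Tw A B u (-s) := by
  unfold Tw; rw [neg_sq]; exact h

lemma neg_opt {u s : RatFunc k} {h : Tw A B u s} : -opt u s h = opt u (-s) h.neg := by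
  unfold opt
  rw [Pt.neg_mk]
  exact Pt.mk_congr rfl (by rw [map_neg, neg_mul])

variable (A B) in
/-- The subgroup of odd points: those on which the hyperelliptic involution acts as `-1`. -/
def odd : AddSubgroup (Pt A B (FF A B)) where
  carrier := {P | pmap (iota A B) P = -P}
  zero_mem' := by simp
  add_mem' := by
    intro P Q hP hQ
    simp only [Set.mem_ofPred_eq] at *
    rw [map_add, hP, hQ, neg_add]
  neg_mem' := by
    intro P hP
    simp only [Set.mem_ofPred_eq] at *
    rw [map_neg, hP]

lemma mem_odd {P : Pt A B (FF A B)} : P ∈ odd A B ↔ pmap (iota A B) P = -P := Iff.rfl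

lemma opt_mem_odd {u s : RatFunc k} {h : Tw A B u s} : opt u s h ∈ odd A B := by
  rw [mem_odd]
  unfold opt
  rw [pmap_mk, Pt.neg_mk, Pt.mk_inj]
  rw [iota_ratFunc, map_mul, iota_ratFunc, iota_y]
  exact ⟨rfl, by ring⟩

lemma gen_mem_odd : gen A B ∈ odd A B := gen_eq (A := A) (B := B) ▸ opt_mem_odd

lemma odd_cases {P : Pt A B (FF A B)} (hP : P ∈ odd A B) : P = 0 ∨ ∃ u s h, P = opt u s h := by
  have := EC.neZero_two A B
  rcases P.cases with rfl | ⟨u, v, h, rfl⟩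
  · exact Or.inl rfl
  · right
    rw [mem_odd, pmap_mk, Pt.neg_mk, Pt.mk_inj] at hP
    obtain ⟨u', rfl⟩ := ratFunc_of_iota_eq hP.1
    obtain ⟨s, rfl⟩ := ratFunc_mul_y_of_iota_eq hP.2
    refine ⟨u', s, ?_, rfl⟩
    apply (algebraMap (RatFunc k) (FF A B)).injective
    rw [mul_pow, yF_sq', ← map_pow, ← map_mul,
      IsScalarTower.algebraMap_apply k (RatFunc k) (FF A B) A,
      IsScalarTower.algebraMap_apply k (RatFunc k) (FF A B) B] at h
    rw [h]; simp

variable (A B) in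
/-- Polynomials as elements of the function field. -/
def pF : k[X] →+* FF A B :=
  (algebraMap (RatFunc k) (FF A B)).comp (algebraMap k[X] (RatFunc k))

lemma pF_injective : Function.Injective (pF A B) :=
  (algebraMap (RatFunc k) (FF A B)).injective.comp (IsFractionRing.injective k[X] (RatFunc k))

lemma pF_C (c : k) : pF A B (C c) = algebraMap k (FF A B) c := by
  rw [IsScalarTower.algebraMap_apply k (RatFunc k) (FF A B),
    IsScalarTower.algebraMap_apply k k[X] (RatFunc k)]
  rfl

/-- The `x`-coordinate of `P` is `[a : b]` with `a, b` coprime polynomials. -/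
def Rep (P : Pt A B (FF A B)) (a b : k[X]) : Prop :=
  IsCoprime a b ∧ ∃ c : FF A B, c ≠ 0 ∧ P.xr = (c * pF A B a, c * pF A B b)

lemma rep_zero : Rep (0 : Pt A B (FF A B)) 1 0 :=
  ⟨isCoprime_one_left, 1, one_ne_zero, by rw [Pt.xr_zero]; simp⟩

lemma rep_opt_iff {u s : RatFunc k} {h : Tw A B u s} {a b : k[X]} :
    Rep (opt u s h) a b ↔ IsCoprime a b ∧ b ≠ 0 ∧
      u = algebraMap k[X] (RatFunc k) a / algebraMap k[X] (RatFunc k) b := by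
  unfold Rep opt
  refine and_congr_right fun hab => ?_
  rw [Pt.xr_mk]
  constructor
  · rintro ⟨c, hc, h⟩
    obtain ⟨h1, h2⟩ := Prod.ext_iff.1 h
    simp only at h1 h2
    have hb : b ≠ 0 := by
      rintro rfl
      simp at h2
    refine ⟨hb, ?_⟩
    apply (algebraMap (RatFunc k) (FF A B)).injective
    have hb' : pF A B b ≠ 0 := (map_ne_zero_iff _ pF_injective).2 hb
    rw [map_div₀]
    change _ = pF A B a / pF A B b
    rw [h1, eq_div_iff hb']
    linear_combination (-pF A B a) * h2
  · rintro ⟨hb, rfl⟩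
    have hb' : pF A B b ≠ 0 := (map_ne_zero_iff _ pF_injective).2 hb
    refine ⟨(pF A B b)⁻¹, inv_ne_zero hb', ?_⟩
    rw [map_div₀]
    change ((pF A B a / pF A B b, _) : FF A B × FF A B) = _
    rw [inv_mul_cancel₀ hb', div_eq_inv_mul]

lemma exists_rep {P : Pt A B (FF A B)} (hP : P ∈ odd A B) : ∃ a b, Rep P a b := by
  rcases odd_cases hP with rfl | ⟨u, s, h, rfl⟩
  · exact ⟨1, 0, rep_zero⟩
  · exact ⟨u.num, u.denom, rep_opt_iff.2 ⟨RatFunc.isCoprime_num_denom u, RatFunc.denom_ne_zero u,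
      (RatFunc.num_div_denom u).symm⟩⟩

lemma Rep.md2_eq {P : Pt A B (FF A B)} {a b a' b' : k[X]} (h : Rep P a b) (h' : Rep P a' b') :
    md2 (a, b) = md2 (a', b') := by
  obtain ⟨hab, c, hc, e⟩ := h
  obtain ⟨hab', c', hc', e'⟩ := h'
  rw [e] at e'
  obtain ⟨h1, h2⟩ := Prod.ext_iff.1 e'
  simp only at h1 h2
  have hx : a * b' = b * a' := by
    apply pF_injective (A := A) (B := B)
    apply mul_left_cancel₀ (mul_ne_zero hc hc')
    rw [map_mul, map_mul]
    linear_combination (c' * pF A B b') * h1 - c' * pF A B a' * h2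
  obtain ⟨r, s, hrs⟩ := hab
  obtain ⟨r', s', hrs'⟩ := hab'
  set g := r' * a + s' * b with hg
  set g' := r * a' + s * b' with hg'
  have a0 : a = g * a' := by rw [hg]; linear_combination (-a) * hrs' + s' * hx
  have b0 : b = g * b' := by rw [hg]; linear_combination (-b) * hrs' - r' * hx
  have hgg : g * g' = 1 := by
    rw [hg']; linear_combination hrs - r * a0 - s * b0
  obtain ⟨c, hc, hcg⟩ := Polynomial.isUnit_iff.1 (IsUnit.of_mul_eq_one _ hgg)
  unfold md2
  rw [a0, b0, ← hcg]
  simp only [natDegree_C_mul hc.ne_zero]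

/-- The height of a point: the degree of its `x`-coordinate. -/
def ht (P : Pt A B (FF A B)) : ℕ :=
  if h : ∃ ab : k[X] × k[X], Rep P ab.1 ab.2 then md2 h.choose else 0

lemma Rep.ht_eq {P : Pt A B (FF A B)} {a b : k[X]} (h : Rep P a b) : ht P = md2 (a, b) := by
  have h' : ∃ ab : k[X] × k[X], Rep P ab.1 ab.2 := ⟨(a, b), h⟩
  unfold ht
  rw [dif_pos h']
  exact h'.choose_spec.md2_eq h

lemma ht_zero : ht (0 : Pt A B (FF A B)) = 0 := by
  rw [rep_zero.ht_eq]; simp [md2]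

lemma Rep.neg {P : Pt A B (FF A B)} {a b : k[X]} (h : Rep P a b) : Rep (-P) a b := by
  have : (-P).xr = P.xr := by
    rcases P.cases with rfl | ⟨u, v, h, rfl⟩
    · rw [neg_zero]
    · rw [Pt.neg_mk, Pt.xr_mk, Pt.xr_mk]
  unfold Rep at *
  rwa [this]

lemma IsCoprime.not_eval {a b : k[X]} (h : IsCoprime a b) (x : k) :
    ((a.eval x, b.eval x) : k × k) ≠ 0 := by
  intro h0
  obtain ⟨r, s, hrs⟩ := h
  have h1 : a.eval x = 0 := congrArg Prod.fst h0
  have h2 : b.eval x = 0 := congrArg Prod.snd h0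
  have := congrArg (eval x) hrs
  rw [eval_add, eval_mul, eval_mul, h1, h2] at this
  simp at this

lemma prim_sy {a b a' b' : k[X]} (h : IsCoprime a b) (h' : IsCoprime a' b') :
    Prim (sy (a, b) (a', b')) := by
  rintro x ⟨h0, h1, h2⟩
  apply sy_ne_zero (IsCoprime.not_eval h x) (IsCoprime.not_eval h' x)
  refine Prod.ext ?_ (Prod.ext ?_ ?_)
  · simpa [sy] using h0
  · simpa [sy] using h1
  · simpa [sy] using h2

lemma prim_ph_sy {a b a' b' : k[X]} (h : IsCoprime a b) (h' : IsCoprime a' b') :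
    Prim (ph (C A) (C B) (sy (a, b) (a', b'))) := by
  rintro x ⟨h0, h1, h2⟩
  apply ph_ne_zero (A := A) (B := B) (L := k)
    (sy_ne_zero (IsCoprime.not_eval h x) (IsCoprime.not_eval h' x))
  refine Prod.ext ?_ (Prod.ext ?_ ?_)
  · simpa [sy, ph] using h0
  · simpa [sy, ph] using h1
  · simpa [sy, ph] using h2

/-- The parallelogram law. -/
theorem ht_add_add_ht_sub [IsAlgClosed k] {P Q : Pt A B (FF A B)} (hP : P ∈ odd A B)
    (hQ : Q ∈ odd A B) : ht (P + Q) + ht (P - Q) = 2 * (ht P + ht Q) := by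
  obtain ⟨a₁, b₁, r₁⟩ := exists_rep hP
  obtain ⟨a₂, b₂, r₂⟩ := exists_rep hQ
  obtain ⟨a₃, b₃, r₃⟩ := exists_rep (add_mem hP hQ)
  obtain ⟨a₄, b₄, r₄⟩ := exists_rep (sub_mem hP hQ)
  rw [r₁.ht_eq, r₂.ht_eq, r₃.ht_eq, r₄.ht_eq]
  have nz : ∀ {a b : k[X]}, IsCoprime a b → ((a, b) : k[X] × k[X]) ≠ 0 := by
    intro a b h h0
    apply IsCoprime.not_eval h 0
    rw [Prod.mk_eq_zero] at h0
    rw [h0.1, h0.2]; simp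
  rw [← md_ph_sy A B (nz r₁.1) (nz r₂.1), ← md_sy (nz r₃.1) (nz r₄.1)]
  obtain ⟨c, hc, e⟩ := prp_ph_xr P Q
  obtain ⟨h1, c₁, hc₁, e₁⟩ := r₁
  obtain ⟨h2, c₂, hc₂, e₂⟩ := r₂
  obtain ⟨h3, c₃, hc₃, e₃⟩ := r₃
  obtain ⟨h4, c₄, hc₄, e₄⟩ := r₄
  rw [e₁, e₂, e₃, e₄] at e
  obtain ⟨i0, i12⟩ := Prod.ext_iff.1 e
  obtain ⟨i1, i2⟩ := Prod.ext_iff.1 i12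
  simp only [sy, ph, Prod.smul_fst, Prod.smul_snd, smul_eq_mul] at i0 i1 i2
  symm
  set G : FF A B := (c₁ * c₂) ^ 2 with hG
  have hG0 : G ≠ 0 := pow_ne_zero _ (mul_ne_zero hc₁ hc₂)
  set H : FF A B := c * (c₃ * c₄) with hH
  have hH0 : H ≠ 0 := mul_ne_zero hc (mul_ne_zero hc₃ hc₄)
  set t := sy (a₃, b₃) (a₄, b₄) with ht
  set s := ph (C A) (C B) (sy (a₁, b₁) (a₂, b₂)) with hs
  have j0 : G * pF A B s.1 = H * pF A B t.1 := by
    simp only [hG, hH, ht, hs, sy, ph, map_add, map_sub, map_mul, map_pow, pF_C, map_ofNat]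
    linear_combination i0
  have j1 : G * pF A B s.2.1 = H * pF A B t.2.1 := by
    simp only [hG, hH, ht, hs, sy, ph, map_add, map_sub, map_mul, map_pow, pF_C, map_ofNat]
    linear_combination i1
  have j2 : G * pF A B s.2.2 = H * pF A B t.2.2 := by
    simp only [hG, hH, ht, hs, sy, ph, map_add, map_sub, map_mul, map_pow, pF_C, map_ofNat]
    linear_combination i2
  refine md_eq_of_prp (prim_ph_sy (A := A) (B := B) h1 h2) (prim_sy h3 h4) ?_ ?_ ?_
  all_goals
    apply pF_injective (A := A) (B := B)
    apply mul_left_cancel₀ (mul_ne_zero hG0 hH0)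
    rw [map_mul, map_mul]
  · linear_combination (H * pF A B t.2.1) * j0 - (H * pF A B t.1) * j1
  · linear_combination (H * pF A B t.2.2) * j0 - (H * pF A B t.1) * j2
  · linear_combination (H * pF A B t.2.2) * j1 - (H * pF A B t.2.1) * j2

end OddPoints

section Parallelogram

variable {G : Type*} [AddCommGroup G] {q : G → ℤ}

/-- The polar form of a function on an abelian group. -/
def polar (q : G → ℤ) (x y : G) : ℤ := q (x + y) - q x - q y

lemma para_zero (h : ∀ x y, q (x + y) + q (x - y) = 2 * (q x + q y)) : q 0 = 0 := by
  have := h 0 0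
  simp only [add_zero, sub_zero] at this; omega

lemma polar_add_left (h : ∀ x y, q (x + y) + q (x - y) = 2 * (q x + q y))
    (x y z : G) : polar q (x + y) z = polar q x z + polar q y z := by
  have a := h (x + z) y
  have b := h (x - y) z
  have c := h x (y + z)
  have d := h x y
  rw [show x + z + y = x + y + z by abel] at a
  rw [show x - y + z = x + z - y by abel] at b
  rw [show x + (y + z) = x + y + z by abel, show x - (y + z) = x - y - z by abel] at c
  unfold polar
  linarith

lemma polar_comm (x y : G) : polar q x y = polar q y x := by
  unfold polar; rw [add_comm]; ring

lemma polar_zsmul_left (h : ∀ x y, q (x + y) + q (x - y) = 2 * (q x + q y))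
    (n : ℤ) (x z : G) : polar q (n • x) z = n * polar q x z := by
  have := (AddMonoidHom.mk' (fun x => polar q x z) (fun x y => polar_add_left h x y z)).map_zsmul n x
  simpa using this

lemma polar_zsmul_right (h : ∀ x y, q (x + y) + q (x - y) = 2 * (q x + q y))
    (n : ℤ) (x z : G) : polar q x (n • z) = n * polar q x z := by
  rw [polar_comm, polar_zsmul_left h, polar_comm]

lemma polar_self (h : ∀ x y, q (x + y) + q (x - y) = 2 * (q x + q y))
    (x : G) : polar q x x = 2 * q x := by
  have := h x x
  rw [sub_self, para_zero h] at this
  unfold polar; linarith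

lemma para_zsmul (h : ∀ x y, q (x + y) + q (x - y) = 2 * (q x + q y))
    (n : ℤ) (x : G) : q (n • x) = n ^ 2 * q x := by
  have := polar_self h (n • x)
  rw [polar_zsmul_left h, polar_zsmul_right h, polar_self h] at this
  linarith

lemma para_comb (h : ∀ x y, q (x + y) + q (x - y) = 2 * (q x + q y))
    (n m : ℤ) (x y : G) :
    q (n • x + m • y) = n ^ 2 * q x + n * m * polar q x y + m ^ 2 * q y := by
  have : q (n • x + m • y) = polar q (n • x) (m • y) + q (n • x) + q (m • y) := by
    unfold polar; ring
  rw [this, polar_zsmul_left h, polar_zsmul_right h, para_zsmul h, para_zsmul h]; ring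

lemma para_comb₃ (h : ∀ x y, q (x + y) + q (x - y) = 2 * (q x + q y))
    (n m l : ℤ) (x y z : G) :
    q (n • x + m • y + l • z) = n ^ 2 * q x + m ^ 2 * q y + l ^ 2 * q z + n * m * polar q x y +
      n * l * polar q x z + m * l * polar q y z := by
  have : q (n • x + m • y + l • z) =
      polar q (n • x + m • y) (l • z) + q (n • x + m • y) + q (l • z) := by
    unfold polar; ring
  rw [this, polar_add_left h, polar_zsmul_left h, polar_zsmul_right h, polar_zsmul_left h,
    polar_zsmul_right h, para_zsmul h, para_comb h]; ring

end Parallelogram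

section Degree

variable {k : Type} [Field k]

/-- The degree of a rational function. -/
def rd (u : RatFunc k) : ℕ := md2 (u.num, u.denom)

/-- `u = a / b` in lowest terms. -/
def Low (u : RatFunc k) (a b : k[X]) : Prop :=
  IsCoprime a b ∧ b ≠ 0 ∧ u = algebraMap k[X] (RatFunc k) a / algebraMap k[X] (RatFunc k) b

lemma low_num_denom (u : RatFunc k) : Low u u.num u.denom :=
  ⟨RatFunc.isCoprime_num_denom u, RatFunc.denom_ne_zero u, (RatFunc.num_div_denom u).symm⟩

lemma algebraMap_poly_ne_zero {b : k[X]} (hb : b ≠ 0) : algebraMap k[X] (RatFunc k) b ≠ 0 :=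
  (map_ne_zero_iff _ (IsFractionRing.injective k[X] (RatFunc k))).2 hb

lemma Low.unique {u : RatFunc k} {a b a' b' : k[X]} (h : Low u a b) (h' : Low u a' b') :
    ∃ c : k, c ≠ 0 ∧ a = C c * a' ∧ b = C c * b' := by
  obtain ⟨hab, hb, e⟩ := h
  obtain ⟨hab', hb', e'⟩ := h'
  rw [e, div_eq_div_iff (algebraMap_poly_ne_zero hb) (algebraMap_poly_ne_zero hb'),
    ← map_mul, ← map_mul] at e'
  have hx : a * b' = b * a' := by
    have := IsFractionRing.injective k[X] (RatFunc k) e'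
    rw [this, mul_comm]
  obtain ⟨r, s, hrs⟩ := hab
  obtain ⟨r', s', hrs'⟩ := hab'
  set g := r' * a + s' * b with hg
  set g' := r * a' + s * b' with hg'
  have a0 : a = g * a' := by rw [hg]; linear_combination (-a) * hrs' + s' * hx
  have b0 : b = g * b' := by rw [hg]; linear_combination (-b) * hrs' - r' * hx
  have hgg : g * g' = 1 := by
    rw [hg']; linear_combination hrs - r * a0 - s * b0
  obtain ⟨c, hc, hcg⟩ := Polynomial.isUnit_iff.1 (IsUnit.of_mul_eq_one _ hgg)
  exact ⟨c, hc.ne_zero, by rw [hcg]; exact a0, by rw [hcg]; exact b0⟩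

lemma Low.rd_eq {u : RatFunc k} {a b : k[X]} (h : Low u a b) : rd u = md2 (a, b) := by
  obtain ⟨c, hc, h1, h2⟩ := h.unique (low_num_denom u)
  unfold rd md2
  simp only [h1, h2, natDegree_C_mul hc]

lemma ht_opt {A B : k} [EC A B] {u s : RatFunc k} (h : Tw A B u s) : ht (opt u s h) = rd u := by
  rw [Rep.ht_eq (rep_opt_iff.2 (low_num_denom u))]; rfl

lemma rd_eq_zero {u : RatFunc k} (h : rd u = 0) : ∃ c : k, u = algebraMap k (RatFunc k) c := by
  unfold rd md2 at h
  simp only [Nat.max_eq_zero_iff] at h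
  obtain ⟨a, ha⟩ := natDegree_eq_zero.1 h.1
  obtain ⟨b, hb⟩ := natDegree_eq_zero.1 h.2
  refine ⟨a / b, ?_⟩
  rw [← RatFunc.num_div_denom u, ← ha, ← hb, map_div₀,
    IsScalarTower.algebraMap_apply k k[X] (RatFunc k),
    IsScalarTower.algebraMap_apply k k[X] (RatFunc k)]
  rfl

lemma low_const (c : k) : Low (algebraMap k (RatFunc k) c) (C c) 1 :=
  ⟨isCoprime_one_right, one_ne_zero, by
    rw [map_one, div_one, IsScalarTower.algebraMap_apply k k[X] (RatFunc k)]; rfl⟩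

lemma rd_const (c : k) : rd (algebraMap k (RatFunc k) c) = 0 := by
  rw [(low_const c).rd_eq]; simp [md2]

lemma low_X : Low (RatFunc.X : RatFunc k) X 1 :=
  ⟨isCoprime_one_right, one_ne_zero, by rw [map_one, div_one, RatFunc.algebraMap_X]⟩

lemma rd_X : rd (RatFunc.X : RatFunc k) = 1 := by
  rw [low_X.rd_eq]; simp [md2]

lemma rd_ne_zero {u : RatFunc k} (h : Transcendental k u) : rd u ≠ 0 := by
  intro h0
  obtain ⟨c, rfl⟩ := rd_eq_zero h0
  exact h (isAlgebraic_algebraMap c)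

/-- Homogenisation of degree `n` of a polynomial, evaluated at a pair. -/
def hom {R S : Type*} [CommSemiring R] [CommSemiring S] [Algebra R S] (n : ℕ) (a : R[X])
    (s t : S) : S :=
  ∑ i ∈ range (n + 1), algebraMap R S (a.coeff i) * s ^ i * t ^ (n - i)

lemma hom_eq_eval {L : Type*} [Field L] [Algebra k L] {n : ℕ} {a : k[X]} (hn : a.natDegree ≤ n)
    {s t : L} (ht : t ≠ 0) : hom n a s t = t ^ n * aeval (s / t) a := by
  unfold hom
  rw [aeval_eq_sum_range' (Nat.lt_succ_of_le hn), mul_sum]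
  refine sum_congr rfl fun i hi => ?_
  have hi' : i ≤ n := Nat.lt_succ_iff.1 (mem_range.1 hi)
  rw [Algebra.smul_def, div_pow, ← Nat.sub_add_cancel hi', pow_add, Nat.add_sub_cancel]
  field_simp

lemma hom_zero_right {L : Type*} [Field L] [Algebra k L] {n : ℕ} {a : k[X]} {s : L} :
    hom n a s 0 = algebraMap k L (a.coeff n) * s ^ n := by
  unfold hom
  rw [sum_eq_single n]
  · simp
  · intro b hb hbn
    rw [zero_pow, mul_zero]
    have := mem_range.1 hb
    omega
  · simp

lemma hom_not_both {a b : k[X]} (hab : IsCoprime a b) {n : ℕ} (hn : n = md2 (a, b)) {s t : k}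
    (ha : hom n a s t = 0) (hb : hom n b s t = 0) : s = 0 ∧ t = 0 := by
  have hna : a.natDegree ≤ n := by rw [hn]; exact le_max_left _ _
  have hnb : b.natDegree ≤ n := by rw [hn]; exact le_max_right _ _
  by_cases ht : t = 0
  · refine ⟨?_, ht⟩
    subst ht
    rw [hom_zero_right] at ha hb
    by_contra hs
    have hs' := pow_ne_zero n hs
    simp only [Algebra.algebraMap_self, RingHom.id_apply, mul_eq_zero, hs', or_false] at ha hb
    have key : ∀ {a b : k[X]}, b.natDegree ≤ a.natDegree → a.coeff a.natDegree = 0 →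
        b.coeff a.natDegree = 0 → IsCoprime a b → False := by
      intro a b h ha hb hab
      have ha0 := leadingCoeff_eq_zero.1 ha
      subst ha0
      rw [natDegree_zero] at h hb
      rw [eq_C_of_natDegree_le_zero h, hb, C_0] at hab
      exact not_isCoprime_zero_zero hab
    rcases le_total a.natDegree b.natDegree with h | h
    · rw [show n = b.natDegree by rw [hn]; exact max_eq_right h] at ha hb
      exact key h hb ha hab.symm
    · rw [show n = a.natDegree by rw [hn]; exact max_eq_left h] at ha hb
      exact key h ha hb hab
  · exfalso
    rw [hom_eq_eval hna ht] at ha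
    rw [hom_eq_eval hnb ht] at hb
    have h1 := (mul_eq_zero.1 ha).resolve_left (pow_ne_zero n ht)
    have h2 := (mul_eq_zero.1 hb).resolve_left (pow_ne_zero n ht)
    refine IsCoprime.not_eval hab (s / t) (Prod.ext ?_ ?_)
    · simpa [aeval_def] using h1
    · simpa [aeval_def] using h2

lemma eval_hom (n : ℕ) (a p q : k[X]) (x : k) :
    (hom n a p q).eval x = hom n a (p.eval x) (q.eval x) := by
  unfold hom
  rw [eval_finsetSum]
  refine sum_congr rfl fun i _ => ?_
  simp

lemma natDegree_hom_le {n l : ℕ} {a p q : k[X]} (hp : p.natDegree ≤ l) (hq : q.natDegree ≤ l) :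
    (hom n a p q).natDegree ≤ n * l := by
  unfold hom
  refine natDegree_sum_le_of_forall_le _ _ fun i hi => ?_
  have hi' : i ≤ n := Nat.lt_succ_iff.1 (mem_range.1 hi)
  calc _ ≤ (0 + i * l) + (n - i) * l := by
        refine natDegree_mul_le.trans (add_le_add (natDegree_mul_le.trans (add_le_add ?_ ?_)) ?_)
        · exact (natDegree_C _).le
        · exact natDegree_pow_le_of_le _ hp
        · exact natDegree_pow_le_of_le _ hq
    _ = n * l := by rw [zero_add, ← add_mul, Nat.add_sub_cancel' hi']

lemma coeff_hom {n l : ℕ} {a p q : k[X]} (hp : p.natDegree ≤ l) (hq : q.natDegree ≤ l) :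
    (hom n a p q).coeff (n * l) = hom n a (p.coeff l) (q.coeff l) := by
  unfold hom
  rw [finsetSum_coeff]
  refine sum_congr rfl fun i hi => ?_
  have hi' : i ≤ n := Nat.lt_succ_iff.1 (mem_range.1 hi)
  have e : n * l = (0 + i * l) + (n - i) * l := by
    rw [zero_add, ← add_mul, Nat.add_sub_cancel' hi']
  have h1 : (algebraMap k k[X] (a.coeff i)).natDegree ≤ 0 := (natDegree_C _).le
  have h2 := natDegree_pow_le_of_le i hp
  have h3 := natDegree_pow_le_of_le (n - i) hq
  rw [e, coeff_mul_add_eq_of_natDegree_le (natDegree_mul_le.trans (add_le_add h1 h2)) h3,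
    coeff_mul_add_eq_of_natDegree_le h1 h2, coeff_pow_of_natDegree_le hp,
    coeff_pow_of_natDegree_le hq]
  simp

lemma isCoprime_of_not_eval [IsAlgClosed k] {a b : k[X]}
    (h : ∀ x, a.eval x = 0 → b.eval x = 0 → False) : IsCoprime a b := by
  rw [Polynomial.isCoprime_iff_aeval_ne_zero_of_isAlgClosed k k]
  intro x
  by_contra! hx
  exact h x (by simpa [aeval_def] using hx.1) (by simpa [aeval_def] using hx.2)

lemma low_comp [IsAlgClosed k] {u v : RatFunc k} (hv : Transcendental k v) {a b c e : k[X]}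
    (hu : Low u a b) (hw : Low v c e) :
    Low (subsR v hv u) (hom (rd u) a c e) (hom (rd u) b c e) := by
  have hd : rd u = md2 (a, b) := hu.rd_eq
  have hna : a.natDegree ≤ rd u := by rw [hd]; exact le_max_left _ _
  have hnb : b.natDegree ≤ rd u := by rw [hd]; exact le_max_right _ _
  have cop : IsCoprime (hom (rd u) a c e) (hom (rd u) b c e) := by
    refine isCoprime_of_not_eval fun x h1 h2 => ?_
    rw [eval_hom] at h1 h2
    obtain ⟨h3, h4⟩ := hom_not_both hu.1 hd h1 h2
    exact IsCoprime.not_eval hw.1 x (Prod.ext h3 h4)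
  have he := algebraMap_poly_ne_zero hw.2.1
  have key : ∀ {P : k[X]}, P.natDegree ≤ rd u → algebraMap k[X] (RatFunc k) (hom (rd u) P c e) =
      (algebraMap k[X] (RatFunc k) e) ^ rd u * aeval v P := by
    intro P hP
    rw [hw.2.2, ← hom_eq_eval hP he]
    unfold hom
    rw [map_sum]
    refine sum_congr rfl fun i _ => ?_
    rw [map_mul, map_mul, map_pow, map_pow, ← IsScalarTower.algebraMap_apply]
  have hb0 : aeval v b ≠ 0 := fun h0 => hv ⟨b, hu.2.1, h0⟩
  refine ⟨cop, ?_, ?_⟩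
  · intro h0
    have := key hnb
    rw [h0, map_zero] at this
    exact mul_ne_zero (pow_ne_zero _ he) hb0 this.symm
  · rw [key hna, key hnb, mul_div_mul_left _ _ (pow_ne_zero _ he)]
    conv_lhs => rw [hu.2.2]
    rw [map_div₀, subsR_poly, subsR_poly]

/-- The degree is multiplicative under composition. -/
theorem rd_comp [IsAlgClosed k] (u v : RatFunc k) (hv : Transcendental k v) :
    rd (subsR v hv u) = rd u * rd v := by
  have hl := low_comp hv (low_num_denom u) (low_num_denom v)
  have h1 : v.num.natDegree ≤ rd v := le_max_left _ _
  have h2 : v.denom.natDegree ≤ rd v := le_max_right _ _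
  rw [hl.rd_eq]
  apply le_antisymm
  · exact max_le (natDegree_hom_le h1 h2) (natDegree_hom_le h1 h2)
  · by_contra hlt
    rw [not_le] at hlt
    have a1 := coeff_eq_zero_of_natDegree_lt ((le_max_left _ _).trans_lt hlt)
    have a2 := coeff_eq_zero_of_natDegree_lt ((le_max_right _ _).trans_lt hlt)
    rw [coeff_hom h1 h2] at a1 a2
    obtain ⟨z1, z2⟩ := hom_not_both (RatFunc.isCoprime_num_denom u) rfl a1 a2
    rcases le_total v.num.natDegree v.denom.natDegree with h | h
    · rw [show rd v = v.denom.natDegree from max_eq_right h] at z2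
      exact RatFunc.denom_ne_zero v (leadingCoeff_eq_zero.1 z2)
    · have e : rd v = v.num.natDegree := max_eq_left h
      rw [e] at z1
      have := leadingCoeff_eq_zero.1 z1
      apply rd_ne_zero hv
      rw [e, this, natDegree_zero]

end Degree

section Semilinear

variable {k : Type} [Field k] {A B : k} [EC A B]
variable {L : Type} [Field L] [Algebra k L] {K : Type} [Field K] [Algebra k K]

/-- Effect of a ring homomorphism fixing the coefficients on points, as a function. -/
def sfun (σ : L →+* K) (hA : σ (algebraMap k L A) = algebraMap k K A)
    (hB : σ (algebraMap k L B) = algebraMap k K B) (P : Pt A B L) : Pt A B K :=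
  if h : ∃ uv : L × L, ∃ h, P = Pt.mk uv.1 uv.2 h then
    Pt.mk (σ h.choose.1) (σ h.choose.2) (by
      obtain ⟨h', -⟩ := h.choose_spec
      rw [← map_pow, h', map_add, map_add, map_mul, map_pow, hA, hB])
  else 0

variable {σ : L →+* K} {hA : σ (algebraMap k L A) = algebraMap k K A}
  {hB : σ (algebraMap k L B) = algebraMap k K B}

lemma sfun_zero : sfun σ hA hB (0 : Pt A B L) = 0 := by
  unfold sfun
  rw [dif_neg]
  rintro ⟨uv, h, h'⟩
  exact Pt.mk_ne_zero _ _ _ h'.symm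

lemma sfun_mk (u v : L) (h) : sfun σ hA hB (Pt.mk u v h) = Pt.mk (σ u) (σ v)
    (by rw [← map_pow, h, map_add, map_add, map_mul, map_pow, hA, hB]) := by
  have h' : ∃ uv : L × L, ∃ h', (Pt.mk u v h : Pt A B L) = Pt.mk uv.1 uv.2 h' :=
    ⟨(u, v), h, rfl⟩
  unfold sfun
  rw [dif_pos h']
  obtain ⟨h1, h2⟩ := h'.choose_spec
  obtain ⟨h3, h4⟩ := Pt.mk_inj.1 h2
  exact Pt.mk_congr (congrArg σ h3.symm) (congrArg σ h4.symm)

lemma sfun_neg (P : Pt A B L) : sfun σ hA hB (-P) = -sfun σ hA hB P := by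
  rcases P.cases with rfl | ⟨u, v, h, rfl⟩
  · rw [neg_zero, sfun_zero, neg_zero]
  · rw [Pt.neg_mk, sfun_mk, sfun_mk, Pt.neg_mk]
    exact Pt.mk_congr rfl (map_neg _ _)

lemma sfun_add (P Q : Pt A B L) : sfun σ hA hB (P + Q) = sfun σ hA hB P + sfun σ hA hB Q := by
  rcases P.cases with rfl | ⟨u, v, h, rfl⟩
  · rw [zero_add, sfun_zero, zero_add]
  rcases Q.cases with rfl | ⟨u', v', h', rfl⟩
  · rw [add_zero, sfun_zero, add_zero]
  by_cases hu : u = u'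
  · subst hu
    rcases Pt.eq_or_neg (h := h) (h' := h') with e | e
    · rw [← e]
      by_cases hv : v = 0
      · have : -(Pt.mk u v h : Pt A B L) = Pt.mk u v h := by
          rw [Pt.neg_mk]; exact Pt.mk_congr rfl (by rw [hv, neg_zero])
        have e2 : ∀ R : Pt A B L, R + R = R - (-R) := fun R => by rw [sub_neg_eq_add]
        have e3 : (Pt.mk u v h : Pt A B L) + Pt.mk u v h = 0 := by rw [e2, this, sub_self]
        have e4 : sfun σ hA hB (Pt.mk u v h) = -sfun σ hA hB (Pt.mk u v h) := by
          rw [← sfun_neg, this]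
        rw [e3, sfun_zero]
        nth_rewrite 1 [e4]
        rw [neg_add_cancel]
      · rw [Pt.double_mk _ hv rfl, sfun_mk, sfun_mk,
          Pt.double_mk (σ ((3 * u ^ 2 + algebraMap k L A) / (2 * v)))
            ((map_ne_zero σ).2 hv) (by
              rw [map_div₀, map_add, map_mul, map_mul, map_pow, hA, map_ofNat, map_ofNat])]
        exact Pt.mk_congr (by simp) (by simp)
    · rw [e, neg_add_cancel, sfun_zero, sfun_neg, neg_add_cancel]
  · rw [Pt.add_mk _ hu rfl, sfun_mk, sfun_mk, sfun_mk,
      Pt.add_mk (σ ((v - v') / (u - u'))) (fun e => hu (σ.injective e)) (by simp)]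
    exact Pt.mk_congr (by simp) (by simp)

variable (σ hA hB) in
/-- Effect of a ring homomorphism fixing the coefficients on points. -/
def smap : Pt A B L →+ Pt A B K := AddMonoidHom.mk' (sfun σ hA hB) sfun_add

lemma smap_mk (u v : L) (h) : smap σ hA hB (Pt.mk u v h) = Pt.mk (σ u) (σ v)
    (by rw [← map_pow, h, map_add, map_add, map_mul, map_pow, hA, hB]) := sfun_mk (hA := hA) (hB := hB) u v h

end Semilinear

section Points

variable {k : Type} [Field k] {A B : k} [EC A B]
variable {L : Type} [Field L] [Algebra k L] {M : Type} [Field M] [Algebra k M]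

lemma mem_range_of_isAlgebraic [IsAlgClosed k] {u : L} (h : IsAlgebraic k u) :
    ∃ c, algebraMap k L c = u :=
  minpoly.mem_range_of_degree_eq_one k u
    (IsAlgClosed.degree_eq_one_of_irreducible k (minpoly.irreducible h.isIntegral))

variable (A B L) in
/-- Constant points. -/
def cst : Pt A B k →+ Pt A B L := pmap (Algebra.ofId k L)

lemma pmap_cst (φ : L →ₐ[k] M) (P : Pt A B k) : pmap φ (cst A B L P) = cst A B M P := by
  unfold cst
  rw [pmap_pmap]
  congr 1
  exact congrArg pmap (Subsingleton.elim _ _)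

lemma cst_injective : Function.Injective (cst A B L) := pmap_injective _

lemma pmap_comp_apply {K : Type} [Field K] [Algebra k K] (φ : L →ₐ[k] K) (ψ : K →ₐ[k] M)
    (P : Pt A B L) : pmap (ψ.comp φ) P = pmap ψ (pmap φ P) := (pmap_pmap φ ψ P).symm

lemma algHom_ext_gen {φ ψ : FF A B →ₐ[k] L} (h : pmap φ (gen A B) = pmap ψ (gen A B)) :
    φ = ψ := by
  unfold gen at h
  rw [pmap_mk, pmap_mk, Pt.mk_inj] at h
  exact algHom_FF_ext h.1 h.2

lemma mk_isCst [IsAlgClosed k] {u v : L} {h} (hu : IsAlgebraic k u) :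
    ∃ Q : Pt A B k, (Pt.mk u v h : Pt A B L) = cst A B L Q := by
  obtain ⟨c, rfl⟩ := mem_range_of_isAlgebraic hu
  have hv : IsAlgebraic k v := by
    have : IsAlgebraic k (v ^ 2) := by
      rw [h]
      exact ((hu.pow 3).add ((isAlgebraic_algebraMap A).mul hu)).add (isAlgebraic_algebraMap B)
    exact this.of_pow two_pos
  obtain ⟨e, rfl⟩ := mem_range_of_isAlgebraic hv
  refine ⟨Pt.mk c e ?_, ?_⟩
  · apply (algebraMap k L).injective
    simpa using h
  · unfold cst
    rw [pmap_mk]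
    exact Pt.mk_congr rfl rfl

/-- A point is either constant or the image of the generic point under an embedding. -/
lemma exists_embedding [IsAlgClosed k] (P : Pt A B L) :
    (∃ Q : Pt A B k, P = cst A B L Q) ∨ ∃ φ : FF A B →ₐ[k] L, pmap φ (gen A B) = P := by
  rcases P.cases with rfl | ⟨u, v, h, rfl⟩
  · exact Or.inl ⟨0, (map_zero _).symm⟩
  · by_cases hu : IsAlgebraic k u
    · exact Or.inl (mk_isCst hu)
    · right
      refine ⟨subs u v hu h, ?_⟩
      unfold gen
      rw [pmap_mk]
      exact Pt.mk_congr (subs_x ..) (subs_y ..)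

lemma gen_ne_cst [IsAlgClosed k] (Q : Pt A B k) : gen A B ≠ cst A B _ Q := by
  intro h
  rcases Q.cases with rfl | ⟨u, v, hc, rfl⟩
  · rw [map_zero] at h
    exact Pt.mk_ne_zero _ _ _ h
  · unfold gen cst at h
    rw [pmap_mk, Pt.mk_inj] at h
    apply transcendental_xF A B
    rw [h.1]
    exact isAlgebraic_algebraMap u

lemma emb_ne_cst [IsAlgClosed k] (φ : FF A B →ₐ[k] L) (Q : Pt A B k) :
    pmap φ (gen A B) ≠ cst A B _ Q := by
  rw [← pmap_cst φ]
  exact fun h => gen_ne_cst Q (pmap_injective φ h)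

lemma pmap_iota_gen : pmap (iota A B) (gen A B) = -gen A B := gen_mem_odd

lemma emb_comp_iota {φ : FF A B →ₐ[k] FF A B} (h : pmap φ (gen A B) ∈ odd A B) :
    φ.comp (iota A B) = (iota A B).comp φ := by
  apply algHom_ext_gen
  rw [pmap_comp_apply, pmap_comp_apply, pmap_iota_gen, map_neg, mem_odd.1 h]

lemma emb_mem_odd {φ : FF A B →ₐ[k] FF A B} (h : pmap φ (gen A B) ∈ odd A B)
    {P : Pt A B (FF A B)} (hP : P ∈ odd A B) : pmap φ P ∈ odd A B := by
  rw [mem_odd, ← pmap_comp_apply, ← emb_comp_iota h, pmap_comp_apply, mem_odd.1 hP, map_neg]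

lemma emb_ratFunc {φ : FF A B →ₐ[k] FF A B} {v t : RatFunc k} {hv : Tw A B v t}
    (h : pmap φ (gen A B) = opt v t hv) : ∃ hvt : Transcendental k v,
    ∀ r : RatFunc k, φ (algebraMap (RatFunc k) _ r) = algebraMap (RatFunc k) _ (subsR v hvt r) := by
  unfold gen opt at h
  rw [pmap_mk, Pt.mk_inj] at h
  have hvt : Transcendental k v := by
    have h1 : Transcendental k (φ (xF A B)) := by
      exact fun ha => transcendental_xF A B
        ((isAlgebraic_algHom_iff φ φ.toRingHom.injective).1 ha)
    rw [h.1] at h1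
    exact (transcendental_algebraMap_iff (algebraMap (RatFunc k) (FF A B)).injective).1 h1
  refine ⟨hvt, fun r => ?_⟩
  have : φ.comp (IsScalarTower.toAlgHom k (RatFunc k) (FF A B)) =
      (IsScalarTower.toAlgHom k (RatFunc k) (FF A B)).comp (subsR v hvt) := by
    apply algHom_ratFunc_ext
    rw [AlgHom.comp_apply, AlgHom.comp_apply, subsR_X]
    exact h.1
  exact DFunLike.congr_fun this r

/-- The height is multiplicative under composition. -/
theorem ht_pmap [IsAlgClosed k] {φ : FF A B →ₐ[k] FF A B} (h : pmap φ (gen A B) ∈ odd A B)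
    {P : Pt A B (FF A B)} (hP : P ∈ odd A B) :
    ht (pmap φ P) = ht P * ht (pmap φ (gen A B)) := by
  rcases odd_cases hP with rfl | ⟨u, s, hu, rfl⟩
  · rw [map_zero, ht_zero, zero_mul]
  have h0 : pmap φ (gen A B) ≠ 0 := by
    have := emb_ne_cst φ (0 : Pt A B k)
    rwa [map_zero] at this
  rcases odd_cases h with h1 | ⟨v, t, hv, h1⟩
  · exact absurd h1 h0
  obtain ⟨hvt, hr⟩ := emb_ratFunc h1
  have h2 : pmap φ (opt u s hu) ≠ 0 := by
    intro e
    rw [← map_zero (pmap φ)] at e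
    exact opt_ne_zero (pmap_injective φ e)
  rcases odd_cases (emb_mem_odd h hP) with h3 | ⟨w, r, hw, h3⟩
  · exact absurd h3 h2
  have hwu : w = subsR v hvt u := by
    apply (algebraMap (RatFunc k) (FF A B)).injective
    rw [← hr]
    unfold opt at h3
    rw [pmap_mk, Pt.mk_inj] at h3
    exact h3.1.symm
  rw [h3, h1, ht_opt, ht_opt, ht_opt, hwu, rd_comp]

lemma ht_gen : ht (gen A B) = 1 := by
  rw [gen_eq, ht_opt, rd_X]

lemma Tw.eq_zero_of_const {u s : RatFunc k} (h : Tw A B u s) {c : k}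
    (hc : u = algebraMap k (RatFunc k) c) : s = 0 := by
  by_contra hs
  subst hc
  set e := c ^ 3 + A * c + B with he
  have h' : s ^ 2 * cubicR A B = algebraMap k (RatFunc k) e := by
    rw [he, h]; simp
  have e0 : e ≠ 0 := by
    intro h0
    rw [h0, map_zero] at h'
    exact mul_ne_zero (pow_ne_zero 2 hs) (cubicR_ne_zero A B) h'
  have := congrArg RatFunc.intDegree h'
  rw [RatFunc.intDegree_mul (pow_ne_zero 2 hs) (cubicR_ne_zero A B), sq,
    RatFunc.intDegree_mul hs hs, intDegree_cubicR, RatFunc.algebraMap_eq_C,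
    RatFunc.intDegree_C] at this
  omega

lemma two_zsmul_of_ht_eq_zero {P : Pt A B (FF A B)} (hP : P ∈ odd A B) (h : ht P = 0) :
    P + P = 0 := by
  rcases odd_cases hP with rfl | ⟨u, s, hu, rfl⟩
  · rw [add_zero]
  · rw [ht_opt] at h
    obtain ⟨c, hc⟩ := rd_eq_zero h
    have hs := hu.eq_zero_of_const hc
    have : -opt u s hu = opt u s hu := by
      rw [neg_opt]; exact opt_congr rfl (by rw [hs, neg_zero])
    nth_rewrite 2 [← this]
    rw [add_neg_cancel]

end Points

section OptAdd

variable {k : Type} [Field k] {A B : k} [EC A B]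

lemma Tw.add {u₁ s₁ u₂ s₂ l : RatFunc k} (h₁ : Tw A B u₁ s₁) (h₂ : Tw A B u₂ s₂)
    (hne : u₁ ≠ u₂) (hl : l = (s₁ - s₂) / (u₁ - u₂)) :
    Tw A B (l ^ 2 * cubicR A B - u₁ - u₂)
      (l * (u₁ - (l ^ 2 * cubicR A B - u₁ - u₂)) - s₁) := by
  have hs : u₁ - u₂ ≠ 0 := sub_ne_zero.2 hne
  unfold Tw at *
  have e1 : l * (u₁ - u₂) = s₁ - s₂ := by rw [hl, div_mul_cancel₀ _ hs]
  have e2 : l * (s₁ + s₂) * cubicR A B =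
      u₁ ^ 2 + u₁ * u₂ + u₂ ^ 2 + algebraMap k (RatFunc k) A := by
    apply mul_left_cancel₀ hs
    linear_combination (s₁ + s₂) * cubicR A B * e1 + h₁ - h₂
  have e3 : 2 * l * s₁ * cubicR A B = u₁ ^ 2 + u₁ * u₂ + u₂ ^ 2 + algebraMap k (RatFunc k) A +
      l ^ 2 * cubicR A B * (u₁ - u₂) := by
    linear_combination e2 - l * cubicR A B * e1
  linear_combination h₁ - (u₁ - (l ^ 2 * cubicR A B - u₁ - u₂)) * e3

lemma opt_add {u₁ s₁ u₂ s₂ l : RatFunc k} {h₁ : Tw A B u₁ s₁} {h₂ : Tw A B u₂ s₂}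
    (hne : u₁ ≠ u₂) (hl : l = (s₁ - s₂) / (u₁ - u₂)) :
    opt u₁ s₁ h₁ + opt u₂ s₂ h₂ = opt _ _ (h₁.add h₂ hne hl) := by
  unfold opt
  rw [Pt.add_mk (algebraMap (RatFunc k) (FF A B) l * yF A B)
    (fun e => hne ((algebraMap (RatFunc k) (FF A B)).injective e))
    (by rw [hl, map_div₀, map_sub, map_sub]; ring)]
  refine Pt.mk_congr ?_ ?_
  · simp only [map_mul, map_sub, map_pow, ← yF_sq']; ring
  · simp only [map_mul, map_sub, map_pow, ← yF_sq']; ring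

lemma two_ne_zero_ratFunc (A B : k) [EC A B] : (2 : RatFunc k) ≠ 0 := EC.two' A B _

lemma Tw.double {u s l : RatFunc k} (h : Tw A B u s) (hs : s ≠ 0)
    (hl : l = (3 * u ^ 2 + algebraMap k (RatFunc k) A) / (2 * s * cubicR A B)) :
    Tw A B (l ^ 2 * cubicR A B - u - u) (l * (u - (l ^ 2 * cubicR A B - u - u)) - s) := by
  have e : 2 * l * s * cubicR A B = 3 * u ^ 2 + algebraMap k (RatFunc k) A := by
    have := two_ne_zero_ratFunc A B
    have := cubicR_ne_zero A B
    rw [hl]; field_simp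
  unfold Tw at *
  linear_combination h - (u - (l ^ 2 * cubicR A B - u - u)) * e

lemma opt_double {u s l : RatFunc k} {h : Tw A B u s} (hs : s ≠ 0)
    (hl : l = (3 * u ^ 2 + algebraMap k (RatFunc k) A) / (2 * s * cubicR A B)) :
    opt u s h + opt u s h = opt _ _ (h.double hs hl) := by
  have hinj := (algebraMap (RatFunc k) (FF A B)).injective
  have hy := yF_ne_zero A B
  have hs' : algebraMap (RatFunc k) (FF A B) s ≠ 0 := (_root_.map_ne_zero _).2 hs
  have h2 : (2 : FF A B) ≠ 0 := EC.two' A B _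
  unfold opt
  rw [Pt.double_mk (algebraMap (RatFunc k) (FF A B) l * yF A B) (mul_ne_zero hs' hy)
    (by
      rw [hl, map_div₀, map_add, map_mul, map_mul, map_mul, map_pow, ← yF_sq', map_ofNat,
        map_ofNat, ← IsScalarTower.algebraMap_apply]
      field_simp)]
  refine Pt.mk_congr ?_ ?_
  · simp only [map_mul, map_sub, map_pow, ← yF_sq']; ring
  · simp only [map_mul, map_sub, map_pow, ← yF_sq']; ring

end OptAdd

section Frobenius

variable {k : Type} [Field k] {A B : k} [EC A B] {p : ℕ}

section Basic

variable {L : Type} [Field L] [Algebra k L] {K : Type} [Field K] [Algebra k K]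

variable (L) in
/-- The Frobenius endomorphism on points of a curve with coefficients in the prime field. -/
def frob [ExpChar L p] (hA : A ^ p = A) (hB : B ^ p = B) : Pt A B L →+ Pt A B L :=
  smap (frobenius L p) (by rw [frobenius_def, ← map_pow, hA]) (by rw [frobenius_def, ← map_pow, hB])

variable [ExpChar L p] [ExpChar K p] {hA : A ^ p = A} {hB : B ^ p = B}

lemma frob_mk (u v : L) (h) : frob L hA hB (Pt.mk u v h) = Pt.mk (u ^ p) (v ^ p)
    (by rw [← pow_mul, mul_comm, pow_mul, h, add_pow_expChar, add_pow_expChar, mul_pow,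
      ← map_pow _ A, hA, ← map_pow _ B, hB]; ring) := by
  unfold frob
  rw [smap_mk]
  exact Pt.mk_congr rfl rfl

lemma frob_pmap (φ : L →ₐ[k] K) (P : Pt A B L) :
    frob K hA hB (pmap φ P) = pmap φ (frob L hA hB P) := by
  rcases P.cases with rfl | ⟨u, v, h, rfl⟩
  · simp only [map_zero]
  · rw [pmap_mk, frob_mk, frob_mk, pmap_mk]
    exact Pt.mk_congr (map_pow _ _ _).symm (map_pow _ _ _).symm

end Basic

instance [ExpChar k p] : ExpChar (FF A B) p :=
  expChar_of_injective_algebraMap (algebraMap k (FF A B)).injective p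

instance [ExpChar k p] : ExpChar (RatFunc k) p :=
  expChar_of_injective_algebraMap (algebraMap k (RatFunc k)).injective p

variable [ExpChar k p] (hA : A ^ p = A) (hB : B ^ p = B)

lemma frob_mem_odd {P : Pt A B (FF A B)} (hP : P ∈ odd A B) : frob _ hA hB P ∈ odd A B := by
  rw [mem_odd, ← frob_pmap, mem_odd.1 hP, map_neg]

lemma Tw.frob {n : ℕ} (hn : p = 2 * n + 1) {u s : RatFunc k} (h : Tw A B u s)
    (hA : A ^ p = A) (hB : B ^ p = B) : Tw A B (u ^ p) (s ^ p * cubicR A B ^ n) := by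
  unfold Tw at *
  have : (s ^ p * cubicR A B ^ n) ^ 2 * cubicR A B = (s ^ 2 * cubicR A B) ^ p := by
    rw [mul_pow, mul_pow, hn]; ring
  rw [this, h, add_pow_expChar, add_pow_expChar, mul_pow, ← map_pow _ A, hA, ← map_pow _ B, hB]
  ring

lemma frob_opt {n : ℕ} (hn : p = 2 * n + 1) {u s : RatFunc k} (h : Tw A B u s) :
    LT.frob _ hA hB (opt u s h) = opt (u ^ p) (s ^ p * cubicR A B ^ n) (h.frob hn hA hB) := by
  unfold opt
  rw [frob_mk]
  refine Pt.mk_congr (map_pow _ _ _).symm ?_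
  rw [map_mul, mul_pow, map_pow, map_pow, ← yF_sq', mul_assoc]
  congr 1
  rw [hn]; ring

lemma rd_pow (u : RatFunc k) (n : ℕ) : rd (u ^ n) = n * rd u := by
  have h := low_num_denom u
  have : Low (u ^ n) (u.num ^ n) (u.denom ^ n) :=
    ⟨h.1.pow, pow_ne_zero _ h.2.1, by rw [map_pow, map_pow, ← div_pow, ← h.2.2]⟩
  rw [this.rd_eq]
  unfold rd md2
  simp only [natDegree_pow]
  exact (Nat.mul_max_mul_left _ _ _).symm ▸ rfl

lemma ht_frob {n : ℕ} (hn : p = 2 * n + 1) {P : Pt A B (FF A B)} (hP : P ∈ odd A B) :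
    ht (LT.frob _ hA hB P) = p * ht P := by
  rcases odd_cases hP with rfl | ⟨u, s, h, rfl⟩
  · rw [map_zero, ht_zero, mul_zero]
  · rw [frob_opt hA hB hn, ht_opt, ht_opt, rd_pow]

/-- Explicit form of the difference of Frobenius and the identity. -/
lemma frob_gen_sub {n : ℕ} (hn : p = 2 * n + 1) (hn0 : 0 < n) :
    ∃ s h, LT.frob _ hA hB (gen A B) - gen A B =
      opt (((cubicR A B ^ n + 1) / (RatFunc.X ^ p - RatFunc.X)) ^ 2 * cubicR A B
        - RatFunc.X ^ p - RatFunc.X) s h := by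
  have hne : (RatFunc.X : RatFunc k) ^ p ≠ RatFunc.X := by
    intro h
    have h1 : rd ((RatFunc.X : RatFunc k) ^ p) = rd (RatFunc.X : RatFunc k) := by rw [h]
    rw [rd_pow, rd_X] at h1
    omega
  rw [gen_eq, frob_opt hA hB hn, sub_eq_add_neg (opt _ _ _), neg_opt,
    opt_add hne (l := (cubicR A B ^ n + 1) / (RatFunc.X ^ p - RatFunc.X)) (by ring)]
  exact ⟨_, _, rfl⟩

end Frobenius

section CubicFacts

variable {k : Type} [Field k] {A B : k}

lemma cubic_derivative : derivative (cubic A B) = 3 * X ^ 2 + C A := by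
  unfold cubic
  simp only [derivative_add, derivative_mul, derivative_X_pow, derivative_C, derivative_X]
  norm_num
  rfl

lemma cubic_bezout (h : 4 * A ^ 3 + 27 * B ^ 2 ≠ 0) :
    IsCoprime (cubic A B) (derivative (cubic A B)) := by
  have hu : IsUnit (C (4 * A ^ 3 + 27 * B ^ 2) : k[X]) := isUnit_C.2 h.isUnit
  obtain ⟨e, he⟩ := hu.exists_left_inv
  refine ⟨e * (27 * C B - 18 * C A * X), e * (6 * C A * X ^ 2 - 9 * C B * X + 4 * C A ^ 2), ?_⟩
  rw [← he, cubic_derivative]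
  unfold cubic
  simp only [map_add, map_mul, map_pow, map_ofNat]
  ring

lemma sq_not_dvd_cubic (h : 4 * A ^ 3 + 27 * B ^ 2 ≠ 0) (x : k) : ¬ (X - C x) ^ 2 ∣ cubic A B := by
  intro hd
  obtain ⟨q, hq⟩ := hd
  have h1 : X - C x ∣ cubic A B := by rw [hq]; exact ⟨(X - C x) * q, by ring⟩
  have h2 : X - C x ∣ derivative (cubic A B) := by
    rw [hq, derivative_mul, derivative_X_sub_C_sq]
    exact ⟨2 * q + (X - C x) * derivative q, by simp only [map_ofNat]; ring⟩
  exact not_isUnit_X_sub_C x ((cubic_bezout h).isUnit_of_dvd' h1 h2)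

end CubicFacts

section Manin

variable {p : ℕ} [Fact p.Prime] (A B : ZMod p)

lemma prod_X_sub_C_zmod : ∏ x : ZMod p, (X - C x) = X ^ p - X := by
  have h1 := FiniteField.roots_X_pow_card_sub_X (ZMod p)
  rw [ZMod.card p] at h1
  have hp := (Fact.out (p := p.Prime)).one_lt
  have hm : (X ^ p - X : (ZMod p)[X]).Monic := by
    apply monic_X_pow_sub
    rw [degree_X]; exact_mod_cast hp
  have h2 := prod_multiset_X_sub_C_of_monic_of_roots_card_eq hm (by
    rw [h1, FiniteField.X_pow_card_sub_X_natDegree_eq _ hp]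
    simp [ZMod.card])
  rw [h1] at h2
  exact h2

/-- The numerator of the abscissa of `π - 1`. -/
def maninN (n : ℕ) : (ZMod p)[X] :=
  (cubic A B ^ n + 1) ^ 2 * cubic A B - (X ^ p + X) * (X ^ p - X) ^ 2

lemma natDegree_maninN {n : ℕ} (hn : p = 2 * n + 1) (hn2 : 2 ≤ n) :
    (maninN A B n).natDegree = 2 * p + 1 := by
  have hf : cubic A B ^ p = X ^ (3 * p) + C A * X ^ p + C B := by
    rw [← ZMod.expand_card]
    unfold cubic
    simp only [map_add, map_mul, map_pow, expand_X, expand_C]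
    ring
  have e : maninN A B n = X ^ (2 * p + 1) + (C A * X ^ p + C B + 2 * cubic A B ^ (n + 1) + cubic A B
      + X ^ (p + 2) - X ^ 3) := by
    have : maninN A B n = cubic A B ^ p + 2 * cubic A B ^ (n + 1) + cubic A B -
        (X ^ p + X) * (X ^ p - X) ^ 2 := by
      have : cubic A B ^ p = cubic A B ^ (2 * n + 1) := congrArg (cubic A B ^ ·) hn
      unfold maninN; rw [this]; ring
    rw [this, hf]; ring
  rw [e]
  have h1 : natDegree (C A * X ^ p + C B + 2 * cubic A B ^ (n + 1) + cubic A B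
      + X ^ (p + 2) - X ^ 3) < 2 * p + 1 := by
    have hc : natDegree (2 * cubic A B ^ (n + 1)) ≤ 3 * (n + 1) := by
      have : (2 : (ZMod p)[X]) = C 2 := rfl
      rw [this]
      refine (natDegree_C_mul_le _ _).trans ?_
      rw [natDegree_pow, natDegree_cubic]; omega
    have : natDegree (C A * X ^ p + C B + 2 * cubic A B ^ (n + 1) + cubic A B
      + X ^ (p + 2) - X ^ 3) ≤ 2 * p := by
      rw [← max_self (2 * p)]
      refine natDegree_sub_le_of_le (natDegree_add_le_of_degree_le (natDegree_add_le_of_degree_le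
        (natDegree_add_le_of_degree_le (natDegree_add_le_of_degree_le ?_ ?_) ?_) ?_) ?_) ?_
      · exact (natDegree_C_mul_X_pow_le _ _).trans (by omega)
      · rw [natDegree_C]; omega
      · exact hc.trans (by omega)
      · rw [natDegree_cubic]; omega
      · rw [natDegree_X_pow]; omega
      · rw [natDegree_X_pow]; omega
    omega
  rw [natDegree_add_eq_left_of_natDegree_lt (by rw [natDegree_X_pow]; exact h1), natDegree_X_pow]

/-- Exponent of `X - x` in the gcd. -/
def eN (x : ZMod p) : ℕ := (1 - quadraticChar (ZMod p) ((cubic A B).eval x)).toNat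
/-- Exponent of `X - x` in the reduced denominator. -/
def eD (x : ZMod p) : ℕ := (1 + quadraticChar (ZMod p) ((cubic A B).eval x)).toNat

lemma chi_cases (x : ZMod p) :
    ((cubic A B).eval x = 0 ∧ eN A B x = 1 ∧ eD A B x = 1) ∨
    ((cubic A B).eval x ≠ 0 ∧ quadraticChar (ZMod p) ((cubic A B).eval x) = 1 ∧
      eN A B x = 0 ∧ eD A B x = 2) ∨
    ((cubic A B).eval x ≠ 0 ∧ quadraticChar (ZMod p) ((cubic A B).eval x) = -1 ∧
      eN A B x = 2 ∧ eD A B x = 0) := by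
  unfold eN eD
  by_cases h : (cubic A B).eval x = 0
  · left; rw [h, quadraticChar_zero]; simp
  · rcases quadraticChar_dichotomy h with h' | h'
    · right; left; rw [h']; simp [h]
    · right; right; rw [h']; simp [h]

lemma eN_add_eD (x : ZMod p) : eN A B x + eD A B x = 2 := by
  rcases chi_cases A B x with ⟨-, h1, h2⟩ | ⟨-, -, h1, h2⟩ | ⟨-, -, h1, h2⟩ <;> omega

lemma pow_half {n : ℕ} (hn : p = 2 * n + 1) (hn2 : 2 ≤ n) (a : ZMod p) :
    a ^ n = (quadraticChar (ZMod p) a : ZMod p) := by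
  have hp : ringChar (ZMod p) ≠ 2 := by rw [ZMod.ringChar_zmod_n]; omega
  rw [quadraticChar_eq_pow_of_char_ne_two' hp, ZMod.card]
  congr 1; omega

lemma card_points {n : ℕ} (hn : p = 2 * n + 1) (hn2 : 2 ≤ n) :
    Nat.card {P : ZMod p × ZMod p // P.2 ^ 2 = P.1 ^ 3 + A * P.1 + B} = ∑ x, eD A B x := by
  have hp : ringChar (ZMod p) ≠ 2 := by rw [ZMod.ringChar_zmod_n]; omega
  let e : {P : ZMod p × ZMod p // P.2 ^ 2 = P.1 ^ 3 + A * P.1 + B} ≃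
      Σ x : ZMod p, {y : ZMod p // y ^ 2 = (cubic A B).eval x} :=
    { toFun := fun P => ⟨P.1.1, P.1.2, by rw [P.2]; simp [cubic]⟩
      invFun := fun P => ⟨(P.1, P.2.1), by have := P.2.2; simpa [cubic] using this⟩
      left_inv := fun P => rfl
      right_inv := fun P => rfl }
  rw [Nat.card_congr e, Nat.card_sigma]
  refine Finset.sum_congr rfl fun x _ => ?_
  have h := quadraticChar_card_sqrts hp ((cubic A B).eval x)
  have h2 : Nat.card {y : ZMod p // y ^ 2 = (cubic A B).eval x}
      = #{y | y ^ 2 = (cubic A B).eval x}.toFinset := by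
    rw [Set.toFinset_card, Nat.card_eq_fintype_card]; rfl
  rw [h2]; unfold eD; omega

lemma prod_dvd_maninN {n : ℕ} (hn : p = 2 * n + 1) (hn2 : 2 ≤ n) :
    ∏ x, (X - C x) ^ eN A B x ∣ maninN A B n := by
  apply Finset.prod_dvd_of_coprime
  · intro x _ y _ hxy
    exact (pairwise_coprime_X_sub_C Function.injective_id hxy).pow
  · intro x _
    have hX : X - C x ∣ (X ^ p - X : (ZMod p)[X]) := by
      rw [← prod_X_sub_C_zmod]; exact Finset.dvd_prod_of_mem _ (mem_univ x)
    have hX2 : (X - C x) ^ 2 ∣ (X ^ p + X : (ZMod p)[X]) * (X ^ p - X) ^ 2 :=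
      Dvd.dvd.mul_left (pow_dvd_pow_of_dvd hX 2) _
    rcases chi_cases A B x with ⟨h, h1, h2⟩ | ⟨-, -, h1, h2⟩ | ⟨-, h, h1, h2⟩
    · rw [h1, pow_one]
      exact dvd_sub (Dvd.dvd.mul_left (dvd_iff_isRoot.2 h) _) ((dvd_pow_self _ two_ne_zero).trans hX2)
    · rw [h1, pow_zero]; exact one_dvd _
    · rw [h1]
      refine dvd_sub (Dvd.dvd.mul_right (pow_dvd_pow_of_dvd (dvd_iff_isRoot.2 ?_) 2) _) hX2
      rw [IsRoot, eval_add, eval_pow, pow_half hn hn2, h]; simp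

/-- Lowest terms for the abscissa of `π - 1`. -/
lemma manin_lowest (hd : 4 * A ^ 3 + 27 * B ^ 2 ≠ 0) {n : ℕ} (hn : p = 2 * n + 1) (hn2 : 2 ≤ n) :
    ∃ g N D : (ZMod p)[X], IsCoprime N D ∧ g ≠ 0 ∧ D ≠ 0 ∧ maninN A B n = g * N ∧
      (X ^ p - X) ^ 2 = g * D ∧
      max N.natDegree D.natDegree =
        1 + Nat.card {P : ZMod p × ZMod p // P.2 ^ 2 = P.1 ^ 3 + A * P.1 + B} := by
  obtain ⟨N, hN⟩ := prod_dvd_maninN A B hn hn2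
  have hg : ∏ x : ZMod p, (X - C x) ^ eN A B x ≠ 0 :=
    Finset.prod_ne_zero_iff.2 fun x _ => pow_ne_zero _ (X_sub_C_ne_zero x)
  have hD : ∏ x : ZMod p, (X - C x) ^ eD A B x ≠ 0 :=
    Finset.prod_ne_zero_iff.2 fun x _ => pow_ne_zero _ (X_sub_C_ne_zero x)
  have hgd : (∏ x : ZMod p, (X - C x) ^ eN A B x).natDegree = ∑ x, eN A B x := by
    rw [natDegree_prod _ _ fun x _ => pow_ne_zero _ (X_sub_C_ne_zero x)]
    simp
  have hDd : (∏ x : ZMod p, (X - C x) ^ eD A B x).natDegree = ∑ x, eD A B x := by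
    rw [natDegree_prod _ _ fun x _ => pow_ne_zero _ (X_sub_C_ne_zero x)]
    simp
  have hsum : ∑ x, eN A B x + ∑ x, eD A B x = 2 * p := by
    rw [← Finset.sum_add_distrib, Finset.sum_congr rfl fun x _ => eN_add_eD A B x]
    simp [ZMod.card, mul_comm]
  have hdeg := natDegree_maninN A B hn hn2
  have hN0 : N ≠ 0 := by rintro rfl; rw [mul_zero] at hN; rw [hN, natDegree_zero] at hdeg; omega
  have hdeg' := hdeg
  rw [hN, natDegree_mul hg hN0, hgd] at hdeg'
  refine ⟨_, N, ∏ x : ZMod p, (X - C x) ^ eD A B x, ?_, hg, hD, hN, ?_, ?_⟩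
  · apply IsCoprime.prod_right
    intro x _
    by_cases h0 : eD A B x = 0
    · rw [h0, pow_zero]; exact isCoprime_one_right
    apply IsCoprime.pow_right
    rw [isCoprime_comm]
    refine (irreducible_X_sub_C x).coprime_iff_not_dvd.2 fun hdvd => ?_
    have hX : X - C x ∣ (X ^ p - X : (ZMod p)[X]) := by
      rw [← prod_X_sub_C_zmod]; exact Finset.dvd_prod_of_mem _ (mem_univ x)
    have hX2 : (X - C x) ^ 2 ∣ (X ^ p + X : (ZMod p)[X]) * (X ^ p - X) ^ 2 :=
      Dvd.dvd.mul_left (pow_dvd_pow_of_dvd hX 2) _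
    rcases chi_cases A B x with ⟨h, h1, h2⟩ | ⟨h0, h, h1, h2⟩ | ⟨-, h, h1, h2⟩
    · have h3 : (X - C x) ^ 2 ∣ maninN A B n := by
        rw [hN, sq]
        refine mul_dvd_mul ?_ hdvd
        refine dvd_trans ?_ (Finset.dvd_prod_of_mem _ (mem_univ x))
        rw [h1, pow_one]
      have h4 : (X - C x) ^ 2 ∣ (cubic A B ^ n + 1) ^ 2 * cubic A B := by
        have := dvd_add h3 hX2
        unfold maninN at this
        rwa [sub_add_cancel] at this
      refine sq_not_dvd_cubic hd x (IsCoprime.dvd_of_dvd_mul_left ?_ h4)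
      apply IsCoprime.pow
      refine (irreducible_X_sub_C x).coprime_iff_not_dvd.2 fun h5 => ?_
      have h6 := dvd_iff_isRoot.1 h5
      rw [IsRoot, eval_add, eval_pow, h, zero_pow (by omega)] at h6
      simp at h6
    · have h3 := dvd_iff_isRoot.1 (hdvd.trans (Dvd.intro_left _ hN.symm))
      unfold maninN at h3
      rw [IsRoot, eval_sub, eval_mul, eval_pow, eval_add, eval_pow, pow_half hn hn2, h,
        eval_mul, dvd_iff_isRoot.1 (hX.trans (dvd_pow_self _ two_ne_zero))] at h3
      have h4 : (2 : ZMod p) ≠ 0 := by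
        have hp2 : p ≠ 2 := by omega
        intro h2
        apply hp2
        have := (ZMod.natCast_eq_zero_iff 2 p).1 (by exact_mod_cast h2)
        exact (Nat.prime_dvd_prime_iff_eq Fact.out Nat.prime_two).1 this
      have h5 : (2 : ZMod p) ^ 2 * (cubic A B).eval x = 0 := by
        rw [← h3]; simp; left; norm_num
      exact mul_ne_zero (pow_ne_zero 2 h4) h0 h5
    · exact absurd h2 (by omega)
  · rw [← Finset.prod_mul_distrib, ← prod_X_sub_C_zmod, ← Finset.prod_pow]
    refine Finset.prod_congr rfl fun x _ => ?_
    rw [← pow_add, eN_add_eD]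
  · rw [hDd, card_points A B hn hn2]
    omega

end Manin

section Char

variable {k : Type} [Field k] {A B : k} [EC A B]

lemma ht_cst {Q : Pt A B k} (h : cst A B (FF A B) Q ∈ odd A B) : ht (cst A B (FF A B) Q) = 0 := by
  rcases Q.cases with rfl | ⟨u, v, hc, rfl⟩
  · rw [map_zero, ht_zero]
  rcases odd_cases h with h1 | ⟨u', s, h', h1⟩
  · rw [h1, ht_zero]
  · rw [h1, ht_opt]
    unfold opt cst at h1
    rw [pmap_mk, Pt.mk_inj] at h1
    have : u' = algebraMap k (RatFunc k) u := by
      apply (algebraMap (RatFunc k) (FF A B)).injective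
      rw [← h1.1, ← IsScalarTower.algebraMap_apply]
      rfl
    rw [this, rd_const]

variable (A B) in
/-- The height as an integer valued function on odd points. -/
def htZ (P : odd A B) : ℤ := ht (P : Pt A B (FF A B))

lemma htZ_para [IsAlgClosed k] (x y : odd A B) :
    htZ A B (x + y) + htZ A B (x - y) = 2 * (htZ A B x + htZ A B y) := by
  unfold htZ
  exact_mod_cast ht_add_add_ht_sub x.2 y.2

end Char

section FrobChar

variable {k : Type} [Field k] [IsAlgClosed k] {p : ℕ} [Fact p.Prime] [Algebra (ZMod p) k]

instance : ExpChar k p := expChar_of_injective_algebraMap (algebraMap (ZMod p) k).injective p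

lemma algebraMap_pow_p (a : ZMod p) : (algebraMap (ZMod p) k a) ^ p = algebraMap (ZMod p) k a := by
  rw [← map_pow, ZMod.pow_card]

/-- Number of affine points. -/
def affCard (A B : ZMod p) : ℕ :=
  Nat.card {P : ZMod p × ZMod p // P.2 ^ 2 = P.1 ^ 3 + A * P.1 + B}

variable {A B : ZMod p} [EC (algebraMap (ZMod p) k A) (algebraMap (ZMod p) k B)]

variable (k A B) in
/-- Frobenius on points of the function field. -/
def fr : Pt (algebraMap (ZMod p) k A) (algebraMap (ZMod p) k B)
      (FF (algebraMap (ZMod p) k A) (algebraMap (ZMod p) k B)) →+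
    Pt (algebraMap (ZMod p) k A) (algebraMap (ZMod p) k B)
      (FF (algebraMap (ZMod p) k A) (algebraMap (ZMod p) k B)) :=
  frob _ (p := p) (algebraMap_pow_p A) (algebraMap_pow_p B)

lemma map_cubic : (cubic A B).map (algebraMap (ZMod p) k) =
    cubic (algebraMap (ZMod p) k A) (algebraMap (ZMod p) k B) := by
  unfold cubic; simp

lemma ht_fr_gen_sub {n : ℕ} (hn : p = 2 * n + 1) (hn2 : 2 ≤ n) :
    ht (fr k A B (gen _ _) - gen _ _) = 1 + affCard A B := by
  have hd : 4 * A ^ 3 + 27 * B ^ 2 ≠ 0 := by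
    intro h0
    have := EC.disc (A := algebraMap (ZMod p) k A) (B := algebraMap (ZMod p) k B)
    apply this
    rw [← map_pow, ← map_pow, ← map_ofNat (algebraMap (ZMod p) k) 4,
      ← map_ofNat (algebraMap (ZMod p) k) 27, ← map_mul, ← map_mul, ← map_add, h0, map_zero]
  obtain ⟨g, N, D, hND, hg, hD, hN, hD', hdeg⟩ := manin_lowest A B hd hn hn2
  obtain ⟨s, h, e⟩ := frob_gen_sub (k := k) (p := p) (algebraMap_pow_p A) (algebraMap_pow_p B) hn
    (by omega)
  unfold fr
  rw [e, ht_opt]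
  set σ := algebraMap (ZMod p) k
  have hlow : Low ((((cubicR (σ A) (σ B) ^ n + 1) / (RatFunc.X ^ p - RatFunc.X)) ^ 2 *
      cubicR (σ A) (σ B) - RatFunc.X ^ p - RatFunc.X)) (N.map σ) (D.map σ) := by
    refine ⟨hND.map (mapRingHom σ), (Polynomial.map_ne_zero_iff σ.injective).2 hD, ?_⟩
    have h1 : (cubic (σ A) (σ B) ^ n + 1) ^ 2 * cubic (σ A) (σ B) - (X ^ p + X) * (X ^ p - X) ^ 2 =
        g.map σ * N.map σ := by
      rw [← Polynomial.map_mul, ← hN, ← map_cubic]; unfold maninN; simp [σ]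
    have h2 : (X ^ p - X : k[X]) ^ 2 = g.map σ * D.map σ := by
      rw [← Polynomial.map_mul, ← hD']; simp
    set r := algebraMap k[X] (RatFunc k)
    have hg' : r (g.map σ) ≠ 0 :=
      algebraMap_poly_ne_zero ((Polynomial.map_ne_zero_iff σ.injective).2 hg)
    have hD2 : r (D.map σ) ≠ 0 :=
      algebraMap_poly_ne_zero ((Polynomial.map_ne_zero_iff σ.injective).2 hD)
    have h1' := congrArg r h1
    have h2' := congrArg r h2
    simp only [map_mul, map_sub, map_add, map_pow, map_one] at h1' h2'
    have h3 : r X = RatFunc.X := RatFunc.algebraMap_X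
    rw [h3] at h1' h2'
    change (cubicR (σ A) (σ B) ^ n + 1) ^ 2 * cubicR (σ A) (σ B) - _ = _ at h1'
    have h4 : (RatFunc.X ^ p - RatFunc.X : RatFunc k) ≠ 0 := by
      intro h0; rw [h0] at h2'
      exact mul_ne_zero hg' hD2 (by rw [← h2']; ring)
    have h5 : r (N.map σ) / r (D.map σ) = (r (g.map σ) * r (N.map σ)) / (r (g.map σ) * r (D.map σ)) := by
      field_simp
    rw [h5, ← h1', ← h2']
    field_simp
    ring
  rw [hlow.rd_eq]
  unfold md2 affCard
  simp only [natDegree_map]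
  exact hdeg

variable (k A B) in
/-- The trace of Frobenius. -/
def tr : ℤ := p - affCard A B

lemma fr_pmap (φ : FF (algebraMap (ZMod p) k A) (algebraMap (ZMod p) k B) →ₐ[k]
    FF (algebraMap (ZMod p) k A) (algebraMap (ZMod p) k B)) (P) :
    fr k A B (pmap φ P) = pmap φ (fr k A B P) := frob_pmap φ P

lemma fr_mem_odd {P} (hP : P ∈ odd (algebraMap (ZMod p) k A) (algebraMap (ZMod p) k B)) :
    fr k A B P ∈ odd _ _ := frob_mem_odd _ _ hP

/-- The characteristic equation of Frobenius, up to two-torsion. -/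
theorem char_eq {n : ℕ} (hn : p = 2 * n + 1) (hn2 : 2 ≤ n) :
    (2 : ℤ) • (fr k A B (fr k A B (gen _ _)) - tr A B • fr k A B (gen _ _) + (p : ℤ) • gen _ _) = 0 ∧
    ∀ i j : ℤ, (ht (i • fr k A B (gen _ _) + j • gen _ _) : ℤ) = i ^ 2 * p + i * j * tr A B + j ^ 2 := by
  set G := odd (algebraMap (ZMod p) k A) (algebraMap (ZMod p) k B)
  set q : G → ℤ := htZ _ _
  have hq : ∀ x y, q (x + y) + q (x - y) = 2 * (q x + q y) := htZ_para
  let P : G := ⟨gen _ _, gen_mem_odd⟩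
  let π : G := ⟨_, fr_mem_odd gen_mem_odd⟩
  let π2 : G := ⟨_, fr_mem_odd (fr_mem_odd gen_mem_odd)⟩
  have hfr : ∀ x : G, q ⟨_, fr_mem_odd x.2⟩ = p * q x := fun x => by
    have := ht_frob (p := p) (algebraMap_pow_p A) (algebraMap_pow_p B) hn x.2
    simp only [q, htZ]; unfold fr; rw [this]; push_cast; rfl
  have qP : q P = 1 := by simp only [q, htZ, P]; rw [ht_gen]; rfl
  have qπ : q π = p := by rw [hfr P, qP, mul_one]
  have qπ2 : q π2 = p * p := by rw [hfr π, qπ]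
  have qs : q (π - P) = 1 + affCard A B := by
    simp only [q, htZ]
    exact_mod_cast ht_fr_gen_sub hn hn2
  have e1 : polar q π P = tr A B := by
    have := hq π P
    unfold polar tr; rw [qs, qπ, qP] at *; linarith
  have qsum : q (π + P) = p + 1 + tr A B := by
    have := hq π P
    unfold tr; rw [qs, qπ, qP] at this; linarith
  have e2 : polar q π2 π = p * tr A B := by
    have h1 : q (π2 - π) = p * q (π - P) := by
      rw [← hfr]; congr 1; apply Subtype.ext
      exact (map_sub (fr k A B) _ _).symm
    have := hq π2 π
    unfold polar tr; rw [h1, qs, qπ, qπ2] at *; linarith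
  have e3 : q (π2 - P) = (p + 1 - tr A B) * (p + 1 + tr A B) := by
    have hfin : q (π - P) = p + 1 - tr A B := by rw [qs]; unfold tr; ring
    rw [← hfin, ← qsum]
    rcases exists_embedding (π + P).1 with ⟨Q, hQ⟩ | ⟨φ, hφ⟩
    · exfalso
      have h0 : q (π + P) = 0 := by
        have := ht_cst (Q := Q) (hQ ▸ (π + P).2)
        simp only [q, htZ]; rw [hQ, this]; rfl
      have hcard : affCard A B ≤ 2 * p := by
        unfold affCard
        rw [card_points A B hn hn2]
        calc ∑ x, eD A B x ≤ ∑ x : ZMod p, 2 :=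
              Finset.sum_le_sum fun x _ => by have := eN_add_eD A B x; omega
          _ = 2 * p := by simp [ZMod.card, mul_comm]
      rw [qsum] at h0
      unfold tr at h0
      omega
    · have hodd : pmap φ (gen _ _) ∈ odd _ _ := hφ ▸ (π + P).2
      have h1 : pmap φ (π - P).1 = (π2 - P).1 := by
        have h2 : pmap φ (π - P).1 =
            fr k A B (pmap φ (gen _ _)) - pmap φ (gen _ _) := by
          rw [fr_pmap, ← map_sub]; rfl
        rw [h2, hφ]
        change fr k A B (fr k A B (gen _ _) + gen _ _) - (fr k A B (gen _ _) + gen _ _) =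
          fr k A B (fr k A B (gen _ _)) - gen _ _
        rw [map_add]; abel
      have h3 := ht_pmap hodd (π - P).2
      rw [h1, hφ] at h3
      simp only [q, htZ]
      exact_mod_cast h3
  have e4 : polar q π2 P = tr A B ^ 2 - 2 * p := by
    have := hq π2 P
    unfold polar; rw [e3, qπ2, qP] at *; linarith
  have hz : q ((1 : ℤ) • π2 + (-tr A B) • π + (p : ℤ) • P) = 0 := by
    rw [para_comb₃ hq, e1, e2, e4, qP, qπ, qπ2]; ring
  constructor
  · have h1 := two_zsmul_of_ht_eq_zero ((1 : ℤ) • π2 + (-tr A B) • π + (p : ℤ) • P).2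
      (by simp only [q, htZ] at hz; exact_mod_cast hz)
    rw [two_zsmul]
    convert h1 using 2 <;>
    · change _ = (1 : ℤ) • fr k A B (fr k A B (gen _ _)) + (-tr A B) • fr k A B (gen _ _) +
        (p : ℤ) • gen _ _
      rw [one_smul, neg_smul]; abel
  · intro i j
    have := para_comb hq i j π P
    rw [e1, qP, qπ, mul_one] at this
    exact this

end FrobChar

section Deriv

variable {k : Type} [Field k]

local notation "r" => algebraMap k[X] (RatFunc k)

/-- The derivative of a rational function. -/
def dR (u : RatFunc k) : RatFunc k :=
  (r (derivative u.num) * r u.denom - r u.num * r (derivative u.denom)) / r u.denom ^ 2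

lemma dR_div (a : k[X]) {b : k[X]} (hb : b ≠ 0) :
    dR (r a / r b) = (r (derivative a) * r b - r a * r (derivative b)) / r b ^ 2 := by
  set u := r a / r b with hu
  have hb' : r b ≠ 0 := algebraMap_poly_ne_zero hb
  have hd' : r u.denom ≠ 0 := algebraMap_poly_ne_zero (RatFunc.denom_ne_zero u)
  have h1 : r u.num * r b = r a * r u.denom := by
    have := RatFunc.num_div_denom u
    rw [hu] at this
    rwa [div_eq_div_iff hd' hb'] at this
  have h2 : u.num * b = a * u.denom := by
    apply RatFunc.algebraMap_injective (K := k)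
    rw [map_mul, map_mul, h1]
  have h3 := congrArg (fun q => r (derivative q)) h2
  simp only [derivative_mul, map_add, map_mul] at h3
  unfold dR
  rw [div_eq_div_iff (pow_ne_zero 2 hd') (pow_ne_zero 2 hb')]
  linear_combination r b * r u.denom * h3 - (r b * r (derivative u.denom) + r (derivative b) * r u.denom) * h1

lemma exists_div (u : RatFunc k) : ∃ a b : k[X], b ≠ 0 ∧ r b ≠ 0 ∧ u = r a / r b :=
  ⟨u.num, u.denom, RatFunc.denom_ne_zero u, algebraMap_poly_ne_zero (RatFunc.denom_ne_zero u),
    (RatFunc.num_div_denom u).symm⟩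

lemma dR_add (u v : RatFunc k) : dR (u + v) = dR u + dR v := by
  obtain ⟨a, b, hb, hb', rfl⟩ := exists_div u
  obtain ⟨c, d, hd, hd', rfl⟩ := exists_div v
  rw [div_add_div _ _ hb' hd', ← map_mul, ← map_mul, ← map_mul, ← map_add,
    dR_div _ (mul_ne_zero hb hd), dR_div _ hb, dR_div _ hd]
  simp only [derivative_add, derivative_mul, map_add, map_mul]
  field_simp
  ring

lemma dR_mul (u v : RatFunc k) : dR (u * v) = dR u * v + u * dR v := by
  obtain ⟨a, b, hb, hb', rfl⟩ := exists_div u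
  obtain ⟨c, d, hd, hd', rfl⟩ := exists_div v
  rw [div_mul_div_comm, ← map_mul, ← map_mul,
    dR_div _ (mul_ne_zero hb hd), dR_div _ hb, dR_div _ hd]
  simp only [derivative_mul, map_add, map_mul]
  field_simp
  ring

lemma dR_poly (a : k[X]) : dR (r a) = r (derivative a) := by
  have := dR_div a (one_ne_zero (α := k[X]))
  simpa using this

lemma dR_const (c : k) : dR (algebraMap k (RatFunc k) c) = 0 := by
  rw [IsScalarTower.algebraMap_apply k k[X] (RatFunc k), dR_poly]
  simp

lemma dR_X : dR (RatFunc.X : RatFunc k) = 1 := by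
  rw [← RatFunc.algebraMap_X, dR_poly]; simp

lemma dR_one : dR (1 : RatFunc k) = 0 := by
  have := dR_const (1 : k); rwa [map_one] at this

lemma dR_zero : dR (0 : RatFunc k) = 0 := by
  have := dR_const (0 : k); rwa [map_zero] at this

lemma dR_neg (u : RatFunc k) : dR (-u) = -dR u := by
  have := dR_add u (-u)
  rw [add_neg_cancel, dR_zero] at this
  linear_combination -this

lemma dR_sub (u v : RatFunc k) : dR (u - v) = dR u - dR v := by
  rw [sub_eq_add_neg, dR_add, dR_neg, sub_eq_add_neg]

lemma dR_pow (u : RatFunc k) (n : ℕ) : dR (u ^ n) = n * u ^ (n - 1) * dR u := by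
  induction n with
  | zero => rw [pow_zero, dR_one]; simp
  | succ m ih =>
    rw [pow_succ, dR_mul, ih, Nat.add_sub_cancel]
    rcases m with _ | m
    · simp
    · rw [Nat.add_sub_cancel, pow_succ]; push_cast; ring

lemma dR_const_mul (c : k) (u : RatFunc k) :
    dR (algebraMap k (RatFunc k) c * u) = algebraMap k (RatFunc k) c * dR u := by
  rw [dR_mul, dR_const]; ring

lemma dR_subsR {v : RatFunc k} (hv : Transcendental k v) (u : RatFunc k) :
    dR (subsR v hv u) = subsR v hv (dR u) * dR v := by
  have hp : ∀ a : k[X], dR (subsR v hv (r a)) = subsR v hv (r (derivative a)) * dR v := by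
    intro a
    induction a using Polynomial.induction_on' with
    | add a b ha hb => simp only [map_add, dR_add, ha, hb, derivative_add]; ring
    | monomial n c =>
      rw [derivative_monomial, ← C_mul_X_pow_eq_monomial, ← C_mul_X_pow_eq_monomial]
      simp only [map_mul, map_pow, RatFunc.algebraMap_X, subsR_X]
      have hc : ∀ e : k, r (C e) = algebraMap k (RatFunc k) e := fun e => by
        rw [IsScalarTower.algebraMap_apply k k[X] (RatFunc k)]; rfl
      rw [hc, hc, AlgHom.commutes, AlgHom.commutes, dR_const_mul, dR_pow, map_natCast]
      ring
  obtain ⟨a, b, hb, hb', rfl⟩ := exists_div u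
  have hb2 : subsR v hv (r b) ≠ 0 := (_root_.map_ne_zero _).2 hb'
  have h1 : subsR v hv (r a / r b) * subsR v hv (r b) = subsR v hv (r a) := by
    rw [← map_mul, div_mul_cancel₀ _ hb']
  have h2 := congrArg dR h1
  rw [dR_mul, hp, hp] at h2
  apply mul_right_cancel₀ hb2
  rw [dR_div _ hb, map_div₀ _ (_ - _), map_sub, map_mul, map_mul, map_pow]
  set w := dR (subsR v hv (r a / r b))
  rw [map_div₀] at h2
  field_simp at h2 ⊢
  linear_combination h2

end Deriv

section IsDiff

variable {k : Type} [Field k] {A B : k} [EC A B]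

local notation "ak" => algebraMap k (RatFunc k)

lemma dR_cubicR : dR (cubicR A B) = 3 * RatFunc.X ^ 2 + ak A := by
  rw [cubicR_eq, dR_add, dR_add, dR_pow, dR_const_mul, dR_const, dR_X]
  push_cast
  ring

/-- The action of `P` on the invariant differential is multiplication by `κ`. -/
def IsDiff (P : Pt A B (FF A B)) (κ : k) : Prop :=
  (P = 0 ∧ κ = 0) ∨ ∃ u s h, P = opt u s h ∧ dR u = ak κ * s ∧
    2 * cubicR A B * dR s + s * dR (cubicR A B) = ak κ * (3 * u ^ 2 + ak A)

lemma isDiff_gen : IsDiff (gen A B) 1 := by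
  refine Or.inr ⟨_, _, _, gen_eq, ?_, ?_⟩
  · rw [dR_X, map_one, mul_one]
  · rw [dR_one, dR_cubicR, map_one]; ring

lemma IsDiff.neg {P : Pt A B (FF A B)} {κ : k} (h : IsDiff P κ) : IsDiff (-P) (-κ) := by
  rcases h with ⟨rfl, rfl⟩ | ⟨u, s, h, rfl, h1, h2⟩
  · exact Or.inl ⟨neg_zero, neg_zero⟩
  · refine Or.inr ⟨_, _, _, neg_opt, ?_, ?_⟩
    · rw [h1, map_neg]; ring
    · rw [dR_neg, map_neg]; linear_combination -h2

lemma IsDiff.add {P Q : Pt A B (FF A B)} {κ κ' : k} (hP : IsDiff P κ) (hQ : IsDiff Q κ') :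
    IsDiff (P + Q) (κ + κ') := by
  rcases hP with ⟨rfl, rfl⟩ | ⟨u₁, s₁, t₁, rfl, a₁, b₁⟩
  · rwa [zero_add, zero_add]
  rcases hQ with ⟨rfl, rfl⟩ | ⟨u₂, s₂, t₂, rfl, a₂, b₂⟩
  · rw [add_zero, add_zero]; exact Or.inr ⟨_, _, _, rfl, a₁, b₁⟩
  have h2 : (2 : RatFunc k) ≠ 0 := two_ne_zero_ratFunc A B
  have hf := cubicR_ne_zero A B
  have t₁' := t₁
  have t₂' := t₂
  unfold Tw at t₁' t₂'
  by_cases hne : u₁ = u₂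
  · subst hne
    by_cases hs : s₁ = s₂
    · subst hs
      by_cases hs0 : s₁ = 0
      · subst hs0
        have h3 : 3 * u₁ ^ 2 + ak A ≠ 0 := by
          intro h0
          have hd := EC.disc' A B (RatFunc k)
          apply hd
          linear_combination (4 * ak A ^ 2 - 9 * ak B * u₁ + 6 * ak A * u₁ ^ 2) * h0 +
            (18 * ak A * u₁ - 27 * ak B) * t₁'
        have e1 : κ = 0 := by
          apply (ak).injective
          rw [map_zero]
          apply mul_right_cancel₀ h3
          rw [← b₁, dR_zero]; ring
        have e2 : κ' = 0 := by
          apply (ak).injective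
          rw [map_zero]
          apply mul_right_cancel₀ h3
          rw [← b₂, dR_zero]; ring
        refine Or.inl ⟨?_, by rw [e1, e2, add_zero]⟩
        have : -opt u₁ 0 t₁ = opt u₁ 0 t₁ := by
          rw [neg_opt]; exact opt_congr rfl neg_zero
        nth_rewrite 1 [← this]
        rw [neg_add_cancel]
      · have hκ : κ' = κ := by
          apply (ak).injective
          apply mul_right_cancel₀ hs0
          rw [← a₁, ← a₂]
        subst hκ
        obtain ⟨l, hl⟩ : ∃ l, l = (3 * u₁ ^ 2 + ak A) / (2 * s₁ * cubicR A B) := ⟨_, rfl⟩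
        have e : 2 * l * s₁ * cubicR A B = 3 * u₁ ^ 2 + ak A := by rw [hl]; field_simp
        refine Or.inr ⟨_, _, _, opt_double hs0 hl, ?_⟩
        have e' := congrArg dR e
        simp only [dR_mul, dR_add, dR_pow, dR_const] at e'
        have d2 : dR (2 : RatFunc k) = 0 := by
          have := dR_const (2 : k); rwa [map_ofNat] at this
        have d3 : dR (3 : RatFunc k) = 0 := by
          have := dR_const (3 : k); rwa [map_ofNat] at this
        rw [d2, d3, a₁] at e'
        have E : 2 * cubicR A B * dR l + l * dR (cubicR A B) =
            2 * ak κ' * (u₁ - (l ^ 2 * cubicR A B - u₁ - u₁)) := by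
          apply mul_right_cancel₀ hs0
          push_cast at e'
          linear_combination e' - l * b₁ + l * ak κ' * e
        have hw : dR (l ^ 2 * cubicR A B - u₁ - u₁) = ak (κ' + κ') *
            (l * (u₁ - (l ^ 2 * cubicR A B - u₁ - u₁)) - s₁) := by
          simp only [dR_sub, dR_mul, dR_pow, map_add]
          push_cast
          linear_combination l * E - 2 * a₁
        refine ⟨hw, ?_⟩
        rw [dR_sub, dR_mul, dR_sub u₁, hw, a₁]
        simp only [map_add]
        linear_combination (u₁ - (l ^ 2 * cubicR A B - u₁ - u₁)) * E - b₁ + 3 * ak κ' * e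
    · have hs' : s₂ = -s₁ := by
        have : (s₁ - s₂) * (s₁ + s₂) = 0 := by
          apply mul_right_cancel₀ hf
          linear_combination t₁' - t₂'
        rcases mul_eq_zero.1 this with h | h
        · exact absurd (sub_eq_zero.1 h) hs
        · linear_combination h
      subst hs'
      have hs0 : s₁ ≠ 0 := by rintro rfl; exact hs neg_zero.symm
      refine Or.inl ⟨?_, ?_⟩
      · rw [show opt u₁ (-s₁) t₂ = -opt u₁ s₁ t₁ from neg_opt.symm, add_neg_cancel]
      · apply (ak).injective
        apply mul_right_cancel₀ hs0
        rw [map_add, map_zero]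
        linear_combination a₂ - a₁
  · obtain ⟨l, hl⟩ : ∃ l, l = (s₁ - s₂) / (u₁ - u₂) := ⟨_, rfl⟩
    have hs : u₁ - u₂ ≠ 0 := sub_ne_zero.2 hne
    have e1 : l * (u₁ - u₂) = s₁ - s₂ := by rw [hl, div_mul_cancel₀ _ hs]
    refine Or.inr ⟨_, _, _, opt_add hne hl, ?_⟩
    have e2 : l * (s₁ + s₂) * cubicR A B =
        u₁ ^ 2 + u₁ * u₂ + u₂ ^ 2 + ak A := by
      apply mul_left_cancel₀ hs
      linear_combination (s₁ + s₂) * cubicR A B * e1 + t₁' - t₂'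
    have e3 : 2 * l * s₁ * cubicR A B = u₁ ^ 2 + u₁ * u₂ + u₂ ^ 2 + ak A +
        l ^ 2 * cubicR A B * (u₁ - u₂) := by
      linear_combination e2 - l * cubicR A B * e1
    have e4 : 2 * l * s₂ * cubicR A B = u₁ ^ 2 + u₁ * u₂ + u₂ ^ 2 + ak A -
        l ^ 2 * cubicR A B * (u₁ - u₂) := by
      linear_combination e2 + l * cubicR A B * e1
    have e' := congrArg dR e1
    simp only [dR_mul, dR_sub, a₁, a₂] at e'
    have E : 2 * cubicR A B * dR l + l * dR (cubicR A B) =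
        ak κ * (u₁ - (l ^ 2 * cubicR A B - u₁ - u₂)) +
        ak κ' * (u₂ - (l ^ 2 * cubicR A B - u₁ - u₂)) := by
      apply mul_right_cancel₀ hs
      linear_combination 2 * cubicR A B * e' + b₁ - b₂ + dR (cubicR A B) * e1 -
        ak κ * e3 + ak κ' * e4
    have hw : dR (l ^ 2 * cubicR A B - u₁ - u₂) = ak (κ + κ') *
        (l * (u₁ - (l ^ 2 * cubicR A B - u₁ - u₂)) - s₁) := by
      simp only [dR_sub, dR_mul, dR_pow, map_add]
      push_cast
      linear_combination l * E - a₁ - a₂ - ak κ' * e1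
    refine ⟨hw, ?_⟩
    rw [dR_sub, dR_mul, dR_sub u₁, hw, a₁]
    simp only [map_add]
    linear_combination (u₁ - (l ^ 2 * cubicR A B - u₁ - u₂)) * E - b₁ + (2 * ak κ + ak κ') * e3

lemma IsDiff.zsmul {P : Pt A B (FF A B)} {κ : k} (h : IsDiff P κ) (n : ℤ) :
    IsDiff (n • P) (n * κ) := by
  have hn : ∀ n : ℕ, IsDiff ((n : ℤ) • P) (n * κ) := by
    intro n
    induction n with
    | zero => exact Or.inl ⟨by simp, by simp⟩
    | succ m ih =>
      have := ih.add h
      convert this using 1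
      · push_cast; rw [add_smul, one_smul]
      · push_cast; ring
  rcases Int.eq_nat_or_neg n with ⟨m, rfl | rfl⟩
  · exact_mod_cast hn m
  · rw [neg_smul]
    convert (hn m).neg using 1
    push_cast; ring

/-- The differential equation satisfied by the abscissa. -/
lemma IsDiff.ode {u s : RatFunc k} {h : Tw A B u s} {κ : k} (hd : IsDiff (opt u s h) κ) :
    cubicR A B * dR u ^ 2 = ak κ ^ 2 * (u ^ 3 + ak A * u + ak B) := by
  rcases hd with ⟨h0, -⟩ | ⟨u', s', h', e, h1, -⟩
  · exact absurd h0 opt_ne_zero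
  · obtain ⟨rfl, rfl⟩ := opt_inj.1 e
    rw [h1, ← h]; ring

end IsDiff

section Infinity

variable {k : Type} [Field k]

/-- The degree of `u` is at most `n`. -/
def DLe (n : ℤ) (u : RatFunc k) : Prop := u = 0 ∨ u.intDegree ≤ n

lemma DLe.mono {n m : ℤ} {u : RatFunc k} (h : DLe n u) (hnm : n ≤ m) : DLe m u :=
  h.imp id fun h => h.trans hnm

lemma DLe.add {n : ℤ} {u v : RatFunc k} (hu : DLe n u) (hv : DLe n v) : DLe n (u + v) := by
  rcases hu with rfl | hu
  · rwa [zero_add]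
  by_cases hv0 : v = 0
  · subst hv0; rw [add_zero]; exact Or.inr hu
  rcases hv with rfl | hv
  · exact absurd rfl hv0
  by_cases h : u + v = 0
  · exact Or.inl h
  · exact Or.inr ((RatFunc.intDegree_add_le hv0 h).trans (max_le hu hv))

lemma DLe.mul {n m : ℤ} {u v : RatFunc k} (hu : DLe n u) (hv : DLe m v) : DLe (n + m) (u * v) := by
  by_cases hu0 : u = 0
  · left; rw [hu0, zero_mul]
  by_cases hv0 : v = 0
  · left; rw [hv0, mul_zero]
  right
  rw [RatFunc.intDegree_mul hu0 hv0]
  exact add_le_add (hu.resolve_left hu0) (hv.resolve_left hv0)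

lemma DLe.pow {n : ℤ} {u : RatFunc k} (hu : DLe n u) (i : ℕ) : DLe (i * n) (u ^ i) := by
  induction i with
  | zero => right; simp
  | succ i ih =>
    rw [pow_succ]
    exact (ih.mul hu).mono (by push_cast; linarith)

lemma dLe_const (c : k) : DLe 0 (algebraMap k (RatFunc k) c) := by
  right; rw [RatFunc.algebraMap_eq_C, RatFunc.intDegree_C]

lemma DLe.const_mul {n : ℤ} {u : RatFunc k} (hu : DLe n u) (c : k) :
    DLe n (algebraMap k (RatFunc k) c * u) := by
  have := (dLe_const c).mul hu; rwa [zero_add] at this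

lemma DLe.neg {n : ℤ} {u : RatFunc k} (hu : DLe n u) : DLe n (-u) := by
  have := hu.const_mul (-1); rwa [map_neg, map_one, neg_one_mul] at this

lemma DLe.le {n : ℤ} {u : RatFunc k} (hu : DLe n u) (h : u ≠ 0) : u.intDegree ≤ n :=
  hu.resolve_left h

lemma dLe_intDegree (u : RatFunc k) : DLe u.intDegree u := Or.inr le_rfl

/-- The abscissa of the double of a point has a pole at infinity. -/
lemma intDegree_double_pos {A B : k} [EC A B] {P : Pt A B (FF A B)} (hP : P ∈ odd A B)
    {w s : RatFunc k} {h : Tw A B w s} (hw : P + P = opt w s h) : 0 < w.intDegree := by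
  rcases odd_cases hP with rfl | ⟨v, t, ht, rfl⟩
  · rw [zero_add] at hw; exact absurd hw.symm opt_ne_zero
  have ht0 : t ≠ 0 := by
    rintro rfl
    have : -opt v 0 ht = opt v 0 ht := by
      rw [neg_opt]; exact opt_congr rfl neg_zero
    nth_rewrite 1 [← this] at hw
    rw [neg_add_cancel] at hw
    exact opt_ne_zero hw.symm
  have hf := cubicR_ne_zero A B
  have h2 : (2 : RatFunc k) ≠ 0 := two_ne_zero_ratFunc A B
  rw [opt_double ht0 rfl, opt_inj] at hw
  have ht' := ht
  unfold Tw at ht'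
  set α := algebraMap k (RatFunc k) A
  set β := algebraMap k (RatFunc k) B
  have hw' : w * (4 * (v ^ 3 + α * v + β)) = v ^ 4 - 2 * α * v ^ 2 - 8 * β * v + α ^ 2 := by
    rw [← hw.1, ← ht']
    field_simp
    linear_combination (-32 * v) * ht'
  set F := v ^ 3 + α * v + β
  set N := v ^ 4 - 2 * α * v ^ 2 - 8 * β * v + α ^ 2 with hN
  have hF0 : F ≠ 0 := by rw [← ht']; exact mul_ne_zero (pow_ne_zero 2 ht0) hf
  have h4 : (4 : RatFunc k) ≠ 0 := by
    have : (4 : RatFunc k) = 2 * 2 := by norm_num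
    rw [this]; exact mul_ne_zero h2 h2
  have hd4 : (4 : RatFunc k).intDegree = 0 := by
    have : (4 : RatFunc k) = RatFunc.C 4 := (map_ofNat RatFunc.C 4).symm
    rw [this, RatFunc.intDegree_C]
  have hFd : F.intDegree = 2 * t.intDegree + 3 := by
    rw [← ht', RatFunc.intDegree_mul (pow_ne_zero 2 ht0) hf, sq, RatFunc.intDegree_mul ht0 ht0,
      intDegree_cubicR]; ring
  have key : N ≠ 0 ∧ F.intDegree < N.intDegree := by
    have hdisc := EC.disc' A B (RatFunc k)
    by_cases hv : 0 < v.intDegree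
    · have hv0 : v ≠ 0 := by rintro rfl; simp at hv
      have hvl := dLe_intDegree v
      set e := v.intDegree
      have hF3 : DLe (3 * e) F := by
        refine ((hvl.pow 3).add ((hvl.const_mul A).mono ?_)).add ((dLe_const B).mono ?_)
        · push_cast; linarith
        · push_cast; linarith
      have hR : DLe (2 * e) (N - v ^ 4) := by
        have : N - v ^ 4 = algebraMap k (RatFunc k) (-2 * A) * v ^ 2 +
            algebraMap k (RatFunc k) (-8 * B) * v + algebraMap k (RatFunc k) (A ^ 2) := by
          rw [hN]; simp only [map_mul, map_neg, map_pow, map_ofNat]; ring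
        rw [this]
        refine (((hvl.pow 2).const_mul _).add ((hvl.const_mul _).mono ?_)).add
          ((dLe_const _).mono ?_)
        · push_cast; linarith
        · push_cast; linarith
      have hv4 : (v ^ 4).intDegree = 4 * e := by
        have : v ^ 4 = v * v * (v * v) := by ring
        rw [this, RatFunc.intDegree_mul (mul_ne_zero hv0 hv0) (mul_ne_zero hv0 hv0),
          RatFunc.intDegree_mul hv0 hv0]; ring
      have hno : ¬ DLe (3 * e) N := by
        intro hN'
        have h5 := (hN'.add (hR.neg.mono (show 2 * e ≤ 3 * e by linarith))).le (by
          rw [← sub_eq_add_neg, sub_sub_cancel]; exact pow_ne_zero 4 hv0)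
        rw [← sub_eq_add_neg, sub_sub_cancel, hv4] at h5
        linarith
      unfold DLe at hno
      rw [not_or, not_le] at hno
      exact ⟨hno.1, (hF3.le hF0).trans_lt hno.2⟩
    · have hvl : DLe 0 v := (dLe_intDegree v).mono (not_lt.1 hv)
      have hF3 : DLe 0 F := by
        refine (((hvl.pow 3).mono (by simp)).add (hvl.const_mul A)).add (dLe_const B)
      have hFneg : F.intDegree ≤ -1 := by
        have := hF3.le hF0
        omega
      have hid : (12 * v ^ 2 + 16 * α) * N - (3 * v ^ 3 - 5 * α * v - 27 * β) * (4 * F) =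
          4 * (4 * α ^ 3 + 27 * β ^ 2) := by ring
      have hno : ¬ DLe (-1) N := by
        intro hN'
        have h5 : DLe 0 (12 * v ^ 2 + 16 * α) := by
          have : (12 * v ^ 2 + 16 * α) = algebraMap k (RatFunc k) 12 * v ^ 2 +
            algebraMap k (RatFunc k) (16 * A) := by simp only [map_mul, map_ofNat]; rfl
          rw [this]
          exact (((hvl.pow 2).mono (by simp)).const_mul _).add (dLe_const _)
        have h6 : DLe 0 (-(3 * v ^ 3 - 5 * α * v - 27 * β)) := by
          have : -(3 * v ^ 3 - 5 * α * v - 27 * β) = algebraMap k (RatFunc k) (-3) * v ^ 3 +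
            algebraMap k (RatFunc k) (5 * A) * v + algebraMap k (RatFunc k) (27 * B) := by
            simp only [map_mul, map_ofNat, map_neg]; ring
          rw [this]
          exact ((((hvl.pow 3).mono (by simp)).const_mul _).add (hvl.const_mul _)).add (dLe_const _)
        have h7 : DLe (-1) (4 * F) := by
          have := (show DLe (-1) F from Or.inr hFneg).const_mul 4
          rwa [map_ofNat] at this
        have h8 : DLe (-1) (4 * (4 * α ^ 3 + 27 * β ^ 2)) := by
          convert (h5.mul hN').add (h6.mul h7) using 1
          · norm_num
          · rw [← hid]; ring
        have h9 := h8.le (mul_ne_zero h4 hdisc)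
        have h10 : 4 * (4 * α ^ 3 + 27 * β ^ 2) =
            RatFunc.C (4 * (4 * A ^ 3 + 27 * B ^ 2)) := by
          rw [← RatFunc.algebraMap_eq_C]
          simp only [map_mul, map_add, map_pow, map_ofNat]
          rfl
        rw [h10, RatFunc.intDegree_C] at h9
        norm_num at h9
      unfold DLe at hno
      rw [not_or, not_le] at hno
      exact ⟨hno.1, by omega⟩
  have hw0 : w ≠ 0 := by
    rintro rfl; rw [zero_mul] at hw'; exact key.1 hw'.symm
  have := congrArg RatFunc.intDegree hw'
  rw [RatFunc.intDegree_mul hw0 (mul_ne_zero h4 hF0), RatFunc.intDegree_mul h4 hF0, hd4] at this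
  omega

end Infinity

section CM

variable {k : Type} [Field k] [IsAlgClosed k] {p : ℕ} [Fact p.Prime] [Algebra (ZMod p) k]
variable {A B : ZMod p} [EC (algebraMap (ZMod p) k A) (algebraMap (ZMod p) k B)]

local notation "Aₖ" => algebraMap (ZMod p) k A
local notation "Bₖ" => algebraMap (ZMod p) k B

lemma cast_p_eq_zero : (p : k) = 0 := by
  rw [← map_natCast (algebraMap (ZMod p) k), CharP.cast_eq_zero, map_zero]

lemma isDiff_fr_gen {n : ℕ} (hn : p = 2 * n + 1) (hn0 : 0 < n) :
    IsDiff (fr k A B (gen Aₖ Bₖ)) 0 := by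
  have hp : ((p : RatFunc k)) = 0 := by
    rw [← map_natCast (algebraMap k (RatFunc k)), cast_p_eq_zero, map_zero]
  obtain ⟨h, e⟩ : ∃ h, fr k A B (gen Aₖ Bₖ) = opt (RatFunc.X ^ p) (1 ^ p * cubicR Aₖ Bₖ ^ n) h := by
    rw [gen_eq]
    exact ⟨_, frob_opt _ _ hn _⟩
  refine Or.inr ⟨_, _, _, e, ?_, ?_⟩
  · rw [dR_pow, hp, map_zero]; ring
  · rw [one_pow, one_mul, dR_pow, map_zero, zero_mul]
    obtain ⟨j, rfl⟩ : ∃ j, n = j + 1 := ⟨n - 1, by omega⟩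
    have hp' : (2 * ((j + 1 : ℕ) : RatFunc k) + 1) = 0 := by
      rw [← hp, hn]; push_cast; ring
    rw [Nat.add_sub_cancel]
    linear_combination cubicR Aₖ Bₖ ^ (j + 1) * dR (cubicR Aₖ Bₖ) * hp'

end CM

section Embeddings

variable {k : Type} [Field k] {A B : k} [EC A B]

lemma pmap_opt {φ : FF A B →ₐ[k] FF A B} {v t : RatFunc k} {hv : Tw A B v t}
    (h : pmap φ (gen A B) = opt v t hv) (hvt : Transcendental k v) {u s : RatFunc k}
    {hu : Tw A B u s} : ∃ s' h', pmap φ (opt u s hu) = opt (subsR v hvt u) s' h' := by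
  have := EC.neZero_two A B
  have ho : pmap φ (opt u s hu) ∈ odd A B := emb_mem_odd (h ▸ opt_mem_odd) opt_mem_odd
  obtain ⟨_, h2⟩ := emb_ratFunc h
  rcases odd_cases ho with h0 | ⟨u', s', h', e⟩
  · exact absurd ((pmap_injective φ) (h0.trans (map_zero _).symm)) opt_ne_zero
  · have e' := e
    unfold opt at e'
    rw [pmap_mk, Pt.mk_inj, h2] at e'
    have : subsR v hvt u = u' := (algebraMap (RatFunc k) (FF A B)).injective e'.1
    subst this
    exact ⟨_, _, e⟩

lemma exists_embedding_of_ht [IsAlgClosed k] {P : Pt A B (FF A B)} (hP : P ∈ odd A B)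
    (h : ht P ≠ 0) : ∃ u s hu, P = opt u s hu ∧ rd u = ht P ∧ ∃ φ : FF A B →ₐ[k] FF A B,
      pmap φ (gen A B) = P := by
  have := EC.neZero_two A B
  rcases odd_cases hP with rfl | ⟨u, s, hu, e⟩
  · exact absurd ht_zero h
  · refine ⟨u, s, hu, e, by rw [e, ht_opt], ?_⟩
    rcases exists_embedding P with ⟨Q, hQ⟩ | hφ
    · rw [hQ] at hP h
      exact absurd (ht_cst hP) h
    · exact hφ

/-- Two commuting endomorphisms, multiplication by `N` and one whose square is multiplication by
`d N ^ 2`, described through their abscissae `μ` and `γ`; `δ` is the abscissa of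
multiplication by `d`. -/
structure IsCM (A B : k) [EC A B] (d : ℤ) (N : ℕ) (κ : k) (μ γ δ : RatFunc k) : Prop where
  N_ne : (N : k) ≠ 0
  sq_κ : κ ^ 2 = d * (N : k) ^ 2
  pt : ∃ s h, (N : ℤ) • gen A B = opt μ s h
  rd_μ : rd μ = N ^ 2
  rd_γ : rd γ = d.natAbs * N ^ 2
  comm : ∀ (hμ : Transcendental k μ) (hγ : Transcendental k γ), subsR γ hγ μ = subsR μ hμ γ
  sq : ∀ (hμ : Transcendental k μ) (hγ : Transcendental k γ),
    subsR γ hγ γ = subsR μ hμ (subsR μ hμ δ)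
  ode_μ : cubicR A B * dR μ ^ 2 = algebraMap k (RatFunc k) N ^ 2 *
    (μ ^ 3 + algebraMap k (RatFunc k) A * μ + algebraMap k (RatFunc k) B)
  ode_γ : cubicR A B * dR γ ^ 2 = algebraMap k (RatFunc k) κ ^ 2 *
    (γ ^ 3 + algebraMap k (RatFunc k) A * γ + algebraMap k (RatFunc k) B)
  pos_μ : 0 < μ.intDegree
  pos_γ : 0 < γ.intDegree

end Embeddings

section CM

variable {k : Type} [Field k] [IsAlgClosed k] {p : ℕ} [Fact p.Prime] [Algebra (ZMod p) k]
variable {A B : ZMod p} [EC (algebraMap (ZMod p) k A) (algebraMap (ZMod p) k B)]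

local notation "Aₖ" => algebraMap (ZMod p) k A
local notation "Bₖ" => algebraMap (ZMod p) k B

lemma exists_isCM {n : ℕ} (hn : p = 2 * n + 1) (hn2 : 2 ≤ n) {d : ℤ} (hd : d < 0) {m : ℕ}
    (hm : (m : k) ≠ 0) (h : tr A B ^ 2 - 4 * p = d * m ^ 2) :
    ∃ μ γ δ, IsCM Aₖ Bₖ d (2 * m) (-2 * (tr A B : k)) μ γ δ := by
  obtain ⟨hchar, hht⟩ := char_eq (k := k) (A := A) (B := B) hn hn2
  obtain ⟨a, ha⟩ : ∃ a, a = tr A B := ⟨_, rfl⟩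
  rw [← ha] at h hchar hht ⊢
  obtain ⟨g, hg⟩ : ∃ g, g = gen Aₖ Bₖ := ⟨_, rfl⟩
  obtain ⟨π, hπ⟩ : ∃ π, π = fr k A B g := ⟨_, rfl⟩
  have hm0 : (m : ℤ) ≠ 0 := by rintro h; apply hm; exact_mod_cast congrArg (Int.cast : ℤ → k) h
  have hgo : g ∈ odd Aₖ Bₖ := hg ▸ gen_mem_odd
  have hπo : π ∈ odd Aₖ Bₖ := hπ ▸ fr_mem_odd hgo
  rw [← hg, ← hπ] at hchar hht
  have h1 : ∀ j : ℤ, (ht (j • g) : ℤ) = j ^ 2 := by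
    intro j; have := hht 0 j; rw [zero_smul, zero_add] at this; rw [this]; ring
  obtain ⟨Γ, hΓ⟩ : ∃ Γ, Γ = (4 : ℤ) • π - (2 * a) • g := ⟨_, rfl⟩
  have hΓo : Γ ∈ odd Aₖ Bₖ := by
    rw [hΓ]; exact sub_mem (zsmul_mem hπo _) (zsmul_mem hgo _)
  have hNo : ((2 * m : ℕ) : ℤ) • g ∈ odd Aₖ Bₖ := zsmul_mem hgo _
  have hdo : d • g ∈ odd Aₖ Bₖ := zsmul_mem hgo _
  have htN : ht (((2 * m : ℕ) : ℤ) • g) = (2 * m) ^ 2 := by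
    have := h1 ((2 * m : ℕ) : ℤ); exact_mod_cast this
  have htΓ : ht Γ = d.natAbs * (2 * m) ^ 2 := by
    have := hht 4 (-(2 * a))
    rw [neg_smul, ← sub_eq_add_neg, ← hΓ] at this
    zify
    rw [this, abs_of_neg hd]
    linear_combination 4 * (-h)
  have htd : (ht (d • g) : ℤ) = d ^ 2 := h1 d
  have hm0' : m ≠ 0 := by exact_mod_cast hm0
  obtain ⟨μ, s, hμ, eμ, rμ, φ, hφ⟩ := exists_embedding_of_ht hNo (by rw [htN]; positivity)
  obtain ⟨γ, t, hγ, eγ, rγ, ψ, hψ⟩ := exists_embedding_of_ht hΓo (by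
    rw [htΓ]; have := Int.natAbs_pos.2 hd.ne; positivity)
  obtain ⟨δ, w, hδ, eδ, -, -⟩ := exists_embedding_of_ht hdo (by
    intro h0; rw [h0] at htd; have := pow_ne_zero 2 hd.ne; exact this htd.symm)
  rw [← hg] at hφ hψ
  have φΓ : pmap φ Γ = ((2 * m : ℕ) : ℤ) • Γ := by
    rw [hΓ, map_sub, map_zsmul, map_zsmul, hπ, ← fr_pmap, hφ, map_zsmul, ← hπ]
    module
  have ψN : pmap ψ (((2 * m : ℕ) : ℤ) • g) = ((2 * m : ℕ) : ℤ) • Γ := by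
    rw [map_zsmul, hψ]
  have ψΓ : pmap ψ Γ = (d * (2 * m : ℕ) ^ 2) • g := by
    have e1 : pmap ψ Γ = (4 : ℤ) • fr k A B Γ - (2 * a) • Γ := by
      nth_rewrite 1 [hΓ]
      rw [map_sub, map_zsmul, map_zsmul, hπ, ← fr_pmap, hψ]
    rw [e1, hΓ, map_sub, map_zsmul, map_zsmul, ← hπ]
    have e2 : d * ((2 * m : ℕ) : ℤ) ^ 2 = 4 * a ^ 2 - 16 * p := by
      push_cast; linear_combination -4 * h
    rw [e2, ← sub_eq_zero]
    have := congrArg (fun x => (8 : ℤ) • x) hchar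
    simp only [smul_zero] at this
    rw [← this]
    module
  have φφd : pmap φ (pmap φ (d • g)) = (d * (2 * m : ℕ) ^ 2) • g := by
    rw [map_zsmul, map_zsmul, hφ, map_zsmul, hφ]; module
  have dbN : ((2 * m : ℕ) : ℤ) • g = (m : ℤ) • g + (m : ℤ) • g := by push_cast; module
  have dbΓ : Γ = ((2 : ℤ) • π - a • g) + ((2 : ℤ) • π - a • g) := by rw [hΓ]; module
  rw [eμ] at hφ ψN dbN htN
  rw [eγ] at hψ φΓ ψΓ dbΓ htΓ
  rw [eδ] at φφd
  rw [hg] at hφ hψ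
  have two : (2 : k) ≠ 0 := EC.two Aₖ Bₖ
  refine ⟨μ, γ, δ, ⟨?_, ?_, ?_, ?_, ?_, ?_, ?_, ?_, ?_, ?_, ?_⟩⟩
  · push_cast; exact mul_ne_zero two hm
  · have := congrArg (Int.cast : ℤ → k) h
    push_cast at this ⊢
    rw [cast_p_eq_zero] at this
    linear_combination 4 * this
  · exact ⟨s, hμ, by rw [← hg]; exact eμ⟩
  · rw [← htN, ht_opt]
  · rw [← htΓ, ht_opt]
  · intro hμt hγt
    obtain ⟨_, _, e1⟩ := pmap_opt (u := μ) (s := s) (hu := hμ) hψ hγt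
    obtain ⟨_, _, e2⟩ := pmap_opt (u := γ) (s := t) (hu := hγ) hφ hμt
    rw [ψN, eγ, ← φΓ, e2, opt_inj] at e1
    exact e1.1.symm
  · intro hμt hγt
    obtain ⟨_, _, e1⟩ := pmap_opt (u := γ) (s := t) (hu := hγ) hψ hγt
    obtain ⟨_, hh, e2⟩ := pmap_opt (u := δ) (s := w) (hu := hδ) hφ hμt
    obtain ⟨_, _, e3⟩ := pmap_opt (hu := hh) hφ hμt
    rw [ψΓ, ← φφd, e2, e3, opt_inj] at e1
    exact e1.1.symm
  · have := (isDiff_gen (A := Aₖ) (B := Bₖ)).zsmul ((2 * m : ℕ) : ℤ)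
    rw [← hg, eμ] at this
    have := this.ode
    rw [this]; push_cast; ring
  · have h3 := ((isDiff_fr_gen (k := k) (A := A) (B := B) hn (by omega)).zsmul 4).add
      (((isDiff_gen (A := Aₖ) (B := Bₖ)).zsmul (2 * a)).neg)
    rw [← hg, ← hπ, ← sub_eq_add_neg, ← hΓ, eγ] at h3
    rw [h3.ode]; push_cast; ring
  · exact intDegree_double_pos (zsmul_mem hgo _) dbN.symm
  · exact intDegree_double_pos (sub_mem (zsmul_mem hπo _) (zsmul_mem hgo _)) dbΓ.symm

end CM

section Order

variable {k : Type} [Field k]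

local notation "r" => algebraMap k[X] (RatFunc k)
local notation "ak" => algebraMap k (RatFunc k)

/-- Order of vanishing of a rational function at a finite point. -/
def od (x : k) (u : RatFunc k) : ℤ :=
  (rootMultiplicity x u.num : ℤ) - rootMultiplicity x u.denom

lemma od_div (x : k) {a b : k[X]} (ha : a ≠ 0) (hb : b ≠ 0) :
    od x (r a / r b) = rootMultiplicity x a - rootMultiplicity x b := by
  obtain ⟨u, hu⟩ : ∃ u, u = r a / r b := ⟨_, rfl⟩
  have hb' : r b ≠ 0 := algebraMap_poly_ne_zero hb
  have hd : u.denom ≠ 0 := RatFunc.denom_ne_zero u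
  have hd' : r u.denom ≠ 0 := algebraMap_poly_ne_zero hd
  have hu0 : u ≠ 0 := by rw [hu]; exact div_ne_zero (algebraMap_poly_ne_zero ha) hb'
  have hn : u.num ≠ 0 := RatFunc.num_ne_zero hu0
  have h1 : r u.num * r b = r a * r u.denom := by
    rw [← div_eq_div_iff hd' hb', RatFunc.num_div_denom, hu]
  rw [← map_mul, ← map_mul] at h1
  have h2 := RatFunc.algebraMap_injective k h1
  have h3 := congrArg (rootMultiplicity x) h2
  rw [rootMultiplicity_mul (mul_ne_zero hn hb), rootMultiplicity_mul (mul_ne_zero ha hd)] at h3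
  rw [← hu]; unfold od; omega

lemma od_poly (x : k) {a : k[X]} (ha : a ≠ 0) : od x (r a) = rootMultiplicity x a := by
  have := od_div x ha (one_ne_zero (α := k[X]))
  rw [map_one, div_one] at this
  rw [this, rootMultiplicity_eq_zero (p := 1) (by simp)]; simp

lemma od_const (x : k) (c : k) : od x (ak c) = 0 := by
  by_cases hc : c = 0
  · subst hc; unfold od; simp
  · have : ak c = r (C c) := rfl
    rw [this, od_poly x (C_ne_zero.2 hc), rootMultiplicity_C]; rfl

lemma od_X_sub (x : k) : od x (RatFunc.X - ak x) = 1 := by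
  have : RatFunc.X - ak x = r (X - C x) := by rw [map_sub, RatFunc.algebraMap_X]; rfl
  rw [this, od_poly x (X_sub_C_ne_zero x), rootMultiplicity_X_sub_C_self]; rfl

lemma exists_div_ne {u : RatFunc k} (hu : u ≠ 0) : ∃ a b : k[X], a ≠ 0 ∧ b ≠ 0 ∧ u = r a / r b :=
  ⟨u.num, u.denom, RatFunc.num_ne_zero hu, RatFunc.denom_ne_zero u, (RatFunc.num_div_denom u).symm⟩

lemma od_mul (x : k) {u v : RatFunc k} (hu : u ≠ 0) (hv : v ≠ 0) :
    od x (u * v) = od x u + od x v := by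
  obtain ⟨a, b, ha, hb, rfl⟩ := exists_div_ne hu
  obtain ⟨c, e, hc, he, rfl⟩ := exists_div_ne hv
  rw [div_mul_div_comm, ← map_mul, ← map_mul, od_div x (mul_ne_zero ha hc) (mul_ne_zero hb he),
    od_div x ha hb, od_div x hc he, rootMultiplicity_mul (mul_ne_zero ha hc),
    rootMultiplicity_mul (mul_ne_zero hb he)]
  push_cast; ring

lemma od_pow (x : k) {u : RatFunc k} (hu : u ≠ 0) (n : ℕ) : od x (u ^ n) = n * od x u := by
  induction n with
  | zero => rw [pow_zero, ← map_one (ak), od_const]; simp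
  | succ n ih => rw [pow_succ, od_mul x (pow_ne_zero n hu) hu, ih]; push_cast; ring

/-- The order of vanishing of `u` at `x` is at least `n`. -/
def OGe (x : k) (n : ℤ) (u : RatFunc k) : Prop := u = 0 ∨ n ≤ od x u

lemma OGe.mono {x : k} {n m : ℤ} {u : RatFunc k} (h : OGe x n u) (hnm : m ≤ n) : OGe x m u :=
  h.imp id fun h => hnm.trans h

lemma oGe_od (x : k) (u : RatFunc k) : OGe x (od x u) u := Or.inr le_rfl

lemma OGe.le {x : k} {n : ℤ} {u : RatFunc k} (h : OGe x n u) (hu : u ≠ 0) : n ≤ od x u :=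
  h.resolve_left hu

lemma oGe_const (x c : k) : OGe x 0 (ak c) := Or.inr (od_const x c).ge

lemma oGe_poly (x : k) (a : k[X]) : OGe x 0 (r a) := by
  by_cases ha : a = 0
  · left; rw [ha, map_zero]
  · right; rw [od_poly x ha]; positivity

lemma OGe.add {x : k} {n : ℤ} {u v : RatFunc k} (hu : OGe x n u) (hv : OGe x n v) :
    OGe x n (u + v) := by
  by_cases hu0 : u = 0
  · rwa [hu0, zero_add]
  by_cases hv0 : v = 0
  · rwa [hv0, add_zero]
  by_cases h : u + v = 0
  · exact Or.inl h
  replace hu := hu.le hu0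
  replace hv := hv.le hv0
  right
  obtain ⟨a, b, ha, hb, rfl⟩ := exists_div_ne hu0
  obtain ⟨c, e, hc, he, rfl⟩ := exists_div_ne hv0
  rw [div_add_div _ _ (algebraMap_poly_ne_zero hb) (algebraMap_poly_ne_zero he), ← map_mul,
    ← map_mul, ← map_mul, ← map_add] at h ⊢
  have hn : a * e + b * c ≠ 0 := by rintro h0; apply h; rw [h0, map_zero, zero_div]
  rw [od_div x hn (mul_ne_zero hb he)]
  rw [od_div x ha hb] at hu
  rw [od_div x hc he] at hv
  have := rootMultiplicity_add (p := a * e) (q := b * c) x hn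
  rw [rootMultiplicity_mul (mul_ne_zero ha he), rootMultiplicity_mul (mul_ne_zero hb hc)] at this
  rw [rootMultiplicity_mul (mul_ne_zero hb he)]
  rcases min_le_iff.1 this with h | h <;> omega

lemma OGe.mul {x : k} {n m : ℤ} {u v : RatFunc k} (hu : OGe x n u) (hv : OGe x m v) :
    OGe x (n + m) (u * v) := by
  by_cases hu0 : u = 0
  · left; rw [hu0, zero_mul]
  by_cases hv0 : v = 0
  · left; rw [hv0, mul_zero]
  right
  rw [od_mul x hu0 hv0]
  exact add_le_add (hu.le hu0) (hv.le hv0)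

lemma OGe.const_mul {x : k} {n : ℤ} {u : RatFunc k} (hu : OGe x n u) (c : k) :
    OGe x n (ak c * u) := by
  have := (oGe_const x c).mul hu; rwa [zero_add] at this

lemma OGe.neg {x : k} {n : ℤ} {u : RatFunc k} (hu : OGe x n u) : OGe x n (-u) := by
  have := hu.const_mul (-1); rwa [map_neg, map_one, neg_one_mul] at this

lemma OGe.sub {x : k} {n : ℤ} {u v : RatFunc k} (hu : OGe x n u) (hv : OGe x n v) :
    OGe x n (u - v) := sub_eq_add_neg u v ▸ hu.add hv.neg

/-- A summand of higher order does not change the order. -/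
lemma od_add_of_lt {x : k} {u v : RatFunc k} (hu : u ≠ 0) (hv : OGe x (od x u + 1) v) :
    u + v ≠ 0 ∧ od x (u + v) = od x u := by
  have h1 : u + v ≠ 0 := by
    intro h
    have h2 : OGe x (od x u + 1) u := by
      have := hv.neg
      rwa [← eq_neg_of_add_eq_zero_left h] at this
    have := h2.le hu; omega
  refine ⟨h1, le_antisymm ?_ (((oGe_od x u).add (hv.mono (by omega))).le h1)⟩
  by_contra! h
  have h2 : OGe x (od x u + 1) (u + v - v) := OGe.sub (Or.inr h) hv
  rw [add_sub_cancel_right] at h2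
  have := h2.le hu; omega

lemma od_dvd {x : k} {a : k[X]} (ha : a ≠ 0) {n : ℕ} : (n : ℤ) ≤ od x (r a) ↔ (X - C x) ^ n ∣ a := by
  rw [od_poly x ha, Nat.cast_le, le_rootMultiplicity_iff ha]

lemma od_cubicR_le {A B : k} [EC A B] (x : k) : od x (cubicR A B) ≤ 1 := by
  by_contra! h
  have : ((2 : ℕ) : ℤ) ≤ od x (r (cubic A B)) := by push_cast; exact h
  exact sq_not_dvd_cubic EC.disc x ((od_dvd (cubic_ne_zero A B)).1 this)

lemma od_cubicR_nonneg {A B : k} (x : k) : 0 ≤ od x (cubicR A B) :=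
  (oGe_poly x (cubic A B)).le (cubicR_ne_zero A B)

/-- The logarithmic derivative has at most a simple pole, with residue the order. -/
lemma dR_mul_X_sub (x : k) {u : RatFunc k} (hu : u ≠ 0) : ∃ v : RatFunc k, OGe x 1 v ∧
    dR u * (RatFunc.X - ak x) = u * (ak (od x u : k) + v) := by
  suffices ∃ a v : RatFunc k, a ≠ 0 ∧ a * (RatFunc.X - ak x) = u ∧
      dR u = a * (ak (od x u : k) + v) ∧ OGe x 1 v by
    obtain ⟨a, v, -, ha, e, hv⟩ := this
    exact ⟨v, hv, by rw [e, mul_right_comm, ha]⟩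
  obtain ⟨a, b, ha, hb, rfl⟩ := exists_div_ne hu
  obtain ⟨a₁, ha₁, hax⟩ := exists_eq_pow_rootMultiplicity_mul_and_not_dvd a ha x
  obtain ⟨b₁, hb₁, hbx⟩ := exists_eq_pow_rootMultiplicity_mul_and_not_dvd b hb x
  obtain ⟨i, hi⟩ : ∃ i, i = rootMultiplicity x a := ⟨_, rfl⟩
  obtain ⟨j, hj⟩ : ∃ j, j = rootMultiplicity x b := ⟨_, rfl⟩
  have hod := od_div x ha hb
  rw [← hi, ← hj] at hod
  rw [← hi] at ha₁
  rw [← hj] at hb₁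
  have ha₁0 : a₁ ≠ 0 := by rintro rfl; exact hax (dvd_zero _)
  have hb₁0 : b₁ ≠ 0 := by rintro rfl; exact hbx (dvd_zero _)
  have hX : r (X - C x) ≠ 0 := algebraMap_poly_ne_zero (X_sub_C_ne_zero x)
  have hA : r a₁ ≠ 0 := algebraMap_poly_ne_zero ha₁0
  have hB : r b₁ ≠ 0 := algebraMap_poly_ne_zero hb₁0
  have hb' : r b ≠ 0 := algebraMap_poly_ne_zero hb
  have oX : od x (r (X - C x)) = 1 := by
    rw [od_poly x (X_sub_C_ne_zero x), rootMultiplicity_X_sub_C_self]; rfl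
  refine ⟨r a / r b / r (X - C x), r (X - C x) * (r (derivative a₁) / r a₁ -
    r (derivative b₁) / r b₁), div_ne_zero hu hX, ?_, ?_, ?_⟩
  · have : RatFunc.X - ak x = r (X - C x) := by rw [map_sub, RatFunc.algebraMap_X]; rfl
    rw [this, div_mul_cancel₀ _ hX]
  · rw [dR_div a hb, hod]
    have da : r (X - C x) * r (derivative a) =
        (i : RatFunc k) * r a + r (X - C x) ^ i * r (X - C x) * r (derivative a₁) := by
      rw [ha₁, ← map_mul, ← map_pow, ← map_mul, ← map_mul, ← map_natCast (r), ← map_mul, ← map_add]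
      congr 1
      rcases i with _ | i
      · simp
      · rw [derivative_mul, derivative_X_sub_C_pow]
        push_cast [Nat.add_sub_cancel, map_add, map_one, map_natCast]; ring
    have db : r (X - C x) * r (derivative b) =
        (j : RatFunc k) * r b + r (X - C x) ^ j * r (X - C x) * r (derivative b₁) := by
      rw [hb₁, ← map_mul, ← map_pow, ← map_mul, ← map_mul, ← map_natCast (r), ← map_mul, ← map_add]
      congr 1
      rcases j with _ | j
      · simp
      · rw [derivative_mul, derivative_X_sub_C_pow]
        push_cast [Nat.add_sub_cancel, map_add, map_one, map_natCast]; ring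
    have ea : r a = r (X - C x) ^ i * r a₁ := by rw [← map_pow, ← map_mul, ← ha₁]
    have eb : r b = r (X - C x) ^ j * r b₁ := by rw [← map_pow, ← map_mul, ← hb₁]
    have h1 : ak (((i : ℤ) - (j : ℤ) : ℤ) : k) = (i : RatFunc k) - j := by
      push_cast; rfl
    rw [h1]
    apply mul_left_cancel₀ hX
    have hb2 := pow_ne_zero 2 hb'
    rw [mul_div_assoc', div_eq_iff hb2, mul_sub]
    have e1 : r (X - C x) * (r a / r b / r (X - C x) * ((i : RatFunc k) - j + r (X - C x) *
        (r (derivative a₁) / r a₁ - r (derivative b₁) / r b₁))) * r b ^ 2 =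
        r a * r b * ((i : RatFunc k) - j) + r (X - C x) ^ i * r (X - C x) * r (derivative a₁) * r b
          - r a * (r (X - C x) ^ j * r (X - C x) * r (derivative b₁)) := by
      rw [eb] at hb'
      rw [ea, eb]
      have hXj := pow_ne_zero j hX
      field_simp
      ring
    rw [e1]
    linear_combination r b * da - r a * db
  · have h1 : OGe x 1 (r (X - C x)) := Or.inr oX.ge
    have h2 : ∀ c e : k[X], e ≠ 0 → ¬ (X - C x) ∣ e → OGe x 0 (r c / r e) := by
      intro c e he hxe
      by_cases hc : c = 0
      · left; rw [hc, map_zero, zero_div]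
      · right
        rw [od_div x hc he, rootMultiplicity_eq_zero (p := e)]
        · simp
        · rwa [← dvd_iff_isRoot]
    exact h1.mul ((h2 _ _ ha₁0 hax).sub (h2 _ _ hb₁0 hbx))

lemma od_dR_aux (x : k) {u : RatFunc k} (hu : u ≠ 0) : ∃ a v : RatFunc k,
    a ≠ 0 ∧ od x a = od x u - 1 ∧ dR u = a * (ak (od x u : k) + v) ∧ OGe x 1 v := by
  obtain ⟨v, hv, h⟩ := dR_mul_X_sub x hu
  have hX0 : RatFunc.X - ak x ≠ 0 := by
    intro h0
    have h1 := od_X_sub x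
    rw [h0, ← map_zero ak, od_const] at h1
    exact zero_ne_one h1
  have ha : u / (RatFunc.X - ak x) ≠ 0 := div_ne_zero hu hX0
  refine ⟨u / (RatFunc.X - ak x), v, ha, ?_, ?_, hv⟩
  · have := od_mul x ha hX0
    rw [div_mul_cancel₀ _ hX0, od_X_sub] at this
    omega
  · rw [div_mul_eq_mul_div, ← h, mul_div_cancel_right₀ _ hX0]

lemma OGe.dR {x : k} {n : ℤ} {u : RatFunc k} (hu : OGe x n u) : OGe x (n - 1) (dR u) := by
  by_cases hu0 : u = 0
  · left; rw [hu0, dR_zero]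
  obtain ⟨a, v, ha, hoa, e, hv⟩ := od_dR_aux x hu0
  rw [e]
  have := (oGe_od x a).mul ((oGe_const x (od x u : k)).add (hv.mono (by norm_num)))
  refine this.mono ?_
  have := hu.le hu0
  omega

lemma OGe.dR_zero {x : k} {u : RatFunc k} (hu : OGe x 0 u) : OGe x 0 (LT.dR u) := by
  by_cases hu0 : u = 0
  · left; rw [hu0, LT.dR_zero]
  obtain ⟨a, v, ha, hoa, e, hv⟩ := od_dR_aux x hu0
  have h0 := hu.le hu0
  rcases h0.eq_or_lt with h0 | h0
  · rw [e, ← h0, Int.cast_zero, map_zero, zero_add]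
    exact ((oGe_od x a).mul hv).mono (by omega)
  · exact (OGe.dR (Or.inr (show (1 : ℤ) ≤ od x u by omega))).mono (by norm_num)

lemma od_dR {x : k} {u : RatFunc k} (h : (od x u : k) ≠ 0) :
    dR u ≠ 0 ∧ od x (dR u) = od x u - 1 := by
  have hu0 : u ≠ 0 := by
    rintro rfl; apply h
    have := od_const x (0 : k)
    rw [map_zero] at this
    rw [this, Int.cast_zero]
  obtain ⟨a, v, ha, hoa, e, hv⟩ := od_dR_aux x hu0
  have hc : ak (od x u : k) ≠ 0 := (_root_.map_ne_zero _).2 h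
  obtain ⟨h1, h2⟩ := od_add_of_lt (x := x) (v := v) hc (by rw [od_const]; exact hv)
  rw [e]
  refine ⟨mul_ne_zero ha h1, ?_⟩
  rw [od_mul x ha h1, h2, od_const, hoa, add_zero]

end Order

section Composition

variable {k : Type} [Field k]

local notation "r" => algebraMap k[X] (RatFunc k)
local notation "ak" => algebraMap k (RatFunc k)

lemma intDegree_const (c : k) : (ak c).intDegree = 0 := by
  rw [RatFunc.algebraMap_eq_C, RatFunc.intDegree_C]

lemma intDegree_pow {u : RatFunc k} (hu : u ≠ 0) (n : ℕ) :
    (u ^ n).intDegree = n * u.intDegree := by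
  induction n with
  | zero => simp
  | succ n ih => rw [pow_succ, RatFunc.intDegree_mul (pow_ne_zero n hu) hu, ih]; push_cast; ring

lemma intDegree_div {a b : k[X]} (ha : a ≠ 0) (hb : b ≠ 0) :
    (r a / r b).intDegree = a.natDegree - b.natDegree := by
  have h := RatFunc.intDegree_mul (div_ne_zero (algebraMap_poly_ne_zero ha)
    (algebraMap_poly_ne_zero hb)) (algebraMap_poly_ne_zero hb)
  rw [div_mul_cancel₀ _ (algebraMap_poly_ne_zero hb), RatFunc.intDegree_polynomial,
    RatFunc.intDegree_polynomial] at h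
  omega

lemma transcendental_of_intDegree {v : RatFunc k} (hv : 0 < v.intDegree) : Transcendental k v :=
  RatFunc.transcendental_of_ne_C _ (by rintro ⟨c, rfl⟩; simp at hv)

/-- A summand of lower degree does not change the degree. -/
lemma intDegree_add_of_lt {u v : RatFunc k} (hu : u ≠ 0) (hv : DLe (u.intDegree - 1) v) :
    u + v ≠ 0 ∧ (u + v).intDegree = u.intDegree := by
  have h1 : u + v ≠ 0 := by
    intro h
    have := hv.neg
    rw [← eq_neg_of_add_eq_zero_left h] at this
    have := this.le hu; omega
  refine ⟨h1, le_antisymm (((dLe_intDegree u).add (hv.mono (by omega))).le h1) ?_⟩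
  by_contra! h
  have h2 : DLe (u.intDegree - 1) (u + v + -v) :=
    (show DLe (u.intDegree - 1) (u + v) from Or.inr (by omega)).add hv.neg
  rw [add_neg_cancel_right] at h2
  have := h2.le hu; omega

lemma intDegree_aeval {v : RatFunc k} (hv : 0 < v.intDegree) :
    ∀ (n : ℕ) (a : k[X]), a ≠ 0 → a.natDegree = n →
      aeval v a ≠ 0 ∧ (aeval v a).intDegree = v.intDegree * n := by
  intro n
  induction n with
  | zero =>
    intro a ha hn
    rw [eq_C_of_natDegree_eq_zero hn] at ha ⊢
    rw [aeval_C]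
    refine ⟨(_root_.map_ne_zero _).2 (by simpa using ha), ?_⟩
    rw [intDegree_const]; simp
  | succ n ih =>
    intro a ha hn
    have hq : a.divX ≠ 0 := by
      intro h
      have := divX_mul_X_add a
      rw [h, zero_mul, zero_add] at this
      rw [← this, natDegree_C] at hn
      omega
    have hqn : a.divX.natDegree = n := by rw [natDegree_divX_eq_natDegree_tsub_one, hn]; rfl
    obtain ⟨h1, h2⟩ := ih _ hq hqn
    have hv0 : v ≠ 0 := by rintro rfl; simp at hv
    have h3 : (aeval v a.divX * v).intDegree = v.intDegree * (n + 1 : ℕ) := by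
      rw [RatFunc.intDegree_mul h1 hv0, h2]; push_cast; ring
    have h4 : 0 < v.intDegree * (n + 1 : ℕ) := by positivity
    have := intDegree_add_of_lt (mul_ne_zero h1 hv0) (v := ak (a.coeff 0))
      ((dLe_const _).mono (by omega))
    rw [h3] at this
    rw [← divX_mul_X_add a, map_add, map_mul, aeval_X, aeval_C]
    exact this

lemma intDegree_subsR {v : RatFunc k} (hv : 0 < v.intDegree) (ht : Transcendental k v)
    (u : RatFunc k) : (subsR v ht u).intDegree = v.intDegree * u.intDegree := by
  by_cases hu : u = 0
  · subst hu; simp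
  obtain ⟨a, b, ha, hb, rfl⟩ := exists_div_ne hu
  obtain ⟨h1, h2⟩ := intDegree_aeval hv _ a ha rfl
  obtain ⟨h3, h4⟩ := intDegree_aeval hv _ b hb rfl
  have h5 := RatFunc.intDegree_mul (div_ne_zero h1 h3) h3
  rw [div_mul_cancel₀ _ h3] at h5
  rw [map_div₀, subsR_poly, subsR_poly, intDegree_div ha hb, mul_sub]
  omega

lemma DLe.dR {n : ℤ} {u : RatFunc k} (hu : DLe n u) : DLe (n - 1) (dR u) := by
  by_cases hu0 : u = 0
  · left; rw [hu0, dR_zero]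
  replace hu := hu.le hu0
  obtain ⟨a, b, ha, hb, rfl⟩ := exists_div_ne hu0
  rw [intDegree_div ha hb] at hu
  rw [dR_div a hb, ← map_mul, ← map_mul, ← map_sub, ← map_pow]
  by_cases h0 : derivative a * b - a * derivative b = 0
  · left; rw [h0, map_zero, zero_div]
  right
  rw [intDegree_div h0 (pow_ne_zero 2 hb), natDegree_pow]
  have hdeg : (derivative a * b - a * derivative b).degree < (a * b).degree := by
    refine (degree_sub_le _ _).trans_lt (max_lt ?_ ?_)
    · rw [degree_mul, degree_mul]
      exact WithBot.add_lt_add_right (degree_ne_bot.2 hb) (degree_derivative_lt ha)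
    · rw [degree_mul, degree_mul]
      exact WithBot.add_lt_add_left (degree_ne_bot.2 ha) (degree_derivative_lt hb)
  have := natDegree_lt_natDegree h0 hdeg
  rw [natDegree_mul ha hb] at this
  push_cast; omega

lemma dLe_sub_const {u : RatFunc k} (hu : DLe 0 u) : ∃ c, DLe (-1) (u - ak c) := by
  by_cases hu0 : u = 0
  · exact ⟨0, Or.inl (by rw [hu0, map_zero, sub_zero])⟩
  replace hu := hu.le hu0
  obtain ⟨a, b, ha, hb, rfl⟩ := exists_div_ne hu0
  rw [intDegree_div ha hb] at hu
  have hq : (a / b).natDegree = 0 := by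
    by_cases hab : degree b ≤ degree a
    · have h := degree_add_div hb hab
      have h0 : a / b ≠ 0 := by rintro h0; rw [Polynomial.div_eq_zero_iff hb] at h0; exact h0.not_ge hab
      rw [← degree_mul] at h
      have h := natDegree_eq_of_degree_eq h
      rw [natDegree_mul hb h0] at h
      omega
    · rw [(Polynomial.div_eq_zero_iff hb).2 (not_le.1 hab), natDegree_zero]
  refine ⟨(a / b).coeff 0, ?_⟩
  have h1 : r a / r b - ak ((a / b).coeff 0) = r (a % b) / r b := by
    rw [eq_div_iff (algebraMap_poly_ne_zero hb), sub_mul,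
      div_mul_cancel₀ _ (algebraMap_poly_ne_zero hb)]
    have : ak ((a / b).coeff 0) = r (a / b) := by
      conv_rhs => rw [eq_C_of_natDegree_eq_zero hq]
      rfl
    rw [this, ← map_mul, ← map_sub]
    congr 1
    have := EuclideanDomain.div_add_mod a b
    linear_combination -this
  rw [h1]
  by_cases h0 : a % b = 0
  · left; rw [h0, map_zero, zero_div]
  right
  rw [intDegree_div h0 hb]
  have := natDegree_lt_natDegree h0 (degree_mod_lt a hb)
  omega

lemma OGe.aeval {v : RatFunc k} {x : k} (hv : OGe x 0 v) (a : k[X]) :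
    OGe x 0 (Polynomial.aeval v a) := by
  induction a using Polynomial.induction_on' with
  | add p q hp hq => rw [map_add]; exact hp.add hq
  | monomial n c =>
    rw [aeval_monomial]
    refine OGe.const_mul ?_ c
    induction n with
    | zero => rw [pow_zero, ← map_one ak]; exact oGe_const x 1
    | succ n ih => rw [pow_succ]; exact ih.mul hv

lemma oGe_of_sub {v : RatFunc k} {x ξ : k} (h : 0 < od x (v - ak ξ)) : OGe x 0 v := by
  have := (show OGe x 0 (v - ak ξ) from Or.inr h.le).add (oGe_const x ξ)
  rwa [sub_add_cancel] at this

lemma od_aeval {v : RatFunc k} {x ξ : k} (h : 0 < od x (v - ak ξ)) (h0 : v - ak ξ ≠ 0)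
    {a : k[X]} (ha : a ≠ 0) :
    aeval v a ≠ 0 ∧ od x (aeval v a) = od x (v - ak ξ) * rootMultiplicity ξ a := by
  obtain ⟨a₁, ha₁, hax⟩ := exists_eq_pow_rootMultiplicity_mul_and_not_dvd a ha ξ
  obtain ⟨q, hq⟩ : (X - C ξ) ∣ a₁ - C (a₁.eval ξ) := X_sub_C_dvd_sub_C_eval
  have hc : a₁.eval ξ ≠ 0 := fun h => hax (dvd_iff_isRoot.2 h)
  have e1 : aeval v a₁ = ak (a₁.eval ξ) + (v - ak ξ) * aeval v q := by
    have := congrArg (aeval v) hq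
    rw [map_sub, map_mul, map_sub, aeval_C, aeval_C, aeval_X] at this
    linear_combination this
  have h2 : OGe x 1 ((v - ak ξ) * aeval v q) :=
    ((show OGe x 1 (v - ak ξ) from Or.inr h).mul ((oGe_of_sub h).aeval q)).mono (by norm_num)
  obtain ⟨h3, h4⟩ := od_add_of_lt (x := x) (u := ak (a₁.eval ξ))
    ((_root_.map_ne_zero _).2 hc) (by rw [od_const]; exact h2)
  rw [od_const, ← e1] at h4
  rw [← e1] at h3
  have e2 : aeval v a = (v - ak ξ) ^ (rootMultiplicity ξ a) * aeval v a₁ := by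
    conv_lhs => rw [ha₁]
    rw [map_mul, map_pow, map_sub, aeval_X, aeval_C]
  rw [e2]
  refine ⟨mul_ne_zero (pow_ne_zero _ h0) h3, ?_⟩
  rw [od_mul x (pow_ne_zero _ h0) h3, od_pow x h0, h4]; ring

/-- Orders of vanishing multiply under composition. -/
lemma od_subsR {v : RatFunc k} (ht : Transcendental k v) {x ξ : k} (h : 0 < od x (v - ak ξ))
    (u : RatFunc k) : od x (subsR v ht u) = od x (v - ak ξ) * od ξ u := by
  have h0 : v - ak ξ ≠ 0 := by
    intro h; rw [sub_eq_zero.1 h] at ht; exact ht (isAlgebraic_algebraMap ξ)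
  by_cases hu : u = 0
  · subst hu
    have : ∀ y : k, od y (0 : RatFunc k) = 0 := fun y => by
      have := od_const y (0 : k); rwa [map_zero] at this
    rw [map_zero, this, this, mul_zero]
  obtain ⟨a, b, ha, hb, rfl⟩ := exists_div_ne hu
  obtain ⟨h1, h2⟩ := od_aeval h h0 ha
  obtain ⟨h3, h4⟩ := od_aeval h h0 hb
  have h5 := od_mul x (div_ne_zero h1 h3) h3
  rw [div_mul_cancel₀ _ h3] at h5
  rw [map_div₀, subsR_poly, subsR_poly, od_div ξ ha hb, mul_sub]
  omega

lemma od_of_root {u : RatFunc k} (hu : u ≠ 0) {x : k} (h : u.num.eval x = 0) : 0 < od x u := by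
  have h1 : ¬ u.denom.IsRoot x := fun h' =>
    LT.IsCoprime.not_eval (RatFunc.isCoprime_num_denom u) x (Prod.ext h h')
  unfold od
  rw [rootMultiplicity_eq_zero h1]
  have := (rootMultiplicity_pos (RatFunc.num_ne_zero hu)).2 h
  omega

lemma od_of_pole {u : RatFunc k} (hu : u ≠ 0) {x : k} (h : u.denom.eval x = 0) : od x u < 0 := by
  have h1 : ¬ u.num.IsRoot x := fun h' =>
    LT.IsCoprime.not_eval (RatFunc.isCoprime_num_denom u) x (Prod.ext h' h)
  unfold od
  rw [rootMultiplicity_eq_zero h1]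
  have := (rootMultiplicity_pos (RatFunc.denom_ne_zero u)).2 h
  omega

variable [IsAlgClosed k]

lemma exists_root_natDegree {a : k[X]} (h : a.natDegree ≠ 0) : ∃ x, a.eval x = 0 :=
  IsAlgClosed.exists_root a (fun h₀ => h (natDegree_eq_of_degree_eq_some h₀))

/-- A rational function with a pole at infinity takes every finite value at a finite point. -/
lemma exists_od_sub_pos {v : RatFunc k} (hv : 0 < v.intDegree) (ξ : k) :
    ∃ x, 0 < od x (v - ak ξ) := by
  have hv0 : v ≠ 0 := by rintro rfl; simp at hv
  obtain ⟨h1, h2⟩ := intDegree_add_of_lt hv0 (v := ak (-ξ)) ((dLe_const _).mono (by omega))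
  rw [map_neg, ← sub_eq_add_neg] at h1 h2
  have h3 : (v - ak ξ).num.natDegree ≠ 0 := by
    have h4 : (v - ak ξ).intDegree = (v - ak ξ).num.natDegree - (v - ak ξ).denom.natDegree := rfl
    omega
  obtain ⟨x, hx⟩ := exists_root_natDegree h3
  exact ⟨x, od_of_root h1 hx⟩

/-- A rational function without finite poles is a polynomial. -/
lemma exists_poly_of_oGe {u : RatFunc k} (h : ∀ x, OGe x 0 u) : ∃ a : k[X], u = r a := by
  by_cases hu : u = 0
  · exact ⟨0, by rw [hu, map_zero]⟩
  have h1 : u.denom.natDegree = 0 := by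
    by_contra h1
    obtain ⟨x, hx⟩ := exists_root_natDegree h1
    have := od_of_pole hu hx
    have := (h x).le hu
    omega
  have h2 : u.denom = 1 := (RatFunc.monic_denom u).natDegree_eq_zero.1 h1
  refine ⟨u.num, ?_⟩
  conv_lhs => rw [← RatFunc.num_div_denom u]
  rw [h2, map_one, div_one]

end Composition

section Normal

variable {k : Type} [Field k]

local notation "r" => algebraMap k[X] (RatFunc k)
local notation "ak" => algebraMap k (RatFunc k)

lemma mem_adjoin_iff_subsR {ρ : RatFunc k} (hρ : Transcendental k ρ) (x : RatFunc k) :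
    x ∈ IntermediateField.adjoin k {ρ} ↔ ∃ u, x = subsR ρ hρ u := by
  rw [IntermediateField.mem_adjoin_simple_iff]
  constructor
  · rintro ⟨a, b, rfl⟩
    exact ⟨r a / r b, by rw [map_div₀, subsR_poly, subsR_poly]⟩
  · rintro ⟨u, rfl⟩
    exact ⟨u.num, u.denom, by
      conv_lhs => rw [← RatFunc.num_div_denom u]
      rw [map_div₀, subsR_poly, subsR_poly]⟩

/-- A nonconstant subfield generated by two elements has a generator with a pole at infinity. -/
lemma exists_generator {μ γ : RatFunc k} (hμ : Transcendental k μ) :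
    ∃ ρ : RatFunc k, 0 < ρ.intDegree ∧
      IntermediateField.adjoin k {μ, γ} = IntermediateField.adjoin k {ρ} := by
  obtain ⟨E, hE⟩ : ∃ E, E = IntermediateField.adjoin k {μ, γ} := ⟨_, rfl⟩
  rw [← hE]
  have hbot : E ≠ ⊥ := by
    rintro rfl
    have h1 : μ ∈ (⊥ : IntermediateField k (RatFunc k)) := by
      rw [hE]; exact IntermediateField.subset_adjoin _ _ (by simp)
    obtain ⟨c, hc⟩ := IntermediateField.mem_bot.1 h1
    rw [← hc] at hμ
    exact hμ (isAlgebraic_algebraMap c)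
  have h1 := RatFunc.Luroth.eq_adjoin_generator (E := E)
  obtain ⟨σ, hσ⟩ : ∃ σ, σ = RatFunc.Luroth.generator E := ⟨_, rfl⟩
  have hσt := RatFunc.Luroth.transcendental_generator hbot
  rw [← hσ] at h1 hσt
  by_cases hd : 0 < σ.intDegree
  · exact ⟨σ, hd, h1⟩
  obtain ⟨c, hc⟩ := dLe_sub_const (u := σ) (Or.inr (not_lt.1 hd))
  have h0 : σ - ak c ≠ 0 := by
    intro h; rw [sub_eq_zero.1 h] at hσt; exact hσt (isAlgebraic_algebraMap c)
  have hc' := hc.le h0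
  have hinv : (σ - ak c)⁻¹.intDegree = -(σ - ak c).intDegree := by
    have := RatFunc.intDegree_mul (inv_ne_zero h0) h0
    rw [inv_mul_cancel₀ h0, RatFunc.intDegree_one] at this
    omega
  refine ⟨(σ - ak c)⁻¹, by omega, ?_⟩
  rw [h1]
  apply le_antisymm
  · rw [IntermediateField.adjoin_simple_le_iff]
    have h2 := IntermediateField.mem_adjoin_simple_self k (σ - ak c)⁻¹
    have h3 := add_mem (inv_mem h2) (IntermediateField.algebraMap_mem _ c)
    rwa [inv_inv, sub_add_cancel] at h3
  · rw [IntermediateField.adjoin_simple_le_iff]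
    exact inv_mem (sub_mem (IntermediateField.mem_adjoin_simple_self k σ)
      (IntermediateField.algebraMap_mem _ c))

variable {A B : k}

/-- Ramification indices of a solution of the differential equation are at most two. -/
lemma ramification_le [EC A B] {μ : RatFunc k} (ht : Transcendental k μ) {c : k} (hc : c ≠ 0)
    {A' B' : k} [EC A' B']
    (hode : cubicR A B * dR μ ^ 2 = ak c * (μ ^ 3 + ak A' * μ + ak B')) (x η : k)
    (h : 0 < od x (μ - ak η)) : od x (μ - ak η) ≤ 2 := by
  have h1 : OGe x (2 * (od x (μ - ak η) - 1)) (cubicR A B * dR μ ^ 2) := by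
    have h2 := (oGe_od x (μ - ak η)).dR
    rw [dR_sub, dR_const, sub_zero] at h2
    have := (show OGe x 0 (cubicR A B) from Or.inr (od_cubicR_nonneg x)).mul (h2.mul h2)
    rw [← sq] at this
    exact this.mono (by omega)
  have hF : μ ^ 3 + ak A' * μ + ak B' = subsR μ ht (cubicR A' B') := (subsR_cubic A' B' μ ht).symm
  have hF0 : subsR μ ht (cubicR A' B') ≠ 0 := (_root_.map_ne_zero _).2 (cubicR_ne_zero A' B')
  have hc0 : ak c ≠ 0 := (_root_.map_ne_zero _).2 hc
  rw [hode, hF] at h1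
  have h3 := h1.le (mul_ne_zero hc0 hF0)
  rw [od_mul x hc0 hF0, od_const, od_subsR ht h] at h3
  have h4 := od_cubicR_le (A := A') (B := B') η
  nlinarith

lemma od_quadruple {x : k} {u : RatFunc k} (hu : u ≠ 0) (h : od x u < 0) (A' B' : k) :
    u ^ 3 + ak A' * u + ak B' ≠ 0 ∧ od x (u ^ 3 + ak A' * u + ak B') = 3 * od x u := by
  have h3 := od_pow x hu 3
  have := od_add_of_lt (x := x) (v := ak A' * u + ak B') (pow_ne_zero 3 hu) (by
    rw [h3]
    exact (((oGe_od x u).const_mul A').mono (by push_cast; omega)).add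
      ((oGe_const x B').mono (by push_cast; omega)))
  rw [h3, ← add_assoc] at this
  exact_mod_cast this

lemma ramification_pole_le [EC A B] {μ : RatFunc k} {c : k} (hc : c ≠ 0)
    {A' B' : k} (hμ : μ ≠ 0)
    (hode : cubicR A B * dR μ ^ 2 = ak c * (μ ^ 3 + ak A' * μ + ak B')) (x : k)
    (h : od x μ < 0) : -2 ≤ od x μ := by
  have h1 : OGe x (2 * (od x μ - 1)) (cubicR A B * dR μ ^ 2) := by
    have h2 := (oGe_od x μ).dR
    have := (show OGe x 0 (cubicR A B) from Or.inr (od_cubicR_nonneg x)).mul (h2.mul h2)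
    rw [← sq] at this
    exact this.mono (by omega)
  obtain ⟨h2, h3⟩ := od_quadruple hμ h A' B'
  have hc0 : ak c ≠ 0 := (_root_.map_ne_zero _).2 hc
  rw [hode] at h1
  have h4 := h1.le (mul_ne_zero hc0 h2)
  rw [od_mul x hc0 h2, od_const, h3] at h4
  omega

lemma intDegree_cubic_comp {u : RatFunc k} (h : 0 < u.intDegree) (A' B' : k) :
    u ^ 3 + ak A' * u + ak B' ≠ 0 ∧ (u ^ 3 + ak A' * u + ak B').intDegree = 3 * u.intDegree := by
  have ht := transcendental_of_intDegree h
  rw [← subsR_cubic A' B' u ht, intDegree_subsR h, intDegree_cubicR]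
  exact ⟨(_root_.map_ne_zero _).2 (cubicR_ne_zero A' B'), mul_comm _ _⟩

/-- A solution of the differential equation with a pole at infinity has a simple pole there. -/
lemma intDegree_eq_one {μ : RatFunc k} {c : k} (hc : c ≠ 0) {A' B' : k}
    (hode : cubicR A B * dR μ ^ 2 = ak c * (μ ^ 3 + ak A' * μ + ak B'))
    (h : 0 < μ.intDegree) : μ.intDegree = 1 ∧ dR μ ≠ 0 ∧ (dR μ).intDegree = 0 := by
  obtain ⟨h1, h2⟩ := intDegree_cubic_comp h A' B'
  have hc0 : ak c ≠ 0 := (_root_.map_ne_zero _).2 hc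
  have hd : dR μ ≠ 0 := by
    rintro hd
    rw [hd] at hode
    exact mul_ne_zero hc0 h1 (by rw [← hode]; ring)
  have h3 := congrArg RatFunc.intDegree hode
  rw [RatFunc.intDegree_mul (cubicR_ne_zero A B) (pow_ne_zero 2 hd), intDegree_cubicR,
    intDegree_pow hd, RatFunc.intDegree_mul hc0 h1, h2, intDegree_const] at h3
  have h4 := ((dLe_intDegree μ).dR).le hd
  push_cast at h3
  exact ⟨by omega, hd, by omega⟩

end Normal

section Normal

variable {k : Type} [Field k] [IsAlgClosed k]

local notation "r" => algebraMap k[X] (RatFunc k)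
local notation "ak" => algebraMap k (RatFunc k)

variable {A B : k} [EC A B]

lemma ramification_factor_le {ρ Ψ μ : RatFunc k} (hρ : Transcendental k ρ)
    (hμ : Transcendental k μ)
    (hΨ : subsR ρ hρ Ψ = μ) {c : k} (hc : c ≠ 0)
    (hode : cubicR A B * dR μ ^ 2 = ak c * (μ ^ 3 + ak A * μ + ak B)) (x ξ : k)
    (h : 0 < od x (ρ - ak ξ)) : od x (ρ - ak ξ) ≤ 2 := by
  have hμ0 : μ ≠ 0 := by rintro h; rw [h] at hμ; exact hμ isAlgebraic_zero
  have hΨ0 : Ψ ≠ 0 := by rintro rfl; rw [map_zero] at hΨ; exact hμ0 hΨ.symm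
  by_cases hpole : Ψ.denom.eval ξ = 0
  · have h1 := od_of_pole hΨ0 hpole
    have h2 := od_subsR hρ h Ψ
    rw [hΨ] at h2
    have h3 := ramification_pole_le hc hμ0 hode x (by rw [h2]; nlinarith)
    nlinarith
  · obtain ⟨η, hη⟩ : ∃ η, η = Ψ.num.eval ξ / Ψ.denom.eval ξ := ⟨_, rfl⟩
    have hne : Ψ - ak η ≠ 0 := by
      intro h
      rw [sub_eq_zero.1 h, AlgHom.commutes] at hΨ
      rw [← hΨ] at hμ
      exact hμ (isAlgebraic_algebraMap η)
    have hd := algebraMap_poly_ne_zero (RatFunc.denom_ne_zero Ψ)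
    have e : Ψ - ak η = r (Ψ.num - C η * Ψ.denom) / r Ψ.denom := by
      rw [map_sub, map_mul, sub_div, RatFunc.num_div_denom, mul_div_cancel_right₀ _ hd]; rfl
    have h0 : Ψ.num - C η * Ψ.denom ≠ 0 := by
      intro h0; rw [h0, map_zero, zero_div] at e; exact hne e
    have h1 : 0 < od ξ (Ψ - ak η) := by
      rw [e, od_div ξ h0 (RatFunc.denom_ne_zero Ψ), rootMultiplicity_eq_zero (p := Ψ.denom) hpole]
      have := (rootMultiplicity_pos h0 (x := ξ)).2 (by
        rw [IsRoot.def, eval_sub, eval_mul, eval_C, hη, div_mul_cancel₀ _ hpole, sub_self])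
      omega
    have h2 := od_subsR hρ h (Ψ - ak η)
    rw [map_sub, hΨ, AlgHom.commutes] at h2
    have h3 := ramification_le hμ hc hode x η (by rw [h2]; positivity)
    nlinarith

lemma exists_cubic_ode {ρ Ψ μ : RatFunc k} (hρd : 0 < ρ.intDegree) (hρ : Transcendental k ρ)
    (hμd : 0 < μ.intDegree) (hΨ : subsR ρ hρ Ψ = μ) {c : k} (hc : c ≠ 0)
    (hode : cubicR A B * dR μ ^ 2 = ak c * (μ ^ 3 + ak A * μ + ak B)) :
    ρ.intDegree = 1 ∧ ∃ h : k[X], cubicR A B * dR ρ ^ 2 = aeval ρ h ∧ h.natDegree = 3 ∧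
      ∀ ξ, ¬ (X - C ξ) ^ 2 ∣ h := by
  have hμ := transcendental_of_intDegree hμd
  have hc0 : ak c ≠ 0 := (_root_.map_ne_zero _).2 hc
  have hf := cubicR_ne_zero A B
  obtain ⟨hμ1, hdμ, hdμ0⟩ := intDegree_eq_one hc hode hμd
  have hchain : dR μ = subsR ρ hρ (dR Ψ) * dR ρ := by rw [← hΨ, dR_subsR]
  have hdρ : dR ρ ≠ 0 := by rintro h; rw [h, mul_zero] at hchain; exact hdμ hchain
  have hdΨ : dR Ψ ≠ 0 := by
    rintro h; rw [h, map_zero, zero_mul] at hchain; exact hdμ hchain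
  have hdΨ' : subsR ρ hρ (dR Ψ) ≠ 0 := (_root_.map_ne_zero _).2 hdΨ
  have hdeg : ρ.intDegree = 1 ∧ Ψ.intDegree = 1 := by
    have h1 := intDegree_subsR hρd hρ Ψ
    rw [hΨ, hμ1] at h1
    have h2 : 0 < Ψ.intDegree := by by_contra! h; nlinarith
    constructor <;> nlinarith
  have hdρ0 : (dR ρ).intDegree = 0 := by
    have h1 := ((dLe_intDegree ρ).dR).le hdρ
    have h2 := ((dLe_intDegree Ψ).dR).le hdΨ
    have h3 := congrArg RatFunc.intDegree hchain
    rw [RatFunc.intDegree_mul hdΨ' hdρ, intDegree_subsR hρd, hdμ0, hdeg.1] at h3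
    omega
  refine ⟨hdeg.1, ?_⟩
  obtain ⟨H, hH⟩ : ∃ H, H = ak c * (Ψ ^ 3 + ak A * Ψ + ak B) / dR Ψ ^ 2 := ⟨_, rfl⟩
  have hHρ : cubicR A B * dR ρ ^ 2 = subsR ρ hρ H := by
    rw [hH, map_div₀, map_mul, map_add, map_add, map_pow, map_mul, AlgHom.commutes,
      AlgHom.commutes, AlgHom.commutes, map_pow, hΨ, eq_div_iff (pow_ne_zero 2 hdΨ'), ← hode,
      hchain]
    ring
  have hH0 : H ≠ 0 := by
    rintro h; rw [h, map_zero] at hHρ; exact mul_ne_zero hf (pow_ne_zero 2 hdρ) hHρ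
  have hreg : ∀ ξ, OGe ξ 0 H := by
    intro ξ
    obtain ⟨x, hx⟩ := exists_od_sub_pos hρd ξ
    have h1 : OGe x 0 (cubicR A B * dR ρ ^ 2) := by
      have h2 : OGe x 0 (dR ρ) := (oGe_of_sub hx).dR_zero
      have := (show OGe x 0 (cubicR A B) from Or.inr (od_cubicR_nonneg x)).mul (h2.mul h2)
      rw [← sq] at this; exact this
    rw [hHρ] at h1
    have h2 := h1.le ((_root_.map_ne_zero _).2 hH0)
    rw [od_subsR hρ hx] at h2
    right; by_contra! h3; nlinarith
  obtain ⟨h, hh⟩ := exists_poly_of_oGe hreg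
  have hh0 : h ≠ 0 := by rintro rfl; rw [map_zero] at hh; exact hH0 hh
  refine ⟨h, by rw [hHρ, hh, subsR_poly], ?_, ?_⟩
  · have h1 := congrArg RatFunc.intDegree hHρ
    rw [RatFunc.intDegree_mul hf (pow_ne_zero 2 hdρ), intDegree_cubicR, intDegree_pow hdρ, hdρ0,
      intDegree_subsR hρd, hdeg.1, hh, RatFunc.intDegree_polynomial] at h1
    omega
  · intro ξ hdvd
    obtain ⟨x, hx⟩ := exists_od_sub_pos hρd ξ
    have he := ramification_factor_le hρ hμ hΨ hc hode x ξ hx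
    have h2 : (2 : k) ≠ 0 := EC.two A B
    have h1 := od_subsR hρ hx H
    have hdρ1 := od_dR (x := x) (u := ρ - ak ξ) (by
      have : od x (ρ - ak ξ) = 1 ∨ od x (ρ - ak ξ) = 2 := by omega
      rcases this with h | h <;> rw [h]
      · simp
      · exact_mod_cast h2)
    rw [dR_sub, dR_const, sub_zero] at hdρ1
    rw [← hHρ, od_mul x hf (pow_ne_zero 2 hdρ), od_pow x hdρ, hdρ1.2, hh] at h1
    have h3 := (od_dvd hh0 (n := 2)).2 hdvd
    have h4 := od_cubicR_le (A := A) (B := B) x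
    push_cast at h1 h3
    nlinarith

end Normal

section Normal

variable {k : Type} [Field k] [IsAlgClosed k]

local notation "r" => algebraMap k[X] (RatFunc k)
local notation "ak" => algebraMap k (RatFunc k)

/-- Over an algebraically closed field a cubic without double roots can be brought to one of the
shapes `X³ - 3X + B₀` and `X³ + 1` by an affine substitution. -/
lemma exists_normal_cubic (h2 : (2 : k) ≠ 0) (h3 : (3 : k) ≠ 0) {h : k[X]} (hd : h.natDegree = 3)
    (hs : ∀ ξ, ¬ (X - C ξ) ^ 2 ∣ h) :
    ∃ t s A₀ B₀ l : k, t ≠ 0 ∧ l ≠ 0 ∧ EC A₀ B₀ ∧ (A₀ = -3 ∨ A₀ = 0 ∧ B₀ = 1) ∧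
      ∀ (L : Type) [Field L] [Algebra k L] (z : L),
        aeval (algebraMap k L t * z + algebraMap k L s) h =
          algebraMap k L t ^ 2 * algebraMap k L l * (z ^ 3 + algebraMap k L A₀ * z +
            algebraMap k L B₀) := by
  obtain ⟨a, b, c, e, ha, rfl⟩ : ∃ a b c e : k, a ≠ 0 ∧
      h = C a * X ^ 3 + C b * X ^ 2 + C c * X + C e := by
    refine ⟨h.coeff 3, h.coeff 2, h.coeff 1, h.coeff 0, ?_, ?_⟩
    · rw [← hd]; exact leadingCoeff_ne_zero.2 (by rintro rfl; simp at hd)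
    · conv_lhs => rw [h.as_sum_range_C_mul_X_pow, hd]
      simp only [Finset.sum_range_succ, Finset.sum_range_zero]
      ring
  clear hd
  obtain ⟨s, hs'⟩ : ∃ s, s = -b / (3 * a) := ⟨_, rfl⟩
  have hs1 : b = -3 * a * s := by rw [hs']; field_simp
  obtain ⟨A₁, hA₁⟩ : ∃ A₁, A₁ = (3 * a * s ^ 2 + 2 * b * s + c) / a := ⟨_, rfl⟩
  obtain ⟨B₁, hB₁⟩ : ∃ B₁, B₁ = (a * s ^ 3 + b * s ^ 2 + c * s + e) / a := ⟨_, rfl⟩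
  have hc : c = a * A₁ - 3 * a * s ^ 2 - 2 * b * s := by rw [hA₁]; field_simp; ring
  have he : e = a * B₁ - a * s ^ 3 - b * s ^ 2 - c * s := by rw [hB₁]; field_simp; ring
  have key : ∀ (L : Type) [Field L] [Algebra k L] (z : L) (t : k), 
      aeval (algebraMap k L t * z + algebraMap k L s)
        (C a * X ^ 3 + C b * X ^ 2 + C c * X + C e) = algebraMap k L a * 
        ((algebraMap k L t * z) ^ 3 + algebraMap k L A₁ * (algebraMap k L t * z) +
          algebraMap k L B₁) := by
    intro L _ _ z t
    simp only [map_add, map_mul, map_pow, aeval_C, aeval_X]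
    rw [he, hc, hs1]
    simp only [map_add, map_sub, map_mul, map_pow, map_neg, map_ofNat]
    ring
  have sqfree : ∀ A₀ B₀ t : k, t ≠ 0 → A₁ = t ^ 2 * A₀ → B₁ = t ^ 3 * B₀ → A₀ = -3 →
      4 * A₀ ^ 3 + 27 * B₀ ^ 2 ≠ 0 := by
    intro A₀ B₀ t ht e1 e2 e3 h0
    have h1 : (2 * (B₀ - 2)) * (2 * (B₀ + 2)) * 27 = 0 := by
      rw [e3] at h0; linear_combination 4 * h0
    have h27 : (27 : k) ≠ 0 := by
      have : (27 : k) = 3 ^ 3 := by norm_num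
      rw [this]; exact pow_ne_zero 3 h3
    have h4 : B₀ = 2 ∨ B₀ = -2 := by
      rcases mul_eq_zero.1 ((mul_eq_zero.1 h1).resolve_right h27) with h | h
      · left; exact sub_eq_zero.1 ((mul_eq_zero.1 h).resolve_left h2)
      · right; exact eq_neg_of_add_eq_zero_left ((mul_eq_zero.1 h).resolve_left h2)
    have : ∃ w : k, w ^ 2 = t ^ 2 ∧ B₁ = 2 * w ^ 3 := by
      rcases h4 with h | h
      · exact ⟨t, rfl, by rw [e2, h]; ring⟩
      · exact ⟨-t, by ring, by rw [e2, h]; ring⟩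
    obtain ⟨w, hw, hB⟩ := this
    refine hs (w + s) ⟨C a * (X - C s + C (2 * w)), ?_⟩
    rw [he, hc, hs1, hB, e1, e3, ← hw]
    simp only [map_add, map_sub, map_mul, map_pow, map_neg, map_ofNat]
    ring
  by_cases hA0 : A₁ = 0
  · have hB0 : B₁ ≠ 0 := by
      rintro hB0
      refine hs s ⟨C a * (X - C s), ?_⟩
      rw [he, hc, hs1, hB0, hA0]
      simp only [map_add, map_sub, map_mul, map_pow, map_neg, map_ofNat, map_zero]
      ring
    obtain ⟨t, ht⟩ := IsAlgClosed.exists_pow_nat_eq B₁ (n := 3) (by norm_num)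
    have ht0 : t ≠ 0 := by rintro rfl; apply hB0; rw [← ht]; ring
    refine ⟨t, s, 0, 1, a * t, ht0, mul_ne_zero ha ht0, ⟨h2, h3, ?_⟩, Or.inr ⟨rfl, rfl⟩, ?_⟩
    · have : (4 * 0 ^ 3 + 27 * 1 ^ 2 : k) = 3 ^ 3 := by norm_num
      rw [this]; exact pow_ne_zero 3 h3
    · intro L _ _ z
      rw [key, hA0, ← ht]
      simp only [map_mul, map_pow, map_zero, map_one]
      ring
  · obtain ⟨t, ht⟩ := IsAlgClosed.exists_pow_nat_eq (-A₁ / 3) (n := 2) (by norm_num)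
    have ht0 : t ≠ 0 := by
      rintro rfl; apply hA0
      rw [eq_div_iff h3] at ht
      linear_combination ht
    have e1 : A₁ = t ^ 2 * (-3) := by rw [ht]; field_simp
    have e2 : B₁ = t ^ 3 * (B₁ / t ^ 3) := by field_simp
    refine ⟨t, s, -3, B₁ / t ^ 3, a * t, ht0, mul_ne_zero ha ht0,
      ⟨h2, h3, sqfree _ _ t ht0 e1 e2 rfl⟩, Or.inl rfl, ?_⟩
    intro L _ _ z
    rw [key, e1]
    have e3 : algebraMap k L B₁ = algebraMap k L t ^ 3 * algebraMap k L (B₁ / t ^ 3) := by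
      rw [← map_pow, ← map_mul, ← e2]
    rw [e3]
    simp only [map_mul, map_pow]
    ring

/-- The normal form of the data attached to a curve with small endomorphisms: `ρ` is a generator
of the field generated by the abscissae, and `R` describes an endomorphism of the quotient. -/
structure IsNormal (A B A₀ B₀ : k) [EC A B] [EC A₀ B₀] (d : ℤ) (N : ℕ) (μ ρ Ψ R : RatFunc k)
    (l : k) : Prop where
  l_ne : l ≠ 0
  N_ne : (N : k) ≠ 0
  pt : ∃ s h, (N : ℤ) • gen A B = opt μ s h
  deg_ρ : ρ.intDegree = 1
  ode_ρ : cubicR A B * dR ρ ^ 2 = ak l * (ρ ^ 3 + ak A₀ * ρ + ak B₀)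
  comp : ∀ hρ, subsR ρ hρ Ψ = μ
  deg_Ψ : Ψ.intDegree = 1
  ode_Ψ : ak l * (cubicR A₀ B₀ * dR Ψ ^ 2) = ak (N : k) ^ 2 * (Ψ ^ 3 + ak A * Ψ + ak B)
  deg_R : R.intDegree = 1
  rd_R : rd R = d.natAbs
  ode_R : cubicR A₀ B₀ * dR R ^ 2 = ak (d : k) * (R ^ 3 + ak A₀ * R + ak B₀)

lemma exists_isNormal {A B : k} [EC A B] {d : ℤ} {N : ℕ} {κ : k} {μ γ δ : RatFunc k}
    (h : IsCM A B d N κ μ γ δ) (hd : (d : k) ≠ 0) :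
    ∃ (A₀ B₀ : k) (_ : EC A₀ B₀) (ρ Ψ R : RatFunc k) (l : k),
      (A₀ = -3 ∨ A₀ = 0 ∧ B₀ = 1) ∧ IsNormal A B A₀ B₀ d N μ ρ Ψ R l := by
  have hμ := transcendental_of_intDegree h.pos_μ
  have hγ := transcendental_of_intDegree h.pos_γ
  have hN2 : (N : k) ^ 2 ≠ 0 := pow_ne_zero 2 h.N_ne
  have hodeμ := h.ode_μ
  rw [← map_pow] at hodeμ
  obtain ⟨ρ₀, hρ₀d, hadj⟩ := exists_generator (γ := γ) hμ
  have hρ₀ := transcendental_of_intDegree hρ₀d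
  have hμmem : μ ∈ IntermediateField.adjoin k {μ, γ} :=
    IntermediateField.subset_adjoin _ _ (by simp)
  have hγmem : γ ∈ IntermediateField.adjoin k {μ, γ} :=
    IntermediateField.subset_adjoin _ _ (by simp)
  obtain ⟨Ψ₀, hΨ₀⟩ := (mem_adjoin_iff_subsR hρ₀ μ).1 (hadj ▸ hμmem)
  obtain ⟨hρ₀1, p, hp, hpd, hps⟩ := exists_cubic_ode hρ₀d hρ₀ h.pos_μ hΨ₀.symm hN2 hodeμ
  obtain ⟨t, s, A₀, B₀, l, ht, hl, hE, hAB, hsub⟩ :=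
    exists_normal_cubic (EC.two A B) (EC.three A B) hpd hps
  have ht' : ak t ≠ 0 := (_root_.map_ne_zero _).2 ht
  obtain ⟨ρ, hρdef⟩ : ∃ ρ, ρ = (ρ₀ - ak s) / ak t := ⟨_, rfl⟩
  have hρ₀ρ : ρ₀ = ak t * ρ + ak s := by rw [hρdef]; field_simp; ring
  have hodeρ : cubicR A B * dR ρ ^ 2 = ak l * (ρ ^ 3 + ak A₀ * ρ + ak B₀) := by
    rw [hρ₀ρ, hsub, dR_add, dR_const_mul, dR_const, add_zero] at hp
    apply mul_left_cancel₀ (pow_ne_zero 2 ht')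
    linear_combination hp
  have hdeg : ρ.intDegree = 1 := by
    have h0 : ρ₀ ≠ 0 := by rintro rfl; simp at hρ₀d
    obtain ⟨h1, h2⟩ := intDegree_add_of_lt h0 (v := ak (-s)) ((dLe_const _).mono (by omega))
    rw [map_neg, ← sub_eq_add_neg, hρ₀1] at h2
    rw [map_neg, ← sub_eq_add_neg] at h1
    have h3 := RatFunc.intDegree_mul (div_ne_zero h1 ht') ht'
    rw [div_mul_cancel₀ _ ht', h2, intDegree_const, ← hρdef] at h3
    omega
  have hρd : 0 < ρ.intDegree := by omega
  have hρ := transcendental_of_intDegree hρd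
  have hadj' : IntermediateField.adjoin k {μ, γ} = IntermediateField.adjoin k {ρ} := by
    rw [hadj]
    apply le_antisymm
    · rw [IntermediateField.adjoin_simple_le_iff, hρ₀ρ]
      exact add_mem (mul_mem (IntermediateField.algebraMap_mem _ t)
        (IntermediateField.mem_adjoin_simple_self k ρ)) (IntermediateField.algebraMap_mem _ s)
    · rw [IntermediateField.adjoin_simple_le_iff, hρdef]
      exact div_mem (sub_mem (IntermediateField.mem_adjoin_simple_self k ρ₀)
        (IntermediateField.algebraMap_mem _ s)) (IntermediateField.algebraMap_mem _ t)
  obtain ⟨Ψ, hΨ⟩ := (mem_adjoin_iff_subsR hρ μ).1 (hadj' ▸ hμmem)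
  have hμ1 := (intDegree_eq_one hN2 hodeμ h.pos_μ).1
  have hdμ := (intDegree_eq_one hN2 hodeμ h.pos_μ).2.1
  have hκ : κ ≠ 0 := by
    rintro hκ
    have := h.sq_κ
    rw [hκ] at this
    exact mul_ne_zero hd hN2 (by rw [← this]; ring)
  have hdρ := (intDegree_eq_one hl hodeρ hρd).2.1
  -- the endomorphism on the quotient
  obtain ⟨R, hR⟩ : ∃ R, subsR γ hγ ρ = subsR μ hμ (subsR ρ hρ R) := by
    have h1 : ρ ∈ IntermediateField.adjoin k {μ, γ} := by
      rw [hadj']; exact IntermediateField.mem_adjoin_simple_self k ρ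
    have h2 : subsR γ hγ ρ ∈ (IntermediateField.adjoin k {μ, γ}).map (subsR γ hγ) :=
      ⟨ρ, h1, rfl⟩
    have h3 : (IntermediateField.adjoin k {μ, γ}).map (subsR γ hγ) ≤
        (IntermediateField.adjoin k {μ, γ}).map (subsR μ hμ) := by
      rw [IntermediateField.adjoin_map, IntermediateField.adjoin_le_iff]
      rintro _ ⟨x, hx, rfl⟩
      rcases hx with hx | hx <;> rw [hx]
      · exact ⟨γ, hγmem, (h.comm hμ hγ).symm⟩
      · refine ⟨subsR μ hμ δ, ?_, (h.sq hμ hγ).symm⟩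
        exact IntermediateField.adjoin.mono k {μ} {μ, γ} (by simp)
          ((mem_adjoin_iff_subsR hμ _).2 ⟨δ, rfl⟩)
    obtain ⟨y, hy, hy'⟩ := h3 h2
    obtain ⟨R, rfl⟩ := (mem_adjoin_iff_subsR hρ y).1 (hadj' ▸ hy)
    exact ⟨R, hy'.symm⟩
  have hγd := h.pos_γ
  have hRdeg : 0 < R.intDegree := by
    have h1 := congrArg RatFunc.intDegree hR
    rw [intDegree_subsR h.pos_γ, intDegree_subsR h.pos_μ, intDegree_subsR hρd, hdeg, hμ1] at h1
    omega
  have hRt := transcendental_of_intDegree hRdeg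
  have hRrd : rd R = d.natAbs := by
    have h1 := congrArg rd hR
    rw [rd_comp, rd_comp, rd_comp, h.rd_μ, h.rd_γ] at h1
    have h2 := rd_ne_zero hρ
    have h3 : N ≠ 0 := by rintro rfl; exact h.N_ne (by simp)
    have h4 : 0 < rd ρ * N ^ 2 := by positivity
    nlinarith
  have hinj : Function.Injective (fun u => subsR μ hμ (subsR ρ hρ u)) :=
    (subsR μ hμ).injective.comp (subsR ρ hρ).injective
  have hodeR : cubicR A₀ B₀ * dR R ^ 2 = ak (d : k) * (R ^ 3 + ak A₀ * R + ak B₀) := by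
    have e0 : ak ((N : k) ^ 2) * ak l ≠ 0 := 
      mul_ne_zero ((_root_.map_ne_zero _).2 hN2) ((_root_.map_ne_zero _).2 hl)
    apply hinj
    simp only [map_mul, map_add, map_pow, AlgHom.commutes]
    rw [subsR_cubic, map_add, map_add, map_mul, map_pow, AlgHom.commutes, AlgHom.commutes, ← hR]
    have f1 : dR (subsR γ hγ ρ) =
        subsR μ hμ (subsR ρ hρ (dR R)) * subsR μ hμ (dR ρ) * dR μ := by
      rw [hR, dR_subsR, dR_subsR, map_mul]
    rw [dR_subsR] at f1
    have f2 := congrArg (subsR γ hγ) hodeρ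
    have f3 := congrArg (subsR μ hμ) hodeρ
    simp only [map_mul, map_add, map_pow, AlgHom.commutes, subsR_cubic] at f2 f3
    have f4 := h.ode_γ
    have f5 := hodeμ
    have f6 : ak κ ^ 2 = ak (d : k) * ak ((N : k) ^ 2) := by
      rw [← map_pow, h.sq_κ, map_mul]
    apply mul_left_cancel₀ e0
    obtain ⟨Y, hY⟩ : ∃ Y, Y = subsR γ hγ ρ := ⟨_, rfl⟩
    obtain ⟨Z, hZ⟩ : ∃ Z, Z = subsR μ hμ (subsR ρ hρ (dR R)) := ⟨_, rfl⟩
    obtain ⟨V, hV⟩ : ∃ V, V = subsR μ hμ (dR ρ) := ⟨_, rfl⟩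
    obtain ⟨W, hW⟩ : ∃ W, W = subsR γ hγ (dR ρ) := ⟨_, rfl⟩
    rw [← hY, ← hZ]
    rw [← hW, ← hZ, ← hV] at f1
    rw [← hW, ← hY] at f2
    rw [← hV] at f3
    linear_combination (-Z ^ 2 * ak ((N : k) ^ 2)) * f3 - Z ^ 2 * V ^ 2 * f5
      - cubicR A B * (W * dR γ + Z * V * dR μ) * f1 + W ^ 2 * f4
      + ak κ ^ 2 * f2 + ak l * (Y ^ 3 + ak A₀ * Y + ak B₀) * f6
  have hΨd : Ψ.intDegree = 1 := by
    have h1 := intDegree_subsR hρd hρ Ψ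
    rw [← hΨ, hμ1, hdeg] at h1
    omega
  refine ⟨A₀, B₀, hE, ρ, Ψ, R, l, hAB, ⟨hl, h.N_ne, h.pt, hdeg, hodeρ, fun _ => hΨ.symm, hΨd, ?_,
    (intDegree_eq_one hd hodeR hRdeg).1, hRrd, hodeR⟩⟩
  refine (subsR ρ hρ).injective (?_ : subsR ρ hρ _ = subsR ρ hρ _)
  simp only [map_mul, map_add, map_pow, AlgHom.commutes, subsR_cubic]
  rw [← hΨ]
  have f1 : dR μ = subsR ρ hρ (dR Ψ) * dR ρ := by
    rw [← dR_subsR, ← hΨ]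
  have f2 := h.ode_μ
  rw [f1] at f2
  obtain ⟨V, hV⟩ : ∃ V, V = subsR ρ hρ (dR Ψ) := ⟨_, rfl⟩
  rw [← hV] at f2 ⊢
  linear_combination f2 - V ^ 2 * hodeρ

end Normal

section Truncated

variable {S : Type} [CommRing S]

/-- The differential operator satisfied by the expansion at infinity of an endomorphism of
`Y² = X³ - 3X + B`. -/
def ode (d B : S) (a : S[X]) : S[X] :=
  X * derivative a ^ 2 * (1 - 3 * X ^ 2 + C B * X ^ 3) - C d * (a - 3 * a ^ 3 + C B * a ^ 4)

lemma ode_add (d B c : S) (α β : S[X]) (i : ℕ) :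
    X ^ (i + 3) ∣ ode d B (X * (C d + X * α) + X ^ (i + 2) * (C c + X * β)) -
      ode d B (X * (C d + X * α)) - C (d * (2 * i + 3) * c) * X ^ (i + 2) := by
  obtain ⟨a, ha⟩ : ∃ a, a = X * (C d + X * α) := ⟨_, rfl⟩
  obtain ⟨e, he⟩ : ∃ e, e = (C c + X * β) * X ^ i := ⟨_, rfl⟩
  obtain ⟨η, hη⟩ : ∃ η, η = X ^ (i + 2) * (C c + X * β) := ⟨_, rfl⟩
  have hηe : η = X ^ 2 * e := by rw [hη, he]; ring
  have da : derivative a = C d + X * (2 * α + X * derivative α) := by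
    rw [ha]; simp; ring
  obtain ⟨a₁, ha₁⟩ : ∃ a₁, a₁ = 2 * α + X * derivative α := ⟨_, rfl⟩
  rw [← ha₁] at da
  have dη : derivative η = X ^ (i + 1) * (C (((i + 2 : ℕ) : S) * c) + X * (((i + 3 : ℕ) : S[X]) * β +
      X * derivative β)) := by
    rw [hη]
    simp [derivative_X_pow]
    rw [show (C (2 : S)) = 2 from map_ofNat C 2]
    ring
  obtain ⟨e₁, he₁⟩ : ∃ e₁, e₁ = ((i + 3 : ℕ) : S[X]) * β + X * derivative β := ⟨_, rfl⟩
  rw [← he₁] at dη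
  obtain ⟨q, hq⟩ : ∃ q : S[X], q = C (((i + 2 : ℕ) : S) * c) := ⟨_, rfl⟩
  rw [← hq] at dη
  obtain ⟨U, hU⟩ : ∃ U : S[X], U = -3 * X + C B * X ^ 2 := ⟨_, rfl⟩
  have hU' : (1 - 3 * X ^ 2 + C B * X ^ 3 : S[X]) = 1 + X * U := by rw [hU]; ring
  have hconst : C (d * (2 * i + 3) * c) = 2 * C d * q - C d * C c := by
    rw [hq]; simp only [map_mul, map_add, map_ofNat, map_natCast, Nat.cast_add, Nat.cast_ofNat]
    ring
  rw [← ha, ← hη, hconst]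
  unfold ode
  rw [hU', derivative_add, da, dη]
  have ha2 : a = X * (C d + X * α) := ha
  obtain ⟨b, hb⟩ : ∃ b, b = C d + X * α := ⟨_, rfl⟩
  rw [← hb] at ha2
  obtain ⟨m, hm⟩ : ∃ m, m = C c + X * β := ⟨_, rfl⟩
  rw [← hm] at hη he
  obtain ⟨p, hp⟩ : ∃ p, p = 2 * a₁ + X ^ i * (q + X * e₁) := ⟨_, rfl⟩
  refine ⟨p * (q + X * e₁) * (1 + X * U) + 2 * C d * e₁ * (1 + X * U) + 2 * C d * q * U
    - C d * (β - m * (3 * (3 * X * b ^ 2 + 3 * b * η + X * e * η)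
      - C B * (4 * X ^ 2 * b ^ 3 + 6 * X * b ^ 2 * η + 4 * b * η ^ 2 + X * e * η ^ 2))), ?_⟩
  have hη3 : η = X * (X * e) := by rw [hηe]; ring
  have e1 : (X * (C d + X * a₁ + X ^ (i + 1) * (q + X * e₁)) ^ 2 * (1 + X * U)
      - X * (C d + X * a₁) ^ 2 * (1 + X * U) - 2 * C d * q * X ^ (i + 2)) =
      X ^ (i + 3) * (p * (q + X * e₁) * (1 + X * U) + 2 * C d * e₁ * (1 + X * U)
        + 2 * C d * q * U) := by
    rw [hp]; ring
  have e2 : (a + η - 3 * (a + η) ^ 3 + C B * (a + η) ^ 4) - (a - 3 * a ^ 3 + C B * a ^ 4)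
      - C c * X ^ (i + 2) = X ^ (i + 3) * (β - m * (3 * (3 * X * b ^ 2 + 3 * b * η + X * e * η)
      - C B * (4 * X ^ 2 * b ^ 3 + 6 * X * b ^ 2 * η + 4 * b * η ^ 2 + X * e * η ^ 2))) := by
    have e3 : (a + η - 3 * (a + η) ^ 3 + C B * (a + η) ^ 4) - (a - 3 * a ^ 3 + C B * a ^ 4) =
        η - η * X * (3 * (3 * X * b ^ 2 + 3 * b * η + X * e * η)
      - C B * (4 * X ^ 2 * b ^ 3 + 6 * X * b ^ 2 * η + 4 * b * η ^ 2 + X * e * η ^ 2)) := by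
      rw [ha2]
      linear_combination (-3 * η ^ 2 + C B * η ^ 3) * hη3
    rw [e3]
    generalize (3 * (3 * X * b ^ 2 + 3 * b * η + X * e * η)
      - C B * (4 * X ^ 2 * b ^ 3 + 6 * X * b ^ 2 * η + 4 * b * η ^ 2 + X * e * η ^ 2)) = W
    rw [hη, hm]; ring
  linear_combination e1 - C d * e2

lemma ode_initial (d B : S) : X ^ 2 ∣ ode d B (X * C d) := by
  refine ⟨C d ^ 2 * X * (-3 + C B * X) - C d * (-3 * X * C d ^ 3 + C B * X ^ 2 * C d ^ 4), ?_⟩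
  unfold ode
  simp only [derivative_mul, derivative_X, derivative_C, one_mul, mul_zero, add_zero]
  ring

/-- Two solutions of the truncated equation with the same linear term agree. -/
lemma ode_unique [IsDomain S] {d B : S} (hd : d ≠ 0) {L : ℕ}
    (hL : ∀ i < L, (2 * (i : S) + 3) ≠ 0) {b b' : S[X]} (hb : X ∣ b - C d) (hb' : X ∣ b' - C d)
    (h : X ^ (L + 2) ∣ ode d B (X * b)) (h' : X ^ (L + 2) ∣ ode d B (X * b')) :
    X ^ (L + 1) ∣ b' - b := by
  suffices ∀ i ≤ L, X ^ (i + 1) ∣ b' - b from this L le_rfl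
  intro i
  induction i with
  | zero => intro _; rw [zero_add, pow_one]; have := dvd_sub hb' hb; simpa using this
  | succ i ih =>
    intro hi
    obtain ⟨v, hv⟩ := ih (by omega)
    obtain ⟨α, hα⟩ := hb
    obtain ⟨β, hβ⟩ : X ∣ v - C (v.coeff 0) := by
      rw [X_dvd_iff]; simp
    obtain ⟨c, hc⟩ : ∃ c, c = v.coeff 0 := ⟨_, rfl⟩
    rw [← hc] at hβ
    have e1 : b = C d + X * α := by rw [← hα]; ring
    have e2 : X * b' = X * (C d + X * α) + X ^ (i + 2) * (C c + X * β) := by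
      rw [← hβ, ← e1]
      linear_combination X * hv
    have key := ode_add d B c α β i
    rw [← e2, ← e1] at key
    have h1 : X ^ (i + 3) ∣ C (d * (2 * i + 3) * c) * X ^ (i + 2) := by
      have h2 := dvd_sub (dvd_sub ((pow_dvd_pow X (by omega)).trans h')
        ((pow_dvd_pow X (by omega)).trans h)) key
      rwa [sub_sub_cancel] at h2
    have h3 : d * (2 * i + 3) * c = 0 := by
      have := (X_pow_dvd_iff.1 h1) (i + 2) (by omega)
      rwa [coeff_C_mul, coeff_X_pow_self, mul_one] at this
    have h4 : c = 0 := (mul_eq_zero.1 h3).resolve_left (mul_ne_zero hd (hL i (by omega)))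
    rw [h4, map_zero, sub_zero] at hβ
    exact ⟨β, by rw [hv, hβ]; ring⟩

end Truncated

section Fil

variable {k : Type} [Field k]

/-- Polynomials whose coefficient of index `j` has degree at most `j`. -/
def Fil (a : k[X][X]) : Prop := ∀ j, (a.coeff j).natDegree ≤ j

lemma Fil.add {a b : k[X][X]} (ha : Fil a) (hb : Fil b) : Fil (a + b) := fun j => by
  rw [coeff_add]; exact natDegree_add_le_of_degree_le (ha j) (hb j)

lemma Fil.neg {a : k[X][X]} (ha : Fil a) : Fil (-a) := fun j => by
  rw [coeff_neg, natDegree_neg]; exact ha j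

lemma Fil.sub {a b : k[X][X]} (ha : Fil a) (hb : Fil b) : Fil (a - b) :=
  sub_eq_add_neg a b ▸ ha.add hb.neg

lemma Fil.mul {a b : k[X][X]} (ha : Fil a) (hb : Fil b) : Fil (a * b) := fun j => by
  rw [coeff_mul]
  refine natDegree_sum_le_of_forall_le _ _ fun x hx => ?_
  have := mem_antidiagonal.1 hx
  exact natDegree_mul_le.trans ((add_le_add (ha _) (hb _)).trans this.le)

lemma Fil.C {c : k} : Fil (C (C c)) := fun j => by
  rw [coeff_C]; split_ifs <;> simp

lemma Fil.one : Fil (1 : k[X][X]) := Fil.C (c := 1)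

lemma Fil.ofNat (n : ℕ) : Fil (n : k[X][X]) := by
  have := Fil.C (c := (n : k)); simpa using this

lemma Fil.pow {a : k[X][X]} (ha : Fil a) (n : ℕ) : Fil (a ^ n) := by
  induction n with
  | zero => rw [pow_zero]; exact Fil.one
  | succ n ih => rw [pow_succ]; exact ih.mul ha

lemma Fil.monomial {c : k[X]} {n : ℕ} (h : c.natDegree ≤ n) :
    Fil (Polynomial.C c * X ^ n) := fun j => by
  rw [coeff_C_mul_X_pow]; split_ifs with hj
  · rw [hj]; exact h
  · simp

lemma Fil.X : Fil (X : k[X][X]) := by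
  have := Fil.monomial (k := k) (c := 1) (n := 1) (by simp); simpa using this

lemma Fil.derivative {b : k[X][X]} (hb : Fil b) : Fil (derivative (Polynomial.X * b)) :=
  fun j => by
    rw [coeff_derivative, coeff_X_mul, ← Nat.cast_one, ← Nat.cast_add, ← map_natCast Polynomial.C]
    exact (natDegree_mul_C_le _ _).trans (hb j)

/-- The generic solution of the truncated equation. -/
lemma exists_ode_generic {d : k} (hd : d ≠ 0) (L : ℕ) (hL : ∀ i < L, (2 * (i : k) + 3) ≠ 0) :
    ∃ b : k[X][X], X ∣ b - C (C d) ∧ Fil b ∧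
      X ^ (L + 2) ∣ ode (C d) (2 + X) (X * b) := by
  induction L with
  | zero => exact ⟨C (C d), by simp, Fil.C, ode_initial _ _⟩
  | succ L ih =>
    obtain ⟨b, hb, hF, h⟩ := ih fun i hi => hL i (by omega)
    obtain ⟨α, hα⟩ := hb
    have e1 : b = C (C d) + X * α := by rw [← hα]; ring
    obtain ⟨v, hv⟩ := h
    obtain ⟨l, hl⟩ : ∃ l : k, l = d * (2 * L + 3) := ⟨_, rfl⟩
    have hl0 : l ≠ 0 := hl ▸ mul_ne_zero hd (hL L (by omega))
    have hdeg : (v.coeff 0).natDegree ≤ L + 1 := by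
      obtain ⟨W, hW, hWF⟩ : ∃ W, ode (C d) (2 + X) (X * b) = X * W ∧ Fil W := by
        refine ⟨derivative (X * b) ^ 2 * (1 - ((3 : ℕ) : k[X][X]) * X ^ 2 + C (2 + X) * X ^ 3) -
          C (C d) * (b * (1 - ((3 : ℕ) : k[X][X]) * (X * b) ^ 2 + C (2 + X) * X ^ 3 * b ^ 3)),
          ?_, ?_⟩
        · unfold ode; push_cast; ring
        · have hB : Fil (C (2 + X) * X ^ 3 : k[X][X]) := Fil.monomial (by
            refine (natDegree_add_le _ _).trans ?_
            rw [natDegree_X]; norm_num)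
          exact ((hF.derivative.pow 2).mul ((Fil.one.sub ((Fil.ofNat 3).mul (Fil.X.pow 2))).add
            hB)).sub (Fil.C.mul (hF.mul ((Fil.one.sub ((Fil.ofNat 3).mul
              ((Fil.X.mul hF).pow 2))).add (hB.mul (hF.pow 3)))))
      have h1 := congrArg (fun P => coeff P (L + 2)) (hW.symm.trans hv)
      simp only [coeff_X_mul] at h1
      rw [coeff_X_pow_mul', if_pos le_rfl, Nat.sub_self] at h1
      rw [← h1]; exact hWF _
    refine ⟨b + C (-C l⁻¹ * v.coeff 0) * X ^ (L + 1), ?_, ?_, ?_⟩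
    · refine ⟨α + C (-C l⁻¹ * v.coeff 0) * X ^ L, ?_⟩
      rw [e1]; ring
    · refine hF.add (Fil.monomial ?_)
      rw [← C_neg]
      exact (natDegree_C_mul_le _ _).trans hdeg
    · have key := ode_add (C d) (2 + X) (-C l⁻¹ * v.coeff 0) α 0 L
      rw [← e1, mul_zero, add_zero] at key
      have e2 : X * (b + C (-C l⁻¹ * v.coeff 0) * X ^ (L + 1)) =
          X * b + X ^ (L + 2) * C (-C l⁻¹ * v.coeff 0) := by ring
      rw [e2]
      obtain ⟨w, hw⟩ := key
      obtain ⟨z, hz⟩ : X ∣ v - C (v.coeff 0) := by rw [X_dvd_iff]; simp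
      refine ⟨w + z, ?_⟩
      have e3 : C d * (2 * (L : k[X]) + 3) * (-C l⁻¹ * v.coeff 0) = -v.coeff 0 := by
        have : C d * (2 * (L : k[X]) + 3) = C l := by
          rw [hl]; simp only [map_mul, map_add, map_ofNat, map_natCast]
        rw [this]
        have h5 : C l * C l⁻¹ = (1 : k[X]) := by rw [← C_mul, mul_inv_cancel₀ hl0, C_1]
        linear_combination (-v.coeff 0) * h5
      rw [e3, map_neg] at hw
      linear_combination hw + hv + X ^ (L + 2) * hz

end Fil

section Homogeneous

variable {S : Type} [CommRing S]

/-- The homogeneous form of `ode`. -/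
def hode (d B : S) (p q : S[X]) : S[X] :=
  X * (derivative p * q - p * derivative q) ^ 2 * (1 - 3 * X ^ 2 + C B * X ^ 3) -
    C d * (p * q ^ 3 - 3 * p ^ 3 * q + C B * p ^ 4)

lemma hode_sub (d B : S) {p q a : S[X]} {L : ℕ} (h : X ^ (L + 1) ∣ p - q * a) :
    X ^ (L + 1) ∣ hode d B p q - q ^ 4 * ode d B a := by
  obtain ⟨w, hw⟩ := h
  have hp : p = q * a + X ^ (L + 1) * w := by rw [← hw]; ring
  have hdp : derivative p = derivative q * a + q * derivative a +
      X ^ L * (((L + 1 : ℕ) : S[X]) * w + X * derivative w) := by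
    rw [hp]
    simp [derivative_X_pow]
    ring
  obtain ⟨v, hv⟩ : ∃ v : S[X], v = ((L + 1 : ℕ) : S[X]) * w + X * derivative w := ⟨_, rfl⟩
  rw [← hv] at hdp
  obtain ⟨y, hy⟩ : ∃ y : S[X], y = v * q - X * w * derivative q := ⟨_, rfl⟩
  have e1 : derivative p * q - p * derivative q = q ^ 2 * derivative a + X ^ L * y := by
    rw [hdp, hp, hy]; ring
  obtain ⟨c, hc⟩ : ∃ c : S[X], c = q * a := ⟨_, rfl⟩
  obtain ⟨η, hη⟩ : ∃ η : S[X], η = X ^ (L + 1) * w := ⟨_, rfl⟩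
  have e2 : p * q ^ 3 - 3 * p ^ 3 * q + C B * p ^ 4 - q ^ 4 * (a - 3 * a ^ 3 + C B * a ^ 4) =
      X ^ (L + 1) * w * (q ^ 3 - 3 * (3 * c ^ 2 + 3 * c * η + η ^ 2) * q +
        C B * (4 * c ^ 3 + 6 * c ^ 2 * η + 4 * c * η ^ 2 + η ^ 3)) := by
    have : p = c + η := by rw [hp, hc, hη]
    rw [this, ← hη, hc]; ring
  unfold hode ode
  rw [e1]
  refine ⟨(2 * q ^ 2 * derivative a * y + X ^ L * y ^ 2) * (1 - 3 * X ^ 2 + C B * X ^ 3) -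
    C d * (w * (q ^ 3 - 3 * (3 * c ^ 2 + 3 * c * η + η ^ 2) * q +
        C B * (4 * c ^ 3 + 6 * c ^ 2 * η + 4 * c * η ^ 2 + η ^ 3))), ?_⟩
  linear_combination (-C d) * e2

lemma map_ode {T : Type} [CommRing T] (φ : S →+* T) (d B : S) (a : S[X]) :
    (ode d B a).map φ = ode (φ d) (φ B) (a.map φ) := by
  unfold ode
  simp [Polynomial.derivative_map]

lemma natDegree_hode_le (d B : S) {p q : S[X]} {n : ℕ} (hp : p.natDegree ≤ n)
    (hq : q.natDegree ≤ n) : (hode d B p q).natDegree ≤ 4 * n + 4 := by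
  have hp' : (derivative p).natDegree ≤ n := (natDegree_derivative_le p).trans (by omega)
  have hq' : (derivative q).natDegree ≤ n := (natDegree_derivative_le q).trans (by omega)
  have hW : (derivative p * q - p * derivative q).natDegree ≤ 2 * n :=
    (natDegree_sub_le_of_le (natDegree_mul_le_of_le hp' hq) (natDegree_mul_le_of_le hp hq')).trans
      (by simp; omega)
  have hV : (1 - 3 * X ^ 2 + C B * X ^ 3 : S[X]).natDegree ≤ 3 := by compute_degree
  unfold hode
  refine (natDegree_sub_le_of_le (m := 4 * n + 4) (n := 4 * n + 4) ?_ ?_).trans (by simp)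
  · have := natDegree_mul_le_of_le (natDegree_mul_le_of_le (natDegree_X_le (R := S))
      (natDegree_pow_le_of_le 2 hW)) hV
    exact this.trans (by omega)
  · refine (natDegree_C_mul_le _ _).trans ?_
    refine (natDegree_add_le_of_degree_le (n := 4 * n) (natDegree_sub_le_of_le (m := 4 * n)
      (n := 4 * n) ?_ ?_ |>.trans (by simp)) ?_).trans (by omega)
    · exact (natDegree_mul_le_of_le hp (natDegree_pow_le_of_le 3 hq)).trans (by omega)
    · have h3 : (3 * p ^ 3 : S[X]).natDegree ≤ 3 * n := by
        have := natDegree_mul_le_of_le (p := (3 : S[X])) (m := 0) (natDegree_ofNat 3).le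
          (natDegree_pow_le_of_le 3 hp)
        exact this.trans (by omega)
      exact (natDegree_mul_le_of_le h3 hq).trans (by omega)
    · exact (natDegree_C_mul_le _ _).trans (natDegree_pow_le_of_le 4 hp)

end Homogeneous

section Determinant

variable {k : Type} [Field k]

/-- The set of parameters for which a Hankel-type system has a nonzero solution is the zero set
of a polynomial of bounded degree, as soon as `0` is not such a parameter. -/
lemma exists_det (n N : ℕ) (a : k[X][X]) (hdeg : ∀ i ≤ n + N, (a.coeff i).natDegree ≤ n + N)
    (h0 : ∀ q : k[X], q.natDegree ≤ n → (∀ i < N, (q * a.map (evalRingHom 0)).coeff (n + 1 + i) = 0)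
      → q = 0) :
    ∃ D : k[X], D ≠ 0 ∧ D.natDegree ≤ (n + 1) * (n + N) ∧ ∀ s : k, ∀ q : k[X], q ≠ 0 →
      q.natDegree ≤ n → (∀ i < N, (q * a.map (evalRingHom s)).coeff (n + 1 + i) = 0) →
      D.eval s = 0 := by
  obtain ⟨M, hM⟩ : ∃ M : Matrix (Fin N) (Fin (n + 1)) k[X],
    M = Matrix.of fun (i : Fin N) (j : Fin (n + 1)) => a.coeff (n + 1 + (i : ℕ) - (j : ℕ)) := ⟨_, rfl⟩
  have hMs : ∀ (s : k) (q : Fin (n + 1) → k) (i : Fin N),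
      (M.map (evalRingHom s)).mulVec q i =
        ((∑ j : Fin (n + 1), C (q j) * X ^ (j : ℕ)) * a.map (evalRingHom s)).coeff (n + 1 + i) := by
    intro s q i
    rw [Finset.sum_mul, finsetSum_coeff, Matrix.mulVec, dotProduct]
    refine Finset.sum_congr rfl fun j _ => ?_
    rw [mul_assoc, coeff_C_mul, coeff_X_pow_mul', if_pos (by omega), coeff_map, hM, mul_comm]
    rfl
  have hcoef : ∀ (q : Fin (n + 1) → k) (j : Fin (n + 1)),
      (∑ j : Fin (n + 1), C (q j) * X ^ (j : ℕ)).coeff j = q j := by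
    intro q j
    rw [finsetSum_coeff, Finset.sum_eq_single j]
    · rw [coeff_C_mul_X_pow, if_pos rfl]
    · intro b _ hb
      rw [coeff_C_mul_X_pow, if_neg]
      exact fun h => hb (Fin.ext h.symm)
    · simp
  have hnd : ∀ q : Fin (n + 1) → k,
      (∑ j : Fin (n + 1), C (q j) * X ^ (j : ℕ)).natDegree ≤ n := fun q =>
    natDegree_sum_le_of_forall_le _ _ fun j _ => (natDegree_C_mul_X_pow_le _ _).trans (by omega)
  have hinj : LinearMap.ker (Matrix.toLin' (M.map (evalRingHom (0 : k)))) = ⊥ := by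
    rw [LinearMap.ker_eq_bot']
    intro q hq
    have := h0 _ (hnd q) fun i hi => by
      rw [← hMs 0 q ⟨i, hi⟩]
      rw [Matrix.toLin'_apply] at hq
      rw [hq]; rfl
    funext j
    rw [← hcoef q j, this]; rfl
  obtain ⟨l, hl⟩ := LinearMap.exists_leftInverse_of_injective _ hinj
  obtain ⟨Λ, hΛ⟩ : ∃ Λ, Λ = LinearMap.toMatrix' l := ⟨_, rfl⟩
  have hΛM : Λ * M.map (evalRingHom (0 : k)) = 1 := by
    have := congrArg LinearMap.toMatrix' hl
    rwa [LinearMap.toMatrix'_comp, LinearMap.toMatrix'_toLin', LinearMap.toMatrix'_id, ← hΛ] at this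
  have hDs : ∀ s : k, (Λ.map C * M).det.eval s = (Λ * M.map (evalRingHom s)).det := by
    intro s
    rw [← coe_evalRingHom, RingHom.map_det]
    congr 1
    rw [RingHom.mapMatrix_apply, Matrix.map_mul]
    congr 1
    ext i j; simp
  refine ⟨(Λ.map C * M).det, ?_, ?_, ?_⟩
  · intro h
    have := hDs 0
    rw [h, hΛM] at this
    simp at this
  · rw [Matrix.det_apply]
    refine natDegree_sum_le_of_forall_le _ _ fun σ _ => ?_
    have h1 : (∏ i, (Λ.map C * M) (σ i) i).natDegree ≤ (n + 1) * (n + N) := by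
      refine (natDegree_prod_le _ _).trans ?_
      refine (Finset.sum_le_card_nsmul _ _ (n + N) fun i _ => ?_).trans (by simp)
      rw [Matrix.mul_apply]
      refine natDegree_sum_le_of_forall_le _ _ fun j _ => ?_
      rw [Matrix.map_apply]
      refine (natDegree_C_mul_le _ _).trans ?_
      rw [hM, Matrix.of_apply]
      exact hdeg _ (by omega)
    rcases Int.units_eq_one_or (Equiv.Perm.sign σ) with h | h <;> rw [h] <;> simpa using h1
  · intro s q hq hqn h
    rw [hDs]
    refine Matrix.exists_mulVec_eq_zero_iff.1 ⟨fun j => q.coeff j, ?_, ?_⟩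
    · intro hz
      apply hq
      ext i
      by_cases hi : i < n + 1
      · exact congrFun hz ⟨i, hi⟩
      · rw [coeff_eq_zero_of_natDegree_lt (by omega), coeff_zero]
    · have hq' : (∑ j : Fin (n + 1), C (q.coeff j) * X ^ (j : ℕ)) = q := by
        rw [Fin.sum_univ_eq_sum_range (fun j => C (q.coeff j) * X ^ j) (n + 1)]
        exact (as_sum_range_C_mul_X_pow' q (by omega)).symm
      rw [← Matrix.mulVec_mulVec]
      have : (M.map (evalRingHom s)).mulVec (fun j => q.coeff j) = 0 := by
        funext i
        rw [hMs, hq', h _ i.2]; rfl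
      rw [this, Matrix.mulVec_zero]

end Determinant

section Value

variable {k : Type} [Field k]

local notation "r" => algebraMap k[X] (RatFunc k)
local notation "ak" => algebraMap k (RatFunc k)

/-- `u` is regular at `x` with value `c`. -/
def Val (x : k) (u : RatFunc k) (c : k) : Prop := OGe x 1 (u - ak c)

lemma Val.oGe {x c : k} {u : RatFunc k} (h : Val x u c) : OGe x 0 u := by
  have := (OGe.mono h (zero_le_one)).add (oGe_const x c)
  rwa [sub_add_cancel] at this

lemma val_const (x c : k) : Val x (ak c) c := Or.inl (sub_self _)

lemma val_X (x : k) : Val x RatFunc.X x := Or.inr (od_X_sub x).ge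

lemma Val.add {x c c' : k} {u u' : RatFunc k} (h : Val x u c) (h' : Val x u' c') :
    Val x (u + u') (c + c') := by
  have := OGe.add h h'
  unfold Val
  rwa [map_add, add_sub_add_comm]

lemma Val.mul {x c c' : k} {u u' : RatFunc k} (h : Val x u c) (h' : Val x u' c') :
    Val x (u * u') (c * c') := by
  have h1 := h.oGe.mul (show OGe x 1 _ from h')
  have h2 := OGe.const_mul (show OGe x 1 _ from h) c'
  rw [zero_add] at h1
  have := h1.add h2
  unfold Val
  rw [map_mul]
  convert this using 1
  ring

lemma Val.pow {x c : k} {u : RatFunc k} (h : Val x u c) (n : ℕ) : Val x (u ^ n) (c ^ n) := by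
  induction n with
  | zero => simpa using val_const x (1 : k)
  | succ n ih => rw [pow_succ, pow_succ]; exact ih.mul h

lemma Val.unique {x c c' : k} {u : RatFunc k} (h : Val x u c) (h' : Val x u c') : c = c' := by
  have := OGe.sub h' h
  rw [sub_sub_sub_cancel_left, ← map_sub] at this
  rcases this with h0 | h0
  · have := (algebraMap k (RatFunc k)).injective (h0.trans (map_zero _).symm)
    exact sub_eq_zero.1 this
  · rw [od_const] at h0; omega

lemma val_zero_of_oGe {x : k} {u : RatFunc k} (h : OGe x 1 u) : Val x u 0 := by
  unfold Val; rwa [map_zero, sub_zero]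

lemma exists_val {x : k} {u : RatFunc k} (h : OGe x 0 u) : ∃ c, Val x u c := by
  by_cases hu : u = 0
  · exact ⟨0, Or.inl (by rw [hu, map_zero, sub_zero])⟩
  have hd : u.denom.eval x ≠ 0 := fun h0 => by
    have := od_of_pole hu h0
    have := h.le hu
    omega
  obtain ⟨c, hc⟩ : ∃ c, c = u.num.eval x / u.denom.eval x := ⟨_, rfl⟩
  refine ⟨c, ?_⟩
  have hd' : r u.denom ≠ 0 := algebraMap_poly_ne_zero (RatFunc.denom_ne_zero u)
  have e : u - ak c = r (u.num - C c * u.denom) / r u.denom := by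
    have : ak c = r (C c) := rfl
    rw [eq_div_iff hd', sub_mul, map_sub, map_mul, this]
    congr 1
    nth_rewrite 1 [← RatFunc.num_div_denom u]
    exact div_mul_cancel₀ _ hd'
  unfold Val
  rw [e]
  by_cases h0 : u.num - C c * u.denom = 0
  · left; rw [h0, map_zero, zero_div]
  · right
    rw [od_div x h0 (RatFunc.denom_ne_zero u), rootMultiplicity_eq_zero (p := u.denom) hd]
    have : 0 < rootMultiplicity x (u.num - C c * u.denom) := by
      rw [rootMultiplicity_pos h0, IsRoot, eval_sub, eval_mul, eval_C, hc, div_mul_cancel₀ _ hd,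
        sub_self]
    simp only [Nat.cast_zero, sub_zero]; omega

lemma no_degenerate_endomorphism {δ : k} (hδ : δ ≠ 0) (h2 : (2 : k) ≠ 0) (h3 : (3 : k) ≠ 0)
    {u : RatFunc k} (hu : ∀ c, u ≠ ak c) {n : ℤ} (hn : ∀ c, od 1 (u - ak c) ≤ n)
    (hδn : ∀ e : ℤ, 0 < e → e ≤ n → (e : k) ^ 2 ≠ δ)
    (h : RatFunc.X * dR u ^ 2 * ((1 - RatFunc.X) ^ 2 * (1 + 2 * RatFunc.X)) =
      ak δ * (u * (1 - u) ^ 2 * (1 + 2 * u))) : False := by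
  have hδ' : ak δ ≠ 0 := (_root_.map_ne_zero ak).2 hδ
  have hX := val_X (1 : k)
  have hX1 : OGe 1 0 (RatFunc.X * (1 + 2 * RatFunc.X) : RatFunc k) := by
    have := (hX.mul ((val_const 1 (1 : k)).add ((val_const 1 (2 : k)).mul hX))).oGe
    rwa [map_one, map_ofNat] at this
  have h20 : (2 : RatFunc k) ≠ 0 := by
    have := (_root_.map_ne_zero ak).2 h2; rwa [map_ofNat] at this
  have hu0 : u ≠ 0 := by have := hu 0; rwa [map_zero] at this
  by_cases hneg : od 1 u < 0
  · obtain ⟨v, hv, e⟩ := dR_mul_X_sub 1 hu0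
    rw [map_one] at e
    have e1 : RatFunc.X * (1 + 2 * RatFunc.X) * (u * (ak (od 1 u : k) + v)) ^ 2 =
        ak δ * (u * (1 - u) ^ 2 * (1 + 2 * u)) := by
      rw [← h, ← e]; ring
    have h2u : 2 * u ≠ 0 := mul_ne_zero h20 hu0
    have o2 : od 1 (2 * u) = od 1 u := by
      rw [od_mul 1 h20 hu0, show (2 : RatFunc k) = ak 2 from (map_ofNat ak 2).symm, od_const,
        zero_add]
    have o1 : od 1 (-u) = od 1 u := by
      have := od_mul 1 (neg_ne_zero.2 one_ne_zero : (-1 : RatFunc k) ≠ 0) hu0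
      rwa [neg_one_mul, show (-1 : RatFunc k) = ak (-1) by rw [map_neg, map_one], od_const,
        zero_add] at this
    have hone : OGe 1 0 (1 : RatFunc k) := by have := oGe_const (1 : k) 1; rwa [map_one] at this
    obtain ⟨n1, d1⟩ := od_add_of_lt (neg_ne_zero.2 hu0) (hone.mono (by omega : od 1 (-u) + 1 ≤ 0))
    obtain ⟨n2, d2⟩ := od_add_of_lt h2u (hone.mono (by omega : od 1 (2 * u) + 1 ≤ 0))
    rw [neg_add_eq_sub] at n1 d1
    rw [add_comm] at n2 d2
    have hR : ak δ * (u * (1 - u) ^ 2 * (1 + 2 * u)) ≠ 0 :=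
      mul_ne_zero hδ' (mul_ne_zero (mul_ne_zero hu0 (pow_ne_zero 2 n1)) n2)
    have oR : od 1 (ak δ * (u * (1 - u) ^ 2 * (1 + 2 * u))) = 4 * od 1 u := by
      rw [od_mul 1 hδ' (mul_ne_zero (mul_ne_zero hu0 (pow_ne_zero 2 n1)) n2), od_const,
        od_mul 1 (mul_ne_zero hu0 (pow_ne_zero 2 n1)) n2, od_mul 1 hu0 (pow_ne_zero 2 n1),
        od_pow 1 n1, d1, d2, o1, o2]
      push_cast; ring
    have hev : OGe 1 (od 1 u) (u * (ak (od 1 u : k) + v)) := by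
      have := (oGe_od 1 u).mul ((oGe_const 1 (od 1 u : k)).add (hv.mono zero_le_one))
      rwa [add_zero] at this
    have hL := hX1.mul (hev.mul hev)
    rw [← sq, e1] at hL
    have := hL.le hR
    omega
  · obtain ⟨c, hc⟩ := exists_val (show OGe 1 0 u from Or.inr (by omega))
    obtain ⟨w, hw⟩ : ∃ w, w = u - ak c := ⟨_, rfl⟩
    have hw0 : w ≠ 0 := hw ▸ sub_ne_zero.2 (hu c)
    obtain ⟨v, hv, e⟩ := dR_mul_X_sub 1 hw0
    have hdw : dR w = dR u := by rw [hw, dR_sub, dR_const, sub_zero]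
    rw [map_one, hdw] at e
    have hwp : 1 ≤ od 1 w := by rw [hw]; exact OGe.le hc (hw ▸ hw0)
    have hwn : od 1 w ≤ n := hw ▸ hn c
    have e1 : RatFunc.X * (1 + 2 * RatFunc.X) * (w * (ak (od 1 w : k) + v)) ^ 2 =
        ak δ * (u * (1 - u) ^ 2 * (1 + 2 * u)) := by
      rw [← h, ← e]; ring
    have hvw : Val 1 w 0 := val_zero_of_oGe (Or.inr hwp)
    have hvv : Val 1 (ak (od 1 w : k) + v) (od 1 w : k) := by
      have := (val_const 1 (od 1 w : k)).add (val_zero_of_oGe hv); rwa [add_zero] at this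
    have hvX : Val 1 (RatFunc.X * (1 + 2 * RatFunc.X)) (3 : k) := by
      have := hX.mul ((val_const 1 (1 : k)).add ((val_const 1 (2 : k)).mul hX))
      rw [map_one, map_ofNat] at this
      convert this using 1
      norm_num
    have hv1 : Val 1 (1 - u) (1 - c) := by
      have := (val_const 1 (1 : k)).add ((val_const 1 (-1 : k)).mul hc)
      rw [map_neg, map_one] at this
      convert this using 1 <;> ring
    have hv2 : Val 1 (1 + 2 * u) (1 + 2 * c) := by
      have := (val_const 1 (1 : k)).add ((val_const 1 (2 : k)).mul hc)
      rwa [map_one, map_ofNat] at this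
    by_cases c1 : c = 1
    · have e2 : RatFunc.X * (1 + 2 * RatFunc.X) * (ak (od 1 w : k) + v) ^ 2 =
          ak δ * (u * (1 + 2 * u)) := by
        apply mul_left_cancel₀ (pow_ne_zero 2 hw0)
        have : 1 - u = -w := by rw [hw, c1, map_one]; ring
        rw [this] at e1
        linear_combination e1
      have l := hvX.mul (hvv.pow 2)
      rw [e2] at l
      have := l.unique ((val_const 1 δ).mul (hc.mul hv2))
      rw [c1] at this
      have h4 : (3 : k) * ((od 1 w : k) ^ 2 - δ) = 0 := by linear_combination this
      exact hδn _ (by omega) hwn (sub_eq_zero.1 ((mul_eq_zero.1 h4).resolve_left h3))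
    by_cases c2 : c = 0
    · have hwu : w = u := by rw [hw, c2, map_zero, sub_zero]
      have e2 : RatFunc.X * (1 + 2 * RatFunc.X) * (w * (ak (od 1 w : k) + v) ^ 2) =
          ak δ * ((1 - u) ^ 2 * (1 + 2 * u)) := by
        apply mul_left_cancel₀ hw0
        linear_combination e1 - ak δ * (1 - u) ^ 2 * (1 + 2 * u) * hwu
      have l := hvX.mul (hvw.mul (hvv.pow 2))
      rw [e2] at l
      have := l.unique ((val_const 1 δ).mul ((hv1.pow 2).mul hv2))
      rw [c2] at this
      apply hδ
      linear_combination -this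
    by_cases c3 : 1 + 2 * c = 0
    · have hwu : 1 + 2 * u = 2 * w := by
        have : 1 + 2 * ak c = 0 := by
          have := congrArg ak c3
          rwa [map_add, map_mul, map_one, map_ofNat, map_zero] at this
        rw [hw]; linear_combination this
      have e2 : RatFunc.X * (1 + 2 * RatFunc.X) * (w * (ak (od 1 w : k) + v) ^ 2) =
          ak δ * (u * (1 - u) ^ 2 * ak 2) := by
        apply mul_left_cancel₀ hw0
        rw [hwu] at e1
        rw [map_ofNat]
        linear_combination e1
      have l := hvX.mul (hvw.mul (hvv.pow 2))
      rw [e2] at l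
      have := l.unique ((val_const 1 δ).mul ((hc.mul (hv1.pow 2)).mul (val_const 1 2)))
      have h5 : δ * (c * (1 - c) ^ 2 * 2) ≠ 0 := mul_ne_zero hδ (mul_ne_zero (mul_ne_zero c2
        (pow_ne_zero 2 (sub_ne_zero.2 (Ne.symm c1)))) h2)
      exact h5 (by linear_combination -this)
    · have l := hvX.mul ((hvw.mul hvv).pow 2)
      rw [e1] at l
      have := l.unique ((val_const 1 δ).mul ((hc.mul (hv1.pow 2)).mul hv2))
      have h5 : δ * (c * (1 - c) ^ 2 * (1 + 2 * c)) ≠ 0 := mul_ne_zero hδ (mul_ne_zero (mul_ne_zero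
        c2 (pow_ne_zero 2 (sub_ne_zero.2 (Ne.symm c1)))) c3)
      exact h5 (by linear_combination -this)

end Value

section Bound

variable {k : Type} [Field k]

local notation "r" => algebraMap k[X] (RatFunc k)
local notation "ak" => algebraMap k (RatFunc k)

lemma hode_two_ne_zero {δ : k} (hδ : δ ≠ 0) (h2 : (2 : k) ≠ 0) (h3 : (3 : k) ≠ 0) {n : ℕ}
    (hδn : ∀ e : ℤ, 0 < e → e ≤ n → (e : k) ^ 2 ≠ δ) {p q : k[X]} (hp : p.natDegree ≤ n)
    (hq : q.natDegree ≤ n) (hq0 : q ≠ 0) (hpq : ∀ c, p ≠ C c * q) : hode δ 2 p q ≠ 0 := by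
  intro h
  have hq' : r q ≠ 0 := algebraMap_poly_ne_zero hq0
  have key : ∀ c, r p / r q - ak c = r (p - C c * q) / r q := by
    intro c
    have : ak c = r (C c) := rfl
    rw [this, map_sub, map_mul, sub_div, mul_div_cancel_right₀ _ hq']
  refine no_degenerate_endomorphism hδ h2 h3 (u := r p / r q) (n := n) ?_ ?_ hδn ?_
  · intro c hc
    apply hpq c
    rw [← sub_eq_zero, key, div_eq_zero_iff, or_iff_left hq'] at hc
    have := RatFunc.algebraMap_injective k (hc.trans (map_zero _).symm)
    exact sub_eq_zero.1 this
  · intro c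
    rw [key, od_div 1 (sub_ne_zero.2 (hpq c)) hq0]
    have h1 := natDegree_le_of_dvd (pow_rootMultiplicity_dvd (p - C c * q) 1)
      (sub_ne_zero.2 (hpq c))
    rw [natDegree_pow, natDegree_X_sub_C, mul_one] at h1
    have h4 : (p - C c * q).natDegree ≤ n := by
      refine (natDegree_sub_le_of_le hp ((natDegree_C_mul_le _ _).trans hq)).trans (by simp)
    omega
  · have h' := congrArg r h
    unfold hode at h'
    rw [map_zero] at h'
    simp only [map_sub, map_add, map_mul, map_pow, map_ofNat, map_one, RatFunc.algebraMap_X] at h'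
    have hC : r (C δ) = ak δ := rfl
    rw [hC] at h'
    rw [dR_div p hq0]
    field_simp
    linear_combination h'

end Bound

section Bound

variable {k : Type} [Field k]

local notation "r" => algebraMap k[X] (RatFunc k)
local notation "ak" => algebraMap k (RatFunc k)

lemma aeval_ratFunc_X (a : k[X]) : aeval (RatFunc.X : RatFunc k) a = r a := by
  rw [← RatFunc.algebraMap_X, aeval_algebraMap_apply, aeval_X_left_apply]

lemma aeval_inv_X (a : k[X]) :
    aeval (RatFunc.X⁻¹ : RatFunc k) a = r a.reverse * (RatFunc.X : RatFunc k)⁻¹ ^ a.natDegree := by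
  have hX : (RatFunc.X : RatFunc k)⁻¹ ≠ 0 := inv_ne_zero RatFunc.X_ne_zero
  let _ := invertibleOfNonzero hX
  have := eval₂_reverse_mul_pow ak (RatFunc.X : RatFunc k)⁻¹ a
  rw [invOf_eq_inv, inv_inv] at this
  rw [aeval_def, ← this, ← aeval_def, aeval_ratFunc_X]

lemma transcendental_inv_X : Transcendental k (RatFunc.X⁻¹ : RatFunc k) := fun h =>
  transcendental_X (by simpa using h.inv)

lemma dR_inv_X : dR (RatFunc.X⁻¹ : RatFunc k) = -(RatFunc.X⁻¹) ^ 2 := by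
  have h := dR_div (1 : k[X]) (X_ne_zero (R := k))
  rw [RatFunc.algebraMap_X, map_one, one_div] at h
  rw [h]
  simp [div_eq_mul_inv]

/-- Expansion at infinity of a solution of the differential equation of an endomorphism. -/
lemma exists_hode {δ B : k} {n : ℕ} {R : RatFunc k} (h1 : R.intDegree = 1) (hn : rd R = n)
    (h : cubicR (-3) B * dR R ^ 2 = ak δ * (R ^ 3 + ak (-3) * R + ak B)) :
    ∃ p q : k[X], (X * p).natDegree ≤ n ∧ q.natDegree ≤ n ∧ p.coeff 0 ≠ 0 ∧ q.coeff 0 ≠ 0 ∧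
      hode δ B (X * p) q = 0 := by
  have hR0 : R ≠ 0 := by rintro rfl; simp at h1
  obtain ⟨P, hP⟩ : ∃ P, P = R.num := ⟨_, rfl⟩
  obtain ⟨Q, hQ⟩ : ∃ Q, Q = R.denom := ⟨_, rfl⟩
  have hP0 : P ≠ 0 := hP ▸ RatFunc.num_ne_zero hR0
  have hQ0 : Q ≠ 0 := hQ ▸ RatFunc.denom_ne_zero R
  have hRe : R = r P / r Q := by rw [hP, hQ, RatFunc.num_div_denom]
  have hdeg : P.natDegree = Q.natDegree + 1 := by
    rw [hRe, intDegree_div hP0 hQ0] at h1; omega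
  have hPn : P.natDegree = n := by
    have : max P.natDegree Q.natDegree = n := by rw [← hn, hP, hQ]; rfl
    omega
  obtain ⟨p, hp⟩ : ∃ p, p = Q.reverse := ⟨_, rfl⟩
  obtain ⟨q, hq⟩ : ∃ q, q = P.reverse := ⟨_, rfl⟩
  have hpc : p.coeff 0 ≠ 0 := by rw [hp, coeff_zero_reverse]; exact leadingCoeff_ne_zero.2 hQ0
  have hqc : q.coeff 0 ≠ 0 := by rw [hq, coeff_zero_reverse]; exact leadingCoeff_ne_zero.2 hP0
  have hpn : (X * p).natDegree ≤ n := by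
    refine natDegree_mul_le.trans ?_
    rw [natDegree_X, hp]
    have := reverse_natDegree_le Q
    omega
  have hqn : q.natDegree ≤ n := by rw [hq]; exact (reverse_natDegree_le P).trans hPn.le
  refine ⟨p, q, hpn, hqn, hpc, hqc, ?_⟩
  have hp0 : p ≠ 0 := by rintro rfl; simp at hpc
  have hXp0 : X * p ≠ 0 := mul_ne_zero X_ne_zero hp0
  have hX0 := RatFunc.X_ne_zero (K := k)
  have hR' : subsR (RatFunc.X⁻¹) transcendental_inv_X R = r q / r (X * p) := by
    rw [hRe, map_div₀, subsR_poly, subsR_poly, aeval_inv_X, aeval_inv_X, ← hp, ← hq, map_mul,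
      RatFunc.algebraMap_X, hdeg, pow_succ]
    have := algebraMap_poly_ne_zero hp0
    field_simp
  have h' := congrArg (subsR (RatFunc.X⁻¹) transcendental_inv_X) h
  have hd := dR_subsR (transcendental_inv_X (k := k)) R
  rw [hR', dR_inv_X, dR_div q hXp0] at hd
  rw [map_mul, map_mul, subsR_cubic, map_add, map_add, map_mul, map_pow, map_pow, AlgHom.commutes,
    AlgHom.commutes, AlgHom.commutes, hR'] at h'
  have hd' : subsR (RatFunc.X⁻¹) transcendental_inv_X (dR R) =
      -RatFunc.X ^ 2 * ((r (derivative q) * r (X * p) - r q * r (derivative (X * p))) /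
        r (X * p) ^ 2) := by
    rw [hd]; field_simp
  rw [hd'] at h'
  have hXp := algebraMap_poly_ne_zero hXp0
  obtain ⟨s, hs⟩ : ∃ s, s = X * p := ⟨_, rfl⟩
  rw [← hs] at h' hXp ⊢
  apply RatFunc.algebraMap_injective k
  unfold hode
  rw [map_zero]
  simp only [map_sub, map_add, map_mul, map_pow, map_ofNat, map_one, RatFunc.algebraMap_X]
  have hCδ : r (C δ) = ak δ := rfl
  have hCB : r (C B) = ak B := rfl
  rw [hCδ, hCB]
  rw [map_neg, map_ofNat] at h'
  have hclear := h'
  field_simp at hclear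
  linear_combination hclear

/-- The first coefficients of a solution agree with those of the generic solution. -/
lemma exists_trunc {δ B : k} (hδ : δ ≠ 0) {L : ℕ} (hL : ∀ i < L, (2 * (i : k) + 3) ≠ 0) {b : k[X]}
    (hb : X ∣ b - C δ) (hode_b : X ^ (L + 2) ∣ ode δ B (X * b)) {p q : k[X]} (hp : p.coeff 0 ≠ 0)
    (hq : q.coeff 0 ≠ 0) (h : hode δ B (X * p) q = 0) : X ^ (L + 2) ∣ X * p - q * (X * b) := by
  have hcop : IsCoprime q (X ^ (L + 2)) := by
    refine IsCoprime.pow_right ?_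
    refine ((irreducible_X.coprime_iff_not_dvd).2 ?_).symm
    rw [X_dvd_iff]; exact hq
  obtain ⟨u, w, huw⟩ := hcop
  have e1 : X * p - q * (X * (u * p)) = X ^ (L + 2) * (w * X * p) := by
    linear_combination (-X * p) * huw
  have h1 := hode_sub δ B (L := L + 1) ⟨_, e1⟩
  rw [h, zero_sub, dvd_neg] at h1
  have h2 : X ^ (L + 2) ∣ ode δ B (X * (u * p)) :=
    IsCoprime.dvd_of_dvd_mul_left (IsCoprime.symm (IsCoprime.pow_left ⟨u, w, huw⟩)) h1
  have hu0 : u.coeff 0 * q.coeff 0 = 1 := by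
    have := congrArg (fun P => coeff P 0) huw
    simpa using this
  have hb'0 : (u * p).coeff 0 ≠ 0 := by
    rw [mul_coeff_zero]
    exact mul_ne_zero (left_ne_zero_of_mul_eq_one hu0) hp
  have hb' : X ∣ u * p - C δ := by
    rw [X_dvd_iff, coeff_sub, coeff_C_zero]
    have h3 : X ^ 2 ∣ ode δ B (X * (u * p)) := (pow_dvd_pow X (by omega)).trans h2
    have h4 := X_pow_dvd_iff.1 h3 1 (by norm_num)
    obtain ⟨b', hb'⟩ : ∃ b', b' = u * p := ⟨_, rfl⟩
    rw [← hb'] at h4 hb'0 ⊢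
    have h5 : ode δ B (X * b') = X * ((b' + X * derivative b') ^ 2 *
        (1 - 3 * X ^ 2 + C B * X ^ 3) - C δ * (b' - 3 * X ^ 2 * b' ^ 3 + C B * X ^ 3 * b' ^ 4)) := by
      unfold ode
      rw [derivative_mul, derivative_X]; ring
    rw [h5, coeff_X_mul] at h4
    simp [coeff_zero_eq_eval_zero] at h4
    rw [coeff_zero_eq_eval_zero] at hb'0 ⊢
    have h6 : b'.eval 0 * (b'.eval 0 - δ) = 0 := by linear_combination h4
    exact (mul_eq_zero.1 h6).resolve_left hb'0
  obtain ⟨z, hz⟩ := ode_unique hδ hL hb hb' hode_b h2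
  exact ⟨w * X * p + q * z, by linear_combination e1 + q * X * hz⟩

/-- There is a bounded number of curves `Y² = X³ - 3X + B` with an endomorphism of degree `n` and
derivative `√δ`. -/
lemma exists_bound {δ : k} (hδ : δ ≠ 0) (h2 : (2 : k) ≠ 0) (h3 : (3 : k) ≠ 0) (n : ℕ)
    (hL : ∀ i < 5 * n + 10, (2 * (i : k) + 3) ≠ 0)
    (hδn : ∀ e : ℤ, 0 < e → e ≤ n → (e : k) ^ 2 ≠ δ) :
    ∃ D : k[X], D ≠ 0 ∧ D.natDegree ≤ (n + 1) * (5 * n + 12) ∧ ∀ s : k, ∀ R : RatFunc k,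
      R.intDegree = 1 → rd R = n →
      cubicR (-3) (2 + s) * dR R ^ 2 = ak δ * (R ^ 3 + ak (-3) * R + ak (2 + s)) →
      D.eval s = 0 := by
  obtain ⟨b, hb, hF, hodeb⟩ := exists_ode_generic hδ (5 * n + 10) hL
  obtain ⟨L, hLe⟩ : ∃ L, L = 5 * n + 10 := ⟨_, rfl⟩
  rw [← hLe] at hL hodeb
  have hbs : ∀ s, X ∣ b.map (evalRingHom s) - C δ ∧
      X ^ (L + 2) ∣ ode δ (2 + s) (X * b.map (evalRingHom s)) := by
    intro s
    constructor
    · have := Polynomial.map_dvd (evalRingHom s) hb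
      simpa using this
    · have := Polynomial.map_dvd (evalRingHom s) hodeb
      rw [map_ode] at this
      simpa using this
  have hdeg : ∀ i ≤ n + (4 * n + 10), ((X * b).coeff i).natDegree ≤ n + (4 * n + 10) := by
    intro i hi
    exact ((Fil.X.mul hF) i).trans hi
  have h0 : ∀ q : k[X], q.natDegree ≤ n →
      (∀ i < 4 * n + 10, (q * (X * b).map (evalRingHom 0)).coeff (n + 1 + i) = 0) → q = 0 := by
    intro q hq hc
    by_contra hq0
    obtain ⟨hb1, hb2⟩ := hbs 0
    rw [add_zero] at hb2
    rw [Polynomial.map_mul, map_X] at hc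
    obtain ⟨a, ha⟩ : ∃ a, a = X * b.map (evalRingHom 0) := ⟨_, rfl⟩
    rw [← ha] at hc hb2
    obtain ⟨p, hp⟩ : ∃ p : k[X], p = ∑ i ∈ range (n + 1), C ((q * a).coeff i) * X ^ i := ⟨_, rfl⟩
    have hpc : ∀ i, p.coeff i = if i < n + 1 then (q * a).coeff i else 0 := by
      intro i
      rw [hp, finsetSum_coeff]
      simp only [coeff_C_mul_X_pow]
      rw [Finset.sum_ite_eq]
      simp
    have hpn : p.natDegree ≤ n := by
      rw [natDegree_le_iff_coeff_eq_zero]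
      intro i hi
      rw [hpc, if_neg (by omega)]
    have hdvd : X ^ (5 * n + 11) ∣ p - q * a := by
      rw [X_pow_dvd_iff]
      intro i hi
      rw [coeff_sub, hpc]
      split_ifs with h
      · rw [sub_self]
      · have := hc (i - (n + 1)) (by omega)
        rw [show n + 1 + (i - (n + 1)) = i by omega] at this
        rw [this, sub_zero]
    refine hode_two_ne_zero hδ h2 h3 hδn hpn hq hq0 ?_ ?_
    · intro c hpq
      obtain ⟨j, hj⟩ : ∃ j, j = rootMultiplicity 0 q := ⟨_, rfl⟩
      obtain ⟨q₁, hq₁, hq₁0⟩ := exists_eq_pow_rootMultiplicity_mul_and_not_dvd q hq0 0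
      rw [← hj, C_0, sub_zero] at hq₁
      rw [C_0, sub_zero, X_dvd_iff] at hq₁0
      have hjn : j ≤ n := by
        have := natDegree_le_of_dvd (Dvd.intro _ hq₁.symm) hq0
        rw [natDegree_X_pow] at this
        exact this.trans hq
      have h5 : X ^ (2 + j) ∣ X ^ j * (C c * q₁ - q₁ * a) := by
        refine (pow_dvd_pow X (by omega)).trans (hdvd.trans (dvd_of_eq ?_))
        rw [hpq, hq₁]; ring
      rw [pow_add, mul_comm] at h5
      have h6 := (mul_dvd_mul_iff_left (pow_ne_zero j X_ne_zero)).1 h5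
      have h7 := X_pow_dvd_iff.1 h6 0 (by norm_num)
      have h8 := X_pow_dvd_iff.1 h6 1 (by norm_num)
      rw [coeff_sub, coeff_C_mul, mul_coeff_zero, ha, mul_coeff_zero, coeff_X_zero, zero_mul,
        mul_zero, sub_zero] at h7
      have hc0 : c = 0 := (mul_eq_zero.1 h7).resolve_right hq₁0
      rw [hc0, C_0, zero_mul, zero_sub, coeff_neg, ha, mul_left_comm, coeff_X_mul,
        mul_coeff_zero, neg_eq_zero] at h8
      rw [X_dvd_iff, coeff_sub, coeff_C_zero, sub_eq_zero] at hb1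
      rw [hb1] at h8
      exact mul_ne_zero hq₁0 hδ h8
    · by_contra hne
      have h5 := hode_sub δ 2 (L := 5 * n + 10) hdvd
      have h6 : X ^ (5 * n + 10 + 1) ∣ hode δ 2 p q := by
        have := dvd_add h5 (((pow_dvd_pow X (by omega)).trans hb2).mul_left (q ^ 4))
        rwa [sub_add_cancel] at this
      have h7 := natDegree_le_of_dvd h6 hne
      rw [natDegree_X_pow] at h7
      have := natDegree_hode_le δ 2 hpn hq
      omega
  obtain ⟨D, hD0, hDn, hD⟩ := exists_det n (4 * n + 10) (X * b) hdeg h0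
  refine ⟨D, hD0, hDn.trans (Nat.mul_le_mul_left _ (by omega)), fun s R h1 hn h => ?_⟩
  obtain ⟨p, q, hpn, hqn, hp, hq, hh⟩ := exists_hode h1 hn h
  obtain ⟨hb1, hb2⟩ := hbs s
  have h5 := exists_trunc hδ hL hb1 hb2 hp hq hh
  refine hD s q (by rintro rfl; simp at hq) hqn fun i hi => ?_
  rw [Polynomial.map_mul, map_X]
  have h6 := X_pow_dvd_iff.1 h5 (n + 1 + i) (by omega)
  rw [coeff_sub, coeff_eq_zero_of_natDegree_lt (by omega), zero_sub, neg_eq_zero] at h6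
  exact h6

end Bound

section Genus

variable {k : Type} [Field k] [IsAlgClosed k]

lemma isSquare_C (c : k) : IsSquare (C c) := by
  obtain ⟨z, hz⟩ := IsAlgClosed.exists_eq_mul_self c
  exact ⟨C z, by rw [hz, C_mul]⟩

lemma isSquare_of_mul {a b : k[X]} (hab : IsCoprime a b) (h : IsSquare (a * b)) : IsSquare a := by
  obtain ⟨c, hc⟩ := h
  obtain ⟨e, u, hu⟩ := exists_associated_pow_of_mul_eq_pow' hab (hc.trans (sq c).symm)
  obtain ⟨z, -, hz⟩ := Polynomial.isUnit_iff.1 u.isUnit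
  rw [← hu, ← hz]
  exact (IsSquare.sq e).mul (isSquare_C z)

/-- Two linear forms in a coprime pair are coprime when their determinant is nonzero. -/
lemma isCoprime_forms {α β : k[X]} (h : IsCoprime α β) {a b c d : k} (hD : a * d - b * c ≠ 0) :
    IsCoprime (C a * α + C b * β) (C c * α + C d * β) := by
  obtain ⟨m, n, hmn⟩ := h
  have hD' : (C (a * d - b * c)⁻¹ : k[X]) * (C a * C d - C b * C c) = 1 := by
    rw [← C_mul, ← C_mul, ← C_sub, ← C_mul, inv_mul_cancel₀ hD, C_1]
  refine ⟨C (a * d - b * c)⁻¹ * (m * C d - n * C c), C (a * d - b * c)⁻¹ * (n * C a - m * C b), ?_⟩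
  linear_combination (m * α + n * β) * hD' + hmn

lemma natDegree_eq_zero_of_four_squares (h2 : (2 : k) ≠ 0) (n : ℕ) : ∀ (p q : k[X]) (l : k),
    p.natDegree ≤ n → q.natDegree ≤ n → IsCoprime p q → l ≠ 0 → l ≠ 1 → IsSquare p → IsSquare q →
    IsSquare (p - q) → IsSquare (p - C l * q) → p.natDegree = 0 ∧ q.natDegree = 0 := by
  induction n using Nat.strong_induction_on with
  | _ n ih =>
    rintro p q l hp hq hpq hl0 hl1 ⟨α, hα⟩ ⟨β, hβ⟩ h1 h3
    rcases Nat.eq_zero_or_pos n with rfl | hn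
    · omega
    obtain ⟨κ, hκ⟩ := IsAlgClosed.exists_eq_mul_self l
    have hκ0 : κ ≠ 0 := by rintro rfl; simp [hκ] at hl0
    have hκ1 : κ - 1 ≠ 0 := fun h => hl1 (by rw [hκ, sub_eq_zero.1 h, mul_one])
    have hκ2 : κ + 1 ≠ 0 := fun h => hl1 (by rw [hκ, eq_neg_of_add_eq_zero_left h]; ring)
    have hco : IsCoprime α β := by
      rw [hα, hβ] at hpq
      exact hpq.of_mul_left_left.of_mul_right_left
    have dα : α.natDegree ≤ n / 2 := by rw [hα, ← sq, natDegree_pow] at hp; omega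
    have dβ : β.natDegree ≤ n / 2 := by rw [hβ, ← sq, natDegree_pow] at hq; omega
    have s1 : IsSquare (C 1 * α + C (-1) * β) := by
      refine isSquare_of_mul (isCoprime_forms hco (a := 1) (b := -1) (c := 1) (d := 1) ?_) ?_
      · intro h; apply h2; linear_combination h
      · convert h1 using 1; rw [hα, hβ]; simp only [C_neg, C_1]; ring
    have s2 : IsSquare (C 1 * α + C 1 * β) := by
      refine isSquare_of_mul (isCoprime_forms hco (a := 1) (b := 1) (c := 1) (d := -1) ?_) ?_
      · intro h; apply h2; linear_combination -h
      · convert h1 using 1; rw [hα, hβ]; simp only [C_neg, C_1]; ring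
    have s3 : IsSquare (C 1 * α + C (-κ) * β) := by
      refine isSquare_of_mul (isCoprime_forms hco (a := 1) (b := -κ) (c := 1) (d := κ) ?_) ?_
      · intro h; apply mul_ne_zero h2 hκ0; linear_combination h
      · convert h3 using 1; rw [hα, hβ, hκ]; simp only [C_neg, C_1, C_mul]; ring
    have s4 : IsSquare (C 1 * α + C κ * β) := by
      refine isSquare_of_mul (isCoprime_forms hco (a := 1) (b := κ) (c := 1) (d := -κ) ?_) ?_
      · intro h; apply mul_ne_zero h2 hκ0; linear_combination -h
      · convert h3 using 1; rw [hα, hβ, hκ]; simp only [C_neg, C_1, C_mul]; ring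
    obtain ⟨l', hl'⟩ : ∃ l', l' = ((1 + κ) / (κ - 1)) ^ 2 := ⟨_, rfl⟩
    have hl'e : l' * (κ - 1) ^ 2 = (1 + κ) ^ 2 := by rw [hl']; field_simp
    have hl'e2 : l' * (κ - 1) = (1 + κ) ^ 2 / (κ - 1) := by rw [← hl'e]; field_simp
    have e5 : C (κ + 1) * α + C (-(κ + 1)) * β = C (κ + 1) * (C 1 * α + C (-1) * β) := by
      simp only [C_neg, C_1]; ring
    have e6 : C (κ - 1) * α + C (κ - 1) * β = C (κ - 1) * (C 1 * α + C 1 * β) := by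
      simp only [C_1]; ring
    have ee : l' * (κ - 1) - (κ + 1) = 2 * (κ + 1) / (κ - 1) := by
      rw [hl'e2]; field_simp; ring
    have ee' : l' * (κ - 1) + (κ + 1) = 2 * (κ + 1) / (κ - 1) * κ := by
      rw [hl'e2]; field_simp; ring
    have hdeg : ∀ a b : k, (C a * α + C b * β).natDegree ≤ n / 2 := fun a b =>
      (natDegree_add_le _ _).trans (max_le ((natDegree_C_mul_le _ _).trans dα)
        ((natDegree_C_mul_le _ _).trans dβ))
    obtain ⟨hU, hW⟩ := ih (n / 2) (by omega) (C (κ + 1) * α + C (-(κ + 1)) * β)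
      (C (κ - 1) * α + C (κ - 1) * β) l' (hdeg _ _) (hdeg _ _)
      (isCoprime_forms hco (by
        intro h
        exact mul_ne_zero h2 (mul_ne_zero hκ1 hκ2) (by linear_combination h)))
      (by rw [hl']; exact pow_ne_zero _ (div_ne_zero (by rwa [add_comm]) hκ1))
      (by
        rintro rfl
        exact mul_ne_zero (mul_ne_zero h2 h2) hκ0 (by linear_combination -hl'e))
      (by rw [e5]; exact (isSquare_C _).mul s1)
      (by rw [e6]; exact (isSquare_C _).mul s2)
      (by
        refine (congrArg IsSquare (?_ : C 2 * (C 1 * α + C (-κ) * β) = _)).mp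
          ((isSquare_C 2).mul s3)
        simp only [C_neg, C_1, C_add, C_sub, ← C_ofNat]
        rw [show (C 2 : k[X]) = 2 from C_ofNat 2]; ring)
      (by
        refine (congrArg IsSquare
          (?_ : C (-(2 * (κ + 1) / (κ - 1))) * (C 1 * α + C κ * β) = _)).mp
          ((isSquare_C _).mul s4)
        have e7 := congrArg (C : k → k[X]) ee
        have e8 := congrArg (C : k → k[X]) ee'
        rw [C_mul (b := κ)] at e8
        simp only [C_sub, C_add, C_mul, C_1] at e7 e8
        simp only [C_neg, C_1, C_add, C_sub]
        linear_combination α * e7 + β * e8)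
    obtain ⟨u, hu⟩ := natDegree_eq_zero.1 hU
    obtain ⟨w, hw⟩ := natDegree_eq_zero.1 hW
    have hD : (C ((κ + 1) * (κ - 1) * 2)⁻¹ : k[X]) * (C (κ + 1) * C (κ - 1) * 2) = 1 := by
      rw [← C_mul, show (2 : k[X]) = C 2 from (C_ofNat 2).symm, ← C_mul, ← C_mul, inv_mul_cancel₀, C_1]
      exact mul_ne_zero (mul_ne_zero hκ2 hκ1) h2
    have eα : α = C (((κ + 1) * (κ - 1) * 2)⁻¹ * ((κ - 1) * u + (κ + 1) * w)) := by
      rw [C_mul, C_add, C_mul, C_mul, hu, hw, C_neg]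
      linear_combination -α * hD
    have eβ : β = C (((κ + 1) * (κ - 1) * 2)⁻¹ * ((κ + 1) * w - (κ - 1) * u)) := by
      rw [C_mul, C_sub, C_mul, C_mul, hu, hw, C_neg]
      linear_combination -β * hD
    refine ⟨?_, ?_⟩
    · rw [hα, ← sq, natDegree_pow, eα, natDegree_C, mul_zero]
    · rw [hβ, ← sq, natDegree_pow, eβ, natDegree_C, mul_zero]

local notation "r" => algebraMap k[X] (RatFunc k)
local notation "ak" => algebraMap k (RatFunc k)

variable {A B : k} [EC A B]

lemma exists_two_torsion (A B : k) [hE : EC A B] : ∃ e₁ e₂ e₃ : k, e₁ + e₂ + e₃ = 0 ∧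
    A = e₁ * e₂ + e₂ * e₃ + e₁ * e₃ ∧ B = -(e₁ * e₂ * e₃) ∧ e₁ ≠ e₂ ∧ e₁ ≠ e₃ ∧ e₂ ≠ e₃ := by
  obtain ⟨e₁, h₁⟩ := IsAlgClosed.exists_root (cubic A B) (by
    rw [degree_eq_natDegree (cubic_ne_zero A B), natDegree_cubic]; decide)
  have h₁ : e₁ ^ 3 + A * e₁ + B = 0 := by simpa [cubic] using h₁
  obtain ⟨z, hz⟩ := IsAlgClosed.exists_eq_mul_self (e₁ ^ 2 - 4 * (A + e₁ ^ 2))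
  have h2 := hE.two
  obtain ⟨e₂, he₂⟩ : ∃ e, e * 2 = -e₁ + z := ⟨(-e₁ + z) / 2, div_mul_cancel₀ _ h2⟩
  have hA : A = e₁ * e₂ + e₂ * (-e₁ - e₂) + e₁ * (-e₁ - e₂) := by
    apply mul_left_cancel₀ (mul_ne_zero h2 h2)
    linear_combination -hz + (2 * e₂ + e₁ + z) * he₂
  have hB : B = -(e₁ * e₂ * (-e₁ - e₂)) := by linear_combination h₁ - e₁ * hA
  have hd := hE.disc
  refine ⟨e₁, e₂, -e₁ - e₂, by ring, hA, hB, ?_, ?_, ?_⟩ <;> intro h <;> apply hd <;> rw [hA, hB]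
  · rw [h]; ring
  · have : e₂ = -e₁ - e₁ := by linear_combination h
    rw [this]; ring
  · have : e₁ = -e₂ - e₂ := by linear_combination h
    rw [this]; ring

/-- A non-isotrivial point over `k(X)` does not exist: elliptic curves are not unirational. -/
theorem exists_eq_cst (P : Pt A B (RatFunc k)) : ∃ Q, P = cst A B _ Q := by
  rcases Pt.cases P with rfl | ⟨u, v, h, rfl⟩
  · exact ⟨0, (map_zero _).symm⟩
  apply mk_isCst
  have h2 := EC.two A B
  obtain ⟨e₁, e₂, e₃, hs, hA, hB, h12, h13, h23⟩ := exists_two_torsion A B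
  obtain ⟨a, ha⟩ : ∃ a, a = u.num := ⟨_, rfl⟩
  obtain ⟨b, hb⟩ : ∃ b, b = u.denom := ⟨_, rfl⟩
  have hco : IsCoprime a b := ha ▸ hb ▸ RatFunc.isCoprime_num_denom u
  have hb0 : b ≠ 0 := hb ▸ RatFunc.denom_ne_zero u
  have hu : u * r b = r a := by
    rw [ha, hb]; nth_rw 1 [← RatFunc.num_div_denom u]
    exact div_mul_cancel₀ _ (algebraMap_poly_ne_zero (RatFunc.denom_ne_zero u))
  have key : (v * r b ^ 2) ^ 2 =
      r (b * ((a - C e₁ * b) * ((a - C e₂ * b) * (a - C e₃ * b)))) := by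
    have hC : ∀ c, r (C c) = ak c := fun c => rfl
    simp only [map_mul, map_sub, hC, ← hu]
    rw [mul_pow, h, hA, hB]
    have hs' : ak e₃ = -ak e₁ - ak e₂ := by
      rw [← map_neg, ← map_sub]; congr 1; linear_combination hs
    simp only [map_mul, map_add, map_neg, hs']
    ring
  obtain ⟨w, hw⟩ := IsIntegrallyClosed.exists_algebraMap_eq_of_isIntegral_pow (R := k[X])
    (K := RatFunc k) (n := 2) (by norm_num) (x := v * r b ^ 2) (by
      rw [key]; exact isIntegral_algebraMap)
  have hsq : IsSquare (b * ((a - C e₁ * b) * ((a - C e₂ * b) * (a - C e₃ * b)))) := by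
    refine ⟨w, RatFunc.algebraMap_injective k ?_⟩
    rw [← key, ← hw, map_mul, sq]
  have fb : C 0 * a + C 1 * b = b := by simp
  have fe : ∀ e : k, C 1 * a + C (-e) * b = a - C e * b := fun e => by
    simp only [C_1, C_neg]; ring
  have cb : ∀ e, IsCoprime b (a - C e * b) := fun e => by
    rw [← fe]; nth_rw 1 [← fb]
    exact isCoprime_forms hco (by norm_num)
  have ce : ∀ e e', e ≠ e' → IsCoprime (a - C e * b) (a - C e' * b) := fun e e' hne => by
    rw [← fe, ← fe]
    exact isCoprime_forms hco (by
      intro h; apply hne; linear_combination h)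
  have s0 : IsSquare b :=
    isSquare_of_mul ((cb e₁).mul_right ((cb e₂).mul_right (cb e₃))) hsq
  have s1 : IsSquare (a - C e₁ * b) := by
    refine isSquare_of_mul (b := b * ((a - C e₂ * b) * (a - C e₃ * b)))
      ((cb e₁).symm.mul_right ((ce _ _ h12).mul_right (ce _ _ h13))) ?_
    convert hsq using 1; ring
  have s2 : IsSquare (a - C e₂ * b) := by
    refine isSquare_of_mul (b := b * ((a - C e₁ * b) * (a - C e₃ * b)))
      ((cb e₂).symm.mul_right ((ce _ _ h12.symm).mul_right (ce _ _ h23))) ?_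
    convert hsq using 1; ring
  have s3 : IsSquare (a - C e₃ * b) := by
    refine isSquare_of_mul (b := b * ((a - C e₁ * b) * (a - C e₂ * b)))
      ((cb e₃).symm.mul_right ((ce _ _ h13.symm).mul_right (ce _ _ h23.symm))) ?_
    convert hsq using 1; ring
  have n12 : e₂ - e₁ ≠ 0 := sub_ne_zero.2 h12.symm
  obtain ⟨l, hl⟩ : ∃ l, l = (e₃ - e₁) / (e₂ - e₁) := ⟨_, rfl⟩
  have hl' : l * (e₂ - e₁) = e₃ - e₁ := by rw [hl, div_mul_cancel₀ _ n12]
  obtain ⟨d1, d2⟩ := natDegree_eq_zero_of_four_squares h2 _ (a - C e₁ * b) (C (e₂ - e₁) * b) l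
    (le_max_left _ _) (le_max_right _ _)
    (by
      have := isCoprime_forms hco (a := 1) (b := -e₁) (c := 0) (d := e₂ - e₁) (by
        intro h; apply n12; linear_combination h)
      rw [fe] at this; simpa using this)
    (by rintro rfl; apply sub_ne_zero.2 h13; linear_combination hl')
    (by rintro rfl; apply h23; linear_combination hl')
    s1 ((isSquare_C _).mul s0) (by convert s2 using 1; rw [C_sub]; ring)
    (by
      convert s3 using 1
      rw [← mul_assoc, ← C_mul, hl', C_sub]; ring)
  rw [natDegree_C_mul n12] at d2
  obtain ⟨y, hy⟩ := natDegree_eq_zero.1 d2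
  obtain ⟨z, hz⟩ := natDegree_eq_zero.1 d1
  have hy0 : ak y ≠ 0 := by
    intro h0; apply hb0; rw [← hy, (_root_.map_eq_zero ak).1 h0, C_0]
  have : u = ak ((z + e₁ * y) / y) := by
    rw [map_div₀, eq_div_iff hy0]
    have e1 : ak y = r b := by rw [← hy]; rfl
    have e2 : r a = ak (z + e₁ * y) := by
      rw [show a = C (z + e₁ * y) by rw [C_add, C_mul, hz, hy]; ring]; rfl
    rw [e1, hu, e2]
  rw [this]; exact isAlgebraic_algebraMap _

variable {A₀ B₀ : k} [EC A₀ B₀]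

/-- A point of `E₀` over the function field of `E` fixed by the involution is constant. -/
lemma exists_eq_cst_of_iota {P : Pt A₀ B₀ (FF A B)} (h : pmap (iota A B) P = P) :
    ∃ Q, P = cst A₀ B₀ _ Q := by
  have := EC.neZero_two A B
  rcases Pt.cases P with rfl | ⟨u, v, hc, rfl⟩
  · exact ⟨0, (map_zero _).symm⟩
  rw [pmap_mk, Pt.mk_inj] at h
  obtain ⟨a, rfl⟩ := ratFunc_of_iota_eq h.1
  obtain ⟨b, rfl⟩ := ratFunc_of_iota_eq h.2
  have hc' : b ^ 2 = a ^ 3 + ak A₀ * a + ak B₀ := by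
    apply (algebraMap (RatFunc k) (FF A B)).injective
    simp only [map_add, map_mul, map_pow, ← IsScalarTower.algebraMap_apply]
    exact hc
  obtain ⟨Q, hQ⟩ := exists_eq_cst (Pt.mk a b hc')
  refine ⟨Q, ?_⟩
  rw [← pmap_cst (IsScalarTower.toAlgHom k (RatFunc k) (FF A B)), ← hQ, pmap_mk]
  rfl

end Genus

section Translation

variable {k : Type} [Field k] [IsAlgClosed k] {A B A₀ B₀ : k} [EC A B] [EC A₀ B₀]

lemma exists_add_self_eq (Q : Pt A B k) : ∃ Q', Q = Q' + Q' := by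
  have h2 := EC.two A B
  have hd := EC.disc (A := A) (B := B)
  rcases Pt.cases Q with rfl | ⟨u, v, h, rfl⟩
  · exact ⟨0, (add_zero 0).symm⟩
  have h' : v ^ 2 = u ^ 3 + A * u + B := h
  obtain ⟨x, hx⟩ := IsAlgClosed.exists_root
    (X ^ 4 - C (2 * A) * X ^ 2 - C (8 * B) * X + C (A ^ 2)
      - C (4 * u) * (X ^ 3 + C A * X + C B) : k[X]) (by
    have : (X ^ 4 - C (2 * A) * X ^ 2 - C (8 * B) * X + C (A ^ 2)
      - C (4 * u) * (X ^ 3 + C A * X + C B) : k[X]).degree = 4 := by compute_degree!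
    rw [this]; decide)
  have hx : x ^ 4 - 2 * A * x ^ 2 - 8 * B * x + A ^ 2 - 4 * u * (x ^ 3 + A * x + B) = 0 := by
    simpa using hx
  obtain ⟨y, hy⟩ := IsAlgClosed.exists_eq_mul_self (x ^ 3 + A * x + B)
  have hy0 : y ≠ 0 := by
    rintro rfl
    have e1 : 3 * x ^ 2 + A = 0 := by
      refine pow_eq_zero_iff (n := 2) (by norm_num) |>.1 ?_
      linear_combination hx + (4 * u + 8 * x) * hy
    apply hd
    have hA : A = -3 * x ^ 2 := by linear_combination e1
    have hB : B = 2 * x ^ 3 := by linear_combination hy - x * e1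
    rw [hA, hB]; ring
  have hc : y ^ 2 = x ^ 3 + algebraMap k k A * x + algebraMap k k B := by
    rw [sq, ← hy]; rfl
  have hu : ((3 * x ^ 2 + algebraMap k k A) / (2 * y)) ^ 2 - x - x = u := by
    have e : algebraMap k k A = A := rfl
    rw [e, div_pow, sub_sub, sub_eq_iff_eq_add, div_eq_iff (pow_ne_zero _ (mul_ne_zero h2 hy0))]
    linear_combination hx + (4 * u + 8 * x) * hy
  have key := Pt.double_mk (A := A) (B := B) (u := x) (v := y) (h := hc) _ hy0 rfl
  obtain ⟨w, hw, key⟩ : ∃ w hw, Pt.mk x y hc + Pt.mk x y hc = (Pt.mk u w hw : Pt A B k) :=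
    ⟨_, _, key.trans (Pt.mk_congr hu rfl)⟩
  rcases Pt.eq_or_neg (h := h) (h' := hw) with e | e
  · exact ⟨_, e.trans key.symm⟩
  · exact ⟨-Pt.mk x y hc, by rw [e, ← key, neg_add]⟩

lemma pmap_id (P : Pt A B (FF A₀ B₀)) : pmap (AlgHom.id k _) P = P := by
  rcases Pt.cases P with rfl | ⟨u, v, h, rfl⟩
  · exact map_zero _
  · rfl

lemma exists_translation (Q : Pt A B k) :
    ∃ τ : FF A B →ₐ[k] FF A B, pmap τ (gen A B) = gen A B + cst A B _ Q := by
  rcases exists_embedding (gen A B + cst A B _ Q) with ⟨R, hR⟩ | h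
  · refine absurd ?_ (gen_ne_cst (R - Q))
    rw [map_sub, ← hR, add_sub_cancel_right]
  · exact h

/-- Translating the argument of an odd map translates its value, homomorphically. -/
theorem exists_translation_hom {P : Pt A₀ B₀ (FF A B)} (hP : pmap (iota A B) P = -P) :
    ∃ D : Pt A B k →+ Pt A₀ B₀ k, ∀ Q (τ : FF A B →ₐ[k] FF A B),
      pmap τ (gen A B) = gen A B + cst A B _ Q → pmap τ P = P + cst A₀ B₀ _ (D Q) := by
  have comp : ∀ Q Q' (τ τ' τ'' : FF A B →ₐ[k] FF A B),
      pmap τ (gen A B) = gen A B + cst A B _ Q → pmap τ' (gen A B) = gen A B + cst A B _ Q' →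
      pmap τ'' (gen A B) = gen A B + cst A B _ (Q + Q') → τ.comp τ' = τ'' := by
    intro Q Q' τ τ' τ'' h h' h''
    apply algHom_ext_gen
    rw [pmap_comp_apply, h', map_add, h, pmap_cst, h'', map_add, add_assoc]
  have ex : ∀ Q, ∃ R, ∀ τ : FF A B →ₐ[k] FF A B,
      pmap τ (gen A B) = gen A B + cst A B _ Q → pmap τ P = P + cst A₀ B₀ _ R := by
    intro Q
    obtain ⟨Q', rfl⟩ := exists_add_self_eq Q
    obtain ⟨σ, hσ⟩ := exists_translation Q'
    obtain ⟨σ', hσ'⟩ := exists_translation (-Q')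
    have c1 : (iota A B).comp σ = σ'.comp (iota A B) := by
      apply algHom_ext_gen
      rw [pmap_comp_apply, pmap_comp_apply, hσ, map_add, pmap_iota_gen, pmap_cst, map_neg, hσ',
        map_neg, neg_add, neg_neg]
    have c2 : (iota A B).comp σ' = σ.comp (iota A B) := by
      apply algHom_ext_gen
      rw [pmap_comp_apply, pmap_comp_apply, hσ', map_add, pmap_iota_gen, pmap_cst,
        map_neg (cst A B _), map_neg (pmap σ), hσ, neg_add]
    obtain ⟨R, hR⟩ := exists_eq_cst_of_iota (P := pmap σ P - pmap σ' P) (by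
      rw [map_sub, ← pmap_comp_apply, ← pmap_comp_apply, c1, c2, pmap_comp_apply,
        pmap_comp_apply, hP, map_neg, map_neg]
      abel)
    refine ⟨R, fun τ hτ => ?_⟩
    have e := congrArg (pmap σ) hR
    rw [map_sub, ← pmap_comp_apply, ← pmap_comp_apply, pmap_cst, comp _ _ σ σ τ hσ hσ hτ] at e
    obtain ⟨τ₀, h₀⟩ := exists_translation (0 : Pt A B k)
    have hid : τ₀ = AlgHom.id k _ := algHom_ext_gen (by
      rw [h₀, map_zero, add_zero]; exact (pmap_id _).symm)
    rw [comp Q' (-Q') σ σ' τ₀ hσ hσ' (by rw [h₀, add_neg_cancel]), hid] at e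
    rw [← e, show pmap (AlgHom.id k _) P = P from pmap_id _]; abel
  choose D hD using ex
  refine ⟨AddMonoidHom.mk' D fun Q Q' => ?_, hD⟩
  obtain ⟨τ, h⟩ := exists_translation Q
  obtain ⟨τ', h'⟩ := exists_translation Q'
  obtain ⟨τ'', h''⟩ := exists_translation (Q + Q')
  apply cst_injective (A := A₀) (B := B₀) (L := FF A B)
  have e := hD _ τ'' h''
  rw [← comp _ _ τ τ' τ'' h h' h'', pmap_comp_apply, hD _ τ' h', map_add, hD _ τ h, pmap_cst,
    add_assoc] at e
  rw [map_add]; exact (add_left_cancel e).symm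

end Translation

section Specialization

variable {k : Type} [Field k] {A B A₀ B₀ : k}

local notation "r" => algebraMap k[X] (RatFunc k)
local notation "ak" => algebraMap k (RatFunc k)
local notation "F" => algebraMap (RatFunc k) (FF A B)

/-- The function `z` on `y² = x³ + Ax + B` is regular at infinity, with value `c` there. -/
def VO (z : FF A B) (c : k) : Prop :=
  ∃ a b : RatFunc k, z = F a + F b * yF A B ∧ DLe (-1) (a - ak c) ∧ DLe (-2) b

lemma vO_const (c : k) : VO (algebraMap k (FF A B) c) c :=
  ⟨ak c, 0, by rw [map_zero, zero_mul, add_zero, ← IsScalarTower.algebraMap_apply],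
    Or.inl (sub_self _), Or.inl rfl⟩

lemma VO.add {z z' : FF A B} {c c' : k} (h : VO z c) (h' : VO z' c') : VO (z + z') (c + c') := by
  obtain ⟨a, b, rfl, h1, h2⟩ := h
  obtain ⟨a', b', rfl, h1', h2'⟩ := h'
  refine ⟨a + a', b + b', by simp only [map_add]; ring, ?_, h2.add h2'⟩
  convert h1.add h1' using 1
  rw [map_add]; ring

lemma VO.mul {z z' : FF A B} {c c' : k} (h : VO z c) (h' : VO z' c') : VO (z * z') (c * c') := by
  obtain ⟨a, b, rfl, h1, h2⟩ := h
  obtain ⟨a', b', rfl, h1', h2'⟩ := h'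
  have ha : DLe 0 a := by
    have := (h1.mono (m := 0) (by omega)).add (dLe_const c)
    rwa [sub_add_cancel] at this
  have ha' : DLe 0 a' := by
    have := (h1'.mono (m := 0) (by omega)).add (dLe_const c')
    rwa [sub_add_cancel] at this
  have hf : DLe 3 (cubicR A B) := Or.inr (intDegree_cubicR A B).le
  refine ⟨a * a' + b * b' * cubicR A B, a * b' + b * a', ?_, ?_, ?_⟩
  · simp only [map_add, map_mul, ← yF_sq']; ring
  · have e1 := (h1.mul ha').add ((h1'.const_mul c).mono (m := -1 + 0) (by omega))
    have e2 := e1.add (((h2.mul h2').mul hf).mono (m := -1 + 0) (by omega))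
    rw [add_zero] at e2
    convert e2 using 1
    rw [map_mul]; ring
  · exact ((ha.mul h2').mono (by omega)).add ((h2.mul ha').mono (by omega))

lemma VO.unique [EC A B] {z : FF A B} {c c' : k} (h : VO z c) (h' : VO z c') : c = c' := by
  obtain ⟨a, b, hz, h1, h2⟩ := h.add ((vO_const (-1)).mul h')
  rw [map_neg, map_one, neg_one_mul, add_neg_cancel] at hz
  have hi := congrArg (iota A B) hz
  rw [map_zero, map_add, map_mul, iota_ratFunc, iota_ratFunc, iota_y] at hi
  have h3 : F 2 * F a = 0 := by
    have : F 2 = 2 := map_ofNat _ 2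
    rw [this]; linear_combination -hz - hi
  rw [mul_eq_zero, _root_.map_eq_zero, _root_.map_eq_zero] at h3
  have h0 : a = 0 := h3.resolve_left (EC.two' A B (RatFunc k))
  rw [h0, zero_sub, ← map_neg] at h1
  by_contra hne
  have h4 : ak (-(c + -1 * c')) ≠ 0 :=
    (_root_.map_ne_zero ak).2 (fun h => hne (by linear_combination -h))
  have := h1.le h4
  rw [intDegree_const] at this
  omega

lemma VO.aeval {z : FF A B} {c : k} (h : VO z c) (a : k[X]) : VO (aeval z a) (a.eval c) := by
  induction a using Polynomial.induction_on' with
  | add p q hp hq => rw [map_add, eval_add]; exact hp.add hq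
  | monomial n x =>
    rw [aeval_monomial, eval_monomial]
    refine (vO_const x).mul ?_
    induction n with
    | zero => rw [pow_zero, pow_zero]; convert vO_const (A := A) (B := B) (1 : k) using 1; simp
    | succ n ih => rw [pow_succ, pow_succ]; exact ih.mul h

variable [EC A₀ B₀]

/-- The value at infinity of the translate of an odd map with a pole there. -/
lemma exists_vO_add_cst [EC A B] {v s : RatFunc k}
    {h : (F s * yF A B) ^ 2 = F v ^ 3 + algebraMap k _ A₀ * F v + algebraMap k _ B₀}
    (hv : 0 < v.intDegree) {x y : k} (hxy) :
    ∃ z w hzw, (Pt.mk (F v) (F s * yF A B) h : Pt A₀ B₀ (FF A B)) +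
      cst A₀ B₀ _ (Pt.mk x y hxy) = Pt.mk z w hzw ∧ VO z x := by
  have hv0 : v ≠ 0 := by rintro rfl; simp at hv
  obtain ⟨hd0, hdd⟩ := intDegree_add_of_lt hv0 (v := ak (-x)) ((dLe_const _).mono (by omega))
  rw [map_neg, ← sub_eq_add_neg] at hd0 hdd
  have hne : F v ≠ algebraMap k (FF A B) x := by
    intro e
    rw [IsScalarTower.algebraMap_apply k (RatFunc k) (FF A B)] at e
    exact hd0 (sub_eq_zero.2 ((algebraMap (RatFunc k) (FF A B)).injective e))
  have hs : s ^ 2 * cubicR A B = v ^ 3 + ak A₀ * v + ak B₀ := by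
    apply (algebraMap (RatFunc k) (FF A B)).injective
    simp only [map_add, map_mul, map_pow, ← yF_sq', ← IsScalarTower.algebraMap_apply]
    rw [← h]; ring
  have hxy' : y ^ 2 = x ^ 3 + A₀ * x + B₀ := hxy
  have hy' := congrArg ak hxy'
  simp only [map_add, map_mul, map_pow] at hy'
  refine ⟨_, _, _, Pt.add_mk (h₂ := map_curve (Algebra.ofId k (FF A B)) hxy) _ hne rfl, ?_⟩
  refine ⟨(s ^ 2 * cubicR A B + ak y ^ 2) / (v - ak x) ^ 2 - v - ak x,
    ak (-2 * y) * (s * ((v - ak x)⁻¹ * (v - ak x)⁻¹)), ?_, ?_, ?_⟩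
  · have hD : F v - F (ak x) ≠ 0 := by rw [← map_sub]; exact (_root_.map_ne_zero F).2 hd0
    show ((F s * yF A B - algebraMap k (FF A B) y) / (F v - algebraMap k (FF A B) x)) ^ 2 - F v -
      algebraMap k (FF A B) x = _
    rw [IsScalarTower.algebraMap_apply k (RatFunc k) (FF A B),
      IsScalarTower.algebraMap_apply k (RatFunc k) (FF A B)]
    simp only [map_sub, map_add, map_mul, map_div₀, map_pow, map_inv₀, ← yF_sq', map_neg,
      map_ofNat]
    field_simp
    ring
  · have e : (s ^ 2 * cubicR A B + ak y ^ 2) / (v - ak x) ^ 2 - v - ak x - ak x =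
        (ak (A₀ + 3 * x ^ 2) * v + ak (B₀ + y ^ 2 - 2 * x ^ 3)) *
          ((v - ak x)⁻¹ * (v - ak x)⁻¹) := by
      rw [hs]
      simp only [map_sub, map_add, map_mul, map_pow, map_ofNat]
      field_simp
      ring
    rw [e]
    have hi : DLe (-v.intDegree) (v - ak x)⁻¹ := Or.inr (by rw [RatFunc.intDegree_inv, hdd])
    exact ((((dLe_intDegree v).const_mul _).add ((dLe_const _).mono hv.le)).mul
      (hi.mul hi)).mono (by omega)
  · have hi : DLe (-v.intDegree) (v - ak x)⁻¹ := Or.inr (by rw [RatFunc.intDegree_inv, hdd])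
    refine DLe.const_mul ?_ _
    by_cases hs0 : s = 0
    · left; rw [hs0, zero_mul]
    have h1 := intDegree_aeval hv 3 (cubic A₀ B₀) (cubic_ne_zero A₀ B₀) (natDegree_cubic A₀ B₀)
    have h2 : aeval v (cubic A₀ B₀) = s ^ 2 * cubicR A B := by rw [hs]; simp [cubic]
    rw [h2, RatFunc.intDegree_mul (pow_ne_zero 2 hs0) (cubicR_ne_zero A B),
      intDegree_pow hs0, intDegree_cubicR] at h1
    refine ((dLe_intDegree s).mul (hi.mul hi)).mono ?_
    have := h1.2
    push_cast at this
    omega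

variable [EC A B] [IsAlgClosed k]

/-- The translation homomorphism attached to an odd map is computed by evaluating the map. -/
theorem translation_hom_eval {v s : RatFunc k}
    {h : (F s * yF A B) ^ 2 = F v ^ 3 + algebraMap k _ A₀ * F v + algebraMap k _ B₀}
    (hv : 0 < v.intDegree) {D : Pt A B k →+ Pt A₀ B₀ k}
    (hD : ∀ Q (τ : FF A B →ₐ[k] FF A B), pmap τ (gen A B) = gen A B + cst A B _ Q →
      pmap τ (Pt.mk (F v) (F s * yF A B) h : Pt A₀ B₀ (FF A B)) = Pt.mk _ _ h + cst A₀ B₀ _ (D Q))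
    {u w : k} (hQ) :
    (D (Pt.mk u w hQ) = 0 → v.denom.eval u = 0) ∧
    ∀ x y hxy, D (Pt.mk u w hQ) = Pt.mk x y hxy →
      v.denom.eval u ≠ 0 ∧ v.num.eval u = x * v.denom.eval u := by
  have hv0 : v ≠ 0 := by rintro rfl; simp at hv
  obtain ⟨τ, hτ⟩ := exists_translation (Pt.mk u w hQ)
  have hX : 0 < (RatFunc.X : RatFunc k).intDegree := by simp
  obtain ⟨ξ, η, hξη, e1, hξ⟩ := exists_vO_add_cst (A := A) (B := B) (A₀ := A) (B₀ := B)
    (v := RatFunc.X) (s := 1) (h := by rw [map_one, one_mul]; exact yF_sq A B) hX hQ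
  have hτx : τ (F RatFunc.X) = ξ := by
    have e2 : (gen A B) = Pt.mk (F RatFunc.X) (F 1 * yF A B)
        (by rw [map_one, one_mul]; exact yF_sq A B) :=
      Pt.mk_congr rfl (by rw [map_one, one_mul])
    rw [← e2, ← hτ, e2, pmap_mk, Pt.mk_inj] at e1
    exact e1.1
  have hpoly : ∀ a : k[X], τ (F (r a)) = aeval ξ a := by
    intro a
    rw [← hτx, ← aeval_ratFunc_X, ← aeval_algebraMap_apply, ← Polynomial.aeval_algHom_apply]
  have hvd : v * r v.denom = r v.num := by
    nth_rw 1 [← RatFunc.num_div_denom v]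
    exact div_mul_cancel₀ _ (algebraMap_poly_ne_zero (RatFunc.denom_ne_zero v))
  have key : τ (F v) * aeval ξ v.denom = aeval ξ v.num := by
    rw [← hpoly, ← hpoly, ← map_mul, ← map_mul, hvd]
  have hn := hξ.aeval v.num
  have hd := hξ.aeval v.denom
  have hτP := hD _ τ hτ
  refine ⟨fun h0 => ?_, fun x y hxy h0 => ?_⟩
  · rw [h0, map_zero, add_zero, pmap_mk, Pt.mk_inj] at hτP
    have hinv : VO (F v⁻¹) 0 := ⟨v⁻¹, 0, by simp, by
      rw [map_zero, sub_zero]; right; rw [RatFunc.intDegree_inv]; omega, Or.inl rfl⟩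
    have e2 := hinv.mul hn
    rw [← key, hτP.1, ← mul_assoc, ← map_mul, inv_mul_cancel₀ hv0, map_one, one_mul,
      zero_mul] at e2
    exact hd.unique e2
  · obtain ⟨z, w', hzw, e2, hz⟩ := exists_vO_add_cst (h := h) hv hxy
    rw [h0, e2, pmap_mk, Pt.mk_inj] at hτP
    have e3 := hz.mul hd
    rw [← hτP.1, key] at e3
    have e4 := hn.unique e3
    refine ⟨fun h5 => ?_, e4⟩
    rw [h5, mul_zero] at e4
    exact LT.IsCoprime.not_eval (RatFunc.isCoprime_num_denom v) u (Prod.ext e4 h5)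

end Specialization

section Uniqueness

variable {k : Type} [Field k]

local notation "r" => algebraMap k[X] (RatFunc k)
local notation "ak" => algebraMap k (RatFunc k)

lemma Val.neg {x c : k} {u : RatFunc k} (h : Val x u c) : Val x (-u) (-c) := by
  unfold Val at *
  convert h.neg using 1
  rw [map_neg]; ring

lemma X_sub_ne_zero (x : k) : RatFunc.X - ak x ≠ 0 := fun h => transcendental_X
  (by rw [sub_eq_zero.1 h]; exact isAlgebraic_algebraMap x)

lemma oGe_cubicR (A B x : k) : OGe x 0 (cubicR A B) := oGe_poly x (cubic A B)

lemma OGe.div_X_sub {x : k} {n : ℤ} {u : RatFunc k} (h : OGe x n u) :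
    OGe x (n - 1) (u / (RatFunc.X - ak x)) := by
  have ht := X_sub_ne_zero x
  rcases eq_or_ne u 0 with rfl | hu
  · exact Or.inl (zero_div _)
  · right
    have h1 := od_mul x (div_ne_zero hu ht) ht
    rw [div_mul_cancel₀ _ ht, od_X_sub] at h1
    have := h.le hu
    omega

lemma Val.exists_eq {x c : k} {u : RatFunc k} (h : Val x u c) :
    ∃ w, OGe x 0 w ∧ u = ak c + (RatFunc.X - ak x) * w :=
  ⟨(u - ak c) / (RatFunc.X - ak x), by simpa using OGe.div_X_sub h, by
    rw [mul_div_cancel₀ _ (X_sub_ne_zero x)]; ring⟩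

lemma od_pole_ge {A₀ B₀ a b x : k} {Φ : RatFunc k}
    (h : cubicR A₀ B₀ * dR Φ ^ 2 = Φ ^ 3 + ak a * Φ + ak b) : OGe x (-2) Φ := by
  by_contra hc
  have h0 : Φ ≠ 0 := fun h0 => hc (Or.inl h0)
  have hlt : od x Φ < -2 := not_le.1 fun h' => hc (Or.inr h')
  have h3 : od x (Φ ^ 3) = 3 * od x Φ := od_pow x h0 3
  have h1 : OGe x (od x (Φ ^ 3) + 1) (ak a * Φ + ak b) :=
    (((oGe_od x Φ).const_mul a).mono (by omega)).add ((oGe_const x b).mono (by omega))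
  obtain ⟨h4, h5⟩ := od_add_of_lt (pow_ne_zero 3 h0) h1
  rw [← add_assoc, ← h] at h4 h5
  have h6 : OGe x (0 + ((od x Φ - 1) + (od x Φ - 1))) (cubicR A₀ B₀ * dR Φ ^ 2) := by
    rw [sq]
    exact OGe.mul (oGe_cubicR A₀ B₀ x) ((oGe_od x Φ).dR.mul (oGe_od x Φ).dR)
  have := h6.le h4
  omega

/-- The principal part at `x` of a solution of the differential equation that has a pole there. -/
lemma exists_principal_part (h2 : (2 : k) ≠ 0) (A₀ B₀ x : k) : ∃ S : RatFunc k, ∀ Φ a b,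
    cubicR A₀ B₀ * dR Φ ^ 2 = Φ ^ 3 + ak a * Φ + ak b → od x Φ < 0 → OGe x 0 (Φ - S) := by
  have hfO : OGe x 0 (cubicR A₀ B₀) := oGe_cubicR A₀ B₀ x
  obtain ⟨c₀, hc₀⟩ := exists_val hfO
  obtain ⟨g, hg, hfg⟩ := hc₀.exists_eq
  obtain ⟨c₁, hc₁⟩ := exists_val hg
  have ht := X_sub_ne_zero x
  obtain ⟨t, htdef⟩ : ∃ t, t = RatFunc.X - ak x := ⟨_, rfl⟩
  have htv : Val x t 0 := htdef ▸ val_zero_of_oGe (Or.inr (od_X_sub x).ge)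
  refine ⟨ak (4 * c₀) / t ^ 2 + ak (if c₀ = 0 then c₁ else 2 * c₁) / t, fun Φ a b h hneg => ?_⟩
  have hΦ2 := od_pole_ge (x := x) h
  have hdt : dR t = 1 := by rw [htdef, dR_sub, dR_X, dR_const, sub_zero]
  have hO : OGe x 0 (t ^ 2 * Φ) := by
    have : OGe x 1 t := htdef ▸ Or.inr (od_X_sub x).ge
    rw [sq]
    exact ((this.mul this).mul hΦ2).mono (by norm_num)
  obtain ⟨v, hv⟩ := exists_val hO
  obtain ⟨z, hz, hVz⟩ := hv.exists_eq
  obtain ⟨z₀, hz₀⟩ := exists_val hz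
  obtain ⟨z₁, hz₁⟩ := exists_val hz.dR_zero
  rw [← htdef] at hfg hVz ht
  have hd : 2 * t * Φ + t ^ 2 * dR Φ = z + t * dR z := by
    have := congrArg dR hVz
    rw [dR_mul, dR_pow, dR_add, dR_mul, dR_const, hdt] at this
    push_cast at this
    linear_combination this
  have hΦ : Φ = (ak v + t * z) / t ^ 2 := by
    rw [eq_div_iff (pow_ne_zero 2 ht)]; linear_combination hVz
  have hE : cubicR A₀ B₀ * (-(ak (2 * v)) + -(t * z) + t ^ 2 * dR z) ^ 2 =
      (ak v + t * z) ^ 3 + ak a * t ^ 4 * (ak v + t * z) + ak b * t ^ 6 := by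
    have e : -(ak (2 * v)) + -(t * z) + t ^ 2 * dR z = t ^ 3 * dR Φ := by
      rw [map_mul, map_ofNat]
      linear_combination (-t) * hd + 2 * hVz
    rw [e, ← hVz]
    linear_combination t ^ 6 * h
  have h0 := Val.unique (hc₀.mul ((((val_const x (2 * v)).neg.add (htv.mul hz₀).neg).add
    ((htv.pow 2).mul hz₁)).pow 2))
    (hE ▸ ((((val_const x v).add (htv.mul hz₀)).pow 3).add (((val_const x a).mul (htv.pow 4)).mul
      ((val_const x v).add (htv.mul hz₀)))).add ((val_const x b).mul (htv.pow 6)))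
  have hreg (hv0 : v = 0) : z₀ ≠ 0 := by
    rintro rfl
    have h1 : Φ = z / t := by
      rw [hΦ, hv0, map_zero, zero_add]; field_simp
    have h2 : OGe x 0 Φ := by
      rw [h1, htdef]
      have : OGe x 1 z := by simpa [Val] using hz₀
      exact this.div_X_sub
    rcases h2 with rfl | h2
    · simp [od] at hneg
    · omega
  have h4 : (4 : k) ≠ 0 := by
    rw [show (4 : k) = 2 * 2 by norm_num]; exact mul_ne_zero h2 h2
  have key : v = 4 * c₀ ∧ z₀ = if c₀ = 0 then c₁ else 2 * c₁ := by
    split_ifs with hc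
    · have hv0 : v = 0 := by
        rw [hc] at h0
        have : v ^ 3 = 0 := by linear_combination -h0
        exact pow_eq_zero_iff (by norm_num) |>.1 this
      refine ⟨by rw [hv0, hc, mul_zero], ?_⟩
      have hE' : g * (-z + t * dR z) ^ 2 = z ^ 3 + ak a * t ^ 2 * z + ak b * t ^ 3 := by
        rw [hfg, hc, hv0, mul_zero, map_zero] at hE
        apply mul_left_cancel₀ (pow_ne_zero 3 ht)
        linear_combination hE
      have h1 := Val.unique (hc₁.mul ((hz₀.neg.add (htv.mul hz₁)).pow 2))
        (hE' ▸ ((hz₀.pow 3).add (((val_const x a).mul (htv.pow 2)).mul hz₀)).add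
          ((val_const x b).mul (htv.pow 3)))
      apply mul_left_cancel₀ (pow_ne_zero 2 (hreg hv0))
      linear_combination -h1
    · by_cases hv0 : v = 0
      · exfalso
        have hE' : cubicR A₀ B₀ * (-z + t * dR z) ^ 2 =
            t * z ^ 3 + ak a * t ^ 3 * z + ak b * t ^ 4 := by
          rw [hv0, mul_zero, map_zero] at hE
          apply mul_left_cancel₀ (pow_ne_zero 2 ht)
          linear_combination hE
        have h1 := Val.unique (hc₀.mul ((hz₀.neg.add (htv.mul hz₁)).pow 2))
          (hE' ▸ ((htv.mul (hz₀.pow 3)).add (((val_const x a).mul (htv.pow 3)).mul hz₀)).add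
            ((val_const x b).mul (htv.pow 4)))
        have h3 : c₀ * z₀ ^ 2 = 0 := by linear_combination h1
        exact mul_ne_zero hc (pow_ne_zero 2 (hreg hv0)) h3
      · have hv4 : v = 4 * c₀ := by
          apply mul_left_cancel₀ (pow_ne_zero 2 hv0)
          linear_combination -h0
        refine ⟨hv4, ?_⟩
        have hE' : ak c₀ * (ak (4 * v) * z + t * z ^ 2 + -(ak (4 * v) * t * dR z) 
              + -(ak 2 * t ^ 2 * (z * dR z)) + t ^ 3 * dR z ^ 2)
            + g * (-(ak (2 * v)) + -(t * z) + t ^ 2 * dR z) ^ 2 =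
            ak (3 * v ^ 2) * z + ak (3 * v) * t * z ^ 2 + t ^ 2 * z ^ 3
              + ak a * t ^ 3 * (ak v + t * z) + ak b * t ^ 5 := by
          have hv4' := congrArg ak hv4
          rw [hfg] at hE
          simp only [map_mul, map_ofNat, map_pow] at hE hv4' ⊢
          apply mul_left_cancel₀ ht
          linear_combination hE + ak v ^ 2 * hv4'
        have h1 := Val.unique (((val_const x c₀).mul (((((((val_const x (4 * v)).mul hz₀).add
          (htv.mul (hz₀.pow 2))).add (((val_const x (4 * v)).mul htv).mul hz₁).neg).add
          (((val_const x 2).mul (htv.pow 2)).mul (hz₀.mul hz₁)).neg).add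
          ((htv.pow 3).mul (hz₁.pow 2))))).add
          (hc₁.mul ((((val_const x (2 * v)).neg.add (htv.mul hz₀).neg).add
            ((htv.pow 2).mul hz₁)).pow 2)))
          (hE' ▸ (((((val_const x (3 * v ^ 2)).mul hz₀).add (((val_const x (3 * v)).mul htv).mul
            (hz₀.pow 2))).add ((htv.pow 2).mul (hz₀.pow 3))).add (((val_const x a).mul
            (htv.pow 3)).mul ((val_const x v).add (htv.mul hz₀)))).add
            ((val_const x b).mul (htv.pow 5)))
        have h5 : 2 * v ^ 2 * z₀ = 2 * v ^ 2 * (2 * c₁) := by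
          linear_combination -h1 - v * z₀ * hv4
        exact mul_left_cancel₀ (mul_ne_zero h2 (pow_ne_zero 2 hv0)) h5
  rw [← key.1, ← key.2]
  have : Φ - (ak v / t ^ 2 + ak z₀ / t) = (z - ak z₀) / t := by
    rw [hΦ]; field_simp; ring
  rw [this, htdef]
  exact OGe.div_X_sub (n := 1) hz₀

lemma dLe_X : DLe 1 (RatFunc.X : RatFunc k) := Or.inr RatFunc.intDegree_X.le

lemma dLe_sub_X {A₀ B₀ a b : k} {Φ : RatFunc k} (hΦ : Φ.intDegree = 1)
    (h : cubicR A₀ B₀ * dR Φ ^ 2 = Φ ^ 3 + ak a * Φ + ak b) : DLe 0 (Φ - RatFunc.X) := by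
  have h0 : Φ ≠ 0 := by rintro rfl; simp at hΦ
  have hX := RatFunc.X_ne_zero (K := k)
  have h1 : DLe 0 (Φ / RatFunc.X) := Or.inr (by
    rw [div_eq_mul_inv, RatFunc.intDegree_mul h0 (inv_ne_zero hX), RatFunc.intDegree_inv,
      RatFunc.intDegree_X, hΦ]; norm_num)
  obtain ⟨γ, hγ⟩ := dLe_sub_const h1
  obtain ⟨w, hw⟩ : ∃ w, w = Φ - ak γ * RatFunc.X := ⟨_, rfl⟩
  have hwD : DLe 0 w := by
    have := hγ.mul dLe_X
    have e : (Φ / RatFunc.X - ak γ) * RatFunc.X = w := by rw [hw]; field_simp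
    rw [e] at this
    exact this
  have hΦe : Φ = ak γ * RatFunc.X + w := by rw [hw]; ring
  have hw' := hwD.dR
  have hd : dR Φ = ak γ + dR w := by rw [hΦe, dR_add, dR_const_mul, dR_X, mul_one]
  have hγ0 : γ ≠ 0 := by
    rintro rfl
    rw [map_zero, zero_mul, zero_add] at hΦe
    rw [← hΦe] at hwD
    have := hwD.le h0
    omega
  have hE : ak (γ ^ 2 - γ ^ 3) * RatFunc.X ^ 3 =
      ak (3 * γ ^ 2) * (RatFunc.X * RatFunc.X * w) + ak (3 * γ) * (RatFunc.X * w * w) + w * w * w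
        + ak a * Φ + ak b + -(ak A₀ * (RatFunc.X * (ak γ + dR w) * (ak γ + dR w)))
        + -(ak B₀ * ((ak γ + dR w) * (ak γ + dR w)))
        + -(ak (2 * γ) * (RatFunc.X * RatFunc.X * RatFunc.X * dR w))
        + -(RatFunc.X * RatFunc.X * RatFunc.X * dR w * dR w) := by
    rw [cubicR_eq, hd, hΦe] at h
    rw [hΦe]
    simp only [map_mul, map_sub, map_pow, map_ofNat]
    linear_combination h
  have hg : DLe 0 (ak γ + dR w) := (dLe_const γ).add (hw'.mono (by norm_num))
  have hX2 := (dLe_X (k := k)).mul dLe_X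
  have hX3 := hX2.mul (dLe_X (k := k))
  have hR : DLe 2 (ak (γ ^ 2 - γ ^ 3) * RatFunc.X ^ 3) := by
    rw [hE]
    refine ((((((((?_ : DLe 2 _).add ?_).add ?_).add ?_).add ?_).add ?_).add ?_).add ?_).add ?_
    · exact ((hX2.mul hwD).const_mul _).mono (by norm_num)
    · exact (((dLe_X.mul hwD).mul hwD).const_mul _).mono (by norm_num)
    · exact ((hwD.mul hwD).mul hwD).mono (by norm_num)
    · exact ((hΦ ▸ dLe_intDegree Φ : DLe 1 Φ).const_mul _).mono (by norm_num)
    · exact (dLe_const b).mono (by norm_num)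
    · exact ((((dLe_X.mul hg).mul hg).const_mul _).mono (by norm_num)).neg
    · exact (((hg.mul hg).const_mul _).mono (by norm_num)).neg
    · exact (((hX3.mul hw').const_mul _).mono (by norm_num)).neg
    · exact ((hX3.mul hw').mul hw' |>.mono (by norm_num)).neg
  have hz : γ ^ 2 - γ ^ 3 = 0 := by
    by_contra hne
    have e1 := hR.le (mul_ne_zero ((_root_.map_ne_zero _).2 hne) (pow_ne_zero 3 hX))
    rw [RatFunc.intDegree_mul ((_root_.map_ne_zero _).2 hne) (pow_ne_zero 3 hX), intDegree_const,
      intDegree_pow hX, RatFunc.intDegree_X] at e1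
    norm_num at e1
  have h1 : γ = 1 := by
    apply mul_left_cancel₀ (pow_ne_zero 2 hγ0)
    linear_combination -hz
  rw [h1, map_one, one_mul] at hw
  rwa [← hw]

/-- A solution of degree one at infinity is determined by its poles. -/
lemma eq_of_same_poles [IsAlgClosed k] (h2 : (2 : k) ≠ 0) (h3 : (3 : k) ≠ 0)
    {A₀ B₀ a b a' b' : k} {Φ Φ' : RatFunc k} (hΦ : Φ.intDegree = 1) (hΦ' : Φ'.intDegree = 1)
    (h : cubicR A₀ B₀ * dR Φ ^ 2 = Φ ^ 3 + ak a * Φ + ak b)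
    (h' : cubicR A₀ B₀ * dR Φ' ^ 2 = Φ' ^ 3 + ak a' * Φ' + ak b')
    (hpole : ∀ x, od x Φ < 0 ↔ od x Φ' < 0) : a = a' ∧ b = b' := by
  have hO x : OGe x 0 (Φ - Φ') := by
    by_cases hx : od x Φ < 0
    · obtain ⟨S, hS⟩ := exists_principal_part h2 A₀ B₀ x
      convert (hS Φ a b h hx).sub (hS Φ' a' b' h' ((hpole x).1 hx)) using 1
      ring
    · exact OGe.sub (Or.inr (not_lt.1 hx)) (Or.inr (not_lt.1 (mt (hpole x).2 hx)))
  obtain ⟨P, hP⟩ := exists_poly_of_oGe hO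
  have hD : DLe 0 (r P) := by
    rw [← hP]
    convert (dLe_sub_X hΦ h).add (dLe_sub_X hΦ' h').neg using 1
    ring
  have hdeg : P.natDegree = 0 := by
    rcases eq_or_ne P 0 with rfl | hP0
    · simp
    · have := hD.le (algebraMap_poly_ne_zero hP0)
      rw [RatFunc.intDegree_polynomial] at this
      omega
  obtain ⟨β, rfl⟩ : ∃ β, P = C β := ⟨_, eq_C_of_natDegree_eq_zero hdeg⟩
  have hβ : Φ = Φ' + ak β := by
    have e : r (C β) = ak β := rfl
    rw [← e, ← hP]; ring
  have hd : dR Φ = dR Φ' := by rw [hβ, dR_add, dR_const, add_zero]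
  rw [hd, h', hβ] at h
  have ht := transcendental_of_intDegree (hΦ' ▸ one_pos)
  have hz : C (3 * β) * X ^ 2 + C (3 * β ^ 2 + a - a') * X + C (β ^ 3 + a * β + b - b') = 0 := by
    by_contra hne
    refine ht ⟨_, hne, ?_⟩
    simp only [map_add, map_mul, map_sub, map_pow, aeval_C, aeval_X, map_ofNat]
    linear_combination -h
  have c2 := congrArg (coeff · 2) hz
  have c1 := congrArg (coeff · 1) hz
  have c0 := congrArg (coeff · 0) hz
  simp only [coeff_add, coeff_C_mul, coeff_X_pow, coeff_X, coeff_C, coeff_zero] at c0 c1 c2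
  norm_num at c0 c1 c2
  have hβ0 : β = 0 := c2.resolve_left h3
  rw [hβ0] at c0 c1
  exact ⟨by linear_combination c1, by linear_combination c0⟩

end Uniqueness

section Poles

variable {k : Type} [Field k] {A B A₀ B₀ : k}

local notation "r" => algebraMap k[X] (RatFunc k)
local notation "ak" => algebraMap k (RatFunc k)

lemma od_neg_iff {x : k} {u : RatFunc k} : od x u < 0 ↔ u.denom.eval x = 0 := by
  rcases eq_or_ne u 0 with rfl | hu
  · simp [od]
  · refine ⟨fun h => ?_, od_of_pole hu⟩
    by_contra hne
    have h0 : rootMultiplicity x u.denom = 0 := rootMultiplicity_eq_zero hne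
    unfold od at h
    omega

lemma od_sub_pos {x c : k} {u : RatFunc k} (hu : Transcendental k u) (h0 : u.denom.eval x ≠ 0)
    (h : u.num.eval x = c * u.denom.eval x) : 0 < od x (u - ak c) := by
  have hne : u - ak c ≠ 0 := fun h' => hu (by
    rw [sub_eq_zero.1 h']; exact isAlgebraic_algebraMap c)
  have hc : r (C c) = ak c := rfl
  have hd := algebraMap_poly_ne_zero (RatFunc.denom_ne_zero u)
  have e : u - ak c = r (u.num - C c * u.denom) / r u.denom := by
    rw [map_sub, map_mul, hc]
    conv_lhs => rw [← RatFunc.num_div_denom u]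
    field_simp
  have hnum : u.num - C c * u.denom ≠ 0 := by
    intro h'; rw [h', map_zero, zero_div] at e; exact hne e
  rw [e, od_div x hnum (RatFunc.denom_ne_zero u), rootMultiplicity_eq_zero (p := u.denom) h0]
  have : 0 < rootMultiplicity x (u.num - C c * u.denom) :=
    (rootMultiplicity_pos hnum).2 (by simp [h])
  omega

lemma od_sub_pos_unique {x c c' : k} {u : RatFunc k} (hu : Transcendental k u)
    (h : 0 < od x (u - ak c)) (h' : 0 < od x (u - ak c')) : c = c' :=
  Val.unique (x := x) (u := u) (Or.inr h) (Or.inr h')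

variable [EC A B] [IsAlgClosed k]

lemma zsmul_translation {n : ℤ} (Q : Pt A B k) (τ : FF A B →ₐ[k] FF A B)
    (h : pmap τ (gen A B) = gen A B + cst A B _ Q) :
    pmap τ (n • gen A B) = n • gen A B + cst A B _ ((zsmulAddGroupHom n) Q) := by
  rw [map_zsmul, h, zsmul_add, zsmulAddGroupHom_apply, map_zsmul]

lemma zsmul_mk_eq_zero_iff {n : ℤ} {v s : RatFunc k} {h : Tw A B v s}
    (hn : n • gen A B = opt v s h) (hv : 0 < v.intDegree) {u w : k} (hQ) :
    n • (Pt.mk u w hQ : Pt A B k) = 0 ↔ od u v < 0 := by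
  have hD := translation_hom_eval (h := h.curve) hv (D := zsmulAddGroupHom n)
    (fun Q τ hτ => by
      have := zsmul_translation (n := n) Q τ hτ
      rw [hn] at this
      exact this) hQ
  rw [od_neg_iff]
  refine ⟨hD.1, fun h0 => ?_⟩
  rcases Pt.cases (n • (Pt.mk u w hQ : Pt A B k)) with h' | ⟨x, y, hxy, h'⟩
  · exact h'
  · exact absurd h0 (hD.2 x y hxy h').1

variable [EC A₀ B₀]

/-- The poles of `Ψ` are the points of a finite subgroup. -/
theorem IsNormal.exists_subgroup {d : ℤ} {N : ℕ} {μ ρ Ψ R : RatFunc k} {l : k}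
    (h : IsNormal A B A₀ B₀ d N μ ρ Ψ R l) :
    ∃ T : AddSubgroup (Pt A₀ B₀ k), (∀ t ∈ T, N • t = 0) ∧
      ∀ x y hxy, Pt.mk x y hxy ∈ T ↔ od x Ψ < 0 := by
  obtain ⟨e, he⟩ := IsAlgClosed.exists_pow_nat_eq l (n := 2) (by norm_num)
  have he0 : e ≠ 0 := by rintro rfl; exact h.l_ne (by rw [← he]; norm_num)
  obtain ⟨σ, hσ⟩ : ∃ σ, σ = dR ρ * ak e⁻¹ := ⟨_, rfl⟩
  have hρd : 0 < ρ.intDegree := by rw [h.deg_ρ]; norm_num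
  have hρ := transcendental_of_intDegree hρd
  have hσe : σ ^ 2 * cubicR A B = ρ ^ 3 + ak A₀ * ρ + ak B₀ := by
    have e0 := (_root_.map_ne_zero ak).2 h.l_ne
    apply mul_left_cancel₀ e0
    have e1 : ak l = ak e ^ 2 := by rw [← he, map_pow]
    have e2 : ak e * ak e⁻¹ = 1 := by rw [← map_mul, mul_inv_cancel₀ he0, map_one]
    rw [hσ, ← h.ode_ρ, e1]
    linear_combination (dR ρ ^ 2 * cubicR A B * (ak e * ak e⁻¹ + 1)) * e2
  have hc : (algebraMap (RatFunc k) (FF A B) σ * yF A B) ^ 2 =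
      algebraMap (RatFunc k) (FF A B) ρ ^ 3 + algebraMap k (FF A B) A₀ *
        algebraMap (RatFunc k) (FF A B) ρ + algebraMap k (FF A B) B₀ := by
    have e1 := congrArg (algebraMap (RatFunc k) (FF A B)) hσe
    rw [map_mul, map_pow, map_add, map_add, map_mul, map_pow, ← IsScalarTower.algebraMap_apply,
      ← IsScalarTower.algebraMap_apply, ← yF_sq'] at e1
    rw [mul_pow]; exact e1
  have hodd : pmap (iota A B) (Pt.mk _ _ hc : Pt A₀ B₀ (FF A B)) = -Pt.mk _ _ hc := by
    rw [pmap_mk, Pt.neg_mk, Pt.mk_inj]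
    rw [iota_ratFunc, map_mul, iota_ratFunc, iota_y]
    exact ⟨rfl, by ring⟩
  obtain ⟨D, hD⟩ := exists_translation_hom hodd
  have hDe := fun u w hQ => translation_hom_eval (h := hc) hρd hD (u := u) (w := w) hQ
  obtain ⟨s, hs, hpt⟩ := h.pt
  have hμ : subsR ρ hρ Ψ = μ := h.comp hρ
  have hμd : 0 < μ.intDegree := by
    rw [← hμ, intDegree_subsR hρd, h.deg_ρ, h.deg_Ψ]; norm_num
  have hker u w hQ := zsmul_mk_eq_zero_iff (u := u) (w := w) hpt hμd hQ
  refine ⟨(zsmulAddGroupHom (N : ℤ)).ker.map D, ?_, fun x y hxy => ⟨?_, fun hx => ?_⟩⟩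
  · rintro _ ⟨Q, hQ, rfl⟩
    have hQ' : N • Q = 0 := by simpa using hQ
    rw [← map_nsmul, hQ', map_zero]
  · rintro ⟨Q, hQ, hQx⟩
    rcases Pt.cases Q with rfl | ⟨u, w, hQ', rfl⟩
    · rw [map_zero] at hQx
      exact absurd hQx.symm (Pt.mk_ne_zero _ _ _)
    · have h1 : od u μ < 0 := (hker u w hQ').1 hQ
      obtain ⟨h2, h3⟩ := (hDe u w hQ').2 x y hxy hQx
      have h4 := od_sub_pos hρ h2 h3
      rw [← hμ, od_subsR hρ h4] at h1
      exact (pos_iff_neg_of_mul_neg h1).1 h4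
  · obtain ⟨u, hu⟩ := exists_od_sub_pos hρd x
    obtain ⟨w, hw⟩ := IsAlgClosed.exists_pow_nat_eq (u ^ 3 + A * u + B) (n := 2) (by norm_num)
    have hQN := (hker u w hw).2 (by rw [← hμ, od_subsR hρ hu]; exact mul_neg_of_pos_of_neg hu hx)
    have hmem : D (Pt.mk u w hw) ∈ (zsmulAddGroupHom (N : ℤ)).ker.map D := ⟨_, hQN, rfl⟩
    rcases Pt.cases (D (Pt.mk u w hw)) with h' | ⟨x', y', hxy', h'⟩
    · exfalso
      have h1 := od_neg_iff.2 ((hDe u w hw).1 h')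
      rcases oGe_of_sub hu with h2 | h2
      · rw [h2] at hρd; simp at hρd
      · omega
    · obtain ⟨h2, h3⟩ := (hDe u w hw).2 x' y' hxy' h'
      obtain rfl := od_sub_pos_unique hρ (od_sub_pos hρ h2 h3) hu
      rw [h'] at hmem
      rcases Pt.eq_or_neg (h := hxy) (h' := hxy') with h4 | h4
      · rwa [h4]
      · rw [h4]; exact neg_mem hmem

lemma IsNormal.ode_normalized {d : ℤ} {N : ℕ} {μ ρ Ψ R : RatFunc k} {l : k}
    (h : IsNormal A B A₀ B₀ d N μ ρ Ψ R l) : ∃ ν : k, ν ≠ 0 ∧ 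
      cubicR A₀ B₀ * dR (ak ν * Ψ) ^ 2 =
        (ak ν * Ψ) ^ 3 + ak (ν ^ 2 * A) * (ak ν * Ψ) + ak (ν ^ 3 * B) := by
  have hl := h.l_ne
  refine ⟨(N : k) ^ 2 / l, div_ne_zero (pow_ne_zero 2 h.N_ne) hl, ?_⟩
  obtain ⟨ν, hν⟩ : ∃ ν, ν = (N : k) ^ 2 / l := ⟨_, rfl⟩
  have e : ak l * ak ν = ak (N : k) ^ 2 := by
    rw [← map_mul, ← map_pow, hν, mul_div_cancel₀ _ hl]
  have e0 := (_root_.map_ne_zero ak).2 hl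
  rw [← hν, dR_const_mul]
  simp only [map_mul, map_pow]
  apply mul_left_cancel₀ e0
  have := h.ode_Ψ
  rw [← e] at this
  linear_combination ak ν ^ 2 * this

lemma IsNormal.unique {A' B' : k} [EC A' B'] {d : ℤ} {N : ℕ} {μ ρ Ψ R : RatFunc k} {l : k}
    {d' : ℤ} {N' : ℕ} {μ' ρ' Ψ' R' : RatFunc k} {l' : k}
    (h : IsNormal A B A₀ B₀ d N μ ρ Ψ R l) (h' : IsNormal A' B' A₀ B₀ d' N' μ' ρ' Ψ' R' l')
    (hpole : ∀ x, od x Ψ < 0 ↔ od x Ψ' < 0) : A ^ 3 * B' ^ 2 = A' ^ 3 * B ^ 2 := by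
  obtain ⟨ν, hν, e⟩ := h.ode_normalized
  obtain ⟨ν', hν', e'⟩ := h'.ode_normalized
  have hd : ∀ {ν : k} {Ψ : RatFunc k}, ν ≠ 0 → Ψ.intDegree = 1 → (ak ν * Ψ).intDegree = 1 := by
    intro ν Ψ h1 h2
    rw [RatFunc.intDegree_mul ((_root_.map_ne_zero _).2 h1) (by rintro rfl; simp at h2),
      intDegree_const, h2, zero_add]
  have ho : ∀ {ν : k} {Ψ : RatFunc k} (x : k), ν ≠ 0 → Ψ.intDegree = 1 →
      od x (ak ν * Ψ) = od x Ψ := by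
    intro ν Ψ x h1 h2
    rw [od_mul x ((_root_.map_ne_zero _).2 h1) (by rintro rfl; simp at h2), od_const, zero_add]
  obtain ⟨h1, h2⟩ := eq_of_same_poles (EC.two A B) (EC.three A B) (hd hν h.deg_Ψ)
    (hd hν' h'.deg_Ψ) e e' (fun x => by rw [ho x hν h.deg_Ψ, ho x hν' h'.deg_Ψ]; exact hpole x)
  have h3 := mul_ne_zero (pow_ne_zero 6 hν) (pow_ne_zero 6 hν')
  apply mul_left_cancel₀ h3
  have h4 : (ν ^ 2 * A) ^ 3 * (ν' ^ 3 * B') ^ 2 = (ν' ^ 2 * A') ^ 3 * (ν ^ 3 * B) ^ 2 := by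
    rw [h1, h2]
  linear_combination h4

end Poles

section Torsion

variable {k : Type} [Field k] {A B : k} [EC A B] [IsAlgClosed k]

local notation "r" => algebraMap k[X] (RatFunc k)
local notation "ak" => algebraMap k (RatFunc k)

lemma ht_nsmul_gen (n : ℕ) : ht (n • gen A B) = n ^ 2 := by
  induction n using Nat.strong_induction_on with
  | _ n ih =>
    match n with
    | 0 => rw [zero_nsmul, ht_zero]; rfl
    | 1 => rw [one_nsmul, ht_gen]; rfl
    | n + 2 =>
      have h := ht_add_add_ht_sub (nsmul_mem (gen_mem_odd (A := A) (B := B)) (n + 1)) gen_mem_odd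
      rw [← succ_nsmul, succ_nsmul (gen A B) n, add_sub_cancel_right, ← succ_nsmul,
        ih n (by omega), ih (n + 1) (by omega), ht_gen] at h
      have h' : ht ((n + 2) • gen A B) + n ^ 2 = 2 * ((n + 1) ^ 2 + 1) := h
      nlinarith

/-- The points with a given abscissa. -/
def fiber (A B : k) [EC A B] (u : k) : Set (Pt A B k) := {P | ∃ w h, P = Pt.mk u w h}

lemma fiber_finite (u : k) : (fiber A B u).Finite ∧ (fiber A B u).ncard ≤ 2 ∧
    (u ^ 3 + A * u + B = 0 → (fiber A B u).ncard ≤ 1) := by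
  obtain ⟨w, hw⟩ := IsAlgClosed.exists_pow_nat_eq (u ^ 3 + A * u + B) (n := 2) (by norm_num)
  have hsub : fiber A B u ⊆ {Pt.mk u w hw, -Pt.mk u w hw} := by
    rintro _ ⟨w', h', rfl⟩
    exact Pt.eq_or_neg
  have hfin := Set.toFinite ({Pt.mk u w hw, -Pt.mk u w hw} : Set (Pt A B k))
  refine ⟨hfin.subset hsub, (Set.ncard_le_ncard hsub hfin).trans ((Set.ncard_insert_le _ _).trans
      (by rw [Set.ncard_singleton])),
    fun h => ?_⟩
  have hw0 : w = 0 := by rw [h] at hw; exact pow_eq_zero_iff (by norm_num) |>.1 hw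
  have e : -Pt.mk u w hw = (Pt.mk u w hw : Pt A B k) := by
    rw [Pt.neg_mk, Pt.mk_inj]; exact ⟨rfl, by rw [hw0, neg_zero]⟩
  rw [e, Set.pair_eq_singleton] at hsub
  exact (Set.ncard_le_ncard hsub (Set.finite_singleton _)).trans (Set.ncard_singleton _).le

lemma od_pole_of_ode {μ : RatFunc k} {c : k} (hc : c ≠ 0) {x : k}
    (h : cubicR A B * dR μ ^ 2 = ak c * (μ ^ 3 + ak A * μ + ak B)) (hx : od x μ < 0) :
    od x (cubicR A B) + 2 * od x (dR μ) = 3 * od x μ ∧ od x μ - 1 ≤ od x (dR μ) := by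
  have h0 : μ ≠ 0 := by rintro rfl; simp [od] at hx
  have hc0 := (_root_.map_ne_zero ak).2 hc
  have h3 : od x (μ ^ 3) = 3 * od x μ := od_pow x h0 3
  have h1 : OGe x (od x (μ ^ 3) + 1) (ak A * μ + ak B) :=
    (((oGe_od x μ).const_mul A).mono (by omega)).add ((oGe_const x B).mono (by omega))
  obtain ⟨h4, h5⟩ := od_add_of_lt (pow_ne_zero 3 h0) h1
  rw [← add_assoc] at h4 h5
  have hd : dR μ ≠ 0 := by
    intro hd
    rw [hd] at h
    apply mul_ne_zero hc0 h4
    rw [← h]; ring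
  have h6 := congrArg (od x) h
  rw [od_mul x (cubicR_ne_zero A B) (pow_ne_zero 2 hd), od_mul x hc0 h4, od_const, h5, h3,
    od_pow x hd] at h6
  push_cast at h6
  exact ⟨by linarith, (oGe_od x μ).dR.le hd⟩

lemma torsion_even {n : ℕ} (hn : ((2 * n : ℕ) : k) ≠ 0) :
    {P : Pt A B k | (2 * n) • P = 0}.Finite ∧
      {P : Pt A B k | (2 * n) • P = 0}.ncard ≤ (2 * n) ^ 2 := by
  have hn0 : n ≠ 0 := by rintro rfl; simp at hn
  have hht := ht_nsmul_gen (A := A) (B := B) (2 * n)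
  have hodd : (2 * n) • gen A B ∈ odd A B := nsmul_mem gen_mem_odd _
  obtain ⟨μ, s, hμ, e, hrd, -⟩ := exists_embedding_of_ht hodd (by rw [hht]; positivity)
  rw [hht] at hrd
  have hpos : 0 < μ.intDegree := by
    refine intDegree_double_pos (P := n • gen A B) (nsmul_mem gen_mem_odd _) (h := hμ) ?_
    rw [← e, two_mul, add_nsmul]
  have hode := ((isDiff_gen (A := A) (B := B)).zsmul ((2 * n : ℕ) : ℤ))
  rw [natCast_zsmul, e] at hode
  have hode := hode.ode
  rw [mul_one, Int.cast_natCast, ← map_pow] at hode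
  have e' : ((2 * n : ℕ) : ℤ) • gen A B = opt μ s hμ := by rw [natCast_zsmul, e]
  have hker u w hQ := zsmul_mk_eq_zero_iff (u := u) (w := w) e' hpos hQ
  simp only [natCast_zsmul] at hker
  have hsub : {P : Pt A B k | (2 * n) • P = 0} ⊆
      {0} ∪ ⋃ u ∈ μ.denom.roots.toFinset, fiber A B u := by
    intro P hP
    rcases P.cases with rfl | ⟨u, w, h, rfl⟩
    · exact Or.inl rfl
    · right
      have := (hker u w h).1 hP
      simp only [Set.mem_iUnion]
      refine ⟨u, ?_, w, h, rfl⟩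
      rw [Multiset.mem_toFinset, mem_roots (RatFunc.denom_ne_zero μ)]
      exact od_neg_iff.1 this
  have hfin : (⋃ u ∈ μ.denom.roots.toFinset, fiber A B u).Finite :=
    Set.Finite.biUnion (Finset.finite_toSet _) fun u _ => (fiber_finite u).1
  have hfin' := (Set.finite_singleton (0 : Pt A B k)).union hfin
  refine ⟨hfin'.subset hsub, (Set.ncard_le_ncard hsub hfin').trans ?_⟩
  have hcard : (⋃ u ∈ μ.denom.roots.toFinset, fiber A B u).ncard ≤ μ.denom.natDegree := by
    refine (Finset.set_ncard_biUnion_le _ _).trans ?_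
    refine le_trans ?_ (card_roots' μ.denom)
    rw [← Multiset.toFinset_sum_count_eq]
    refine Finset.sum_le_sum fun u hu => ?_
    rw [Multiset.mem_toFinset, mem_roots (RatFunc.denom_ne_zero μ)] at hu
    have ho := od_neg_iff.2 hu
    rw [count_roots]
    have h1 : od u μ = -(rootMultiplicity u μ.denom : ℤ) := by
      have h0 : ¬ μ.num.IsRoot u := fun h' =>
        LT.IsCoprime.not_eval (RatFunc.isCoprime_num_denom μ) u (Prod.ext h' hu)
      unfold od
      rw [rootMultiplicity_eq_zero h0]; simp
    by_cases hf : u ^ 3 + A * u + B = 0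
    · have := (fiber_finite (A := A) (B := B) u).2.2 hf
      omega
    · have h2 := (fiber_finite (A := A) (B := B) u).2.1
      obtain ⟨h3, h4⟩ := od_pole_of_ode (pow_ne_zero 2 hn) hode ho
      have h5 : od u (cubicR A B) = 0 := by
        have : od u (cubicR A B) = rootMultiplicity u (cubic A B) := od_poly u (cubic_ne_zero A B)
        rw [this, rootMultiplicity_eq_zero (by simpa [cubic] using hf)]; rfl
      omega
  have hdeg : μ.denom.natDegree + 1 ≤ (2 * n) ^ 2 := by
    rw [← hrd]
    unfold RatFunc.intDegree at hpos
    have : μ.num.natDegree ≤ rd μ := le_max_left _ _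
    omega
  refine (Set.ncard_union_le _ _).trans ?_
  rw [Set.ncard_singleton]
  omega

/-- There are at most `n ^ 2` points of order dividing `n`. -/
theorem torsion_card {n : ℕ} (hn : (n : k) ≠ 0) :
    {P : Pt A B k | n • P = 0}.Finite ∧ {P : Pt A B k | n • P = 0}.ncard ≤ n ^ 2 := by
  have h2 := EC.two A B
  obtain ⟨hfin, hcard⟩ := torsion_even (A := A) (B := B) (n := n)
    (by push_cast; exact mul_ne_zero h2 hn)
  obtain ⟨e₁, e₂, e₃, h0, hA, hB, h12, h13, h23⟩ := exists_two_torsion A B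
  have hz : ∀ e, (e = e₁ ∨ e = e₂ ∨ e = e₃) → (0 : k) ^ 2 = e ^ 3 + A * e + B := by
    have h3 : e₃ = -e₁ - e₂ := by linear_combination h0
    rintro e (rfl | rfl | rfl) <;> rw [hA, hB] <;> subst h3 <;> ring
  obtain ⟨p₁, hp₁⟩ : ∃ p : Pt A B k, p = Pt.mk e₁ 0 (hz _ (Or.inl rfl)) := ⟨_, rfl⟩
  obtain ⟨p₂, hp₂⟩ : ∃ p : Pt A B k, p = Pt.mk e₂ 0 (hz _ (Or.inr (Or.inl rfl))) := ⟨_, rfl⟩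
  obtain ⟨p₃, hp₃⟩ : ∃ p : Pt A B k, p = Pt.mk e₃ 0 (hz _ (Or.inr (Or.inr rfl))) := ⟨_, rfl⟩
  have hdbl : ∀ e h, (Pt.mk e 0 h : Pt A B k) + Pt.mk e 0 h = 0 := fun e h => by
    have := Pt.mk_add_mk_neg (h := h) (h' := by rwa [neg_zero])
    rwa [Pt.mk_congr rfl neg_zero] at this
  have hV : ∀ v ∈ ({0, p₁, p₂, p₃} : Finset (Pt A B k)), v + v = 0 := by
    intro v hv
    simp only [Finset.mem_insert, Finset.mem_singleton] at hv
    rcases hv with rfl | rfl | rfl | rfl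
    · rw [add_zero]
    · rw [hp₁, hdbl]
    · rw [hp₂, hdbl]
    · rw [hp₃, hdbl]
  have hVc : ({0, p₁, p₂, p₃} : Finset (Pt A B k)).card = 4 := by
    rw [card_insert_of_notMem, card_insert_of_notMem, card_insert_of_notMem, card_singleton]
    · rw [hp₂, hp₃, Finset.mem_singleton, Pt.mk_inj]; exact fun h => h23 h.1
    · rw [hp₁, hp₂, hp₃, Finset.mem_insert, Finset.mem_singleton, Pt.mk_inj, Pt.mk_inj]
      exact fun h => h.elim (fun h => h12 h.1) (fun h => h13 h.1)
    · rw [hp₁, hp₂, hp₃]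
      simp only [Finset.mem_insert, Finset.mem_singleton, not_or]
      exact ⟨(Pt.mk_ne_zero _ _ _).symm, (Pt.mk_ne_zero _ _ _).symm, (Pt.mk_ne_zero _ _ _).symm⟩
  choose half hhalf using fun Q : Pt A B k => exists_add_self_eq Q
  have hfin1 : {P : Pt A B k | n • P = 0}.Finite :=
    hfin.subset fun P hP => by
      show (2 * n) • P = 0
      rw [mul_nsmul', hP, nsmul_zero]
  refine ⟨hfin1, ?_⟩
  have hinj : (hfin1.toFinset ×ˢ ({0, p₁, p₂, p₃} : Finset (Pt A B k))).card ≤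
      hfin.toFinset.card := by
    refine Finset.card_le_card_of_injOn (fun x => half x.1 + x.2) ?_ ?_
    · rintro ⟨P, v⟩ hx
      simp only [Finset.coe_product, Set.mem_prod, Finset.mem_coe, Set.Finite.mem_toFinset] at hx
      simp only [Set.Finite.coe_toFinset]
      show (2 * n) • (half P + v) = 0
      rw [mul_nsmul, two_nsmul]
      have e : half P + v + (half P + v) = (half P + half P) + (v + v) := by abel
      rw [e, ← hhalf, hV v hx.2, add_zero]
      exact hx.1
    · rintro ⟨P, v⟩ hx ⟨P', v'⟩ hx' h
      simp only [Finset.coe_product, Set.mem_prod, Finset.mem_coe] at hx hx'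
      have h : half P + v = half P' + v' := h
      have hP : P = P' := by
        have e1 : P = (half P + v) + (half P + v) := by
          rw [show half P + v + (half P + v) = (half P + half P) + (v + v) by abel, ← hhalf,
            hV v hx.2, add_zero]
        have e2 : P' = (half P' + v') + (half P' + v') := by
          rw [show half P' + v' + (half P' + v') = (half P' + half P') + (v' + v') by abel,
            ← hhalf, hV v' hx'.2, add_zero]
        rw [e1, e2, h]
      subst hP
      exact Prod.ext rfl (add_left_cancel h)
  rw [card_product, hVc, ← Set.ncard_eq_toFinset_card _ hfin1,
    ← Set.ncard_eq_toFinset_card _ hfin] at hinj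
  nlinarith

end Torsion

section Subgroups

lemma exists_basis_of_finite {T : Type*} [AddCommGroup T] [Finite T] :
    ∃ (h z : T) (e : ℕ), e ∣ addOrderOf h ∧ addOrderOf h = AddMonoid.exponent T ∧ e • z = 0 ∧
      (∀ i : ℤ, i • z ∈ AddSubgroup.zmultiples h → (e : ℤ) ∣ i) ∧
      ∀ t, ∃ c : ℤ, e • (t - c • h) = 0 := by
  obtain ⟨h, hh⟩ := AddMonoid.exists_addOrderOf_eq_exponent
    (AddMonoid.ExponentExists.of_finite (G := T))
  obtain ⟨q, hq⟩ := AddMonoid.exists_addOrderOf_eq_exponent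
    (AddMonoid.ExponentExists.of_finite (G := T ⧸ AddSubgroup.zmultiples h))
  obtain ⟨z₀, rfl⟩ := QuotientAddGroup.mk_surjective q
  obtain ⟨e, he⟩ : ∃ e, e = AddMonoid.exponent (T ⧸ AddSubgroup.zmultiples h) := ⟨_, rfl⟩
  rw [← he] at hq
  have hb : ∀ t : T, addOrderOf h • t = 0 := fun t => by
    rw [hh]; exact AddMonoid.exponent_nsmul_eq_zero t
  have hbpos : 0 < addOrderOf h := addOrderOf_pos h
  have heb : e ∣ addOrderOf h := by
    rw [he]
    refine AddMonoid.exponent_dvd_of_forall_nsmul_eq_zero fun g => ?_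
    obtain ⟨t, rfl⟩ := QuotientAddGroup.mk_surjective g
    rw [← QuotientAddGroup.mk_nsmul, hb, QuotientAddGroup.mk_zero]
  obtain ⟨f, hf⟩ := heb
  have key : ∀ t : T, ∃ c : ℤ, e • (t - c • h) = 0 := by
    intro t
    have h1 : e • t ∈ AddSubgroup.zmultiples h := by
      rw [← QuotientAddGroup.eq_zero_iff, QuotientAddGroup.mk_nsmul, he]
      exact AddMonoid.exponent_nsmul_eq_zero _
    obtain ⟨c, hc⟩ := AddSubgroup.mem_zmultiples_iff.1 h1
    have h2 : ((addOrderOf h : ℕ) : ℤ) ∣ f * c := by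
      rw [addOrderOf_dvd_iff_zsmul_eq_zero, mul_smul, hc, natCast_zsmul, ← mul_nsmul, ← hf, hb]
    obtain ⟨c', rfl⟩ : (e : ℤ) ∣ c := by
      rw [hf] at h2
      push_cast at h2
      have hf0 : (f : ℤ) ≠ 0 := by
        rintro h0
        have : f = 0 := by exact_mod_cast h0
        rw [this] at hf; omega
      rw [mul_comm (e : ℤ)] at h2
      exact (mul_dvd_mul_iff_left hf0).1 h2
    refine ⟨c', ?_⟩
    rw [nsmul_sub, ← hc, mul_smul, natCast_zsmul, sub_self]
  obtain ⟨c, hc⟩ := key z₀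
  refine ⟨h, z₀ - c • h, e, ⟨f, hf⟩, hh, hc, fun i hi => ?_, key⟩
  rw [← hq, addOrderOf_dvd_iff_zsmul_eq_zero, ← QuotientAddGroup.mk_zsmul,
    QuotientAddGroup.eq_zero_iff]
  have : i • z₀ = i • (z₀ - c • h) + (i * c) • h := by rw [smul_sub, mul_smul]; abel
  rw [this]
  exact add_mem hi (AddSubgroup.zsmul_mem_zmultiples h _)

variable {G : Type*} [AddCommGroup G]

/-- A finite subgroup of a group with the torsion of an elliptic curve is the sum of a full
torsion subgroup and a cyclic group. -/
lemma mem_subgroup_iff {N : ℕ} (hN : N ≠ 0)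
    (hG : ∀ n, n ∣ N → {P : G | n • P = 0}.Finite ∧ {P : G | n • P = 0}.ncard ≤ n ^ 2)
    (T : AddSubgroup G) (hT : ∀ t ∈ T, N • t = 0) :
    ∃ (h : G) (e : ℕ), e ∣ N ∧ addOrderOf h ∣ N ∧
      ∀ t, t ∈ T ↔ ∃ g ∈ AddSubgroup.zmultiples h, e • (t - g) = 0 := by
  have hfin : Finite T := ((hG N dvd_rfl).1.subset fun t ht => hT t ht).to_subtype
  obtain ⟨h, z, e, heb, hexp, hz, hzi, hdec⟩ := exists_basis_of_finite (T := T)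
  have hbN : addOrderOf h ∣ N := by
    rw [hexp]
    exact AddMonoid.exponent_dvd_of_forall_nsmul_eq_zero fun t => Subtype.ext (hT t t.2)
  obtain ⟨f, hf⟩ := heb
  have hb := addOrderOf_pos h
  have he : 0 < e := Nat.pos_of_ne_zero fun h0 => by rw [h0] at hf; omega
  have hfpos : 0 < f := Nat.pos_of_ne_zero fun h0 => by rw [h0] at hf; omega
  have heN : e ∣ N := (Dvd.intro f hf.symm).trans hbN
  obtain ⟨hEfin, hEcard⟩ := hG e heN
  let W : Finset G := (range e ×ˢ range e).image
    fun x : ℕ × ℕ => ((x.1 • z + x.2 • (f • h) : T) : G)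
  have hWsub : (W : Set G) ⊆ {P : G | e • P = 0} := by
    intro P hP
    simp only [W, Finset.coe_image] at hP
    obtain ⟨⟨i, j⟩, -, rfl⟩ := hP
    have h1 : e • (i • z + j • (f • h) : T) = 0 := by
      rw [nsmul_add, nsmul_left_comm z i e, hz, nsmul_zero, zero_add, nsmul_left_comm _ j e,
        ← mul_nsmul' h e f, ← hf, addOrderOf_nsmul_eq_zero, nsmul_zero]
    exact congrArg (Subtype.val : T → G) h1
  have hWc : W.card = e ^ 2 := by
    rw [Finset.card_image_of_injOn, card_product, card_range, sq]
    rintro ⟨i, j⟩ hx ⟨i', j'⟩ hx' heq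
    simp only [Finset.coe_product, Set.mem_prod, Finset.mem_coe, Finset.mem_range] at hx hx'
    have heq : (i • z + j • (f • h) : T) = i' • z + j' • (f • h) := Subtype.ext heq
    have hi : ((i : ℤ) - i') • z ∈ AddSubgroup.zmultiples h := by
      have : ((i : ℤ) - i') • z = (((j' : ℤ) - j) * f) • h := by
        rw [sub_smul, mul_smul, sub_smul, natCast_zsmul, natCast_zsmul, natCast_zsmul,
          natCast_zsmul, natCast_zsmul]
        rw [sub_eq_sub_iff_add_eq_add, heq]; abel
      rw [this]
      exact AddSubgroup.zsmul_mem_zmultiples h _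
    have hii : i = i' := by
      have := Int.eq_zero_of_abs_lt_dvd (hzi _ hi) (by
        rw [abs_lt]; constructor <;> linarith [hx.1, hx'.1])
      omega
    subst hii
    have hj := add_left_cancel heq
    have hjz : (((j : ℤ) - j') * f) • h = 0 := by
      rw [mul_smul, sub_smul, natCast_zsmul, natCast_zsmul, natCast_zsmul, hj, sub_self]
    rw [← addOrderOf_dvd_iff_zsmul_eq_zero, hf] at hjz
    push_cast at hjz
    have hjd : (e : ℤ) ∣ (j : ℤ) - j' :=
      (mul_dvd_mul_iff_right (by exact_mod_cast hfpos.ne')).1 hjz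
    have := Int.eq_zero_of_abs_lt_dvd hjd (by
      rw [abs_lt]; constructor <;> linarith [hx.2, hx'.2])
    exact Prod.ext rfl (by show j = j'; omega)
  have hWeq : (W : Set G) = {P : G | e • P = 0} :=
    Set.eq_of_subset_of_ncard_le hWsub (by rw [Set.ncard_coe_finset, hWc]; exact hEcard) hEfin
  have hsub : ∀ P : G, e • P = 0 → P ∈ T := by
    intro P hP
    have : P ∈ (W : Set G) := by rw [hWeq]; exact hP
    simp only [W, Finset.coe_image] at this
    obtain ⟨x, -, rfl⟩ := this
    exact Subtype.prop _
  refine ⟨h, e, heN, by rwa [AddSubgroup.addOrderOf_coe], fun t => ⟨fun ht => ?_, ?_⟩⟩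
  · obtain ⟨c, hc⟩ := hdec ⟨t, ht⟩
    refine ⟨c • (h : G), AddSubgroup.zsmul_mem_zmultiples _ _, ?_⟩
    exact congrArg (Subtype.val : T → G) hc
  · rintro ⟨g, hg, hge⟩
    obtain ⟨c, rfl⟩ := AddSubgroup.mem_zmultiples_iff.1 hg
    have := add_mem (hsub _ hge) (AddSubgroup.zsmul_mem T h.2 c)
    rwa [sub_add_cancel] at this

lemma le_card_divisors_mul_totient (n : ℕ) : n ≤ n.divisors.card * n.totient := by
  rcases Nat.eq_zero_or_pos n with rfl | hn
  · simp
  conv_lhs => rw [← Nat.sum_totient n]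
  refine (Finset.sum_le_card_nsmul _ _ n.totient fun d hd => ?_)
  exact Nat.le_of_dvd (Nat.totient_pos.2 hn)
    (Nat.totient_dvd_of_dvd (Nat.dvd_of_mem_divisors hd))

/-- The cyclic subgroups of order `b`. -/
def cyclicSubgroups (G : Type*) [AddCommGroup G] (b : ℕ) : Set (AddSubgroup G) :=
  {C | ∃ h, addOrderOf h = b ∧ C = AddSubgroup.zmultiples h}

lemma cyclicSubgroups_card {b : ℕ} (hb : 0 < b)
    (hG : {P : G | b • P = 0}.Finite ∧ {P : G | b • P = 0}.ncard ≤ b ^ 2) :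
    (cyclicSubgroups G b).Finite ∧ (cyclicSubgroups G b).ncard ≤ b * b.divisors.card := by
  obtain ⟨hfin, hcard⟩ := hG
  have hsub : cyclicSubgroups G b ⊆ AddSubgroup.zmultiples '' {P : G | b • P = 0} := by
    rintro _ ⟨h, rfl, rfl⟩
    exact ⟨h, addOrderOf_nsmul_eq_zero h, rfl⟩
  have hCfin := (hfin.image _).subset hsub
  refine ⟨hCfin, ?_⟩
  choose! g hg hgC using fun (C : AddSubgroup G) (hC : C ∈ cyclicSubgroups G b) => hC
  have hinj : (hCfin.toFinset ×ˢ (range b).filter b.Coprime).card ≤ hfin.toFinset.card := by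
    refine Finset.card_le_card_of_injOn (fun x => x.2 • g x.1) ?_ ?_
    · rintro ⟨C, i⟩ hx
      simp only [Finset.coe_product, Set.mem_prod, Finset.mem_coe, Set.Finite.mem_toFinset] at hx
      simp only [Set.Finite.coe_toFinset]
      show b • (i • g C) = 0
      rw [nsmul_left_comm, ← hg C hx.1]
      rw [hg C hx.1]
      nth_rewrite 1 [← hg C hx.1]
      rw [addOrderOf_nsmul_eq_zero, nsmul_zero]
    · rintro ⟨C, i⟩ hx ⟨C', i'⟩ hx' h
      simp only [Finset.coe_product, Set.mem_prod, Finset.mem_coe, Set.Finite.mem_toFinset,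
        Finset.mem_filter, Finset.mem_range] at hx hx'
      have h : i • g C = i' • g C' := h
      have hz : ∀ C i, C ∈ cyclicSubgroups G b → b.Coprime i →
          AddSubgroup.zmultiples (i • g C) = C := by
        intro C i hC hi
        nth_rewrite 2 [hgC C hC]
        have ho : (addOrderOf (g C)).Coprime i := by rwa [hg C hC]
        apply le_antisymm
        · rw [AddSubgroup.zmultiples_le]
          exact AddSubgroup.nsmul_mem_zmultiples _ _
        · rw [AddSubgroup.zmultiples_le]
          obtain ⟨m, hm⟩ := exists_nsmul_eq_self_of_coprime ho.symm
          have := AddSubgroup.nsmul_mem _ (AddSubgroup.mem_zmultiples (i • g C)) m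
          rwa [hm] at this
      have hCC : C = C' := by rw [← hz C i hx.1 hx.2.2, ← hz C' i' hx'.1 hx'.2.2, h]
      subst hCC
      refine Prod.ext rfl ?_
      have hb' := hg C hx.1
      exact nsmul_injOn_Iio_addOrderOf (by rw [hb']; exact hx.2.1) (by rw [hb']; exact hx'.2.1) h
  rw [card_product, ← Nat.totient_eq_card_coprime, ← Set.ncard_eq_toFinset_card _ hCfin,
    ← Set.ncard_eq_toFinset_card _ hfin] at hinj
  have h1 := le_card_divisors_mul_totient b
  have h2 := Nat.totient_pos.2 hb
  refine Nat.le_of_mul_le_mul_right (?_ : _ * b.totient ≤ _ * b.totient) h2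
  calc _ ≤ b ^ 2 := hinj.trans hcard
    _ = b * b := sq b
    _ ≤ b * (b.divisors.card * b.totient) := Nat.mul_le_mul_left _ h1
    _ = _ := by ring

theorem subgroups_card {N : ℕ} (hN : N ≠ 0)
    (hG : ∀ n, n ∣ N → {P : G | n • P = 0}.Finite ∧ {P : G | n • P = 0}.ncard ≤ n ^ 2) :
    {T : AddSubgroup G | ∀ t ∈ T, N • t = 0}.Finite ∧
      {T : AddSubgroup G | ∀ t ∈ T, N • t = 0}.ncard ≤ N * N.divisors.card ^ 3 := by
  have hC b (hb : b ∈ N.divisors) := cyclicSubgroups_card (G := G) (Nat.pos_of_mem_divisors hb)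
    (hG b (Nat.dvd_of_mem_divisors hb))
  let f : AddSubgroup G × ℕ → Set G := fun x => {t | ∃ g ∈ x.1, x.2 • (t - g) = 0}
  let S : Set (AddSubgroup G × ℕ) := ⋃ b ∈ N.divisors, cyclicSubgroups G b ×ˢ (N.divisors : Set ℕ)
  have hSfin : S.Finite := Set.Finite.biUnion (Finset.finite_toSet _) fun b hb =>
    (hC b hb).1.prod (Finset.finite_toSet _)
  have hSc : S.ncard ≤ N * N.divisors.card ^ 3 := by
    refine (Finset.set_ncard_biUnion_le _ _).trans ?_
    have hle : ∀ b ∈ N.divisors, (cyclicSubgroups G b ×ˢ (N.divisors : Set ℕ)).ncard ≤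
        N * N.divisors.card ^ 2 := by
      intro b hb
      rw [Set.ncard_prod, Set.ncard_coe_finset]
      have h1 := Nat.le_of_dvd (Nat.pos_of_ne_zero hN) (Nat.dvd_of_mem_divisors hb)
      have h2 := Finset.card_le_card (Nat.divisors_subset_of_dvd hN (Nat.dvd_of_mem_divisors hb))
      calc _ ≤ b * b.divisors.card * N.divisors.card := Nat.mul_le_mul_right _ (hC b hb).2
        _ ≤ N * N.divisors.card * N.divisors.card := by gcongr
        _ = _ := by ring
    refine (Finset.sum_le_card_nsmul _ _ _ hle).trans (le_of_eq ?_)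
    rw [smul_eq_mul]; ring
  have hmap : (SetLike.coe '' {T : AddSubgroup G | ∀ t ∈ T, N • t = 0} : Set (Set G)) ⊆ f '' S := by
    rintro _ ⟨T, hT, rfl⟩
    obtain ⟨h, e, he, hh, hmem⟩ := mem_subgroup_iff hN hG T hT
    refine ⟨(AddSubgroup.zmultiples h, e), ?_, ?_⟩
    · simp only [S, Set.mem_iUnion]
      exact ⟨addOrderOf h, Nat.mem_divisors.2 ⟨hh, hN⟩, ⟨h, rfl, rfl⟩,
        Nat.mem_divisors.2 ⟨he, hN⟩⟩
    · ext t; exact (hmem t).symm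
  have hfin := ((hSfin.image f).subset hmap)
  refine ⟨hfin.of_finite_image SetLike.coe_injective.injOn, ?_⟩
  rw [← Set.ncard_image_of_injective _ (SetLike.coe_injective (A := AddSubgroup G))]
  exact ((Set.ncard_le_ncard hmap (hSfin.image f)).trans (Set.ncard_image_le hSfin)).trans hSc

end Subgroups

/-- The divisor function is `O(n ^ (1 / 9))`. -/
lemma exists_card_divisors_pow_le : ∃ C : ℕ, ∀ {n : ℕ}, n ≠ 0 → n.divisors.card ^ 9 ≤ C * n := by
  refine ⟨(18 ^ 9) ^ (Finset.range 512).card, fun {n} hn => ?_⟩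
  have h2 : ∀ a : ℕ, a + 1 ≤ 2 ^ a := fun a => Nat.lt_two_pow_self
  have h18 : ∀ a : ℕ, (a + 1) ^ 9 ≤ 18 ^ 9 * 2 ^ a := by
    intro a
    have h : a + 1 ≤ 9 * 2 ^ (a / 9) := by have := h2 (a / 9); omega
    calc (a + 1) ^ 9 ≤ (9 * 2 ^ (a / 9)) ^ 9 := Nat.pow_le_pow_left h 9
      _ = 9 ^ 9 * 2 ^ (a / 9 * 9) := by rw [mul_pow, ← pow_mul]
      _ ≤ 18 ^ 9 * 2 ^ a := Nat.mul_le_mul (by norm_num)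
          (Nat.pow_le_pow_right (by norm_num) (Nat.div_mul_le_self a 9))
  rw [Nat.card_divisors hn, ← Finset.prod_pow]
  have hstep : ∀ p ∈ n.primeFactors, (n.factorization p + 1) ^ 9 ≤
      (if p < 512 then 18 ^ 9 else 1) * p ^ n.factorization p := by
    intro p hp
    have hp2 := (Nat.prime_of_mem_primeFactors hp).two_le
    split_ifs with h
    · exact (h18 _).trans (Nat.mul_le_mul_left _ (Nat.pow_le_pow_left hp2 _))
    · rw [one_mul]
      calc _ ≤ (2 ^ n.factorization p) ^ 9 := Nat.pow_le_pow_left (h2 _) 9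
        _ = (2 ^ 9) ^ n.factorization p := by rw [← pow_mul, ← pow_mul, mul_comm]
        _ ≤ _ := Nat.pow_le_pow_left (by omega) _
  refine (Finset.prod_le_prod' hstep).trans ?_
  rw [Finset.prod_mul_distrib]
  have hprod : ∏ p ∈ n.primeFactors, p ^ n.factorization p = n :=
    Nat.prod_factorization_pow_eq_self hn
  rw [hprod, ← Finset.prod_filter, Finset.prod_const]
  refine Nat.mul_le_mul_right _ (Nat.pow_le_pow_right (by norm_num) ?_)
  exact Finset.card_le_card fun p hp => Finset.mem_range.2 (Finset.mem_filter.1 hp).2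

section Classes

variable {k : Type} [Field k]

/-- The values of `A ^ 3 / B ^ 2` of the curves whose data have normal form on `A₀, B₀`. -/
def normalClasses (A₀ B₀ : k) (d : ℤ) (N : ℕ) : Set k :=
  {c | ∃ (A B : k) (_ : EC A B) (_ : EC A₀ B₀) (μ ρ Ψ R : RatFunc k) (l : k), B ≠ 0 ∧
    A ^ 3 = c * B ^ 2 ∧ IsNormal A B A₀ B₀ d N μ ρ Ψ R l}

lemma normalClasses_card [IsAlgClosed k] (A₀ B₀ : k) (d : ℤ) {N : ℕ}
    (hN : (N : k) ≠ 0) : (normalClasses A₀ B₀ d N).Finite ∧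
      (normalClasses A₀ B₀ d N).ncard ≤ N * N.divisors.card ^ 3 := by
  rcases (normalClasses A₀ B₀ d N).eq_empty_or_nonempty with he | ⟨c, A, B, hAB, hEC, -⟩
  · rw [he]; simp
  obtain ⟨hfin, hcard⟩ := subgroups_card (G := Pt A₀ B₀ k) (N := N)
    (by rintro rfl; simp at hN) fun n hn => torsion_card (by
      rintro h0
      obtain ⟨e, rfl⟩ := hn
      rw [Nat.cast_mul, h0, zero_mul] at hN
      exact hN rfl)
  have hex : ∀ c ∈ normalClasses A₀ B₀ d N, ∃ T : AddSubgroup (Pt A₀ B₀ k), (∀ t ∈ T, N • t = 0) ∧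
      ∃ (A B : k) (_ : EC A B) (μ ρ Ψ R : RatFunc k) (l : k), B ≠ 0 ∧ A ^ 3 = c * B ^ 2 ∧
        IsNormal A B A₀ B₀ d N μ ρ Ψ R l ∧ ∀ x y hxy, Pt.mk x y hxy ∈ T ↔ od x Ψ < 0 := by
    rintro c ⟨A, B, hAB, _, μ, ρ, Ψ, R, l, hB, hc, h⟩
    obtain ⟨T, hT, hTm⟩ := h.exists_subgroup
    exact ⟨T, hT, A, B, hAB, μ, ρ, Ψ, R, l, hB, hc, h, hTm⟩
  choose! T hT A B hAB μ ρ Ψ R l hB hc hn hTm using hex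
  have hmaps : Set.MapsTo T (normalClasses A₀ B₀ d N) {T | ∀ t ∈ T, N • t = 0} := hT
  have hinj : Set.InjOn T (normalClasses A₀ B₀ d N) := by
    intro c hcm c' hcm' hTT
    have := hAB c hcm
    have := hAB c' hcm'
    have hu := (hn c hcm).unique (hn c' hcm') fun x => by
      obtain ⟨y, hy⟩ := IsAlgClosed.exists_pow_nat_eq (x ^ 3 + A₀ * x + B₀) (n := 2) (by norm_num)
      rw [← hTm c hcm x y hy, ← hTm c' hcm' x y hy, hTT]
    rw [hc c hcm, hc c' hcm'] at hu
    have h1 := hB c hcm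
    have h2 := hB c' hcm'
    refine mul_right_cancel₀ (mul_ne_zero (pow_ne_zero 2 h1) (pow_ne_zero 2 h2)) ?_
    linear_combination hu
  exact ⟨Set.Finite.of_finite_image (hfin.subset hmaps.image_subset) hinj,
    (Set.ncard_le_ncard_of_injOn T hmaps hinj hfin).trans hcard⟩

end Classes

/-- The values of `A ^ 3 / B ^ 2` on the curves `Y² = X³ + AX + B` over `𝔽_p` with given trace. -/
def traceClasses (p : ℕ) (a : ℤ) : Set (ZMod p) :=
  {c | ∃ A B : ZMod p, B ≠ 0 ∧ 4 * A ^ 3 + 27 * B ^ 2 ≠ 0 ∧ A ^ 3 = c * B ^ 2 ∧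
    frobTrace p A B = a}

theorem traceClasses_card {d : ℤ} (hd : d < 0) : ∃ K p₀ : ℕ, ∀ p : ℕ, p.Prime → p₀ ≤ p →
    ∀ a m : ℤ, a ≠ 0 → a ^ 2 - 4 * p = d * m ^ 2 →
      (traceClasses p a).ncard ^ 3 ≤ K * p ^ 2 := by
  obtain ⟨n, hn⟩ : ∃ n, n = d.natAbs := ⟨_, rfl⟩
  obtain ⟨C, hC⟩ := exists_card_divisors_pow_le
  obtain ⟨M, hM⟩ : ∃ M, M = (n + 1) * (5 * n + 12) + 1 := ⟨_, rfl⟩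
  refine ⟨M ^ 3 * (C * 256), n ^ 2 + 20 * n + 100, fun p hp hpp a m ha hm => ?_⟩
  have : Fact p.Prime := ⟨hp⟩
  let k := AlgebraicClosure (ZMod p)
  have : CharP k p := charP_of_injective_algebraMap (algebraMap (ZMod p) k).injective p
  have hsmall : ∀ z : ℤ, z ≠ 0 → |z| < p → (z : k) ≠ 0 := by
    intro z hz hzp h0
    rw [CharP.intCast_eq_zero_iff k p] at h0
    exact hz (Int.eq_zero_of_abs_lt_dvd h0 hzp)
  have hp100 : (n : ℤ) ^ 2 + 20 * n + 100 ≤ p := by exact_mod_cast hpp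
  have hdn : d = -n := by rw [hn]; omega
  have hn1 : (1 : ℤ) ≤ n := by omega
  have h2 : (2 : k) ≠ 0 := by
    have := hsmall 2 (by norm_num) (by rw [abs_of_pos] <;> nlinarith); exact_mod_cast this
  have h3 : (3 : k) ≠ 0 := by
    have := hsmall 3 (by norm_num) (by rw [abs_of_pos] <;> nlinarith); exact_mod_cast this
  have hdk : (d : k) ≠ 0 := hsmall d hd.ne (by rw [abs_of_neg hd]; nlinarith)
  -- `m` is prime to `p`
  have ha2 : 0 < a ^ 2 := by positivity
  have hmp : ¬ (p : ℤ) ∣ m := by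
    intro hdvd
    have h1 : (p : ℤ) ∣ a := by
      refine (Nat.prime_iff_prime_int.1 hp).dvd_of_dvd_pow (n := 2) ?_
      have : a ^ 2 = p * 4 + d * m ^ 2 := by linarith
      rw [this]
      exact dvd_add (dvd_mul_right _ _) ((dvd_pow hdvd two_ne_zero).mul_left _)
    have h2 := Int.le_of_dvd ha2 (pow_dvd_pow_of_dvd h1 2)
    nlinarith [sq_nonneg m]
  have hm2 : m ^ 2 ≤ 4 * p := by nlinarith [sq_nonneg m]
  have hmN : ((m.natAbs : ℕ) : k) ≠ 0 := by
    rw [Ne, CharP.cast_eq_zero_iff k p, ← Int.natCast_dvd]; exact hmp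
  obtain ⟨N, hN⟩ : ∃ N, N = 2 * m.natAbs := ⟨_, rfl⟩
  have hNk : (N : k) ≠ 0 := by
    rw [hN, Nat.cast_mul]; exact mul_ne_zero (by exact_mod_cast h2) hmN
  have hN0 : N ≠ 0 := by rintro h; rw [h] at hNk; simp at hNk
  obtain ⟨D, hD0, hDdeg, hD⟩ := exists_bound hdk h2 h3 n (fun i hi => by
      have := hsmall (2 * i + 3) (by omega) (by
        rw [abs_of_pos (by omega)]; nlinarith)
      rwa [Int.cast_add, Int.cast_mul, Int.cast_natCast, Int.cast_ofNat, Int.cast_ofNat] at this) (fun e he hen => by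
      have := hsmall (e ^ 2 - d) (by nlinarith) (by
        rw [abs_of_pos (by nlinarith)]; nlinarith)
      rw [← sub_ne_zero]; exact_mod_cast this)
  obtain ⟨q, hq⟩ : ∃ q, p = 2 * q + 1 := by
    rcases hp.eq_two_or_odd' with h | h
    · omega
    · exact h
  let E : Finset (k × k) := insert (0, 1) (D.roots.toFinset.image fun s => (-3, 2 + s))
  have hE : E.card ≤ M := by
    refine (Finset.card_insert_le _ _).trans ?_
    rw [hM]
    exact Nat.succ_le_succ ((Finset.card_image_le.trans (Multiset.toFinset_card_le _)).trans
      ((card_roots' D).trans hDdeg))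
  have hsub : algebraMap (ZMod p) k '' traceClasses p a ⊆
      ⋃ e ∈ E, normalClasses e.1 e.2 d N := by
    rintro _ ⟨c, ⟨A, B, hB, hdisc, hc, htr⟩, rfl⟩
    have hEC : EC (algebraMap (ZMod p) k A) (algebraMap (ZMod p) k B) := ⟨h2, h3, by
      have := (_root_.map_ne_zero (algebraMap (ZMod p) k)).2 hdisc
      simpa only [map_add, map_mul, map_pow, map_ofNat] using this⟩
    have htr' : tr A B = a := by
      rw [← htr, tr, affCard, frobTrace, numPoints]
      push_cast
      ring
    obtain ⟨μ, γ, δ, h⟩ := exists_isCM (k := k) (A := A) (B := B) hq (by omega) hd hmN (by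
      rw [htr', hm]; simp)
    rw [← hN] at h
    obtain ⟨A₀, B₀, hEC₀, ρ, Ψ, R, l, hA₀, hnorm⟩ := exists_isNormal h hdk
    have hmem : (A₀, B₀) ∈ E := by
      rcases hA₀ with rfl | ⟨rfl, rfl⟩
      · refine Finset.mem_insert_of_mem (Finset.mem_image.2 ⟨B₀ - 2, ?_, by rw [add_sub_cancel]⟩)
        rw [Multiset.mem_toFinset, mem_roots hD0]
        refine hD _ R hnorm.deg_R (by rw [hnorm.rd_R, hn]) ?_
        rw [add_sub_cancel]
        exact hnorm.ode_R
      · exact Finset.mem_insert_self _ _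
    simp only [Set.mem_iUnion]
    refine ⟨_, hmem, _, _, hEC, hEC₀, μ, ρ, Ψ, R, l,
      (_root_.map_ne_zero (algebraMap (ZMod p) k)).2 hB, ?_, hnorm⟩
    rw [← map_pow, hc, map_mul, map_pow]
  have hfin : (⋃ e ∈ E, normalClasses e.1 e.2 d N).Finite :=
    Set.Finite.biUnion (Finset.finite_toSet _) fun e _ => (normalClasses_card _ _ d hNk).1
  have hcard : (traceClasses p a).ncard ≤ M * (N * N.divisors.card ^ 3) := by
    rw [← Set.ncard_image_of_injective _ (algebraMap (ZMod p) k).injective]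
    refine (Set.ncard_le_ncard hsub hfin).trans ((Finset.set_ncard_biUnion_le _ _).trans ?_)
    refine (Finset.sum_le_card_nsmul _ _ _ fun e _ => (normalClasses_card _ _ d hNk).2).trans ?_
    rw [smul_eq_mul]
    exact Nat.mul_le_mul_right _ hE
  have hN4 : N ^ 4 ≤ 256 * p ^ 2 := by
    have h1 : m.natAbs ^ 2 ≤ 4 * p := by
      have := Int.natAbs_sq m
      zify; rw [sq_abs]; exact hm2
    calc N ^ 4 = 16 * (m.natAbs ^ 2) ^ 2 := by rw [hN]; ring
      _ ≤ 16 * (4 * p) ^ 2 := Nat.mul_le_mul_left _ (Nat.pow_le_pow_left h1 2)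
      _ = _ := by ring
  calc (traceClasses p a).ncard ^ 3 ≤ (M * (N * N.divisors.card ^ 3)) ^ 3 :=
        Nat.pow_le_pow_left hcard 3
    _ = M ^ 3 * (N ^ 3 * N.divisors.card ^ 9) := by ring
    _ ≤ M ^ 3 * (N ^ 3 * (C * N)) := by gcongr; exact hC hN0
    _ = M ^ 3 * C * N ^ 4 := by ring
    _ ≤ M ^ 3 * C * (256 * p ^ 2) := Nat.mul_le_mul_left _ hN4
    _ = _ := by ring

section Family

variable {f g : ℤ[X]}

/-- A nonconstant `j`-invariant gives a nonvanishing minor of the coefficients of `f ^ 3`, `g ^ 2`. -/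
lemma exists_minor_ne_zero (hfg : Nondeg f g) : ∃ i j : ℕ,
    (f ^ 3).coeff i * (g ^ 2).coeff j - (f ^ 3).coeff j * (g ^ 2).coeff i ≠ 0 := by
  by_contra! h
  obtain ⟨hD, hj⟩ := hfg
  obtain ⟨P, hP⟩ : ∃ P, P = f.map (Int.castRingHom ℚ) := ⟨_, rfl⟩
  obtain ⟨Q, hQ⟩ : ∃ Q, Q = g.map (Int.castRingHom ℚ) := ⟨_, rfl⟩
  have hmap : (Dpoly f g).map (Int.castRingHom ℚ) = -16 * (4 * P ^ 3 + 27 * Q ^ 2) := by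
    rw [Dpoly, hP, hQ]; simp
  have hD' : (Dpoly f g).map (Int.castRingHom ℚ) ≠ 0 :=
    (Polynomial.map_ne_zero_iff (RingHom.injective_int _)).2 hD
  rw [hmap] at hj hD'
  rw [← hP] at hj
  rcases eq_or_ne (g ^ 2) 0 with hg | hg
  · have : Q = 0 := by rw [hQ, pow_eq_zero_iff two_ne_zero |>.1 hg, Polynomial.map_zero]
    refine hj ⟨1728, ?_⟩
    rw [this, show (C 1728 : ℚ[X]) = 1728 from rfl]; ring
  · obtain ⟨j, hjc⟩ : ∃ j, (g ^ 2).coeff j ≠ 0 := by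
      by_contra! h0; exact hg (Polynomial.ext fun n => by rw [h0, coeff_zero])
    have hjq : ((g ^ 2).coeff j : ℚ) ≠ 0 := by exact_mod_cast hjc
    obtain ⟨c, hc⟩ : ∃ c : ℚ, c = (f ^ 3).coeff j / (g ^ 2).coeff j := ⟨_, rfl⟩
    have hPQ : P ^ 3 = C c * Q ^ 2 := by
      rw [hP, hQ, ← Polynomial.map_pow, ← Polynomial.map_pow]
      ext i
      rw [coeff_C_mul, coeff_map, coeff_map, hc, div_mul_eq_mul_div, eq_div_iff hjq]
      have := h i j
      simp only [eq_intCast]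
      exact_mod_cast sub_eq_zero.1 this
    have h4 : 4 * c + 27 ≠ 0 := by
      intro h0
      apply hD'
      have : (4 * C c + 27 : ℚ[X]) = 0 := by
        rw [show (4 * C c + 27 : ℚ[X]) = C (4 * c + 27) by
          simp only [map_add, map_mul, map_ofNat], h0, C_0]
      rw [hPQ]
      linear_combination (-16 * Q ^ 2) * this
    refine hj ⟨1728 * 64 * c / (16 * (4 * c + 27)), ?_⟩
    have : C (1728 * 64 * c / (16 * (4 * c + 27))) * (16 * (4 * C c + 27)) =
        (1728 * 64 * C c : ℚ[X]) := by
      rw [show (16 * (4 * C c + 27) : ℚ[X]) = C (16 * (4 * c + 27)) by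
          simp only [map_add, map_mul, map_ofNat], ← C_mul,
        div_mul_cancel₀ _ (mul_ne_zero (by norm_num) h4)]
      simp only [map_mul, map_ofNat]
    rw [mul_pow, hPQ]
    linear_combination Q ^ 2 * this

/-- The parameters in `𝔽_p` of the fibres of good reduction with trace `a`. -/
def traceParams (f g : ℤ[X]) (p : ℕ) (a : ℤ) : Set (ZMod p) :=
  {u | ((Dpoly f g).map (Int.castRingHom (ZMod p))).eval u ≠ 0 ∧
    frobTrace p ((f.map (Int.castRingHom (ZMod p))).eval u)
      ((g.map (Int.castRingHom (ZMod p))).eval u) = a}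

theorem traceParams_card (hfg : Nondeg f g) {d : ℤ} (hd : d < 0) : ∃ K p₀ : ℕ, ∀ p : ℕ,
    p.Prime → p₀ ≤ p → ∀ a m : ℤ, a ≠ 0 → a ^ 2 - 4 * p = d * m ^ 2 →
      (traceParams f g p a).ncard ^ 3 ≤ K * p ^ 2 := by
  obtain ⟨K, p₀, hK⟩ := traceClasses_card hd
  obtain ⟨i, j, hij⟩ := exists_minor_ne_zero hfg
  obtain ⟨W, hW⟩ : ∃ W, W = (f ^ 3).coeff i * (g ^ 2).coeff j -
    (f ^ 3).coeff j * (g ^ 2).coeff i := ⟨_, rfl⟩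
  rw [← hW] at hij
  obtain ⟨M, hM⟩ : ∃ M, M = 3 * f.natDegree + 2 * g.natDegree := ⟨_, rfl⟩
  refine ⟨M ^ 3 * (4 * (1 + K)), p₀ + W.natAbs + 1, fun p hp hpp a m ha hm => ?_⟩
  have : Fact p.Prime := ⟨hp⟩
  have hWp : (W : ZMod p) ≠ 0 := by
    rw [Ne, ZMod.intCast_zmod_eq_zero_iff_dvd, ← Int.dvd_natAbs, Int.natCast_dvd_natCast]
    exact fun h => by have := Nat.le_of_dvd (Int.natAbs_pos.2 hij) h; omega
  obtain ⟨P, hP⟩ : ∃ P, P = f.map (Int.castRingHom (ZMod p)) := ⟨_, rfl⟩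
  obtain ⟨Q, hQ⟩ : ∃ Q, Q = g.map (Int.castRingHom (ZMod p)) := ⟨_, rfl⟩
  have hWPQ : (W : ZMod p) = (P ^ 3).coeff i * (Q ^ 2).coeff j - (P ^ 3).coeff j * (Q ^ 2).coeff i := by
    rw [hP, hQ, ← Polynomial.map_pow, ← Polynomial.map_pow, hW]
    simp only [coeff_map, eq_intCast]
    push_cast; ring
  have hQ0 : Q ≠ 0 := by
    rintro h; rw [h] at hWPQ; exact hWp (by rw [hWPQ]; simp)
  have hc0 : ∀ c : ZMod p, P ^ 3 - C c * Q ^ 2 ≠ 0 := by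
    intro c h
    rw [sub_eq_zero.1 h, coeff_C_mul, coeff_C_mul] at hWPQ
    exact hWp (by rw [hWPQ]; ring)
  have hPdeg : P.natDegree ≤ f.natDegree := by rw [hP]; exact natDegree_map_le
  have hQdeg : Q.natDegree ≤ g.natDegree := by rw [hQ]; exact natDegree_map_le
  have hcdeg : ∀ c : ZMod p, (P ^ 3 - C c * Q ^ 2).natDegree ≤ M := by
    intro c
    refine (natDegree_sub_le _ _).trans (max_le ?_ ?_)
    · rw [natDegree_pow]; omega
    · refine (natDegree_C_mul_le _ _).trans ?_
      rw [natDegree_pow]; omega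
  have hfin : (traceClasses p a).Finite := Set.toFinite _
  have hsub : traceParams f g p a ⊆ (Q.roots.toFinset ∪ hfin.toFinset.biUnion
      fun c => (P ^ 3 - C c * Q ^ 2).roots.toFinset : Finset (ZMod p)) := by
    rintro u ⟨hu, htr⟩
    rw [Finset.mem_coe, Finset.mem_union]
    rw [← hP, ← hQ] at htr
    have hdisc : 4 * P.eval u ^ 3 + 27 * Q.eval u ^ 2 ≠ 0 := by
      rintro h0
      apply hu
      have : (Dpoly f g).map (Int.castRingHom (ZMod p)) = -16 * (4 * P ^ 3 + 27 * Q ^ 2) := by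
        rw [Dpoly, hP, hQ]; simp
      rw [this]
      simp [h0]
    rcases eq_or_ne (Q.eval u) 0 with h | h
    · left; rw [Multiset.mem_toFinset, mem_roots hQ0]; exact h
    · right
      have hc : P.eval u ^ 3 = P.eval u ^ 3 / Q.eval u ^ 2 * Q.eval u ^ 2 :=
        (div_mul_cancel₀ _ (pow_ne_zero 2 h)).symm
      refine Finset.mem_biUnion.2 ⟨P.eval u ^ 3 / Q.eval u ^ 2, ?_, ?_⟩
      · rw [Set.Finite.mem_toFinset]
        exact ⟨_, _, h, hdisc, hc, htr⟩
      · rw [Multiset.mem_toFinset, mem_roots (hc0 _), IsRoot.def]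
        simp only [eval_sub, eval_mul, eval_pow, eval_C]
        rw [← hc, sub_self]
  have hle : (traceParams f g p a).ncard ≤ M * (1 + (traceClasses p a).ncard) := by
    refine (Set.ncard_le_ncard hsub (Finset.finite_toSet _)).trans ?_
    rw [Set.ncard_coe_finset]
    refine (Finset.card_union_le _ _).trans ?_
    rw [mul_add, mul_one]
    refine add_le_add ?_ ?_
    · exact ((Multiset.toFinset_card_le _).trans (card_roots' Q)).trans (by omega)
    · refine Finset.card_biUnion_le.trans ?_
      rw [Set.ncard_eq_toFinset_card _ hfin, mul_comm]
      exact Finset.sum_le_card_nsmul _ _ _ fun c _ =>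
        ((Multiset.toFinset_card_le _).trans (card_roots' _)).trans (hcdeg c)
  have hs := hK p hp (by omega) a m ha hm
  obtain ⟨s, hs'⟩ : ∃ s, s = (traceClasses p a).ncard := ⟨_, rfl⟩
  rw [← hs'] at hs hle
  have h1 : (1 + s) ^ 3 ≤ 4 * (1 + s ^ 3) := by
    zify
    nlinarith [mul_nonneg (sq_nonneg ((s : ℤ) - 1)) (by positivity : (0 : ℤ) ≤ s + 1)]
  have hp2 : 1 ≤ p ^ 2 := Nat.one_le_pow _ _ hp.pos
  calc _ ≤ (M * (1 + s)) ^ 3 := Nat.pow_le_pow_left hle 3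
    _ = M ^ 3 * (1 + s) ^ 3 := mul_pow _ _ _
    _ ≤ M ^ 3 * (4 * (1 + K) * p ^ 2) := Nat.mul_le_mul_left _ (by nlinarith)
    _ = _ := by ring

end Family

section Counting

lemma card_filter_residue_le {p : ℕ} (hp : p.Prime) (S : Set (ZMod p)) (T : ℕ) :
    ((Finset.Icc 1 T).filter fun t : ℕ => (t : ZMod p) ∈ S).card ≤ S.ncard * (T / p + 1) := by
  have : Fact p.Prime := ⟨hp⟩
  have hfin : S.Finite := Set.toFinite _
  rw [Set.ncard_eq_toFinset_card _ hfin, ← Finset.card_range (T / p + 1), ← Finset.card_product]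
  refine Finset.card_le_card_of_injOn (fun t => ((t : ZMod p), t / p)) ?_ ?_
  · intro t ht
    have ht := Finset.mem_filter.1 (Finset.mem_coe.1 ht)
    refine Finset.mem_coe.2 (Finset.mem_product.2 ⟨(Set.Finite.mem_toFinset _).2 ht.2, ?_⟩)
    exact Finset.mem_range.2 (Nat.lt_succ_of_le (Nat.div_le_div_right (Finset.mem_Icc.1 ht.1).2))
  · intro t _ t' _ h
    obtain ⟨h1, h2⟩ := Prod.ext_iff.1 h
    have h1 : t % p = t' % p := (ZMod.natCast_eq_natCast_iff' _ _ _).1 h1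
    have h2 : t / p = t' / p := h2
    rw [← Nat.div_add_mod t p, ← Nat.div_add_mod t' p, h1, h2]

lemma sum_inv_sqrt_le (Y : ℕ) : ∑ m ∈ Finset.Icc 1 Y, 1 / √(m : ℝ) ≤ 2 * √(Y : ℝ) := by
  induction Y with
  | zero => simp
  | succ n ih =>
    rw [Finset.sum_Icc_succ_top (by omega)]
    have h1 : 0 < √((n + 1 : ℕ) : ℝ) := Real.sqrt_pos.2 (by positivity)
    have h2 := Real.sqrt_nonneg (n : ℝ)
    have h3 := Real.sq_sqrt (by positivity : (0 : ℝ) ≤ ((n + 1 : ℕ) : ℝ))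
    have h4 := Real.sq_sqrt (by positivity : (0 : ℝ) ≤ (n : ℝ))
    push_cast at h1 h3 ih ⊢
    have : 1 / √((n : ℝ) + 1) ≤ 2 * (√((n : ℝ) + 1) - √n) := by
      rw [div_le_iff₀ h1]
      nlinarith [sq_nonneg (√((n : ℝ) + 1) - √n)]
    linarith

lemma sum_filter_le {F : ℚ → ℝ} (hF : ∀ t, 0 ≤ F t) (T : ℕ) (P : ℚ → Prop) [DecidablePred P] :
    ∑ t ∈ (Finset.Icc 1 T).filter fun t => P (t : ℚ), F (t : ℚ) ≤
      ∑ t ∈ Finset.Icc 1 T, F ((t : ℕ) : ℚ) := by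
  rw [← Finset.sum_image (f := F) (g := fun t : ℕ => (t : ℚ)) Nat.cast_injective.injOn]
  refine Finset.sum_le_sum_of_subset_of_nonneg (fun t ht => ?_) fun _ _ _ => hF _
  have ht := (Finset.mem_filter.1 ht).1
  simpa [Finset.mem_sup, eq_comm] using ht

/-- The pairs `(t, p)` with `p₀ ≤ p` counted by the sum. -/
def pairs (f g : ℤ[X]) (d : ℤ) (p₀ T X : ℕ) : Finset (ℕ × ℕ) :=
  (Finset.Icc 1 T ×ˢ Finset.Icc 1 X).filter fun z => p₀ ≤ z.2 ∧ z.2.Prime ∧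
    goodRed f g z.2 (z.1 : ℚ) ∧ apE f g z.2 (z.1 : ℚ) ≠ 0 ∧
      ∃ m : ℤ, 0 < m ∧ (apE f g z.2 (z.1 : ℚ)) ^ 2 - 4 * (z.2 : ℤ) = d * m ^ 2

variable (f g : ℤ[X]) (d : ℤ)

lemma sum_piK_le (p₀ T : ℕ) (x : ℝ) :
    ∑ t ∈ Finset.Icc 1 T, piK f g d ((t : ℕ) : ℚ) x ≤ p₀ * T + (pairs f g d p₀ T ⌊x⌋₊).card := by
  calc
    _ ≤ ∑ t ∈ Finset.Icc 1 T, (p₀ + ((Finset.Icc 1 ⌊x⌋₊).filter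
        fun p => (t, p) ∈ pairs f g d p₀ T ⌊x⌋₊).card) := by
      refine Finset.sum_le_sum fun t ht => ?_
      refine (Finset.card_le_card fun p hp => ?_).trans ((Finset.card_union_le _ _).trans
        (Nat.add_le_add_right (Finset.card_range p₀).le _))
      obtain ⟨hpI, hpp, hp⟩ := Finset.mem_filter.1 hp
      rcases lt_or_ge p p₀ with h | h
      · exact Finset.mem_union_left _ (Finset.mem_range.2 h)
      · exact Finset.mem_union_right _ (Finset.mem_filter.2 ⟨hpI,
          Finset.mem_filter.2 ⟨Finset.mem_product.2 ⟨ht, hpI⟩, h, hpp, hp⟩⟩)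
    _ = p₀ * T + ∑ t ∈ Finset.Icc 1 T, ((Finset.Icc 1 ⌊x⌋₊).filter
        fun p => (t, p) ∈ pairs f g d p₀ T ⌊x⌋₊).card := by
      rw [Finset.sum_add_distrib, Finset.sum_const, Nat.card_Icc, smul_eq_mul,
        Nat.add_sub_cancel, mul_comm]
    _ = _ := by
      congr 1
      simp only [Finset.card_filter]
      rw [← Finset.sum_product' (f := fun t p => if (t, p) ∈ pairs f g d p₀ T ⌊x⌋₊ then 1 else 0),
        ← Finset.card_filter]
      congr 1
      ext z
      rw [Finset.mem_filter]
      exact ⟨fun h => h.2, fun h => ⟨(Finset.mem_filter.1 h).1, h⟩⟩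

variable {f g d}

lemma card_pairs_le (hfg : Nondeg f g) (hd : d < 0) : ∃ (K : ℝ) (p₀ : ℕ), 0 < K ∧
    ∀ (T : ℕ) (w : ℝ), 1 ≤ w → ∀ X : ℕ, (X : ℝ) ≤ w ^ 12 →
      ((pairs f g d p₀ T X).card : ℝ) ≤ K * (T * w ^ 10 + w ^ 20) := by
  obtain ⟨K, p₀, hK⟩ := traceParams_card hfg hd
  refine ⟨48 * (K + 1), p₀, by positivity, fun T w hw X hX => ?_⟩
  obtain ⟨Y, hY⟩ : ∃ Y, Y = Nat.sqrt (4 * X) := ⟨_, rfl⟩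
  have hw0 : 0 < w := by linarith
  have hYX : Y ^ 2 ≤ 4 * X := by rw [hY]; exact Nat.sqrt_le' _
  have hYw : (Y : ℝ) ≤ 2 * w ^ 6 := by
    refine le_of_pow_le_pow_left₀ (n := 2) (by norm_num) (by positivity) ?_
    have : (Y : ℝ) ^ 2 ≤ 4 * X := by exact_mod_cast hYX
    nlinarith
  let B : Finset (ℤ × ℕ) := Finset.Icc (-(Y : ℤ)) Y ×ˢ Finset.Icc 1 Y
  have hex : ∀ z ∈ pairs f g d p₀ T X, ∃ m : ℕ, (apE f g z.2 (z.1 : ℚ), m) ∈ B ∧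
      (apE f g z.2 (z.1 : ℚ)) ^ 2 - 4 * (z.2 : ℤ) = d * (m : ℤ) ^ 2 := by
    intro z hz
    obtain ⟨hzI, -, -, -, -, m, hm, h⟩ := Finset.mem_filter.1 hz
    have hzX := (Finset.mem_Icc.1 (Finset.mem_product.1 hzI).2).2
    have hzX : (z.2 : ℤ) ≤ X := by exact_mod_cast hzX
    obtain ⟨m, rfl⟩ := Int.eq_ofNat_of_zero_le hm.le
    obtain ⟨a, ha⟩ : ∃ a, a = apE f g z.2 (z.1 : ℚ) := ⟨_, rfl⟩
    rw [← ha] at h ⊢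
    have hsq : ∀ n : ℕ, (n : ℤ) ^ 2 ≤ 4 * X → n ≤ Y := fun n hn => by
      rw [hY, Nat.le_sqrt']; exact_mod_cast hn
    have hmY := hsq m (by nlinarith [sq_nonneg a])
    have haY := hsq a.natAbs (by rw [Int.natAbs_sq]; nlinarith [sq_nonneg (m : ℤ)])
    refine ⟨m, Finset.mem_product.2 ⟨Finset.mem_Icc.2 ?_, Finset.mem_Icc.2 ?_⟩, h⟩ <;> omega
  choose! μ hμB hμ using hex
  obtain ⟨φ, hφ⟩ : ∃ φ : ℕ × ℕ → ℤ × ℕ, φ = fun z => (apE f g z.2 (z.1 : ℚ), μ z) := ⟨_, rfl⟩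
  have hmaps : ∀ z ∈ pairs f g d p₀ T X, φ z ∈ B := by rw [hφ]; exact hμB
  have hfib : ∀ b ∈ B, (((pairs f g d p₀ T X).filter fun z => φ z = b).card : ℝ) ≤
      (K + 1) * (2 * T * (1 / √(b.2 : ℝ)) + w ^ 8) := by
    rintro ⟨a, m⟩ hb
    have hm1 : 1 ≤ m := (Finset.mem_Icc.1 (Finset.mem_product.1 hb).2).1
    rcases ((pairs f g d p₀ T X).filter fun z => φ z = (a, m)).eq_empty_or_nonempty with he | ⟨z, hz⟩
    · rw [he, Finset.card_empty, Nat.cast_zero]; positivity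
    have hfm : ∀ z ∈ (pairs f g d p₀ T X).filter fun z => φ z = (a, m),
        apE f g z.2 (z.1 : ℚ) = a ∧ a ^ 2 - 4 * (z.2 : ℤ) = d * (m : ℤ) ^ 2 := by
      intro z hz
      obtain ⟨hz, hφz⟩ := Finset.mem_filter.1 hz
      rw [hφ] at hφz
      obtain ⟨h1, h2⟩ := Prod.ext_iff.1 hφz
      have h1 : apE f g z.2 (z.1 : ℚ) = a := h1
      have h2 : μ z = m := h2
      have := hμ z hz
      rw [h1, h2] at this
      exact ⟨h1, this⟩
    obtain ⟨hza, hzm⟩ := hfm z hz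
    obtain ⟨p, hpz⟩ : ∃ p, p = z.2 := ⟨_, rfl⟩
    obtain ⟨hzI, hp₀, hp, -, ha0, -⟩ := Finset.mem_filter.1 (Finset.mem_filter.1 hz).1
    have hpX := (Finset.mem_Icc.1 (Finset.mem_product.1 hzI).2).2
    rw [hza] at ha0
    rw [← hpz] at hp₀ hp hzm hpX
    have hr := hK p hp hp₀ a m ha0 hzm
    obtain ⟨r, hr'⟩ : ∃ r, r = (traceParams f g p a).ncard := ⟨_, rfl⟩
    rw [← hr'] at hr
    have hcard : ((pairs f g d p₀ T X).filter fun z => φ z = (a, m)).card ≤ r * (T / p + 1) := by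
      rw [hr']
      refine le_trans (Finset.card_le_card_of_injOn Prod.fst ?_ ?_)
        (card_filter_residue_le hp (traceParams f g p a) T)
      · intro y hy
        obtain ⟨hya, hym⟩ := hfm y hy
        have hyp : y.2 = p := by omega
        obtain ⟨hyI, -, -, hgood, -⟩ := Finset.mem_filter.1 (Finset.mem_filter.1 hy).1
        rw [hyp] at hya hgood
        refine Finset.mem_coe.2 (Finset.mem_filter.2 ⟨(Finset.mem_product.1 hyI).1, ?_⟩)
        have hred : redQ p (y.1 : ℚ) = (y.1 : ZMod p) := by simp [redQ]
        have h2 := hgood.2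
        rw [apE, hred] at hya
        rw [hred] at h2
        exact ⟨h2, hya⟩
      · intro y hy y' hy' h
        have h1 := (hfm y hy).2
        have h2 := (hfm y' hy').2
        exact Prod.ext h (by omega)
    -- pass to the cube root of `p`
    obtain ⟨y, hy⟩ : ∃ y, y = (p : ℝ) ^ ((1 : ℝ) / 3) := ⟨_, rfl⟩
    have hp0 : (0 : ℝ) < p := by exact_mod_cast hp.pos
    have hy0 : 0 < y := by rw [hy]; positivity
    have hy3 : y ^ 3 = p := by
      rw [hy, ← Real.rpow_natCast, ← Real.rpow_mul hp0.le]; norm_num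
    have hyw : y ≤ w ^ 4 := by
      refine le_of_pow_le_pow_left₀ (n := 3) (by norm_num) (by positivity) ?_
      rw [hy3, ← pow_mul]
      exact le_trans (by exact_mod_cast hpX) hX
    have hry : (r : ℝ) ≤ (K + 1) * y ^ 2 := by
      refine le_of_pow_le_pow_left₀ (n := 3) (by norm_num) (by positivity) ?_
      have h1 : (r : ℝ) ^ 3 ≤ K * p ^ 2 := by exact_mod_cast hr
      have h2 : (K : ℝ) ≤ (K + 1) ^ 3 := by
        nlinarith [pow_nonneg (Nat.cast_nonneg (α := ℝ) K) 2, pow_nonneg (Nat.cast_nonneg (α := ℝ) K) 3]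
      calc (r : ℝ) ^ 3 ≤ K * (y ^ 3) ^ 2 := by rw [hy3]; exact h1
        _ ≤ (K + 1) ^ 3 * (y ^ 3) ^ 2 := by gcongr
        _ = _ := by ring
    have hms : 0 < √(m : ℝ) := Real.sqrt_pos.2 (by exact_mod_cast hm1)
    have hym : √(m : ℝ) ≤ 2 * y := by
      refine le_of_pow_le_pow_left₀ (n := 6) (by norm_num) (by positivity) ?_
      have h1 : (√(m : ℝ)) ^ 6 = (m : ℝ) ^ 3 := by
        rw [show (6 : ℕ) = 2 * 3 from rfl, pow_mul, Real.sq_sqrt (by positivity)]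
      have h2 : (m : ℝ) ^ 2 ≤ 4 * p := by
        have : (m : ℤ) ^ 2 ≤ 4 * p := by nlinarith [sq_nonneg a, sq_nonneg (m : ℤ)]
        exact_mod_cast this
      have h3 : (1 : ℝ) ≤ m := by exact_mod_cast hm1
      calc _ = (m : ℝ) ^ 3 := h1
        _ ≤ (m : ℝ) ^ 4 := pow_le_pow_right₀ h3 (by norm_num)
        _ = ((m : ℝ) ^ 2) ^ 2 := by ring
        _ ≤ (4 * y ^ 3) ^ 2 := by rw [hy3]; gcongr
        _ ≤ (2 * y) ^ 6 := by nlinarith [pow_pos hy0 6]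
    have hTy : (T : ℝ) / y ≤ 2 * T * (1 / √(m : ℝ)) := by
      rw [mul_one_div, div_le_div_iff₀ hy0 hms]
      nlinarith [Nat.cast_nonneg (α := ℝ) T]
    calc _ ≤ ((r * (T / p + 1) : ℕ) : ℝ) := by exact_mod_cast hcard
      _ ≤ (K + 1) * y ^ 2 * (T / y ^ 3 + 1) := by
        push_cast
        gcongr
        rw [hy3]; exact Nat.cast_div_le
      _ = (K + 1) * (T / y + y ^ 2) := by field_simp
      _ ≤ (K + 1) * (2 * T * (1 / √(m : ℝ)) + (w ^ 4) ^ 2) := by gcongr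
      _ = _ := by ring
  have hsqY : √(Y : ℝ) ≤ 2 * w ^ 3 := by
    rw [Real.sqrt_le_left (by positivity)]
    nlinarith [pow_pos hw0 6]
  rcases Nat.eq_zero_or_pos Y with hY0 | hY0
  · have : (pairs f g d p₀ T X) = ∅ := Finset.eq_empty_of_forall_notMem fun z hz => by
      have := hmaps z hz
      simp [B, hY0] at this
    rw [this, Finset.card_empty, Nat.cast_zero]; positivity
  have hY1 : (1 : ℝ) ≤ Y := by exact_mod_cast hY0
  rw [Finset.card_eq_sum_card_fiberwise hmaps]
  push_cast
  refine (Finset.sum_le_sum hfib).trans ?_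
  simp only [B, Finset.sum_product]
  rw [Finset.sum_const, Int.card_Icc, nsmul_eq_mul, ← Finset.mul_sum,
    Finset.sum_add_distrib, ← Finset.mul_sum, Finset.sum_const, Nat.card_Icc, nsmul_eq_mul]
  have hc : ((((Y : ℤ) + 1 - -(Y : ℤ)).toNat : ℕ) : ℝ) ≤ 3 * Y := by
    have : ((Y : ℤ) + 1 - -(Y : ℤ)).toNat ≤ 3 * Y := by omega
    exact_mod_cast this
  rw [Nat.add_sub_cancel]
  have hS := sum_inv_sqrt_le Y
  calc _ ≤ 3 * (Y : ℝ) * ((K + 1) * (2 * T * (2 * √(Y : ℝ)) + Y * w ^ 8)) := by gcongr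
    _ ≤ 3 * (2 * w ^ 6) * ((K + 1) * (2 * T * (2 * (2 * w ^ 3)) + 2 * w ^ 6 * w ^ 8)) := by gcongr
    _ = 12 * (K + 1) * (4 * (T * w ^ 9) + w ^ 20) := by ring
    _ ≤ 48 * (K + 1) * (T * w ^ 10 + w ^ 20) := by
      have h1 : w ^ 9 ≤ w ^ 10 := pow_le_pow_right₀ hw (by norm_num)
      have h2 : (0 : ℝ) ≤ w ^ 20 := by positivity
      have h3 : (T : ℝ) * w ^ 9 ≤ T * w ^ 10 := by gcongr
      have hK0 : (0 : ℝ) ≤ K + 1 := by positivity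
      nlinarith

end Counting

end LT

/-- Theorem 1.9 (Lang–Trotter for Frobenius fields on average over
`I(T) = {1, …, T}`), for the imaginary quadratic field `K = ℚ(√d)`. -/
theorem LT_fields_average_IT (f g : Polynomial ℤ) (hfg : Nondeg f g)
    (d : ℤ) (hd : d < 0) (hsf : Squarefree d) :
    ∃ C : ℝ, 0 < C ∧ ∀ T : ℕ, 0 < T → ∀ x : ℝ, 2 ≤ x →
      (∑ t ∈ (Finset.Icc 1 T).filter fun t => aeval (t : ℚ) (Dpoly f g) ≠ 0,
          (piK f g d (t : ℚ) x : ℝ)) ≤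
        C * ((T : ℝ) ^ ((1 : ℝ) / 2) * x ^ ((4 : ℝ) / 3) + (T : ℝ) * x ^ ((5 : ℝ) / 6)) := by
  obtain ⟨K, p₀, hK, h⟩ := LT.card_pairs_le hfg hd
  refine ⟨K + p₀ + 1, by positivity, fun T hT x hx => ?_⟩
  obtain ⟨w, hw⟩ : ∃ w, w = x ^ ((1 : ℝ) / 12) := ⟨_, rfl⟩
  have hx0 : 0 < x := by linarith
  have hw1 : 1 ≤ w := by rw [hw]; exact Real.one_le_rpow (by linarith) (by norm_num)
  have hpow : ∀ n : ℕ, w ^ n = x ^ ((n : ℝ) / 12) := fun n => by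
    rw [hw, ← Real.rpow_natCast, ← Real.rpow_mul hx0.le]; congr 1; ring
  have h12 : x = w ^ 12 := by rw [hpow]; norm_num
  have h43 : x ^ ((4 : ℝ) / 3) = w ^ 16 := by rw [hpow]; norm_num
  have h56 : x ^ ((5 : ℝ) / 6) = w ^ 10 := by rw [hpow]; norm_num
  obtain ⟨s, hs⟩ : ∃ s, s = (T : ℝ) ^ ((1 : ℝ) / 2) := ⟨_, rfl⟩
  have hs2 : s ^ 2 = T := by
    rw [hs, ← Real.sqrt_eq_rpow, Real.sq_sqrt (by positivity)]
  have hs0 : 0 ≤ s := by rw [hs]; positivity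
  have hX : (⌊x⌋₊ : ℝ) ≤ w ^ 12 := h12 ▸ Nat.floor_le hx0.le
  have hw0 : 0 < w := by linarith
  rw [h43, h56, ← hs]
  have hsw : 0 ≤ s * w ^ 16 := by positivity
  have hTw : (0 : ℝ) ≤ T * w ^ 10 := by positivity
  have hp0 : (0 : ℝ) ≤ p₀ := by positivity
  refine (LT.sum_filter_le (F := fun t => (piK f g d t x : ℝ)) (fun t => Nat.cast_nonneg _) T _).trans ?_
  rcases le_total s (w ^ 4) with hc | hc
  · have hle : ∀ t ∈ Finset.Icc 1 T, (piK f g d (t : ℚ) x : ℝ) ≤ w ^ 12 := fun t _ => by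
      refine le_trans ?_ hX
      have := Finset.card_filter_le (Finset.Icc 1 ⌊x⌋₊) fun p =>
        p.Prime ∧ goodRed f g p (t : ℚ) ∧ apE f g p (t : ℚ) ≠ 0 ∧
        ∃ m : ℤ, 0 < m ∧ (apE f g p (t : ℚ)) ^ 2 - 4 * (p : ℤ) = d * m ^ 2
      rw [Nat.card_Icc, Nat.add_sub_cancel] at this
      exact_mod_cast this
    calc _ ≤ _ := Finset.sum_le_card_nsmul _ _ _ hle
      _ ≤ (T : ℝ) * w ^ 12 := by
        rw [nsmul_eq_mul, Nat.card_Icc, Nat.add_sub_cancel]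
      _ = s * (s * w ^ 12) := by rw [← hs2]; ring
      _ ≤ s * (w ^ 4 * w ^ 12) := by gcongr
      _ = s * w ^ 16 := by ring
      _ ≤ _ := by nlinarith
  · have h1 := LT.sum_piK_le f g d p₀ T x
    have h2 := h T w hw1 _ hX
    have h3 : w ^ 20 ≤ s * w ^ 16 := by
      calc w ^ 20 = w ^ 4 * w ^ 16 := by ring
        _ ≤ _ := by gcongr
    have h4 : (T : ℝ) ≤ T * w ^ 10 := le_mul_of_one_le_right (by positivity) (one_le_pow₀ hw1)
    calc _ ≤ (p₀ * T + (LT.pairs f g d p₀ T ⌊x⌋₊).card : ℝ) := by exact_mod_cast h1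
      _ ≤ p₀ * (T * w ^ 10) + K * (T * w ^ 10 + s * w ^ 16) := by
        refine add_le_add (by gcongr) (h2.trans ?_)
        gcongr
      _ ≤ _ := by nlinarith [mul_nonneg hp0 hsw]
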